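/- Let l > 5 be a prime with l ≡ 1 (mod 5). Let N be the number of pairs (u,v) ∈ 𝔽_l × 𝔽_l such that the quadratic x² + u·x + v is irreducible in 𝔽_l[x], divides the Hasse invariant Ĥ_{5,l}(x) in 𝔽_l[x], and u = e⁵·(v−1) for some e ∈ 𝔽_l with e² + e = 1. Then: if l ≡ 1 (mod 4), 2·N = h(−5l); if l ≡ 3 (mod 8), N = h(−5l) − 1; and if l ≡ 7 (mod 8), N = 2·h(−5l) − 1. -/

import Mathlib

open Polynomial

/-- The Hasse invariant `Ĥ_{5,l}(x)` of the Tate normal form `E₅` in characteristic `l`. -/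
noncomputable def hasseInvariant5 (l : ℕ) : Polynomial (ZMod l) :=
  let n := l / 12
  let r := if l % 3 = 2 then 1 else 0
  let s := if l % 4 = 3 then 1 else 0
  let c4 : Polynomial (ZMod l) := X ^ 4 + 12 * X ^ 3 + 14 * X ^ 2 - 12 * X + 1
  let D : Polynomial (ZMod l) := X ^ 5 * (1 - 11 * X - X ^ 2)
  c4 ^ r * ((X ^ 2 + 1) * (X ^ 4 + 18 * X ^ 3 + 74 * X ^ 2 - 18 * X + 1)) ^ s *
    ∑ k ∈ Finset.range (n + 1),
      (Nat.choose (2 * n + s) (2 * k + s) : Polynomial (ZMod l)) *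
        (Nat.choose (2 * n - 2 * k) (n - k) : Polynomial (ZMod l)) *
        (-432 : Polynomial (ZMod l)) ^ (n - k) *
        (c4 ^ 3 - 1728 * D) ^ k * D ^ (n - k)

section
namespace HQ
open PowerSeries Filter Topology

/-- `f` is given on the open unit disc by the power series `p`. -/
def Ser (R : Type*) [CommRing R] [Algebra R ℂ] (f : ℂ → ℂ) (p : PowerSeries R) : Prop :=
  ∀ z : ℂ, ‖z‖ < 1 → HasSum (fun n => algebraMap R ℂ (coeff n p) * z ^ n) (f z)

section ser
variable {R : Type*} [CommRing R] [Algebra R ℂ] {f g : ℂ → ℂ} {p q : PowerSeries R}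

lemma Ser.summable_norm (h : Ser R f p) {z : ℂ} (hz : ‖z‖ < 1) :
    Summable (fun n => ‖algebraMap R ℂ (coeff n p) * z ^ n‖) := (h z hz).summable.norm

lemma Ser.congr (h : Ser R f p) (hfg : ∀ z, ‖z‖ < 1 → f z = g z) : Ser R g p := by
  intro z hz; rw [← hfg z hz]; exact h z hz

lemma Ser.hasFPower (h : Ser R f p) :
    HasFPowerSeriesOnBall f (FormalMultilinearSeries.ofScalars ℂ (fun n => algebraMap R ℂ (coeff n p)))
      0 1 := by
  refine ⟨?_, by simp, ?_⟩
  · refine ENNReal.le_of_forall_nnreal_lt fun r hr => ?_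
    apply FormalMultilinearSeries.le_radius_of_summable_norm
    have hr1 : (r : ℝ) < 1 := by exact_mod_cast hr
    have := h.summable_norm (z := (r : ℝ)) (by simpa using hr1)
    simpa [FormalMultilinearSeries.ofScalars_norm] using this
  · intro y hy
    have hy' : ‖y‖ < 1 := by
      simpa [Metric.mem_eball, edist_zero_right, enorm_eq_nnnorm, ← NNReal.coe_lt_coe] using hy
    have := h y hy'
    simpa [FormalMultilinearSeries.ofScalars_apply_eq, mul_comm] using this

lemma Ser.differentiableOn (h : Ser R f p) : DifferentiableOn ℂ f (Metric.ball 0 1) := by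
  have := h.hasFPower.differentiableOn
  intro z hz
  exact (this z (by simpa [Metric.mem_eball, edist_zero_right, enorm_eq_nnnorm, ← NNReal.coe_lt_coe] using hz)).mono
    (by intro w hw; simpa [Metric.mem_eball, edist_zero_right, enorm_eq_nnnorm, ← NNReal.coe_lt_coe] using hw)

lemma Ser.continuousAt (h : Ser R f p) : ContinuousAt f 0 :=
  h.hasFPower.analyticAt.continuousAt

lemma Ser.apply_zero (h : Ser R f p) : f 0 = algebraMap R ℂ (constantCoeff p) := by
  have h1 := h 0 (by simp)
  have h2 := hasSum_single (f := fun n => algebraMap R ℂ (coeff n p) * (0 : ℂ) ^ n) 0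
    (by intro n hn; simp [hn])
  simpa using h1.unique h2

lemma Ser.coeff_eq_iteratedDeriv (h : Ser R f p) (n : ℕ) :
    algebraMap R ℂ (coeff n p) = iteratedDeriv n f 0 / (n.factorial : ℂ) := by
  have h1 := h.hasFPower.hasFPowerSeriesAt
  have h2 := h1.analyticAt.hasFPowerSeriesAt
  have h3 := congrFun (congrArg FormalMultilinearSeries.coeff (h1.eq_formalMultilinearSeries h2)) n
  simpa [FormalMultilinearSeries.coeff_ofScalars] using h3

lemma ser_of_differentiableOn (h : DifferentiableOn ℂ f (Metric.ball 0 1)) :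
    ∃ p : PowerSeries ℂ, Ser ℂ f p := by
  refine ⟨PowerSeries.mk fun n => iteratedDeriv n f 0 / (n.factorial : ℂ), ?_⟩
  intro z hz
  have := Complex.hasSum_taylorSeries_on_ball (f := f) (c := 0) (r := 1) h (z := z) (by simpa using hz)
  have h2 : (fun n => algebraMap ℂ ℂ (coeff n (PowerSeries.mk fun n =>
      iteratedDeriv n f 0 / (n.factorial : ℂ))) * z ^ n) =
      fun n : ℕ => ((n.factorial : ℂ)⁻¹ • (z - 0) ^ n • iteratedDeriv n f 0) := by
    funext n
    simp only [PowerSeries.coeff_mk, Algebra.algebraMap_self, RingHom.id_apply, smul_eq_mul, sub_zero]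
    ring
  rw [h2]
  exact this

lemma Ser.unique [FaithfulSMul R ℂ] (hf : Ser R f p) (hg : Ser R g q) (h : f =ᶠ[𝓝 0] g) : p = q := by
  ext n
  apply FaithfulSMul.algebraMap_injective R ℂ
  rw [hf.coeff_eq_iteratedDeriv, hg.coeff_eq_iteratedDeriv, h.iteratedDeriv_eq n]

lemma Ser.map {S : Type*} [CommRing S] [Algebra S ℂ] (φ : R →+* S)
    (hφ : ∀ r, algebraMap S ℂ (φ r) = algebraMap R ℂ r) (hf : Ser R f p) :
    Ser S f (PowerSeries.map φ p) := by
  intro z hz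
  simpa [hφ] using hf z hz

lemma Ser.of_map {S : Type*} [CommRing S] [Algebra S ℂ] (φ : R →+* S)
    (hφ : ∀ r, algebraMap S ℂ (φ r) = algebraMap R ℂ r) (hf : Ser S f (PowerSeries.map φ p)) :
    Ser R f p := by
  intro z hz
  simpa [hφ] using hf z hz

lemma Ser.add (hf : Ser R f p) (hg : Ser R g q) : Ser R (fun z => f z + g z) (p + q) := by
  intro z hz
  simpa [add_mul] using (hf z hz).add (hg z hz)

lemma Ser.neg (hf : Ser R f p) : Ser R (fun z => - f z) (-p) := by
  intro z hz
  simpa using (hf z hz).neg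

lemma Ser.sub (hf : Ser R f p) (hg : Ser R g q) : Ser R (fun z => f z - g z) (p - q) := by
  simpa [sub_eq_add_neg] using hf.add hg.neg

lemma ser_C (r : R) : Ser R (fun _ => algebraMap R ℂ r) (PowerSeries.C r) := by
  intro z hz
  have := hasSum_single (f := fun n => algebraMap R ℂ (coeff n (PowerSeries.C r)) * z ^ n) 0
    (by intro n hn; simp [PowerSeries.coeff_C, hn])
  simpa using this

lemma ser_one : Ser R (fun _ => 1) 1 := by
  simpa using ser_C (R := R) 1

lemma ser_natCast (n : ℕ) : Ser R (fun _ => (n : ℂ)) (n : PowerSeries R) := by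
  simpa using ser_C (R := R) (n : R)

lemma ser_X : Ser R (fun z => z) PowerSeries.X := by
  intro z hz
  have := hasSum_single (f := fun n => algebraMap R ℂ (coeff n (PowerSeries.X : PowerSeries R)) * z ^ n) 1
    (by intro n hn; simp [PowerSeries.coeff_X, hn])
  simpa using this

lemma Ser.mul (hf : Ser R f p) (hg : Ser R g q) : Ser R (fun z => f z * g z) (p * q) := by
  intro z hz
  have h := summable_norm_sum_mul_antidiagonal_of_summable_norm (hf.summable_norm hz)
    (hg.summable_norm hz)
  have h2 := tsum_mul_tsum_eq_tsum_sum_antidiagonal_of_summable_norm (hf.summable_norm hz)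
    (hg.summable_norm hz)
  rw [(hf z hz).tsum_eq, (hg z hz).tsum_eq] at h2
  have h3 : (fun n => algebraMap R ℂ (coeff n (p * q)) * z ^ n) = fun n =>
      ∑ kl ∈ Finset.HasAntidiagonal.antidiagonal n, algebraMap R ℂ (coeff kl.1 p) * z ^ kl.1 *
        (algebraMap R ℂ (coeff kl.2 q) * z ^ kl.2) := by
    funext n
    rw [PowerSeries.coeff_mul, map_sum, Finset.sum_mul]
    refine Finset.sum_congr rfl fun kl hkl => ?_
    rw [Finset.HasAntidiagonal.mem_antidiagonal] at hkl
    rw [map_mul, ← hkl, pow_add]; ring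
  rw [h3]
  beta_reduce
  rw [h2]
  exact h.of_norm.hasSum

lemma Ser.pow (hf : Ser R f p) (n : ℕ) : Ser R (fun z => f z ^ n) (p ^ n) := by
  induction n with
  | zero => simpa using ser_one
  | succ n ih => simpa [pow_succ] using ih.mul hf

lemma ser_prod {ι : Type*} (s : Finset ι) (F : ι → ℂ → ℂ) (P : ι → PowerSeries R)
    (h : ∀ i ∈ s, Ser R (F i) (P i)) : Ser R (fun z => ∏ i ∈ s, F i z) (∏ i ∈ s, P i) := by
  classical
  induction s using Finset.induction_on with
  | empty => simpa using ser_one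
  | insert a s ha ih =>
    simp only [Finset.prod_insert ha]
    exact (h a (by simp)).mul (ih fun i hi => h i (by simp [hi]))

lemma ser_sum {ι : Type*} (s : Finset ι) (F : ι → ℂ → ℂ) (P : ι → PowerSeries R)
    (h : ∀ i ∈ s, Ser R (F i) (P i)) : Ser R (fun z => ∑ i ∈ s, F i z) (∑ i ∈ s, P i) := by
  classical
  induction s using Finset.induction_on with
  | empty => simpa using ser_C (R := R) 0
  | insert a s ha ih =>
    simp only [Finset.sum_insert ha]
    exact (h a (by simp)).add (ih fun i hi => h i (by simp [hi]))

lemma Ser.smul (r : R) (hf : Ser R f p) : Ser R (fun z => algebraMap R ℂ r * f z) (PowerSeries.C r * p) :=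
  (ser_C r).mul hf

lemma Ser.rescale (r : R) (hr : ‖algebraMap R ℂ r‖ ≤ 1) (hf : Ser R f p) :
    Ser R (fun z => f (algebraMap R ℂ r * z)) (PowerSeries.rescale r p) := by
  intro z hz
  have h1 : ‖algebraMap R ℂ r * z‖ < 1 := by
    rw [norm_mul]; exact lt_of_le_of_lt (mul_le_of_le_one_left (norm_nonneg _) hr) hz
  convert hf _ h1 using 2 with n
  rw [PowerSeries.coeff_rescale, map_mul, map_pow]; ring

lemma Ser.expand (m : ℕ) (hm : m ≠ 0) (hf : Ser R f p) :
    Ser R (fun z => f (z ^ m)) (PowerSeries.expand m hm p) := by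
  intro z hz
  have h1 : ‖z ^ m‖ < 1 := by
    rw [norm_pow]; exact pow_lt_one₀ (norm_nonneg _) hz hm
  have h := hf _ h1
  have hinj : Function.Injective (fun n : ℕ => m * n) := fun a b h => Nat.eq_of_mul_eq_mul_left (Nat.pos_of_ne_zero hm) h
  rw [← hinj.hasSum_iff]
  · convert h using 2 with n
    simp [PowerSeries.coeff_expand_mul, pow_mul]
  · intro n hn
    rw [PowerSeries.coeff_expand_of_not_dvd, map_zero, zero_mul]
    rintro ⟨k, rfl⟩; exact hn ⟨k, rfl⟩

/-- Inverse of a nonvanishing function. -/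
lemma Ser.inv [FaithfulSMul R ℂ] (hf : Ser R f p) (h0 : ∀ z, ‖z‖ < 1 → f z ≠ 0) (hpq : p * q = 1) :
    Ser R (fun z => (f z)⁻¹) q := by
  obtain ⟨r, hr⟩ := ser_of_differentiableOn (f := fun z => (f z)⁻¹)
    (hf.differentiableOn.inv fun z hz => h0 z (by simpa using hz))
  set φ := algebraMap R ℂ
  have hφ : ∀ r, algebraMap ℂ ℂ (φ r) = algebraMap R ℂ r := fun r => rfl
  have h1 : PowerSeries.map φ p * r = 1 := by
    refine ((hf.map φ hφ).mul hr).unique ser_one ?_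
    filter_upwards [Metric.ball_mem_nhds (0 : ℂ) one_pos] with z hz
    exact mul_inv_cancel₀ (h0 z (by simpa using hz))
  have h2 : PowerSeries.map φ p * PowerSeries.map φ q = 1 := by
    rw [← map_mul, hpq, map_one]
  have h3 : r = PowerSeries.map φ q := by
    calc r = (PowerSeries.map φ q * PowerSeries.map φ p) * r := by rw [mul_comm (PowerSeries.map φ q), h2, one_mul]
      _ = PowerSeries.map φ q := by rw [mul_assoc, h1, mul_one]
  subst h3
  exact hr.of_map φ hφ

/-- Locally uniform limits of functions with eventually constant coefficients. -/
lemma ser_of_tendsto {F : ℕ → ℂ → ℂ} {P : ℕ → PowerSeries R}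
    (hF : ∀ N, Ser R (F N) (P N))
    (hlim : TendstoLocallyUniformlyOn F f atTop (Metric.ball 0 1))
    (hP : ∀ n, ∀ᶠ N in atTop, coeff n (P N) = coeff n p) : Ser R f p := by
  have hd : DifferentiableOn ℂ f (Metric.ball 0 1) :=
    hlim.differentiableOn (Eventually.of_forall fun N => (hF N).differentiableOn) Metric.isOpen_ball
  have key : ∀ n, TendstoLocallyUniformlyOn (fun N => iteratedDeriv n (F N)) (iteratedDeriv n f) atTop
      (Metric.ball 0 1) ∧ ∀ N, DifferentiableOn ℂ (iteratedDeriv n (F N)) (Metric.ball 0 1) := by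
    intro n
    induction n with
    | zero => simpa using ⟨hlim, fun N => (hF N).differentiableOn⟩
    | succ n ih =>
      refine ⟨?_, fun N => ?_⟩
      · simp only [iteratedDeriv_succ]
        exact ih.1.deriv (Eventually.of_forall ih.2) Metric.isOpen_ball
      · simp only [iteratedDeriv_succ]
        exact (ih.2 N).deriv Metric.isOpen_ball
  obtain ⟨r, hr⟩ := ser_of_differentiableOn hd
  intro z hz
  convert hr z hz using 3 with n
  have h1 : Tendsto (fun N => algebraMap R ℂ (coeff n (P N))) atTop (𝓝 (algebraMap ℂ ℂ (coeff n r))) := by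
    rw [hr.coeff_eq_iteratedDeriv]
    simp only [(hF _).coeff_eq_iteratedDeriv]
    exact ((key n).1.tendsto_at (by simp)).div_const _
  refine tendsto_nhds_unique ?_ h1
  refine Tendsto.congr' ?_ tendsto_const_nhds
  filter_upwards [hP n] with N hN
  rw [hN]

end ser

/-- The Euler product. -/
noncomputable def euler (z : ℂ) : ℂ := ∏' n : ℕ, (1 - z ^ (n + 1))

lemma ser_euler : Ser ℤ euler (pentagonalSeries ℤ) := by
  refine ser_of_tendsto (F := fun N z => ∏ i ∈ Finset.range N, (1 - z ^ (i + 1)))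
    (P := fun N => ∏ i ∈ Finset.range N, (1 - PowerSeries.X ^ (i + 1))) ?_ ?_ ?_
  · intro N
    exact ser_prod _ _ _ fun i _ => ser_one.sub (ser_X.pow _)
  · have h := ModularForm.multipliableLocallyUniformlyOn_one_sub_pow.hasProdLocallyUniformlyOn
    have h2 := h.tendstoLocallyUniformlyOn_finsetRange
    exact h2
  · intro n
    have := coeff_prod_one_sub_X_pow_eventually_eq ℤ n
    exact tendsto_finset_range.eventually this

lemma euler_ne_zero {z : ℂ} (hz : ‖z‖ < 1) : euler z ≠ 0 := by
  have h := tprod_one_add_ne_zero_of_summable (f := fun n : ℕ => -z ^ (n + 1)) ?_ ?_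
  · simpa [euler, sub_eq_add_neg] using h
  · intro n h
    have h1 : z ^ (n + 1) = 1 := by linear_combination -h
    have h2 : ‖z ^ (n + 1)‖ < 1 := by
      rw [norm_pow]; exact pow_lt_one₀ (norm_nonneg _) hz (by simp)
    rw [h1] at h2; simp at h2
  · simpa using (summable_nat_add_iff 1).mpr (summable_geometric_of_lt_one (norm_nonneg _) hz)

end HQ
end

section
namespace HQ
open PowerSeries Filter Topology UpperHalfPlane
open scoped MatrixGroups ModularForm Manifold

/-- The Moebius action of an integral matrix. -/
noncomputable def mob (a b c d : ℤ) (τ : ℍ) : ℍ := ofComplex ((a * τ + b) / (c * τ + d))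

lemma lin_ne_zero {a b c d : ℤ} (h : 0 < a * d - b * c) (τ : ℍ) : (c * τ + d : ℂ) ≠ 0 := by
  intro h0
  have h1 := congrArg Complex.im h0
  have h2 := congrArg Complex.re h0
  have h3 := τ.im_pos
  simp at h1 h2
  rcases h1 with h1 | h1
  · simp [h1] at h2
    simp [h1, h2] at h
  · exact absurd h1 h3.ne'

lemma mob_im {a b c d : ℤ} (τ : ℍ) :
    ((a * τ + b : ℂ) / (c * τ + d)).im = (a * d - b * c : ℤ) * τ.im / Complex.normSq (c * τ + d) := by
  rw [Complex.div_im]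
  simp
  ring

lemma coe_mob {a b c d : ℤ} (h : 0 < a * d - b * c) (τ : ℍ) :
    (mob a b c d τ : ℂ) = (a * τ + b) / (c * τ + d) := by
  unfold mob
  rw [ofComplex_apply_of_im_pos]
  · rw [mob_im]
    have := Complex.normSq_pos.mpr (lin_ne_zero h τ)
    have h3 := τ.im_pos
    have : (0 : ℝ) < ((a * d - b * c : ℤ) : ℝ) := by exact_mod_cast h
    positivity

lemma mob_im' {a b c d : ℤ} (h : 0 < a * d - b * c) (τ : ℍ) :
    (mob a b c d τ).im = (a * d - b * c : ℤ) * τ.im / Complex.normSq (c * τ + d) := by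
  rw [← mob_im, ← coe_mob h]; simp

lemma mob_mob {a b c d a' b' c' d' : ℤ} (h : 0 < a * d - b * c) (h' : 0 < a' * d' - b' * c') (τ : ℍ) :
    mob a b c d (mob a' b' c' d' τ) =
      mob (a * a' + b * c') (a * b' + b * d') (c * a' + d * c') (c * b' + d * d') τ := by
  have h2 : 0 < (a * a' + b * c') * (c * b' + d * d') - (a * b' + b * d') * (c * a' + d * c') := by
    have := mul_pos h h'; nlinarith
  apply UpperHalfPlane.ext
  rw [coe_mob h, coe_mob h2, coe_mob h']
  have e1 := lin_ne_zero h' τ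
  have e2 := lin_ne_zero h2 τ
  rw [mul_div_assoc', mul_div_assoc', div_add' _ _ _ e1, div_add' _ _ _ e1, div_div_div_cancel_right₀ e1]
  push_cast
  congr 1 <;> ring

lemma mob_eq_of_scale {a b c d : ℤ} (k : ℤ) (hk : k ≠ 0) (h : 0 < a * d - b * c) (τ : ℍ) :
    mob (k * a) (k * b) (k * c) (k * d) τ = mob a b c d τ := by
  unfold mob
  congr 1
  have e1 := lin_ne_zero h τ
  have : (k : ℂ) ≠ 0 := by exact_mod_cast hk
  push_cast
  rw [show ((k * a : ℂ) * τ + k * b) = k * (a * τ + b) by ring,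
    show ((k * c : ℂ) * τ + k * d) = k * (c * τ + d) by ring, mul_div_mul_left _ _ this]

lemma sl_det (γ : SL(2, ℤ)) : γ 0 0 * γ 1 1 - γ 0 1 * γ 1 0 = 1 := by
  have := γ.det_coe
  rwa [Matrix.det_fin_two] at this

lemma sl_det_pos (γ : SL(2, ℤ)) : 0 < γ 0 0 * γ 1 1 - γ 0 1 * γ 1 0 := by
  rw [sl_det]; norm_num

lemma sl_smul (γ : SL(2, ℤ)) (τ : ℍ) : γ • τ = mob (γ 0 0) (γ 0 1) (γ 1 0) (γ 1 1) τ := by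
  have h := sl_det_pos γ
  apply UpperHalfPlane.ext
  rw [coe_mob h, UpperHalfPlane.specialLinearGroup_apply]
  simp

/-- Build an element of `SL(2,ℤ)`. -/
def mkSL (a b c d : ℤ) (h : a * d - b * c = 1) : SL(2, ℤ) :=
  ⟨!![a, b; c, d], by rw [Matrix.det_fin_two_of, h]⟩

lemma mkSL_smul (a b c d : ℤ) (h : a * d - b * c = 1) (τ : ℍ) :
    mkSL a b c d h • τ = mob a b c d τ := by
  rw [sl_smul]; rfl

/-- holomorphic functions on the upper half plane -/
def Hol (F : ℍ → ℂ) : Prop := ∀ τ : ℍ, DifferentiableAt ℂ (F ∘ ofComplex) τ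

lemma hol_iff (F : ℍ → ℂ) : Hol F ↔ MDiff F := by
  rw [UpperHalfPlane.mdifferentiable_iff]
  constructor
  · intro h z hz
    exact (h ⟨z, hz⟩).differentiableWithinAt
  · intro h τ
    exact (h τ τ.im_pos).differentiableAt (isOpen_upperHalfPlaneSet.mem_nhds τ.im_pos)

lemma hol_of_differentiable {g : ℂ → ℂ} (h : ∀ z : ℂ, 0 < z.im → DifferentiableAt ℂ g z) :
    Hol (fun τ => g τ) := by
  intro τ
  refine (h τ τ.im_pos).congr_of_eventuallyEq ?_
  filter_upwards [isOpen_upperHalfPlaneSet.mem_nhds τ.im_pos] with z hz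
  simp [ofComplex_apply_of_im_pos hz]

variable {F G : ℍ → ℂ}
lemma hol_const (c : ℂ) : Hol (fun _ => c) := fun _ => differentiableAt_const c
lemma Hol.add (hF : Hol F) (hG : Hol G) : Hol (fun τ => F τ + G τ) := fun τ => (hF τ).add (hG τ)
lemma Hol.sub (hF : Hol F) (hG : Hol G) : Hol (fun τ => F τ - G τ) := fun τ => (hF τ).sub (hG τ)
lemma Hol.neg (hF : Hol F) : Hol (fun τ => - F τ) := fun τ => (hF τ).neg
lemma Hol.mul (hF : Hol F) (hG : Hol G) : Hol (fun τ => F τ * G τ) := fun τ => (hF τ).mul (hG τ)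
lemma Hol.pow (hF : Hol F) (n : ℕ) : Hol (fun τ => F τ ^ n) := fun τ => (hF τ).pow n
lemma Hol.inv (hF : Hol F) (h0 : ∀ τ, F τ ≠ 0) : Hol (fun τ => (F τ)⁻¹) :=
  fun τ => (hF τ).inv (by simpa using h0 _)
lemma Hol.div (hF : Hol F) (hG : Hol G) (h0 : ∀ τ, G τ ≠ 0) : Hol (fun τ => F τ / G τ) := by
  simpa [div_eq_mul_inv] using hF.mul (hG.inv h0)

lemma hol_prod {ι : Type*} (s : Finset ι) (F : ι → ℍ → ℂ) (h : ∀ i ∈ s, Hol (F i)) :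
    Hol (fun τ => ∏ i ∈ s, F i τ) := by
  classical
  induction s using Finset.induction_on with
  | empty => simpa using hol_const 1
  | insert a s ha ih =>
    simp only [Finset.prod_insert ha]
    exact (h a (by simp)).mul (ih fun i hi => h i (by simp [hi]))

lemma hol_sum {ι : Type*} (s : Finset ι) (F : ι → ℍ → ℂ) (h : ∀ i ∈ s, Hol (F i)) :
    Hol (fun τ => ∑ i ∈ s, F i τ) := by
  classical
  induction s using Finset.induction_on with
  | empty => simpa using hol_const 0
  | insert a s ha ih =>
    simp only [Finset.sum_insert ha]
    exact (h a (by simp)).add (ih fun i hi => h i (by simp [hi]))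

lemma mob_differentiableAt {a b c d : ℤ} (h : 0 < a * d - b * c) (τ : ℍ) :
    HasDerivAt (fun z : ℂ => (a * z + b) / (c * z + d)) ((a * d - b * c : ℤ) / (c * τ + d : ℂ) ^ 2) τ := by
  have h1 : HasDerivAt (fun z : ℂ => a * z + b) a (τ : ℂ) := by
    simpa using ((hasDerivAt_id (τ : ℂ)).const_mul (a : ℂ)).add_const (b : ℂ)
  have h2 : HasDerivAt (fun z : ℂ => c * z + d) c (τ : ℂ) := by
    simpa using ((hasDerivAt_id (τ : ℂ)).const_mul (c : ℂ)).add_const (d : ℂ)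
  have h3 := h1.div h2 (lin_ne_zero h τ)
  have e : ((a * d - b * c : ℤ) / (c * τ + d : ℂ) ^ 2) =
      (a * (c * τ + d) - (a * τ + b) * c) / (c * τ + d : ℂ) ^ 2 := by
    congr 1
    push_cast; ring
  rw [e]; exact h3

lemma comp_mob_eventuallyEq {a b c d : ℤ} (_h : 0 < a * d - b * c) (F : ℍ → ℂ) (τ : ℍ) :
    ((fun τ => F (mob a b c d τ)) ∘ ofComplex) =ᶠ[𝓝 (τ : ℂ)]
      (F ∘ ofComplex) ∘ (fun z : ℂ => (a * z + b) / (c * z + d)) := by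
  filter_upwards [isOpen_upperHalfPlaneSet.mem_nhds τ.im_pos] with z hz
  simp [mob, ofComplex_apply_of_im_pos hz]

lemma Hol.comp_mob (hF : Hol F) {a b c d : ℤ} (h : 0 < a * d - b * c) :
    Hol (fun τ => F (mob a b c d τ)) := by
  intro τ
  refine DifferentiableAt.congr_of_eventuallyEq ?_ (comp_mob_eventuallyEq h F τ)
  refine DifferentiableAt.comp _ ?_ (mob_differentiableAt h τ).differentiableAt
  rw [← coe_mob h]; exact hF _

lemma Hol.comp_smul (hF : Hol F) (γ : SL(2, ℤ)) : Hol (fun τ => F (γ • τ)) := by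
  simp only [sl_smul]
  exact hF.comp_mob (sl_det_pos γ)

/-- Constancy of holomorphic functions invariant under a finite index subgroup and bounded at the cusps. -/
lemma const_of_bounded (Γ : Subgroup SL(2, ℤ)) [Γ.FiniteIndex] (hF : Hol F)
    (hinv : ∀ γ ∈ Γ, ∀ τ, F (γ • τ) = F τ)
    (hb : ∀ γ : SL(2, ℤ), IsBoundedAtImInfty (fun τ => F (γ • τ))) : ∃ c, ∀ τ, F τ = c := by
  let f : ModularForm (Γ : Subgroup (GL (Fin 2) ℝ)) 0 :=
    { toFun := F
      slash_action_eq' := by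
        rintro _ ⟨γ, hγ, rfl⟩
        have : F ∣[(0:ℤ)] γ = F := by
          funext τ
          rw [ModularForm.SL_slash_apply]
          simpa using hinv γ hγ τ
        exact this
      holo' := (hol_iff F).mp hF
      bdd_at_cusps' := by
        intro c hc
        have hc' : IsCusp c 𝒮ℒ := by
          apply hc.mono
          rintro _ ⟨γ, hγ, rfl⟩
          exact ⟨γ, rfl⟩
        rw [OnePoint.isBoundedAt_iff_forall_SL2Z hc']
        intro γ _
        convert hb γ using 1
        funext τ
        show (F ∣[(0:ℤ)] γ) τ = _
        rw [ModularForm.SL_slash_apply]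
        simp }
  obtain ⟨c, hc⟩ := ModularForm.eq_const_of_weight_zero f
  exact ⟨c, fun τ => congrFun hc τ⟩

lemma bdd_iff (F : ℍ → ℂ) : IsBoundedAtImInfty F ↔ ∃ M A : ℝ, ∀ τ : ℍ, A ≤ τ.im → ‖F τ‖ ≤ M :=
  isBoundedAtImInfty_iff

/-- Coset representatives for `Γ₀(5)` in `SL(2,ℤ)`. -/
lemma exists_coset (γ : SL(2, ℤ)) : (γ ∈ CongruenceSubgroup.Gamma0 5) ∨
    ∃ j : ℤ, 0 ≤ j ∧ j < 5 ∧ ∃ δ ∈ CongruenceSubgroup.Gamma0 5, γ = δ * (ModularGroup.S * ModularGroup.T ^ j) := by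
  by_cases h : γ ∈ CongruenceSubgroup.Gamma0 5
  · exact Or.inl h
  right
  rw [CongruenceSubgroup.Gamma0_mem] at h
  have hp : Fact (Nat.Prime 5) := ⟨by norm_num⟩
  -- j with c j = d mod 5
  set c : ZMod 5 := ((γ 1 0 : ℤ) : ZMod 5)
  set d : ZMod 5 := ((γ 1 1 : ℤ) : ZMod 5)
  set x : ZMod 5 := c⁻¹ * d with hx
  refine ⟨(x.val : ℤ), by positivity, by exact_mod_cast x.val_lt,
    γ * (ModularGroup.S * ModularGroup.T ^ (x.val : ℤ))⁻¹, ?_, by group⟩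
  rw [CongruenceSubgroup.Gamma0_mem]
  have e : (γ * (ModularGroup.S * ModularGroup.T ^ (x.val : ℤ))⁻¹) 1 0 = γ 1 0 * (x.val : ℤ) - γ 1 1 := by
    rw [Matrix.SpecialLinearGroup.coe_mul, Matrix.SpecialLinearGroup.coe_inv, Matrix.SpecialLinearGroup.coe_mul,
      ModularGroup.coe_T_zpow, ModularGroup.coe_S]
    simp [Matrix.mul_apply, Fin.sum_univ_two, Matrix.adjugate_fin_two]
    ring
  rw [e]
  push_cast
  rw [ZMod.natCast_zmod_val, hx]
  show c * (c⁻¹ * d) - d = 0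
  rw [mul_inv_cancel_left₀ h, sub_self]

lemma const5 (hF : Hol F) (hinv : ∀ γ ∈ CongruenceSubgroup.Gamma0 5, ∀ τ, F (γ • τ) = F τ)
    (h1 : IsBoundedAtImInfty F) (h2 : IsBoundedAtImInfty (fun τ => F (ModularGroup.S • τ))) :
    ∃ c, ∀ τ, F τ = c := by
  refine const_of_bounded (CongruenceSubgroup.Gamma0 5) hF hinv fun γ => ?_
  rcases exists_coset γ with h | ⟨j, _, _, δ, hδ, rfl⟩
  · have : (fun τ => F (γ • τ)) = F := funext fun τ => hinv γ h τ
    rw [this]; exact h1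
  · simp only [mul_smul, hinv δ hδ]
    rw [bdd_iff] at h2 ⊢
    obtain ⟨M, A, h⟩ := h2
    refine ⟨M, A, fun τ hτ => h _ ?_⟩
    rw [UpperHalfPlane.modular_T_zpow_smul]
    simpa using hτ

lemma const1 (hF : Hol F) (hinv : ∀ γ : SL(2, ℤ), ∀ τ, F (γ • τ) = F τ)
    (h1 : IsBoundedAtImInfty F) :
    ∃ c, ∀ τ, F τ = c := by
  refine const_of_bounded ⊤ hF (fun γ _ => hinv γ) fun γ => ?_
  have : (fun τ => F (γ • τ)) = F := funext fun τ => hinv γ τ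
  rw [this]; exact h1

end HQ
end

section
namespace HQ
open PowerSeries Filter Topology UpperHalfPlane
open scoped MatrixGroups ModularForm Manifold

noncomputable def qq (τ : ℍ) : ℂ := Complex.exp (2 * Real.pi * Complex.I * τ)

lemma qq_ne_zero (τ : ℍ) : qq τ ≠ 0 := Complex.exp_ne_zero _

lemma norm_qq (τ : ℍ) : ‖qq τ‖ = Real.exp (-2 * Real.pi * τ.im) := by
  rw [qq, Complex.norm_exp]; simp

lemma norm_qq_lt_one (τ : ℍ) : ‖qq τ‖ < 1 := by
  rw [norm_qq, Real.exp_lt_one_iff]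
  have := mul_pos Real.pi_pos τ.im_pos
  linarith

/-- Discriminant -/
noncomputable def Del (τ : ℍ) : ℂ := ModularForm.discriminant τ

lemma Del_ne_zero (τ : ℍ) : Del τ ≠ 0 := ModularForm.discriminant_ne_zero τ

lemma eta_eq (τ : ℍ) : ModularForm.eta τ = Complex.exp (2 * Real.pi * Complex.I * τ / 24) * euler (qq τ) := by
  unfold ModularForm.eta
  congr 1
  · unfold euler
    congr 1
    funext n
    rw [ModularForm.eta_q_eq_pow]; rfl

lemma Del_eq (τ : ℍ) : Del τ = qq τ * euler (qq τ) ^ 24 := by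
  unfold Del ModularForm.discriminant
  rw [eta_eq, mul_pow, ← Complex.exp_nat_mul]
  congr 1
  unfold qq
  congr 1
  push_cast; ring

lemma Del_smul (γ : SL(2, ℤ)) (τ : ℍ) : Del (γ • τ) = (γ 1 0 * τ + γ 1 1 : ℂ) ^ 12 * Del τ := by
  have h := congrFun (SlashInvariantForm.slash_action_generators_SL2Z ModularForm.discriminant_S_invariant ModularForm.discriminant_T_invariant γ) τ
  rw [ModularForm.SL_slash_apply] at h
  have hd : denom γ τ = (γ 1 0 * τ + γ 1 1 : ℂ) := by
    simp [denom]
  rw [hd] at h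
  unfold Del
  rw [← h]
  have h0 := lin_ne_zero (sl_det_pos γ) τ
  rw [mul_comm, mul_assoc]
  have : ((γ 1 0 * τ + γ 1 1 : ℂ)) ^ (-12 : ℤ) * (γ 1 0 * τ + γ 1 1 : ℂ) ^ 12 = 1 := by
    rw [← zpow_natCast, ← zpow_add₀ h0]; simp
  rw [this, mul_one]

lemma Del_mob {a b c d : ℤ} (h : a * d - b * c = 1) (τ : ℍ) :
    Del (mob a b c d τ) = (c * τ + d : ℂ) ^ 12 * Del τ := by
  rw [← mkSL_smul a b c d h, Del_smul]; rfl

lemma coe_five (τ : ℍ) : (mob 5 0 0 1 τ : ℂ) = 5 * τ := by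
  rw [coe_mob (by norm_num)]; simp

noncomputable def tt (τ : ℍ) : ℂ := (ModularForm.eta τ / ModularForm.eta (mob 5 0 0 1 τ)) ^ 6

lemma eta_ne (τ : ℍ) : ModularForm.eta τ ≠ 0 := ModularForm.eta_ne_zero τ.im_pos

lemma tt_ne_zero (τ : ℍ) : tt τ ≠ 0 := pow_ne_zero _ (div_ne_zero (eta_ne _) (eta_ne _))

lemma hol_eta : Hol (fun τ => ModularForm.eta τ) :=
  hol_of_differentiable fun _ hz => ModularForm.differentiableAt_eta_of_mem_upperHalfPlaneSet hz

lemma hol_tt : Hol tt :=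
  (hol_eta.div (hol_eta.comp_mob (by norm_num)) fun _ => eta_ne _).pow 6

lemma hol_Del : Hol Del := hol_eta.pow 24

lemma tt_pow_four (τ : ℍ) : tt τ ^ 4 = Del τ / Del (mob 5 0 0 1 τ) := by
  unfold tt Del ModularForm.discriminant
  rw [← pow_mul, div_pow]

/-- `T(z) = (euler z / euler z^5)^6` -/
noncomputable def tf (z : ℂ) : ℂ := (euler z / euler (z ^ 5)) ^ 6

lemma qq_five (τ : ℍ) : qq (mob 5 0 0 1 τ) = qq τ ^ 5 := by
  unfold qq
  rw [coe_five, ← Complex.exp_nat_mul]; congr 1; push_cast; ring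

lemma tt_eq (τ : ℍ) : tt τ = (qq τ)⁻¹ * tf (qq τ) := by
  unfold tt tf
  rw [eta_eq, eta_eq, qq_five, mul_div_mul_comm, mul_pow, ← Complex.exp_sub, ← Complex.exp_nat_mul]
  congr 1
  unfold qq
  rw [← Complex.exp_neg, coe_five]
  congr 1; push_cast; ring

/-- integral power series inverse -/
noncomputable def tp : PowerSeries ℤ :=
  (pentagonalSeries ℤ * invOfUnit (PowerSeries.expand 5 (by norm_num) (pentagonalSeries ℤ)) 1) ^ 6

lemma pent_const : constantCoeff (pentagonalSeries ℤ) = 1 := by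
  have h := ser_euler.apply_zero
  have : euler 0 = 1 := by simp [euler]
  rw [this] at h
  have h' : ((constantCoeff (pentagonalSeries ℤ) : ℤ) : ℂ) = 1 := by simpa using h.symm
  exact_mod_cast h'

lemma pent5_const : constantCoeff (PowerSeries.expand 5 (by norm_num) (pentagonalSeries ℤ)) = 1 := by
  rw [PowerSeries.constantCoeff_expand, pent_const]

lemma ser_tf : Ser ℤ tf tp := by
  have h5 := ser_euler.expand 5 (by norm_num)
  have hn : ∀ z : ℂ, ‖z‖ < 1 → ‖z ^ 5‖ < 1 := fun z hz => by
    rw [norm_pow]; exact pow_lt_one₀ (norm_nonneg _) hz (by norm_num)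
  have hi := h5.inv (fun z hz => euler_ne_zero (hn z hz))
    (q := invOfUnit (PowerSeries.expand 5 (by norm_num) (pentagonalSeries ℤ)) 1)
    (mul_invOfUnit _ _ (by rw [pent5_const]; rfl))
  exact ((ser_euler.mul hi).pow 6).congr fun z _ => by simp [tf, div_eq_mul_inv]

lemma tp_const : constantCoeff tp = 1 := by
  simp [tp, pent_const]

lemma tf_ne_zero {z : ℂ} (hz : ‖z‖ < 1) : tf z ≠ 0 := by
  have : ‖z ^ 5‖ < 1 := by
    rw [norm_pow]; exact pow_lt_one₀ (norm_nonneg _) hz (by norm_num)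
  exact pow_ne_zero _ (div_ne_zero (euler_ne_zero hz) (euler_ne_zero this))

lemma coe_S (τ : ℍ) : (mob 0 (-1) 1 0 τ : ℂ) = -1 / τ := by
  rw [coe_mob (by norm_num)]; simp

lemma eta_S (τ : ℍ) : ModularForm.eta (-1 / τ) = (Complex.sqrt Complex.I)⁻¹ * (Complex.sqrt τ * ModularForm.eta τ) := by
  simpa using ModularForm.eta_comp_eq_csqrt_I_inv τ.im_pos

lemma csqrt_sq (z : ℂ) : Complex.sqrt z ^ 2 = z := by
  unfold Complex.sqrt
  rw [← Complex.cpow_nat_mul]; simp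

/-- Fricke involution -/
lemma tt_W (τ : ℍ) : tt (mob 0 (-1) 5 0 τ) * tt τ = 125 := by
  unfold tt
  have h1 : (mob 0 (-1) 5 0 τ : ℂ) = -1 / (mob 5 0 0 1 τ) := by
    rw [coe_five, coe_mob (by norm_num)]; simp
  have h2 : (mob 5 0 0 1 (mob 0 (-1) 5 0 τ) : ℂ) = -1 / τ := by
    rw [coe_five, h1, coe_five]
    have := τ.ne_zero
    field_simp
  rw [h2, h1, eta_S, eta_S, ← mul_pow]
  have e1 := eta_ne τ
  have e2 := eta_ne (mob 5 0 0 1 τ)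
  have e3 : Complex.sqrt Complex.I ≠ 0 := by
    intro h; have := csqrt_sq Complex.I; rw [h] at this; simp at this; exact Complex.I_ne_zero this.symm
  have e4 : Complex.sqrt τ ≠ 0 := by
    intro h; have := csqrt_sq τ; rw [h] at this; simp at this; exact τ.ne_zero this.symm
  have : (Complex.sqrt Complex.I)⁻¹ * (Complex.sqrt (mob 5 0 0 1 τ) * ModularForm.eta (mob 5 0 0 1 τ)) /
      ((Complex.sqrt Complex.I)⁻¹ * (Complex.sqrt τ * ModularForm.eta τ)) *
      (ModularForm.eta τ / ModularForm.eta (mob 5 0 0 1 τ)) = Complex.sqrt (mob 5 0 0 1 τ) / Complex.sqrt τ := by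
    field_simp
  rw [this, div_pow, show 6 = 2 * 3 from rfl, pow_mul, pow_mul, csqrt_sq, csqrt_sq, coe_five]
  have := τ.ne_zero
  field_simp
  norm_num

lemma qq_T (k : ℤ) (τ : ℍ) : qq (mob 1 k 0 1 τ) = qq τ := by
  unfold qq
  rw [coe_mob (by norm_num)]
  rw [Complex.exp_eq_exp_iff_exists_int]
  exact ⟨k, by push_cast; ring⟩

lemma tt_T (k : ℤ) (τ : ℍ) : tt (mob 1 k 0 1 τ) = tt τ := by
  rw [tt_eq, tt_eq, qq_T]

lemma tt_V (τ : ℍ) : tt (mob 1 0 5 1 τ) = tt τ := by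
  have h1 := tt_W (mob 1 0 5 1 τ)
  have h2 := tt_W τ
  have h3 : mob 0 (-1) 5 0 (mob 1 0 5 1 τ) = mob 1 (-1) 0 1 (mob 0 (-1) 5 0 τ) := by
    rw [mob_mob (by norm_num) (by norm_num), mob_mob (by norm_num) (by norm_num)]
    norm_num
  rw [h3, tt_T] at h1
  have h4 := tt_ne_zero (mob 0 (-1) 5 0 τ)
  exact mul_left_cancel₀ h4 (h1.trans h2.symm)

lemma tt_pow_four_inv {a b c d : ℤ} (h : a * d - b * (5 * c) = 1) (τ : ℍ) :
    tt (mob a b (5 * c) d τ) ^ 4 = tt τ ^ 4 := by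
  rw [tt_pow_four, tt_pow_four]
  have h3 : mob 5 0 0 1 (mob a b (5 * c) d τ) = mob a (5 * b) c d (mob 5 0 0 1 τ) := by
    rw [mob_mob (by norm_num) (by omega), mob_mob (by linarith) (by norm_num)]
    congr 1 <;> ring
  rw [h3, Del_mob h, Del_mob (by linarith), coe_five]
  have e1 : ((5 * c : ℤ) : ℂ) * τ + d ≠ 0 := lin_ne_zero (a := a) (b := b) (by omega) τ
  rw [show (c : ℂ) * (5 * τ) + d = ((5 * c : ℤ) : ℂ) * τ + d by push_cast; ring,
    mul_div_mul_left _ _ (pow_ne_zero _ e1)]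

lemma Hol.continuous {F : ℍ → ℂ} (hF : Hol F) : Continuous F := ((hol_iff F).mp hF).continuous

lemma tt_inv_of_fixed {a b c d : ℤ} (h : a * d - b * (5 * c) = 1) (τ₀ : ℍ)
    (h0 : mob a b (5 * c) d τ₀ = τ₀) (τ : ℍ) : tt (mob a b (5 * c) d τ) = tt τ := by
  let f : ℍ → ℂ := fun τ => tt (mob a b (5 * c) d τ) / tt τ
  have hf : Continuous f := ((hol_tt.comp_mob (by omega)).div hol_tt tt_ne_zero).continuous
  have hf4 : ∀ τ, f τ ^ 4 = 1 := fun τ => by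
    simp only [f]
    rw [div_pow, tt_pow_four_inv h, div_self (pow_ne_zero _ (tt_ne_zero τ))]
  have hfin : Set.Finite {x : ℂ | x ^ 4 = 1} := by
    refine ((Polynomial.nthRoots 4 (1 : ℂ)).toFinset.finite_toSet).subset ?_
    intro x hx
    simpa [Polynomial.mem_nthRoots] using hx
  have : f τ = f τ₀ := by
    refine IsPreconnected.constant_of_mapsTo (S := Set.univ) (T := {x : ℂ | x ^ 4 = 1})
      isPreconnected_univ hf.continuousOn (fun x _ => hf4 x) (Set.mem_univ _) (Set.mem_univ _) (hT := ?_)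
    exact hfin.isDiscrete
  have h1 : f τ₀ = 1 := by
    simp only [f]; rw [h0, div_self (tt_ne_zero _)]
  rw [h1] at this
  exact (div_eq_one_iff_eq (tt_ne_zero _)).mp this

lemma ext_mob {a b c d : ℤ} (h : 0 < a * d - b * c) (τ : ℍ) (hq : (c : ℂ) * τ ^ 2 + (d - a) * τ - b = 0) :
    mob a b c d τ = τ := by
  apply UpperHalfPlane.ext
  rw [coe_mob h, div_eq_iff (lin_ne_zero h τ)]
  linear_combination -hq

lemma tt_e1 (τ : ℍ) : tt (mob 2 (-1) 5 (-2) τ) = tt τ := by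
  refine tt_inv_of_fixed (c := 1) (by norm_num) ⟨(2 + Complex.I) / 5, by simp⟩ ?_ τ
  apply ext_mob (by norm_num)
  simp only []
  push_cast
  ring_nf
  rw [Complex.I_sq]; ring

lemma tt_e2 (τ : ℍ) : tt (mob 3 (-2) 5 (-3) τ) = tt τ := by
  refine tt_inv_of_fixed (c := 1) (by norm_num) ⟨(3 + Complex.I) / 5, by simp⟩ ?_ τ
  apply ext_mob (by norm_num)
  simp only []
  push_cast
  ring_nf
  rw [Complex.I_sq]; ring

lemma tt_mob_aux (n : ℕ) : ∀ (a b c d : ℤ), a * d - b * (5 * c) = 1 → c.natAbs < n → ∀ τ,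
    tt (mob a b (5 * c) d τ) = tt τ := by
  induction n with
  | zero => intro a b c d _ h; omega
  | succ n ih =>
    intro a b c d h hc τ
    -- reduce to c > 0
    have key : ∀ (a b c d : ℤ), a * d - b * (5 * c) = 1 → c.natAbs < n + 1 → 0 < c → ∀ τ,
        tt (mob a b (5 * c) d τ) = tt τ := by
      clear h hc τ a b c d
      intro a b c d h hc hpos τ
      -- generic step
      have step : ∀ (a b c d : ℤ), a * d - b * (5 * c) = 1 → c.natAbs < n + 1 → 0 < c → 0 ≤ d → d < 5 * c → ∀ τ,
          tt (mob a b (5 * c) d τ) = tt τ := by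
        clear h hc hpos τ a b c d
        intro a b c d h hc hpos hd0 hd1 τ
        have hd : d ≠ 0 := by
          rintro rfl
          have : (5 : ℤ) ∣ 1 := ⟨-b * c, by linarith⟩
          norm_num at this
        have aux : ∀ (p q r s : ℤ), p * s - q * (5 * r) = 1 → (∀ τ, tt (mob p q (5 * r) s τ) = tt τ) →
            (c * p + d * r).natAbs < n → tt (mob a b (5 * c) d τ) = tt τ := by
          intro p q r s hdet hinv hlt
          have inner : mob p q (5 * r) s (mob s (-q) (-(5 * r)) p τ) = mob 1 0 0 1 τ := by
            rw [mob_mob (by omega) (by linarith)]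
            congr 1 <;> linarith
          have e : mob a b (5 * c) d τ = mob a b (5 * c) d (mob p q (5 * r) s (mob s (-q) (-(5 * r)) p τ)) := by
            rw [inner, mob_mob (by omega) (by norm_num)]
            simp
          rw [e, mob_mob (by omega) (by omega)]
          have e2 : 5 * c * p + d * (5 * r) = 5 * (c * p + d * r) := by ring
          rw [e2, ih _ _ _ _ (by linear_combination (p * s - q * (5 * r)) * h + hdet) hlt]
          have e3 : tt τ = tt (mob p q (5 * r) s (mob s (-q) (-(5 * r)) p τ)) := by
            rw [inner, tt_T]
          rw [e3, hinv]
        have hV : ∀ τ, tt (mob 1 0 (5 * 1) 1 τ) = tt τ := by simpa using tt_V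
        have hV' : ∀ τ, tt (mob 1 0 (5 * (-1)) 1 τ) = tt τ := by
          intro τ
          rw [← tt_V (mob 1 0 (5 * (-1)) 1 τ), mob_mob (by norm_num) (by norm_num)]
          norm_num [tt_T]
        by_cases h1 : d < 2 * c
        · exact aux 1 0 (-1) 1 (by norm_num) hV' (by omega)
        -- combined with the shift T⁻¹
        have shiftT : ∀ (p q r s : ℤ), p * s - q * (5 * r) = 1 → (∀ τ, tt (mob p q (5 * r) s τ) = tt τ) →
            p * s - 5 * r * q = 1 ∧ ∀ τ, tt (mob (p - 5 * r) (q - s) (5 * r) s τ) = tt τ := by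
          intro p q r s hdet hinv
          refine ⟨by linarith, fun τ => ?_⟩
          rw [← hinv τ, ← tt_T (-1) (mob p q (5 * r) s τ), mob_mob (by norm_num) (by omega)]
          congr 2 <;> ring
        by_cases h2 : 3 * c < d
        · exact aux (1 - 5 * 1) (0 - 1) 1 1 (by norm_num) (shiftT 1 0 1 1 (by norm_num) hV).2 (by omega)
        by_cases h3 : d = 2 * c
        · exact aux (3 - 5 * 1) (-2 - (-3)) 1 (-3) (by norm_num) (shiftT 3 (-2) 1 (-3) (by norm_num) (by simpa using tt_e2)).2 (by omega)
        · exact aux (2 - 5 * 1) (-1 - (-2)) 1 (-2) (by norm_num) (shiftT 2 (-1) 1 (-2) (by norm_num) (by simpa using tt_e1)).2 (by omega)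
      have e := step a (b - a * (d / (5 * c))) c (d % (5 * c)) (by
        have := Int.emod_add_mul_ediv d (5 * c)
        linear_combination h + a * this) hc hpos (Int.emod_nonneg _ (by omega)) (Int.emod_lt_of_pos _ (by omega))
        (mob 1 (d / (5 * c)) 0 1 τ)
      rw [tt_T, mob_mob ?_ (by norm_num)] at e
      · rw [← e]
        congr 2
        · ring
        · ring
        · ring
        · have := Int.emod_add_mul_ediv d (5 * c)
          linarith
      · have := Int.emod_add_mul_ediv d (5 * c)
        have : a * (d % (5 * c)) - (b - a * (d / (5 * c))) * (5 * c) = 1 := by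
          linear_combination h + a * this
        omega
    rcases lt_trichotomy c 0 with hc0 | hc0 | hc0
    · rw [← mob_eq_of_scale (-1) (by norm_num) (by omega)]
      have := key (-a) (-b) (-c) (-d) (by linarith) (by omega) (by omega) τ
      rw [← this]; congr 2 <;> ring
    · subst hc0
      have had : a * d = 1 := by linarith
      rcases Int.eq_one_or_neg_one_of_mul_eq_one had with rfl | rfl
      · obtain rfl : d = 1 := by linarith
        simpa using tt_T b τ
      · obtain rfl : d = -1 := by linarith
        rw [← mob_eq_of_scale (-1) (by norm_num) (by omega)]
        simpa using tt_T (-b) τ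
    · exact key a b c d h hc hc0 τ

lemma tt_mob {a b c d : ℤ} (h : a * d - b * (5 * c) = 1) (τ : ℍ) : tt (mob a b (5 * c) d τ) = tt τ :=
  tt_mob_aux (c.natAbs + 1) a b c d h (by omega) τ

lemma tt_smul (γ : SL(2, ℤ)) (hγ : γ ∈ CongruenceSubgroup.Gamma0 5) (τ : ℍ) : tt (γ • τ) = tt τ := by
  rw [CongruenceSubgroup.Gamma0_mem] at hγ
  obtain ⟨c, hc⟩ : (5 : ℤ) ∣ γ 1 0 := by
    have := (ZMod.intCast_zmod_eq_zero_iff_dvd _ 5).mp hγ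
    exact_mod_cast this
  have := sl_det γ
  rw [sl_smul, hc]
  rw [hc] at this
  exact tt_mob this τ

end HQ
end

section
namespace HQ
open PowerSeries Filter Topology UpperHalfPlane
open scoped MatrixGroups ModularForm Manifold

section
variable {R : Type*} [CommRing R] [Algebra R ℂ] {f g : ℂ → ℂ} {p q : PowerSeries R}

lemma Ser.div_X (m : ℕ) (hf : Ser R f (PowerSeries.X ^ m * p)) :
    ∃ g, Ser R g p ∧ ∀ z, ‖z‖ < 1 → f z = z ^ m * g z := by
  have hs : ∀ z : ℂ, ‖z‖ < 1 → Summable (fun n => algebraMap R ℂ (coeff n p) * z ^ n) := by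
    intro z hz
    by_cases h0 : z = 0
    · subst h0
      apply summable_of_ne_finset_zero (s := {0})
      intro n hn
      have : n ≠ 0 := by simpa using hn
      simp [this]
    have h := (summable_nat_add_iff m).mpr (hf z hz).summable
    have h2 := h.mul_left ((z ^ m)⁻¹)
    refine h2.congr fun n => ?_
    rw [PowerSeries.coeff_X_pow_mul, pow_add]
    field_simp
  refine ⟨fun z => ∑' n, algebraMap R ℂ (coeff n p) * z ^ n, fun z hz => (hs z hz).hasSum, fun z hz => ?_⟩
  have h1 : Ser R (fun z => ∑' n, algebraMap R ℂ (coeff n p) * z ^ n) p := fun z hz => (hs z hz).hasSum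
  have h2 := ((ser_X (R := R)).pow m).mul h1 z hz
  exact (hf z hz).unique h2

/-- homogenization -/
noncomputable def homog {S : Type*} [CommRing S] (n : ℕ) (P : Polynomial S) (h : PowerSeries S) : PowerSeries S :=
  ∑ i ∈ Finset.range (n + 1), PowerSeries.C (P.coeff i) * PowerSeries.X ^ (n - i) * h ^ i

lemma homog_succ {S : Type*} [CommRing S] (n : ℕ) (P : Polynomial S) (h : PowerSeries S) :
    homog (n + 1) P h = PowerSeries.X * homog n P h + PowerSeries.C (P.coeff (n + 1)) * h ^ (n + 1) := by
  unfold homog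
  rw [Finset.sum_range_succ]
  congr 1
  · rw [Finset.mul_sum]
    refine Finset.sum_congr rfl fun i hi => ?_
    have : n + 1 - i = (n - i) + 1 := by have := Finset.mem_range.mp hi; omega
    rw [this, pow_succ]; ring
  · simp

lemma homog_sub {S : Type*} [CommRing S] (n : ℕ) (P Q : Polynomial S) (h : PowerSeries S) :
    homog n (P - Q) h = homog n P h - homog n Q h := by
  unfold homog
  rw [← Finset.sum_sub_distrib]
  refine Finset.sum_congr rfl fun i _ => ?_
  simp; ring

lemma homog_map {S S' : Type*} [CommRing S] [CommRing S'] (φ : S →+* S') (n : ℕ) (P : Polynomial S) (h : PowerSeries S) :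
    PowerSeries.map φ (homog n P h) = homog n (P.map φ) (PowerSeries.map φ h) := by
  unfold homog
  simp [map_sum]

lemma homog_eq_zero {S : Type*} [CommRing S] (n : ℕ) : ∀ (P : Polynomial S) (h : PowerSeries S),
    constantCoeff h = 1 → P.natDegree ≤ n → PowerSeries.X ^ (n + 1) ∣ homog n P h → P = 0 := by
  induction n with
  | zero =>
    intro P h h1 hP hd
    rw [Polynomial.eq_C_of_natDegree_le_zero hP] at hd ⊢
    have := PowerSeries.X_pow_dvd_iff.mp hd 0 (by norm_num)
    simp [homog] at this
    simp [this]
  | succ n ih =>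
    intro P h h1 hP hd
    have h0 := PowerSeries.X_pow_dvd_iff.mp hd 0 (by omega)
    rw [homog_succ] at h0 hd
    simp [h1] at h0
    rw [h0, map_zero, zero_mul, add_zero] at hd
    refine ih P h h1 ?_ ?_
    · rw [Polynomial.natDegree_le_iff_coeff_eq_zero]
      intro N hN
      rcases (by omega : N = n + 1 ∨ n + 1 < N) with rfl | hN
      · exact h0
      · exact Polynomial.coeff_eq_zero_of_natDegree_lt (by omega)
    · rw [PowerSeries.X_pow_dvd_iff] at hd ⊢
      intro m hm
      have := hd (m + 1) (by omega)
      rwa [PowerSeries.coeff_succ_X_mul] at this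

lemma homog_inj {S : Type*} [CommRing S] {n : ℕ} {P Q : Polynomial S} {h : PowerSeries S}
    (h1 : constantCoeff h = 1) (hP : P.natDegree ≤ n) (hQ : Q.natDegree ≤ n)
    (hd : PowerSeries.X ^ (n + 1) ∣ homog n P h - homog n Q h) : P = Q := by
  rw [← homog_sub] at hd
  exact sub_eq_zero.mp (homog_eq_zero n _ h h1 ((Polynomial.natDegree_sub_le_of_le hP hQ).trans (by simp)) hd)

lemma ser_homog {hf : ℂ → ℂ} {hp : PowerSeries R} (h : Ser R hf hp) (n : ℕ) (P : Polynomial R) :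
    Ser R (fun z => ∑ i ∈ Finset.range (n + 1), algebraMap R ℂ (P.coeff i) * z ^ (n - i) * hf z ^ i) (homog n P hp) := by
  apply ser_sum
  intro i _
  exact ((ser_C _).mul (ser_X.pow _)).mul (h.pow i)

end

/-- local parameter -/
noncomputable def zz (m : ℕ) (τ : ℍ) : ℂ := Complex.exp (2 * Real.pi * Complex.I * τ / m)

lemma zz_ne_zero (m : ℕ) (τ : ℍ) : zz m τ ≠ 0 := Complex.exp_ne_zero _

lemma zz_pow (m : ℕ) (hm : m ≠ 0) (τ : ℍ) : zz m τ ^ m = qq τ := by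
  unfold zz qq
  rw [← Complex.exp_nat_mul]
  congr 1
  have : (m : ℂ) ≠ 0 := by exact_mod_cast hm
  field_simp

lemma norm_zz (m : ℕ) (τ : ℍ) : ‖zz m τ‖ = Real.exp (-2 * Real.pi * τ.im / m) := by
  rw [zz, Complex.norm_exp]
  congr 1
  rw [Complex.div_natCast_re]
  simp

lemma norm_zz_lt_one (m : ℕ) (hm : m ≠ 0) (τ : ℍ) : ‖zz m τ‖ < 1 := by
  rw [norm_zz, Real.exp_lt_one_iff]
  have h := mul_pos Real.pi_pos τ.im_pos
  have : (0 : ℝ) < m := by exact_mod_cast Nat.pos_of_ne_zero hm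
  rw [div_neg_iff]; right; constructor <;> linarith

lemma zz_T (m : ℕ) (τ : ℍ) : zz m (mob 1 1 0 1 τ) = Complex.exp (2 * Real.pi * Complex.I / m) * zz m τ := by
  unfold zz
  rw [← Complex.exp_add, coe_mob (by norm_num)]
  congr 1
  push_cast
  ring

lemma exists_zz (m : ℕ) (hm : m ≠ 0) {z : ℂ} (hz : z ≠ 0) (hz1 : ‖z‖ < 1) : ∃ τ : ℍ, zz m τ = z := by
  have hm' : (m : ℂ) ≠ 0 := by exact_mod_cast hm
  have hmr : (0 : ℝ) < m := by exact_mod_cast Nat.pos_of_ne_zero hm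
  let w : ℂ := m * (Complex.log z / (2 * Real.pi * Complex.I))
  have him : 0 < w.im := by
    have : Complex.log z / (2 * Real.pi * Complex.I) = (Complex.log z * (-Complex.I)) * ((1 / (2 * Real.pi) : ℝ) : ℂ) := by
      have hpi : (Real.pi : ℂ) ≠ 0 := by exact_mod_cast Real.pi_ne_zero
      push_cast
      field_simp
      rw [Complex.I_sq]; ring
    simp only [w]
    rw [this, ← Complex.ofReal_natCast, Complex.im_ofReal_mul, Complex.im_mul_ofReal]
    have hl : Real.log ‖z‖ < 0 := Real.log_neg (norm_pos_iff.mpr hz) hz1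
    have : (Complex.log z * (-Complex.I)).im = - Real.log ‖z‖ := by simp [Complex.log_re]
    rw [this]
    have := Real.pi_pos
    have : 0 < 1 / (2 * Real.pi) := by positivity
    have h3 : 0 < -Real.log ‖z‖ := by linarith
    positivity
  refine ⟨⟨w, him⟩, ?_⟩
  unfold zz
  have : 2 * Real.pi * Complex.I * w / m = Complex.log z := by
    have hpi : (Real.pi : ℂ) ≠ 0 := by exact_mod_cast Real.pi_ne_zero
    simp only [w]
    field_simp
  show Complex.exp (2 * Real.pi * Complex.I * w / m) = z
  rw [this, Complex.exp_log hz]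

lemma tendsto_zz (m : ℕ) (hm : m ≠ 0) : Tendsto (zz m) atImInfty (𝓝 0) := by
  rw [tendsto_zero_iff_norm_tendsto_zero]
  simp only [norm_zz]
  have hmr : (0 : ℝ) < m := by exact_mod_cast Nat.pos_of_ne_zero hm
  have h1 : Tendsto (fun y : ℝ => Real.exp (-2 * Real.pi * y / m)) atTop (𝓝 0) := by
    apply Real.tendsto_exp_atBot.comp
    have : (fun y : ℝ => -2 * Real.pi * y / m) = fun y : ℝ => (-2 * Real.pi / m) * y := by
      funext y; ring
    rw [this]
    apply Tendsto.const_mul_atTop_of_neg _ tendsto_id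
    have := Real.pi_pos
    rw [div_neg_iff]; right; constructor <;> linarith
  exact h1.comp tendsto_comap

lemma exp_root (m : ℕ) (hm : m ≠ 0) (k : ℕ) (h : Complex.exp (2 * Real.pi * Complex.I / m) ^ k = 1) : m ∣ k :=
  (Complex.isPrimitiveRoot_exp m hm).dvd_of_pow_eq_one k h

lemma bounded_of_ser {R : Type*} [CommRing R] [Algebra R ℂ] {f : ℂ → ℂ} {p : PowerSeries R} (hf : Ser R f p)
    (m : ℕ) (hm : m ≠ 0) {F : ℍ → ℂ} (hF : ∀ τ, F τ = f (zz m τ)) :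
    Tendsto F atImInfty (𝓝 (algebraMap R ℂ (constantCoeff p))) := by
  have : F = f ∘ zz m := funext hF
  rw [this, ← hf.apply_zero]
  exact hf.continuousAt.tendsto.comp (tendsto_zz m hm)

lemma isBounded_of_tendsto {F : ℍ → ℂ} {c : ℂ} (h : Tendsto F atImInfty (𝓝 c)) : IsBoundedAtImInfty F :=
  h.isBigO_one ℝ

instance : NeBot atImInfty := by
  unfold atImInfty
  rw [Filter.comap_neBot_iff]
  intro s hs
  obtain ⟨a, ha⟩ := Filter.mem_atTop_sets.mp hs
  refine ⟨⟨(max a 1 : ℝ) * Complex.I, by simp⟩, ?_⟩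
  apply ha
  show a ≤ Complex.im _
  simp

/-- Class of functions for which boundedness implies constancy, with a Hauptmodul `h`. -/
structure Haupt (R : Type*) [CommRing R] [Algebra R ℂ] (V : Subalgebra ℂ (ℍ → ℂ)) (h : ℍ → ℂ)
    (hf : ℂ → ℂ) (hp : PowerSeries R) : Prop where
  per : ∀ F ∈ V, ∀ τ, F (mob 1 1 0 1 τ) = F τ
  const : ∀ F ∈ V, IsBoundedAtImInfty F → ∃ c, ∀ τ, F τ = c
  mem : h ∈ V
  eq : ∀ τ, h τ = (qq τ)⁻¹ * hf (qq τ)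
  ser : Ser R hf hp
  one : constantCoeff hp = 1

theorem Haupt.poly {R : Type*} [CommRing R] [Algebra R ℂ] [FaithfulSMul R ℂ] {V : Subalgebra ℂ (ℍ → ℂ)} {h : ℍ → ℂ}
    {hf : ℂ → ℂ} {hp : PowerSeries R} (H : Haupt R V h hf hp) (m : ℕ) (hm : m ≠ 0) (n : ℕ) :
    ∀ F ∈ V, ∀ (f : ℂ → ℂ) (p : PowerSeries R), Ser R f p → (∀ τ, zz m τ ^ (m * n) * F τ = f (zz m τ)) →
    ∃ P : Polynomial R, P.natDegree ≤ n ∧ (∀ τ, F τ = Polynomial.aeval (h τ) P) ∧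
      p = PowerSeries.expand m hm (homog n P hp) := by
  -- first existence
  have ex : ∀ n : ℕ, ∀ F ∈ V, ∀ (f : ℂ → ℂ) (p : PowerSeries R), Ser R f p →
      (∀ τ, zz m τ ^ (m * n) * F τ = f (zz m τ)) →
      ∃ P : Polynomial R, P.natDegree ≤ n ∧ (∀ τ, F τ = Polynomial.aeval (h τ) P) := by
    clear n
    intro n
    induction n with
    | zero =>
      intro F hF f p hs he
      have he' : ∀ τ, F τ = f (zz m τ) := fun τ => by simpa using he τ
      have ht := bounded_of_ser hs m hm he'
      obtain ⟨c, hc⟩ := H.const F hF (isBounded_of_tendsto ht)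
      refine ⟨Polynomial.C (constantCoeff p), by simp, fun τ => ?_⟩
      have : Tendsto F atImInfty (𝓝 c) := by
        rw [funext hc]; exact tendsto_const_nhds
      rw [hc, tendsto_nhds_unique this ht]; simp
    | succ n ih =>
      intro F hF f p hs he
      set a := constantCoeff p with ha
      let F' : ℍ → ℂ := F - algebraMap R ℂ a • h ^ (n + 1)
      have hF' : F' ∈ V := V.sub_mem hF (V.smul_mem (V.pow_mem H.mem _) _)
      let g : ℂ → ℂ := fun z => f z - algebraMap R ℂ a * hf (z ^ m) ^ (n + 1)
      let pg : PowerSeries R := p - PowerSeries.C a * (PowerSeries.expand m hm hp) ^ (n + 1)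
      have hg : Ser R g pg := hs.sub (((H.ser.expand m hm).pow (n + 1)).smul a)
      have hgF : ∀ τ, zz m τ ^ (m * (n + 1)) * F' τ = g (zz m τ) := by
        intro τ
        have e1 := zz_ne_zero m τ
        have e2 := qq_ne_zero τ
        have e3 := zz_pow m hm τ
        simp only [F', g, Pi.sub_apply, Pi.smul_apply, Pi.pow_apply, smul_eq_mul]
        rw [mul_sub, he, H.eq, pow_mul, e3]
        congr 1
        rw [mul_pow, inv_pow]
        field_simp
      have hg0 : constantCoeff pg = 0 := by
        simp only [pg, map_sub, map_mul, PowerSeries.constantCoeff_C, map_pow, PowerSeries.constantCoeff_expand, H.one]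
        simp [ha]
      set ζ : ℂ := Complex.exp (2 * Real.pi * Complex.I / m) with hζ
      have hζm : ζ ^ m = 1 := (Complex.isPrimitiveRoot_exp m hm).pow_eq_one
      have hζn : ‖ζ‖ = 1 := Complex.norm_eq_one_of_pow_eq_one hζm hm
      have hgz : ∀ z : ℂ, ‖z‖ < 1 → g (ζ * z) = g z := by
        intro z hz
        by_cases h0 : z = 0
        · simp [h0]
        obtain ⟨τ, rfl⟩ := exists_zz m hm h0 hz
        rw [← zz_T, ← hgF, ← hgF, H.per F' hF', zz_T, mul_pow, ← hζ, pow_mul ζ, hζm, one_pow, one_mul]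
      have hgC : Ser ℂ g (PowerSeries.map (algebraMap R ℂ) pg) := hg.map _ (fun r => rfl)
      have hres := hgC.rescale ζ (by simp [hζn])
      have hEq := hres.unique hgC (by
        filter_upwards [Metric.ball_mem_nhds (0 : ℂ) one_pos] with z hz
        exact hgz z (by simpa using hz))
      have hco : ∀ k, ¬ m ∣ k → coeff k pg = 0 := by
        intro k hk
        have := congrArg (PowerSeries.coeff k) hEq
        rw [PowerSeries.coeff_rescale, PowerSeries.coeff_map] at this
        by_contra hne
        have hne' : algebraMap R ℂ (coeff k pg) ≠ 0 := by
          intro h; exact hne (FaithfulSMul.algebraMap_injective R ℂ (by rw [h, map_zero]))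
        exact hk (exp_root m hm k (mul_right_cancel₀ hne' (by rw [this, one_mul])))
      have hdvd : PowerSeries.X ^ m ∣ pg := by
        rw [PowerSeries.X_pow_dvd_iff]
        intro k hk
        by_cases hk0 : k = 0
        · subst hk0; simpa using hg0
        · exact hco k (fun hd => by have := Nat.le_of_dvd (Nat.pos_of_ne_zero hk0) hd; omega)
      obtain ⟨p', hp'⟩ := hdvd
      rw [hp'] at hg
      obtain ⟨g', hg', hgg⟩ := hg.div_X
      obtain ⟨P, hP, hPe⟩ := ih F' hF' g' p' hg' (fun τ => by
        have h1 := hgF τ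
        rw [hgg _ (norm_zz_lt_one m hm τ), mul_add, mul_one, pow_add] at h1
        have := zz_ne_zero m τ
        apply mul_left_cancel₀ (pow_ne_zero m this)
        rw [← h1]; ring)
      refine ⟨P + Polynomial.C a * Polynomial.X ^ (n + 1), ?_, fun τ => ?_⟩
      · apply Polynomial.natDegree_add_le_of_degree_le (by omega)
        exact Polynomial.natDegree_C_mul_X_pow_le _ _
      · have := hPe τ
        simp only [F', Pi.sub_apply, Pi.smul_apply, Pi.pow_apply, smul_eq_mul] at this
        simp only [map_add, ← this, map_mul, Polynomial.aeval_C, map_pow, Polynomial.aeval_X]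
        ring
  intro F hF f p hs he
  obtain ⟨P, hP, hPe⟩ := ex n F hF f p hs he
  refine ⟨P, hP, hPe, ?_⟩
  refine hs.unique ((ser_homog H.ser n P).expand m hm) ?_
  have hne : ∀ z : ℂ, z ≠ 0 → ‖z‖ < 1 → f z =
      ∑ i ∈ Finset.range (n + 1), algebraMap R ℂ (P.coeff i) * (z ^ m) ^ (n - i) * hf (z ^ m) ^ i := by
    intro z hz hz1
    obtain ⟨τ, rfl⟩ := exists_zz m hm hz hz1
    rw [← he, hPe, Polynomial.aeval_eq_sum_range' (n := n + 1) (by omega), pow_mul, zz_pow m hm, Finset.mul_sum]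
    refine Finset.sum_congr rfl fun i hi => ?_
    have hi' : i ≤ n := by have := Finset.mem_range.mp hi; omega
    have e2 := qq_ne_zero τ
    rw [H.eq, Algebra.smul_def, mul_pow, inv_pow, ← Nat.sub_add_cancel hi', pow_add, Nat.add_sub_cancel]
    field_simp
  filter_upwards [Metric.ball_mem_nhds (0 : ℂ) one_pos] with z hz
  have hz1 : ‖z‖ < 1 := by simpa using hz
  by_cases h0 : z = 0
  · -- continuity
    have c1 := hs.continuousAt
    have c2 := ((ser_homog H.ser n P).expand m hm).continuousAt
    rw [h0]
    refine tendsto_nhds_unique_of_frequently_eq (l := 𝓝[≠] (0 : ℂ)) (c1.tendsto.mono_left nhdsWithin_le_nhds)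
      (c2.tendsto.mono_left nhdsWithin_le_nhds) ?_
    apply Eventually.frequently
    filter_upwards [self_mem_nhdsWithin, nhdsWithin_le_nhds (Metric.ball_mem_nhds (0 : ℂ) one_pos)] with w hw hw1
    exact hne w hw (by simpa using hw1)
  · exact hne z h0 hz1

end HQ
end

section
namespace HQ
open PowerSeries Filter Topology UpperHalfPlane
open scoped MatrixGroups ModularForm Manifold

/-- power series of an Eisenstein series -/
noncomputable def esp (c : ℤ) (k : ℕ) : PowerSeries ℤ :=
  PowerSeries.mk fun n => if n = 0 then 1 else c * (ArithmeticFunction.sigma k n : ℕ)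

noncomputable def esf (c : ℤ) (k : ℕ) (z : ℂ) : ℂ :=
  ∑' n, algebraMap ℤ ℂ (PowerSeries.coeff n (esp c k)) * z ^ n

lemma ser_esf (c : ℤ) (k : ℕ) : Ser ℤ (esf c k) (esp c k) := by
  intro z hz
  refine Summable.hasSum ?_
  have h := (summable_pow_mul_geometric_of_norm_lt_one (R := ℝ) (k + 1) (r := ‖z‖) (by simpa using hz)).mul_left ((|c| : ℤ) : ℝ)
  have h0 := (summable_geometric_of_lt_one (norm_nonneg z) hz).add h
  refine Summable.of_norm_bounded h0 fun n => ?_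
  rw [norm_mul, norm_pow]
  have : ‖algebraMap ℤ ℂ (PowerSeries.coeff n (esp c k))‖ ≤ 1 + ((|c| : ℤ) : ℝ) * (n : ℝ) ^ (k + 1) := by
    simp only [esp, PowerSeries.coeff_mk]
    split_ifs with h
    · simp [h]
    · have h1 : (ArithmeticFunction.sigma k n : ℕ) ≤ n ^ (k + 1) := ArithmeticFunction.sigma_le_pow_succ k n
      have h2 : ((ArithmeticFunction.sigma k n : ℕ) : ℝ) ≤ (n : ℝ) ^ (k + 1) := by exact_mod_cast h1
      have h3 : (0 : ℝ) ≤ ((|c| : ℤ) : ℝ) := by exact_mod_cast abs_nonneg c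
      simp only [algebraMap_int_eq, eq_intCast, Int.cast_mul, Int.cast_natCast, norm_mul, Complex.norm_natCast, Complex.norm_intCast]
      rw [← Int.cast_abs]
      nlinarith [mul_le_mul_of_nonneg_left h2 h3]
  calc _ ≤ (1 + ((|c| : ℤ) : ℝ) * (n : ℝ) ^ (k + 1)) * ‖z‖ ^ n := by gcongr
    _ = _ := by ring

lemma esp_const (c k) : constantCoeff (esp c k) = 1 := by
  rw [← PowerSeries.coeff_zero_eq_constantCoeff_apply]; simp [esp]

/-- weight k invariance -/
def IsWt (k : ℕ) (F : ℍ → ℂ) : Prop := ∀ (γ : SL(2, ℤ)) (τ : ℍ), F (γ • τ) = (γ 1 0 * τ + γ 1 1 : ℂ) ^ k * F τ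

noncomputable def E2 (τ : ℍ) : ℂ := EisensteinSeries.E2 τ
noncomputable def E4 (τ : ℍ) : ℂ := ModularForm.E₄ τ
noncomputable def E6 (τ : ℍ) : ℂ := ModularForm.E₆ τ

lemma denom_eq (γ : SL(2, ℤ)) (τ : ℍ) : denom γ τ = (γ 1 0 * τ + γ 1 1 : ℂ) := by
  simp [denom]

lemma lin_ne (γ : SL(2, ℤ)) (τ : ℍ) : (γ 1 0 * τ + γ 1 1 : ℂ) ≠ 0 := by
  rw [← denom_eq]; exact denom_ne_zero _ _

lemma isWt_of_slash {k : ℕ} {F : ℍ → ℂ} (h : ∀ γ : SL(2, ℤ), F ∣[(k : ℤ)] γ = F) : IsWt k F := by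
  intro γ τ
  have h1 := congrFun (h γ) τ
  rw [ModularForm.SL_slash_apply, denom_eq] at h1
  have := lin_ne γ τ
  rw [zpow_neg, zpow_natCast] at h1
  rw [← h1]
  field_simp

lemma IsWt.slash {k : ℕ} {F : ℍ → ℂ} (h : IsWt k F) (γ : SL(2, ℤ)) : F ∣[(k : ℤ)] γ = F := by
  ext τ
  rw [ModularForm.SL_slash_apply, denom_eq, h γ τ, zpow_neg, zpow_natCast]
  have := lin_ne γ τ
  field_simp

lemma isWt_E4 : IsWt 4 E4 := isWt_of_slash fun γ => by
  have := SlashInvariantFormClass.slash_action_eq ModularForm.E₄ (γ : GL (Fin 2) ℝ) ⟨γ, rfl⟩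
  exact this
lemma isWt_E6 : IsWt 6 E6 := isWt_of_slash fun γ => by
  have := SlashInvariantFormClass.slash_action_eq ModularForm.E₆ (γ : GL (Fin 2) ℝ) ⟨γ, rfl⟩
  exact this

lemma hol_E4 : Hol E4 := (hol_iff _).mpr (ModularFormClass.holo ModularForm.E₄)
lemma hol_E6 : Hol E6 := (hol_iff _).mpr (ModularFormClass.holo ModularForm.E₆)
lemma hol_E2 : Hol E2 := (hol_iff _).mpr E2_mdifferentiable

lemma E2_eq (τ : ℍ) : E2 τ = esf (-24) 1 (qq τ) := by
  have h := EisensteinSeries.hasSum_qExpansion_E2 (z := τ)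
  have e : (fun m : ℕ => (if m = 0 then 1 else -24 * ((ArithmeticFunction.sigma 1 m : ℕ) : ℂ)) •
      Complex.exp (2 * Real.pi * Complex.I * τ) ^ m) =
      fun n => algebraMap ℤ ℂ (PowerSeries.coeff n (esp (-24) 1)) * qq τ ^ n := by
    funext m
    by_cases hm : m = 0 <;> simp [esp, hm, qq]
  rw [e] at h
  exact h.unique (ser_esf (-24) 1 (qq τ) (norm_qq_lt_one τ))

lemma E_eq_aux {k : ℕ} (hk : 3 ≤ k) (hk2 : Even k) (c : ℤ) (hc : -(2 * k / (bernoulli k : ℂ)) = c) (τ : ℍ) :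
    ModularForm.E hk τ = esf c (k - 1) (qq τ) := by
  rw [EisensteinSeries.q_expansion_bernoulli hk hk2]
  have h := ser_esf c (k - 1) (qq τ) (norm_qq_lt_one τ)
  have h2 := (hasSum_nat_add_iff' 1).mpr h
  have e2 := h2.tsum_eq
  rw [sub_eq_add_neg, ← neg_mul, hc]
  simp only [zpow_natCast]
  rw [tsum_pnat_eq_tsum_succ (f := fun n => ((ArithmeticFunction.sigma (k-1) n : ℕ) : ℂ) * Complex.exp (2 * Real.pi * Complex.I * τ) ^ n)]
  rw [← tsum_mul_left]
  have e3 : (fun n : ℕ => algebraMap ℤ ℂ (PowerSeries.coeff (n + 1) (esp c (k-1))) * qq τ ^ (n+1)) =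
    fun n => (c : ℂ) * (((ArithmeticFunction.sigma (k-1) (n+1) : ℕ) : ℂ) * Complex.exp (2 * Real.pi * Complex.I * τ) ^ (n+1)) := by
    funext n
    simp [esp, qq, mul_assoc]
  rw [e3] at e2
  rw [e2]
  simp [esp]

lemma bern6 : _root_.bernoulli 6 = 1 / 42 := by
  rw [bernoulli_eq_bernoulli'_of_ne_one (by norm_num), bernoulli'_def]
  have h5 : bernoulli' 5 = 0 := bernoulli'_eq_zero_of_odd (by decide) (by norm_num)
  norm_num [Finset.sum_range_succ, bernoulli'_four, bernoulli'_three, bernoulli'_two, bernoulli'_one, bernoulli'_zero, h5, Nat.choose]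

lemma E4_eq (τ : ℍ) : E4 τ = esf 240 3 (qq τ) := by
  refine E_eq_aux (by norm_num) (by decide) _ ?_ τ
  rw [bernoulli_eq_bernoulli'_of_ne_one (by norm_num), bernoulli'_four]; norm_num
lemma E6_eq (τ : ℍ) : E6 τ = esf (-504) 5 (qq τ) := by
  refine E_eq_aux (by norm_num) (by decide) _ ?_ τ
  rw [bern6]; norm_num

lemma Del_E (τ : ℍ) : E4 τ ^ 3 - E6 τ ^ 2 = 1728 * Del τ := by
  have := ModularForm.discriminant_eq_E₄_cube_sub_E₆_sq τ
  unfold Del E4 E6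
  rw [this]; ring

/-! derivative -/
lemma Ser.deriv {R : Type*} [CommRing R] [Algebra R ℂ] {f : ℂ → ℂ} {p : PowerSeries R} (h : Ser R f p) :
    Ser R (deriv f) (PowerSeries.derivative R p) := by
  have hd : DifferentiableOn ℂ (_root_.deriv f) (Metric.ball 0 1) := h.differentiableOn.deriv Metric.isOpen_ball
  obtain ⟨q, hq⟩ := ser_of_differentiableOn hd
  refine Ser.of_map (algebraMap R ℂ) (fun _ => rfl) ?_
  have : PowerSeries.map (algebraMap R ℂ) (PowerSeries.derivative R p) = q := by
    ext n
    have h1 := hq.coeff_eq_iteratedDeriv n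
    have h2 := h.coeff_eq_iteratedDeriv (n + 1)
    rw [← iteratedDeriv_succ'] at h1
    simp only [Algebra.algebraMap_self, RingHom.id_apply] at h1
    rw [h1, PowerSeries.coeff_map, PowerSeries.coeff_derivative, map_mul, h2, Nat.factorial_succ]
    have : (n.factorial : ℂ) ≠ 0 := by exact_mod_cast Nat.factorial_ne_zero n
    have : (n + 1 : ℂ) ≠ 0 := by exact_mod_cast Nat.succ_ne_zero n
    simp only [map_add, map_natCast, map_one]
    push_cast
    field_simp
  rw [this]; exact hq

/-- theta operator on power series -/
noncomputable def theta {R : Type*} [CommRing R] (p : PowerSeries R) : PowerSeries R :=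
  PowerSeries.X * PowerSeries.derivative R p

lemma hasDeriv_comp_qq {f : ℂ → ℂ} {R : Type*} [CommRing R] [Algebra R ℂ] {p : PowerSeries R} (h : Ser R f p)
    {F : ℍ → ℂ} (hF : ∀ τ, F τ = f (qq τ)) (τ : ℍ) :
    Derivative.normalizedDerivOfComplex F τ = qq τ * _root_.deriv f (qq τ) := by
  unfold Derivative.normalizedDerivOfComplex
  have e : (F ∘ ofComplex) =ᶠ[𝓝 (τ : ℂ)] fun w => f (Complex.exp (2 * Real.pi * Complex.I * w)) := by
    filter_upwards [isOpen_upperHalfPlaneSet.mem_nhds τ.im_pos] with w hw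
    rw [Function.comp_apply, hF, qq, ofComplex_apply_of_im_pos hw]
  have h1 : HasDerivAt (fun w : ℂ => Complex.exp (2 * Real.pi * Complex.I * w)) (Complex.exp (2 * Real.pi * Complex.I * τ) * (2 * Real.pi * Complex.I)) (τ : ℂ) := by
    have := ((hasDerivAt_id (τ : ℂ)).const_mul (2 * Real.pi * Complex.I)).cexp
    simpa using this
  have h2 : HasDerivAt f (_root_.deriv f (qq τ)) (qq τ) := by
    refine (h.differentiableOn.differentiableAt (Metric.isOpen_ball.mem_nhds ?_)).hasDerivAt
    simpa using norm_qq_lt_one τ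
  have h3 := (HasDerivAt.comp (τ : ℂ) h2 h1).congr_of_eventuallyEq e
  rw [h3.deriv]
  have : (2 * Real.pi * Complex.I : ℂ) ≠ 0 := Complex.two_pi_I_ne_zero
  change _ * (_ * (qq τ * _)) = _
  field_simp

lemma Ser.theta {R : Type*} [CommRing R] [Algebra R ℂ] {f : ℂ → ℂ} {p : PowerSeries R} (h : Ser R f p) :
    Ser R (fun z => z * _root_.deriv f z) (theta p) := ser_X.mul h.deriv

lemma vanish {k : ℕ} (hk : k < 12) {G : ℍ → ℂ} (hG : Hol G) (hw : IsWt k G) {g : ℂ → ℂ}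
    {p : PowerSeries ℤ} (hg : Ser ℤ g p) {c : ℂ} (hGg : ∀ τ, G τ = c * g (qq τ)) (h0 : constantCoeff p = 0) :
    ∀ τ, G τ = 0 := by
  obtain ⟨p', hp'⟩ := PowerSeries.X_dvd_iff.mpr h0
  obtain ⟨g', hg', hgg⟩ := Ser.div_X (p := p') 1 (by rw [pow_one, ← hp']; exact hg)
  have hH : Hol (fun τ => G τ ^ 12 / Del τ ^ k) := (hG.pow 12).div (hol_Del.pow k) fun τ => pow_ne_zero _ (Del_ne_zero τ)
  have hlim : Tendsto (fun τ => G τ ^ 12 / Del τ ^ k) atImInfty (𝓝 0) := by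
    have hq : Tendsto qq atImInfty (𝓝 0) := by
      have := tendsto_zz 1 (by norm_num)
      refine this.congr fun τ => ?_
      simp [zz, qq]
    have e : ∀ τ, (c * g' (qq τ)) ^ 12 / (euler (qq τ)) ^ (24 * k) * qq τ ^ (12 - k) = G τ ^ 12 / Del τ ^ k := by
      intro τ
      rw [hGg, hgg _ (norm_qq_lt_one τ), Del_eq]
      have h1 := qq_ne_zero τ
      have h2 := euler_ne_zero (norm_qq_lt_one τ)
      rw [mul_pow (qq τ), ← pow_mul, pow_one]
      field_simp
      rw [mul_assoc, ← pow_add, Nat.sub_add_cancel hk.le]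
    refine Tendsto.congr e ?_
    have t1 : Tendsto (fun τ => g' (qq τ)) atImInfty (𝓝 (g' 0)) := hg'.continuousAt.tendsto.comp hq
    have t2 : Tendsto (fun τ => euler (qq τ)) atImInfty (𝓝 (euler 0)) := ser_euler.continuousAt.tendsto.comp hq
    have t3 := (((t1.const_mul c).pow 12).div (t2.pow (24 * k)) (pow_ne_zero _ (euler_ne_zero (by simp)))).mul (hq.pow (12 - k))
    rw [zero_pow (by omega), mul_zero] at t3
    exact t3
  obtain ⟨c', hc⟩ := const1 hH (fun γ τ => by
    have := lin_ne γ τ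
    have := Del_ne_zero τ
    rw [hw, Del_smul]
    generalize (γ 1 0 * τ + γ 1 1 : ℂ) = w at *
    field_simp
    ring) (isBounded_of_tendsto hlim)
  have hc0 : c' = 0 := by
    refine tendsto_nhds_unique ?_ hlim
    exact (tendsto_congr hc).mpr tendsto_const_nhds
  intro τ
  have h := hc τ
  rw [hc0, div_eq_zero_iff] at h
  rcases h with h | h
  · exact pow_eq_zero_iff (by norm_num) |>.mp h
  · exact absurd h (pow_ne_zero _ (Del_ne_zero τ))


lemma hol_D {F : ℍ → ℂ} (h : Hol F) : Hol ((Derivative.normalizedDerivOfComplex) F) :=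
  (hol_iff _).mpr (Derivative.normalizedDerivOfComplex_mdifferentiable ((hol_iff _).mp h))

lemma isWt_serre {k : ℕ} {F : ℍ → ℂ} (hF : Hol F) (h : IsWt k F) :
    IsWt (k + 2) (fun τ => (Derivative.normalizedDerivOfComplex) F τ - k * 12⁻¹ * E2 τ * F τ) := by
  apply isWt_of_slash
  intro γ
  exact Derivative.serreDerivative_slash_invariant (k := k) ((hol_iff _).mp hF) (h.slash γ)

lemma IsWt.add {k : ℕ} {F G : ℍ → ℂ} (h : IsWt k F) (h' : IsWt k G) : IsWt k (fun τ => F τ + G τ) := by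
  intro γ τ; simp only [h γ τ, h' γ τ]; ring
lemma IsWt.cmul {k : ℕ} {F : ℍ → ℂ} (c : ℂ) (h : IsWt k F) : IsWt k (fun τ => c * F τ) := by
  intro γ τ; simp only [h γ τ]; ring
lemma IsWt.mul {k k' : ℕ} {F G : ℍ → ℂ} (h : IsWt k F) (h' : IsWt k' G) : IsWt (k + k') (fun τ => F τ * G τ) := by
  intro γ τ; simp only [h γ τ, h' γ τ]; ring

lemma theta_const {R : Type*} [CommRing R] (p : PowerSeries R) : constantCoeff (theta p) = 0 := by
  simp [theta]

lemma ram4 (τ : ℍ) : 3 * (Derivative.normalizedDerivOfComplex) E4 τ = E2 τ * E4 τ - E6 τ := by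
  have h := vanish (k := 6) (by norm_num) (G := fun τ => ((Derivative.normalizedDerivOfComplex) E4 τ - (4 : ℕ) * 12⁻¹ * E2 τ * E4 τ) + 3⁻¹ * E6 τ)
    (((hol_D hol_E4).sub (((hol_const _).mul hol_E2).mul hol_E4)).add ((hol_const _).mul hol_E6))
    ((isWt_serre hol_E4 isWt_E4).add (isWt_E6.cmul 3⁻¹))
    ((((ser_esf 240 3).theta.smul 3).sub ((ser_esf (-24) 1).mul (ser_esf 240 3))).add (ser_esf (-504) 5)) (c := 3⁻¹)
    (fun τ => by
      simp only [hasDeriv_comp_qq (ser_esf 240 3) E4_eq, E4_eq, E6_eq, E2_eq]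
      simp; ring)
    (by simp [esp_const, theta_const])
  have := h τ
  push_cast at this
  linear_combination 3 * this

lemma ram6 (τ : ℍ) : 2 * (Derivative.normalizedDerivOfComplex) E6 τ = E2 τ * E6 τ - E4 τ ^ 2 := by
  have h := vanish (k := 8) (by norm_num) (G := fun τ => ((Derivative.normalizedDerivOfComplex) E6 τ - (6 : ℕ) * 12⁻¹ * E2 τ * E6 τ) + 2⁻¹ * (E4 τ * E4 τ))
    (((hol_D hol_E6).sub (((hol_const _).mul hol_E2).mul hol_E6)).add ((hol_const _).mul (hol_E4.mul hol_E4)))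
    ((isWt_serre hol_E6 isWt_E6).add ((isWt_E4.mul isWt_E4).cmul 2⁻¹))
    ((((ser_esf (-504) 5).theta.smul 2).sub ((ser_esf (-24) 1).mul (ser_esf (-504) 5))).add ((ser_esf 240 3).mul (ser_esf 240 3))) (c := 2⁻¹)
    (fun τ => by
      simp only [hasDeriv_comp_qq (ser_esf (-504) 5) E6_eq, E4_eq, E6_eq, E2_eq]
      simp; ring)
    (by simp [esp_const, theta_const])
  have := h τ
  push_cast at this
  linear_combination 2 * this

lemma E2_slash (γ : SL(2, ℤ)) : E2 ∣[(2 : ℤ)] γ = fun τ : ℍ => E2 τ + 12 * (2 * Real.pi * Complex.I)⁻¹ * (γ 1 0 / denom γ τ) := by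
  have := EisensteinSeries.E2_slash_action γ
  unfold E2
  refine this.trans ?_
  ext τ
  simp only [Pi.sub_apply, Pi.smul_apply, EisensteinSeries.D2, riemannZeta_two, smul_eq_mul]
  have hI : Complex.I ≠ 0 := Complex.I_ne_zero
  have hpi : (Real.pi : ℂ) ≠ 0 := by exact_mod_cast Real.pi_ne_zero
  have hd := denom_ne_zero γ τ
  field_simp
  ring_nf
  simp [Complex.I_sq]
  try ring

lemma isWt_DE2 : IsWt 4 (fun τ => (Derivative.normalizedDerivOfComplex) E2 τ + (- 12⁻¹) * (E2 τ * E2 τ)) := by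
  intro γ τ
  have h1 := congrFun (Derivative.normalizedDerivOfComplex_SL_slash (k := 2) ((hol_iff _).mp hol_E2) (γ := γ)) τ
  have h2 := congrFun (E2_slash γ) τ
  have hd := lin_ne γ τ
  have h3 : (Derivative.normalizedDerivOfComplex) (fun τ : ℍ => E2 τ + 12 * (2 * Real.pi * Complex.I)⁻¹ * (γ 1 0 / denom γ τ)) τ
     = (Derivative.normalizedDerivOfComplex) E2 τ - 12 * (2 * Real.pi * Complex.I)⁻¹ ^ 2 * (γ 1 0 / denom γ τ) ^ 2 := by
    unfold Derivative.normalizedDerivOfComplex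
    have hE : HasDerivAt (E2 ∘ ofComplex) (deriv (E2 ∘ ofComplex) τ) τ := (hol_E2 τ).hasDerivAt
    have hl : HasDerivAt (fun w : ℂ => (γ 1 0 * w + γ 1 1 : ℂ)) (γ 1 0 : ℂ) (τ : ℂ) := by
      simpa using ((hasDerivAt_id (τ : ℂ)).const_mul (γ 1 0 : ℂ)).add_const (γ 1 1 : ℂ)
    have hs := hE.add (((hl.inv hd).const_mul (γ 1 0 : ℂ)).const_mul (12 * (2 * Real.pi * Complex.I : ℂ)⁻¹))
    have e : ((fun τ : ℍ => E2 τ + 12 * (2 * Real.pi * Complex.I)⁻¹ * (γ 1 0 / denom γ τ)) ∘ ofComplex) =ᶠ[𝓝 (τ : ℂ)]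
        ((E2 ∘ ofComplex) + fun w : ℂ => 12 * (2 * Real.pi * Complex.I : ℂ)⁻¹ * ((γ 1 0 : ℂ) * (fun w : ℂ => (γ 1 0 * w + γ 1 1 : ℂ))⁻¹ w)) := by
      filter_upwards [isOpen_upperHalfPlaneSet.mem_nhds τ.im_pos] with w hw
      simp only [Function.comp_apply, denom_eq, Pi.add_apply, Pi.inv_apply]
      rw [ofComplex_apply_of_im_pos hw]
      rfl
    rw [(hs.congr_of_eventuallyEq e).deriv, denom_eq]
    field_simp
    ring
  rw [E2_slash, h3] at h1
  simp only [Pi.sub_apply] at h1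
  rw [ModularForm.SL_slash_apply] at h1 h2
  rw [denom_eq] at h1 h2
  set κ := (2 * Real.pi * Complex.I : ℂ)⁻¹
  set d := (γ 1 0 * τ + γ 1 1 : ℂ)
  set u := (γ 1 0 : ℂ) / d
  have e1 : (Derivative.normalizedDerivOfComplex) E2 (γ • τ) = d ^ 4 * ((Derivative.normalizedDerivOfComplex) E2 τ + 2 * κ * u * E2 τ + 12 * κ ^ 2 * u ^ 2) := by
    have : (Derivative.normalizedDerivOfComplex) E2 (γ • τ) = d ^ 4 * ((Derivative.normalizedDerivOfComplex) E2 (γ • τ) * d ^ (-(2 + 2) : ℤ)) := by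
      rw [show (-(2 + 2) : ℤ) = -(4 : ℕ) by norm_num, zpow_neg, zpow_natCast]; field_simp
    rw [this]
    congr 1
    push_cast at h1
    norm_num at h1 ⊢
    linear_combination -h1
  have e2 : E2 (γ • τ) = d ^ 2 * (E2 τ + 12 * κ * u) := by
    rw [← h2, show (-2 : ℤ) = -(2 : ℕ) by norm_num, zpow_neg, zpow_natCast]; field_simp
  show (Derivative.normalizedDerivOfComplex) E2 (γ • τ) + -12⁻¹ * (E2 (γ • τ) * E2 (γ • τ)) = d ^ 4 * ((Derivative.normalizedDerivOfComplex) E2 τ + -12⁻¹ * (E2 τ * E2 τ))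
  rw [e1, e2]; ring

lemma ram2 (τ : ℍ) : 12 * (Derivative.normalizedDerivOfComplex) E2 τ = E2 τ ^ 2 - E4 τ := by
  have h := vanish (k := 4) (by norm_num) (G := fun τ => ((Derivative.normalizedDerivOfComplex) E2 τ + (- 12⁻¹) * (E2 τ * E2 τ)) + 12⁻¹ * E4 τ)
    (((hol_D hol_E2).add ((hol_const _).mul (hol_E2.mul hol_E2))).add ((hol_const _).mul hol_E4))
    (isWt_DE2.add (isWt_E4.cmul _))
    ((((ser_esf (-24) 1).theta.smul 12).sub ((ser_esf (-24) 1).mul (ser_esf (-24) 1))).add (ser_esf 240 3)) (c := 12⁻¹)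
    (fun τ => by
      simp only [hasDeriv_comp_qq (ser_esf (-24) 1) E2_eq, E4_eq, E2_eq]
      simp; ring)
    (by simp [esp_const, theta_const])
  have := h τ
  linear_combination 12 * this

lemma Ser.unique_zz {R : Type*} [CommRing R] [Algebra R ℂ] [FaithfulSMul R ℂ] {f g : ℂ → ℂ} {p q : PowerSeries R}
    (hf : Ser R f p) (hg : Ser R g q) (m : ℕ) (hm : m ≠ 0) (h : ∀ τ, f (zz m τ) = g (zz m τ)) : p = q := by
  have hne : ∀ z : ℂ, z ≠ 0 → ‖z‖ < 1 → f z = g z := by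
    intro z hz hz1
    obtain ⟨τ, rfl⟩ := exists_zz m hm hz hz1
    exact h τ
  refine hf.unique hg ?_
  filter_upwards [Metric.ball_mem_nhds (0 : ℂ) one_pos] with z hz
  have hz1 : ‖z‖ < 1 := by simpa using hz
  by_cases h0 : z = 0
  · rw [h0]
    refine tendsto_nhds_unique_of_frequently_eq (l := 𝓝[≠] (0 : ℂ)) (hf.continuousAt.tendsto.mono_left nhdsWithin_le_nhds)
      (hg.continuousAt.tendsto.mono_left nhdsWithin_le_nhds) ?_
    apply Eventually.frequently
    filter_upwards [self_mem_nhdsWithin, nhdsWithin_le_nhds (Metric.ball_mem_nhds (0 : ℂ) one_pos)] with w hw hw1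
    exact hne w hw (by simpa using hw1)
  · exact hne z h0 hz1

lemma zz_one (τ : ℍ) : zz 1 τ = qq τ := by simp [zz, qq]

lemma Ser.unique_qq {R : Type*} [CommRing R] [Algebra R ℂ] [FaithfulSMul R ℂ] {f g : ℂ → ℂ} {p q : PowerSeries R}
    (hf : Ser R f p) (hg : Ser R g q) (h : ∀ τ, f (qq τ) = g (qq τ)) : p = q :=
  hf.unique_zz hg 1 one_ne_zero fun τ => by rw [zz_one]; exact h τ

noncomputable def e2p : PowerSeries ℤ := esp (-24) 1
noncomputable def e4p : PowerSeries ℤ := esp 240 3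
noncomputable def e6p : PowerSeries ℤ := esp (-504) 5
/-- `Δ = q * dp0` -/
noncomputable def dp0 : PowerSeries ℤ := pentagonalSeries ℤ ^ 24

lemma ser_df : Ser ℤ (fun z => euler z ^ 24) dp0 := ser_euler.pow 24

lemma del_ps : e4p ^ 3 - e6p ^ 2 = 1728 * (PowerSeries.X * dp0) := by
  refine Ser.unique_qq (((ser_esf 240 3).pow 3).sub ((ser_esf (-504) 5).pow 2)) ((ser_natCast 1728).mul (ser_X.mul ser_df)) fun τ => ?_
  have := Del_E τ
  rw [E4_eq, E6_eq, Del_eq] at this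
  simpa using this

lemma ram4_ps : 3 * theta e4p = e2p * e4p - e6p := by
  refine Ser.unique_qq ((ser_natCast 3).mul (ser_esf 240 3).theta)
    (((ser_esf (-24) 1).mul (ser_esf 240 3)).sub (ser_esf (-504) 5)) fun τ => ?_
  have := ram4 τ
  rw [hasDeriv_comp_qq (ser_esf 240 3) E4_eq, E4_eq, E6_eq, E2_eq] at this
  simpa using this

lemma ram6_ps : 2 * theta e6p = e2p * e6p - e4p ^ 2 := by
  refine Ser.unique_qq ((ser_natCast 2).mul (ser_esf (-504) 5).theta)
    (((ser_esf (-24) 1).mul (ser_esf (-504) 5)).sub ((ser_esf 240 3).pow 2)) fun τ => ?_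
  have := ram6 τ
  rw [hasDeriv_comp_qq (ser_esf (-504) 5) E6_eq, E4_eq, E6_eq, E2_eq] at this
  simpa using this

lemma ram2_ps : 12 * theta e2p = e2p ^ 2 - e4p := by
  refine Ser.unique_qq ((ser_natCast 12).mul (ser_esf (-24) 1).theta)
    (((ser_esf (-24) 1).pow 2).sub (ser_esf 240 3)) fun τ => ?_
  have := ram2 τ
  rw [hasDeriv_comp_qq (ser_esf (-24) 1) E2_eq, E4_eq, E2_eq] at this
  simpa using this

end HQ
end

section
namespace HQ
open PowerSeries Filter Topology UpperHalfPlane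
open scoped MatrixGroups ModularForm Manifold

lemma t_trunc {S : Type*} [CommRing S] (x t P1 P5: S) (h : x^7=0) (h1 : P1 = 1 - x - x^2+x^5) (h5 : P5 = 1-x^5) (ht : t * P5^6 = P1^6) :
    t * (1+744*x^5) = (t^2+10*x*t+5*x^2)^3 := by
  have h6 : P5^6*(1+6*x^5) = 1 := by
    rw [h5]; linear_combination ((-21)*x^3 + (70)*x^8 + (-105)*x^13 + (84)*x^18 + (-35)*x^23 + (6)*x^28) * h
  have ht : t = 1 - 6*x+9*x^2+10*x^3-30*x^4+6*x^5-25*x^6 := by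
    rw [h1] at ht
    linear_combination (1+6*x^5)*ht - t * h6 + ((90)*x^0 + (90)*x^1 + (-280)*x^2 + (-42)*x^3 + (102)*x^4 + (307)*x^5 + (270)*x^6 + (-705)*x^7 + (-358)*x^8 + (186)*x^9 + (606)*x^10 + (655)*x^11 + (-630)*x^12 + (-681)*x^13 + (-230)*x^14 + (345)*x^15 + (720)*x^16 + (15)*x^17 + (-264)*x^18 + (-306)*x^19 + (-96)*x^20 + (180)*x^21 + (90)*x^22 + (37)*x^23 + (-36)*x^24 + (-36)*x^25 + (6)*x^28) * h
  rw [ht]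
  linear_combination ((480)*x^0 + (-2580)*x^1 + (5590)*x^2 + (-195279)*x^3 + (1112064)*x^4 + (-1411366)*x^5 + (-3176640)*x^6 + (8241840)*x^7 + (-21472494)*x^8 + (97360365)*x^9 + (-98720820)*x^10 + (-340492130)*x^11 + (801400860)*x^12 + (-714604455)*x^13 + (389629900)*x^14 + (1567421400)*x^15 + (-3972452580)*x^16 + (3969704685)*x^17 + (-3726415506)*x^18 + (-174798369)*x^19 + (5675908346)*x^20 + (-8272123935)*x^21 + (11972007180)*x^22 + (-10734425406)*x^23 + (8468385150)*x^24 + (-6473868750)*x^25 + (2762812500)*x^26 + (-1968750000)*x^27 + (351562500)*x^28 + (-244140625)*x^29) * h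

lemma pent_trunc : ∃ a, pentagonalSeries ℤ = 1 - PowerSeries.X - PowerSeries.X ^ 2 + PowerSeries.X ^ 5 + PowerSeries.X ^ 7 * a := by
  have : PowerSeries.X ^ 7 ∣ pentagonalSeries ℤ - (1 - PowerSeries.X - PowerSeries.X ^ 2 + PowerSeries.X ^ 5) := by
    rw [PowerSeries.X_pow_dvd_iff]
    intro m hm
    have h0 : (pentagonalSeries ℤ).coeff 0 = 1 := by simpa using pent_const
    have h1 : (pentagonalSeries ℤ).coeff 1 = -1 := by simpa [pentagonal] using coeff_pentagonalSeries_pentagonal ℤ 1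
    have h2 : (pentagonalSeries ℤ).coeff 2 = -1 := by simpa [pentagonal] using coeff_pentagonalSeries_pentagonal ℤ (-1)
    have h5 : (pentagonalSeries ℤ).coeff 5 = 1 := by
      have := coeff_pentagonalSeries_pentagonal ℤ 2
      simpa [pentagonal, Int.negOnePow_even 2 (by decide)] using this
    have hn : ∀ n : ℕ, (n = 3 ∨ n = 4 ∨ n = 6) → (pentagonalSeries ℤ).coeff n = 0 := by
      intro n hn
      apply coeff_pentagonalSeries_eq_zero
      rintro ⟨k, hk⟩
      have h2 := two_mul_natCast_pentagonal k
      rw [hk] at h2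
      have k1 : k ≤ 3 := by by_contra hc; rcases hn with rfl | rfl | rfl <;> push_cast at h2 <;> nlinarith
      have k2 : -3 ≤ k := by by_contra hc; rcases hn with rfl | rfl | rfl <;> push_cast at h2 <;> nlinarith
      interval_cases k <;> omega
    interval_cases m
    all_goals simp [pent_const, h1, h2, h5, hn, PowerSeries.coeff_X_pow, PowerSeries.coeff_X, PowerSeries.coeff_one]
  obtain ⟨a, ha⟩ := this
  exact ⟨a, by linear_combination ha⟩

/-! ### level one -/
noncomputable def jj (τ : ℍ) : ℂ := E4 τ ^ 3 / Del τ
noncomputable def jf (z : ℂ) : ℂ := esf 240 3 z ^ 3 * (euler z ^ 24)⁻¹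
noncomputable def jp : PowerSeries ℤ := e4p ^ 3 * invOfUnit dp0 1

lemma dp0_const : constantCoeff dp0 = 1 := by simp [dp0, pent_const]
lemma e4p_const : constantCoeff e4p = 1 := esp_const _ _
lemma e6p_const : constantCoeff e6p = 1 := esp_const _ _

lemma dp0_inv : dp0 * invOfUnit dp0 1 = 1 := PowerSeries.mul_invOfUnit _ _ (by simp [dp0_const])

lemma ser_jf : Ser ℤ jf jp :=
  ((ser_esf 240 3).pow 3).mul (ser_df.inv (fun z hz => pow_ne_zero _ (euler_ne_zero hz)) dp0_inv)

lemma jp_const : constantCoeff jp = 1 := by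
  simp [jp, e4p_const]

lemma jj_eq (τ : ℍ) : jj τ = (qq τ)⁻¹ * jf (qq τ) := by
  unfold jj jf
  rw [E4_eq, Del_eq, div_eq_mul_inv, mul_inv]; ring

lemma hol_jj : Hol jj := (hol_E4.pow 3).div hol_Del Del_ne_zero

lemma jj_smul (γ : SL(2, ℤ)) (τ : ℍ) : jj (γ • τ) = jj τ := by
  unfold jj
  rw [isWt_E4, Del_smul]
  have := lin_ne γ τ
  have := Del_ne_zero τ
  generalize (γ 1 0 * τ + γ 1 1 : ℂ) = w at *
  field_simp

lemma jj_mob {a b c d : ℤ} (h : a * d - b * c = 1) (τ : ℍ) : jj (mob a b c d τ) = jj τ := by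
  rw [← mkSL_smul a b c d h, jj_smul]

lemma hol_neg_const (c : ℂ) : Hol (fun _ => c) := hol_const c

/-- holomorphic SL2(Z)-invariant functions -/
noncomputable def V1 : Subalgebra ℂ (ℍ → ℂ) where
  carrier := {F | Hol F ∧ ∀ (γ : SL(2, ℤ)) τ, F (γ • τ) = F τ}
  mul_mem' := fun ha hb => ⟨ha.1.mul hb.1, fun γ τ => by simp only [Pi.mul_apply, ha.2 γ τ, hb.2 γ τ]⟩
  add_mem' := fun ha hb => ⟨ha.1.add hb.1, fun γ τ => by simp only [Pi.add_apply, ha.2 γ τ, hb.2 γ τ]⟩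
  algebraMap_mem' := fun c => ⟨hol_const c, fun _ _ => rfl⟩

lemma T_smul_eq (τ : ℍ) : mob 1 1 0 1 τ = mkSL 1 1 0 1 (by norm_num) • τ := (mkSL_smul ..).symm

lemma haupt1 : Haupt ℤ V1 jj jf jp where
  per := fun F hF τ => by rw [T_smul_eq]; exact hF.2 _ τ
  const := fun F hF hb => const1 hF.1 hF.2 hb
  mem := ⟨hol_jj, jj_smul⟩
  eq := jj_eq
  ser := ser_jf
  one := jp_const

/-- Γ₀(5)-invariant functions bounded at the cusp 0 -/
noncomputable def V5 : Subalgebra ℂ (ℍ → ℂ) where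
  carrier := {F | Hol F ∧ (∀ γ ∈ CongruenceSubgroup.Gamma0 5, ∀ τ, F (γ • τ) = F τ) ∧
    IsBoundedAtImInfty (fun τ => F (ModularGroup.S • τ))}
  mul_mem' := fun ha hb => ⟨ha.1.mul hb.1, fun γ hγ τ => by simp only [Pi.mul_apply, ha.2.1 γ hγ τ, hb.2.1 γ hγ τ],
    ha.2.2.mul hb.2.2⟩
  add_mem' := fun ha hb => ⟨ha.1.add hb.1, fun γ hγ τ => by simp only [Pi.add_apply, ha.2.1 γ hγ τ, hb.2.1 γ hγ τ],
    ha.2.2.add hb.2.2⟩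
  algebraMap_mem' := fun c => ⟨hol_const c, fun _ _ _ => rfl, isBounded_of_tendsto (tendsto_const_nhds (x := c))⟩

lemma qq_div (m : ℕ) (hm : m ≠ 0) (b : ℤ) (τ : ℍ) :
    qq (mob 1 b 0 m τ) = Complex.exp (2 * Real.pi * Complex.I * b / m) * zz m τ := by
  have : (0 : ℤ) < m := by exact_mod_cast Nat.pos_of_ne_zero hm
  have hc : (m : ℂ) ≠ 0 := by exact_mod_cast hm
  unfold qq zz
  rw [coe_mob (by simpa using this), ← Complex.exp_add]
  congr 1
  simp only [Int.cast_natCast, Int.cast_one, Int.cast_zero]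
  simp only [zero_mul, zero_add, one_mul]
  field_simp
  ring

lemma qq_div_zero (m : ℕ) (hm : m ≠ 0) (τ : ℍ) : qq (mob 1 0 0 m τ) = zz m τ := by
  simpa using qq_div m hm 0 τ

lemma S_smul_eq (τ : ℍ) : ModularGroup.S • τ = mob 0 (-1) 5 0 (mob 1 0 0 5 τ) := by
  rw [sl_smul, mob_mob (by norm_num) (by norm_num)]
  simp only [ModularGroup.S]
  have := mob_eq_of_scale (a := 0) (b := -1) (c := 1) (d := 0) 5 (by norm_num) (by norm_num) τ
  norm_num at this ⊢
  rw [← this]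

lemma tt_S (τ : ℍ) : tt (ModularGroup.S • τ) = 125 * (tt (mob 1 0 0 5 τ))⁻¹ := by
  rw [S_smul_eq, ← tt_W (mob 1 0 0 5 τ), mul_assoc, mul_inv_cancel₀ (tt_ne_zero _), mul_one]

lemma tf_inv : Ser ℤ (fun z => (tf z)⁻¹) (invOfUnit tp 1) :=
  ser_tf.inv (fun z hz => tf_ne_zero hz) (PowerSeries.mul_invOfUnit _ _ (by simp [tp_const]))

lemma tt_mem : tt ∈ V5 := by
  refine ⟨hol_tt, tt_smul, ?_⟩
  refine isBounded_of_tendsto (bounded_of_ser ((ser_natCast 125).mul (ser_X.mul tf_inv)) 5 (by norm_num) fun τ => ?_)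
  rw [tt_S, tt_eq, mul_inv, inv_inv, show ((5 : ℤ)) = ((5 : ℕ) : ℤ) by norm_num, qq_div_zero 5 (by norm_num)]
  norm_num

lemma haupt5 : Haupt ℤ V5 tt tf tp where
  per := fun F hF τ => by
    rw [T_smul_eq]; exact hF.2.1 _ (by rw [CongruenceSubgroup.Gamma0_mem]; simp [mkSL]) τ
  const := fun F hF hb => const5 hF.1 hF.2.1 hb hF.2.2
  mem := tt_mem
  eq := tt_eq
  ser := ser_tf
  one := tp_const

lemma tj_mem : (fun τ => tt τ * jj (mob 5 0 0 1 τ)) ∈ V5 := by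
  refine ⟨hol_tt.mul (hol_jj.comp_mob (by norm_num)), fun γ hγ τ => ?_, ?_⟩
  · change tt (γ • τ) * jj (mob 5 0 0 1 (γ • τ)) = tt τ * jj (mob 5 0 0 1 τ)
    rw [tt_smul γ hγ]
    suffices e : jj (mob 5 0 0 1 (γ • τ)) = jj (mob 5 0 0 1 τ) by rw [e]
    rw [CongruenceSubgroup.Gamma0_mem, ZMod.intCast_zmod_eq_zero_iff_dvd] at hγ
    obtain ⟨c, hc⟩ := hγ
    have hdet := sl_det γ
    push_cast at hc
    rw [hc] at hdet
    rw [sl_smul, mob_mob (by norm_num) (by rw [hc]; omega), hc]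
    rw [← jj_mob (a := γ 0 0) (b := 5 * γ 0 1) (c := c) (d := γ 1 1) (by linarith) (mob 5 0 0 1 τ), mob_mob (by linarith) (by norm_num)]
    have e1 : 5 * γ 0 0 + 0 * (5 * c) = γ 0 0 * 5 + 5 * γ 0 1 * 0 := by ring
    have e2 : 5 * γ 0 1 + 0 * γ 1 1 = γ 0 0 * 0 + 5 * γ 0 1 * 1 := by ring
    have e3 : 0 * γ 0 0 + 1 * (5 * c) = c * 5 + γ 1 1 * 0 := by ring
    have e4 : 0 * γ 0 1 + 1 * γ 1 1 = c * 0 + γ 1 1 * 1 := by ring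
    rw [e1, e2, e3, e4]
  · refine isBounded_of_tendsto (bounded_of_ser ((ser_natCast 125).mul (tf_inv.mul ser_jf)) 5 (by norm_num) fun τ => ?_)
    change tt (ModularGroup.S • τ) * jj (mob 5 0 0 1 (ModularGroup.S • τ)) = _
    rw [tt_S]
    have e : jj (mob 5 0 0 1 (ModularGroup.S • τ)) = jj (mob 1 0 0 5 τ) := by
      rw [← jj_mob (a := 0) (b := -1) (c := 1) (d := 0) (by norm_num) (mob 1 0 0 5 τ), sl_smul]
      simp only [ModularGroup.S]
      rw [mob_mob (by norm_num) (by norm_num), mob_mob (by norm_num) (by norm_num)]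
      norm_num
    rw [e, tt_eq, jj_eq, show ((5 : ℤ)) = ((5 : ℕ) : ℤ) by norm_num, qq_div_zero 5 (by norm_num)]
    have := zz_ne_zero 5 τ
    have := tf_ne_zero (norm_zz_lt_one 5 (by norm_num) τ)
    push_cast
    field_simp

lemma jp_trunc : ∃ a, jp = 1 + 744 * PowerSeries.X + PowerSeries.X ^ 2 * a := by
  obtain ⟨a, ha⟩ := pent_trunc
  have h4 : PowerSeries.X ^ 2 ∣ e4p - (1 + 240 * PowerSeries.X) := by
    rw [PowerSeries.X_pow_dvd_iff]
    intro m hm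
    have : (240 * PowerSeries.X : PowerSeries ℤ) = PowerSeries.C 240 * PowerSeries.X := by simp
    interval_cases m
    · simp [e4p, esp_const]
    · rw [this, map_sub, map_add, PowerSeries.coeff_C_mul]; simp [e4p, esp, PowerSeries.coeff_one, PowerSeries.coeff_X]
  obtain ⟨b, hb⟩ := h4
  have hj : jp * dp0 = e4p ^ 3 := by
    rw [jp]; linear_combination e4p ^ 3 * dp0_inv
  have hx := Ideal.Quotient.eq_zero_iff_mem.mpr (Ideal.mem_span_singleton_self ((PowerSeries.X : PowerSeries ℤ) ^ 2))
  set φ := Ideal.Quotient.mk (Ideal.span {(PowerSeries.X : PowerSeries ℤ) ^ 2})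
  have h1 := congrArg φ ha
  have h2 := congrArg φ hj
  have h3 := congrArg φ hb
  simp only [map_mul, map_sub, map_add, map_pow, map_one, dp0, map_ofNat] at h1 h2 h3 hx
  set x := φ PowerSeries.X
  have h1' : φ (pentagonalSeries ℤ) = 1 - x := by
    rw [h1]; linear_combination (-1 + x ^ 3 + x ^ 5 * φ a) * hx
  have h3' : φ e4p = 1 + 240 * x := by linear_combination h3 + φ b * hx
  rw [h1', h3'] at h2
  have h6 : (1 - x) ^ 24 * (1 + 24 * x) = 1 := by
    have h12 : (1 - x) ^ 24 = 1 - 24 * x := by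
      have e2 : (1 - x) ^ 2 = 1 - 2 * x := by linear_combination hx
      have e3 : (1 - x) ^ 3 = 1 - 3 * x := by linear_combination (3 - x) * hx
      have e6 : (1 - x) ^ 6 = 1 - 6 * x := by
        rw [show (1 - x) ^ 6 = ((1 - x) ^ 3) ^ 2 by ring, e3]; linear_combination 9 * hx
      have e12 : (1 - x) ^ 12 = 1 - 12 * x := by
        rw [show (1 - x) ^ 12 = ((1 - x) ^ 6) ^ 2 by ring, e6]; linear_combination 36 * hx
      rw [show (1 - x) ^ 24 = ((1 - x) ^ 12) ^ 2 by ring, e12]; linear_combination 144 * hx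
    rw [h12]; linear_combination -576 * hx
  have h7 : φ (jp - (1 + 744 * PowerSeries.X)) = 0 := by
    simp only [map_mul, map_sub, map_add, map_one, map_ofNat]
    change φ jp - (1 + 744 * x) = 0
    linear_combination (1 + 24 * x) * h2 - φ jp * h6 + (240^3 * x * (1 + 24 * x) + 3 * 240^2*(1+24*x) + 720 * 24) * hx
  obtain ⟨c, hc⟩ := Ideal.mem_span_singleton.mp (Ideal.Quotient.eq_zero_iff_mem.mp h7)
  exact ⟨c, by linear_combination hc⟩

lemma tj_ps_dvd : PowerSeries.X ^ 7 ∣ tp * PowerSeries.expand 5 (by norm_num) jp -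
    homog 6 ((Polynomial.X ^ 2 + 10 * Polynomial.X + 5) ^ 3) tp := by
  have hh : homog 6 ((Polynomial.X ^ 2 + 10 * Polynomial.X + 5) ^ 3) tp
      = (tp ^ 2 + 10 * PowerSeries.X * tp + 5 * PowerSeries.X ^ 2) ^ 3 := by
    have e : ((Polynomial.X ^ 2 + 10 * Polynomial.X + 5) ^ 3 : Polynomial ℤ) = Polynomial.C 1 * Polynomial.X ^ 6
      + Polynomial.C 30 * Polynomial.X ^ 5 + Polynomial.C 315 * Polynomial.X ^ 4 + Polynomial.C 1300 * Polynomial.X ^ 3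
      + Polynomial.C 1575 * Polynomial.X ^ 2 + Polynomial.C 750 * Polynomial.X ^ 1 + Polynomial.C 125 * Polynomial.X ^ 0 := by
      simp only [map_ofNat, map_one]; ring
    rw [e]
    simp only [homog, Finset.sum_range_succ, Finset.sum_range_zero, Polynomial.coeff_add, Polynomial.coeff_C_mul,
      Polynomial.coeff_X_pow]
    norm_num
    ring
  rw [hh]
  obtain ⟨a, ha⟩ := pent_trunc
  obtain ⟨b, hb⟩ := jp_trunc
  have hP5 : PowerSeries.expand 5 (by norm_num) (pentagonalSeries ℤ) = 1 - PowerSeries.X ^ 5 + PowerSeries.X ^ 7 *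
    (-PowerSeries.X ^ 3 + PowerSeries.X ^ 18 + PowerSeries.X ^ 28 * PowerSeries.expand 5 (by norm_num) a) := by
    rw [ha]; simp only [map_mul, map_sub, map_add, map_pow, map_one, PowerSeries.expand_X]; ring
  have hj5 : PowerSeries.expand 5 (by norm_num) jp = 1 + 744 * PowerSeries.X ^ 5 + PowerSeries.X ^ 7 *
    (PowerSeries.X ^ 3 * PowerSeries.expand 5 (by norm_num) b) := by
    rw [hb]; simp only [map_mul, map_sub, map_add, map_pow, map_one, PowerSeries.expand_X, map_ofNat]; ring
  have ht : tp * (PowerSeries.expand 5 (by norm_num) (pentagonalSeries ℤ)) ^ 6 = pentagonalSeries ℤ ^ 6 := by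
    have := PowerSeries.mul_invOfUnit (PowerSeries.expand 5 (by norm_num) (pentagonalSeries ℤ)) 1 (by rw [pent5_const]; simp)
    rw [tp, ← mul_pow, mul_assoc, mul_comm (invOfUnit _ _), this, mul_one]
  have hx := Ideal.Quotient.eq_zero_iff_mem.mpr (Ideal.mem_span_singleton_self ((PowerSeries.X : PowerSeries ℤ) ^ 7))
  rw [← Ideal.mem_span_singleton, ← Ideal.Quotient.eq_zero_iff_mem]
  set φ := Ideal.Quotient.mk (Ideal.span {(PowerSeries.X : PowerSeries ℤ) ^ 7})
  have h1 := congrArg φ ha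
  have h2 := congrArg φ hP5
  have h3 := congrArg φ hj5
  have h4 := congrArg φ ht
  have e10 : φ 10 = 10 := map_ofNat φ 10
  have e5 : φ 5 = 5 := map_ofNat φ 5
  have e744 : φ 744 = 744 := map_ofNat φ 744
  simp only [map_mul, map_sub, map_add, map_pow, map_one, e10, e5, e744] at h1 h2 h3 h4 hx ⊢
  rw [hx, zero_mul, add_zero] at h1 h2 h3
  rw [h3, t_trunc _ _ _ _ hx h1 h2 h4, sub_self]

lemma tj_eq (τ : ℍ) : tt τ * jj (mob 5 0 0 1 τ) = (tt τ ^ 2 + 10 * tt τ + 5) ^ 3 := by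
  obtain ⟨P, hP, hPe, hp⟩ := haupt5.poly 1 one_ne_zero 6 _ tj_mem _ _ (ser_tf.mul (ser_jf.expand 5 (by norm_num))) (fun τ => by
    simp only [zz_one, mul_one]
    rw [tt_eq, jj_eq, qq_five]
    have := qq_ne_zero τ
    field_simp)
  have hd := tj_ps_dvd
  rw [hp, PowerSeries.expand_one_apply] at hd
  have := homog_inj tp_const hP ?_ hd
  · rw [hPe τ, this]
    simp only [map_add, map_mul, map_pow, map_ofNat, Polynomial.aeval_X]
  · compute_degree

end HQ
end

section
namespace HQ
open PowerSeries Filter Topology UpperHalfPlane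
open scoped MatrixGroups ModularForm Manifold

/-! ### M8: the Hasse invariant via the Ramanujan equations mod l -/
section
variable {S : Type*} [CommRing S] (δ : Derivation ℤ S S) {e2 e4 e6 D : S}

lemma mkDer {f : S → S} (h1 : ∀ a b, f (a + b) = f a + f b) (h2 : ∀ a b, f (a * b) = a * f b + b * f a) :
    ∃ δ : Derivation ℤ S S, ∀ p, δ p = f p :=
  ⟨Derivation.mk' (AddMonoidHom.mk' f h1).toIntLinearMap (fun a b => by simp [h2]), fun p => rfl⟩

lemma der_D (h4 : 3 * δ e4 = e2 * e4 - e6) (h6 : 2 * δ e6 = e2 * e6 - e4 ^ 2)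
    (hE : e4 ^ 3 - e6 ^ 2 = 1728 * D) (hc : ∀ x y : S, 1728 * x = 1728 * y → x = y) : δ D = e2 * D := by
  have h := congrArg δ hE
  have h1728' : ∀ x, δ (1728 * x) = 1728 * δ x := fun x => by
    have := δ.map_smul_of_tower (1728 : ℤ) x
    simpa using this
  rw [h1728', map_sub, Derivation.leibniz_pow, Derivation.leibniz_pow] at h
  simp only [smul_eq_mul, nsmul_eq_mul] at h
  apply hc
  rw [← h]
  push_cast
  linear_combination e4 ^ 2 * h4 - e6 * h6 + e2 * hE

lemma der_pow_D (hD : δ D = e2 * D) (p : ℕ) : δ (D ^ p) = p * e2 * D ^ p := by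
  induction p with
  | zero => simp
  | succ p ih =>
    rw [pow_succ, Derivation.leibniz, ih, hD]
    simp only [smul_eq_mul]; push_cast; ring

lemma der_pow_6 (h6 : 2 * δ e6 = e2 * e6 - e4 ^ 2) (m : ℕ) :
    2 * δ (e6 ^ m) = m * (e2 * e6 ^ m - e4 ^ 2 * e6 ^ (m - 1)) := by
  cases m with
  | zero => simp
  | succ m =>
    rw [Derivation.leibniz_pow]
    simp only [smul_eq_mul, nsmul_eq_mul, Nat.add_sub_cancel]
    linear_combination ((m + 1 : ℕ) : S) * e6 ^ m * h6

lemma der2_mono (h4 : 3 * δ e4 = e2 * e4 - e6) (h6 : 2 * δ e6 = e2 * e6 - e4 ^ 2)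
    (h2 : 12 * δ e2 = e2 ^ 2 - e4) (hD : δ D = e2 * D) (hE : e4 ^ 3 - e6 ^ 2 = 1728 * D)
    (r m p : ℕ) (hr : r ≤ 1) (hw : (4 * r + 6 * m + 12 * p + 1 : S) = 0) :
    144 * δ (δ (e4 ^ r * e6 ^ m * D ^ p)) = e4 ^ (1 + r) * ((6 * m + 1 + 4 * r) ^ 2 * e6 ^ m * D ^ p +
      62208 * (m * (m - 1)) * e6 ^ (m - 2) * D ^ (p + 1)) := by
  have hA := der_pow_6 δ h6 m
  have hd := der_pow_D δ hD p
  have hB : 2 * m * δ (e6 ^ (m - 1)) = m * (m - 1) * (e2 * e6 ^ (m - 1) - e4 ^ 2 * e6 ^ (m - 2)) := by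
    cases m with
    | zero => simp
    | succ m =>
      have := der_pow_6 δ h6 m
      simp only [Nat.add_sub_cancel, show m + 1 - 2 = m - 1 by omega]
      push_cast
      linear_combination ((m : S) + 1) * this
  have hb : e6 * e6 ^ (m - 1) * m = m * e6 ^ m := by
    cases m with
    | zero => simp
    | succ m => simp only [Nat.add_sub_cancel]; ring
  have hc : e6 * e6 ^ (m - 2) * (m * (m - 1)) = m * (m - 1) * e6 ^ (m - 1) := by
    rcases m with _ | _ | m
    · simp
    · simp
    · simp only [show m + 1 + 1 - 2 = m by omega, Nat.add_sub_cancel]; push_cast; ring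
  rw [pow_succ D p]
  generalize e6 ^ (m - 2) = c at *
  generalize e6 ^ (m - 1) = b at *
  generalize e6 ^ m = a at *
  generalize D ^ p = d at *
  have hmm : δ (m : S) = 0 := by simp
  have h12 : ∀ x, δ (12 * x) = 12 * δ x := fun x => by
    have := δ.map_smul_of_tower (12 : ℤ) x
    simpa using this
  interval_cases r
  · have e1 : 12 * δ (e4 ^ 0 * a * d) = -(e2 * a * d + 6 * (m * (e4 * (e4 * (b * d))))) := by
      simp only [pow_zero, one_mul, Derivation.leibniz, smul_eq_mul]
      push_cast at hw
      linear_combination 6 * d * hA + 12 * a * hd + e2 * a * d * hw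
    have e2' : 144 * δ (δ (e4 ^ 0 * a * d)) = 12 * δ (12 * δ (e4 ^ 0 * a * d)) := by rw [h12]; ring
    have h66 : ∀ x, δ (6 * x) = 6 * δ x := fun x => by
      have := δ.map_smul_of_tower (6 : ℤ) x
      simpa using this
    rw [e2', e1]
    simp only [Derivation.leibniz, smul_eq_mul, map_neg, map_add, hmm, h66]
    push_cast at hw ⊢
    linear_combination -a * d * h2 - 6 * e2 * d * hA - 12 * e2 * a * hd - 48 * m * e4 * b * d * h4 - 36 * e4 ^ 2 * d * hB
      - 72 * m * e4 ^ 2 * b * hd - (e2 ^ 2 * a * d) * hw - 6 * e2 * e4 ^ 2 * b * d * m * hw + 48 * e4 * d * hb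
      + 36 * m * (m - 1) * e4 * c * d * hE + 36 * e4 * e6 * d * hc + 36 * e4 * d * (m - 1) * hb
  · have e1 : 12 * δ (e4 ^ 1 * a * d) = -(e2 * e4 * a * d + 4 * (e6 * a * d) + 6 * (m * (e4 * (e4 * (e4 * (b * d)))))) := by
      simp only [pow_one, Derivation.leibniz, smul_eq_mul]
      push_cast at hw
      linear_combination 6 * d * e4 * hA + 12 * a * e4 * hd + 4 * a * d * h4 + e2 * e4 * a * d * hw
    have e2' : 144 * δ (δ (e4 ^ 1 * a * d)) = 12 * δ (12 * δ (e4 ^ 1 * a * d)) := by rw [h12]; ring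
    have h66 : ∀ x, δ (6 * x) = 6 * δ x := fun x => by
      have := δ.map_smul_of_tower (6 : ℤ) x
      simpa using this
    have h44 : ∀ x, δ (4 * x) = 4 * δ x := fun x => by
      have := δ.map_smul_of_tower (4 : ℤ) x
      simpa using this
    rw [e2', e1]
    simp only [Derivation.leibniz, smul_eq_mul, map_neg, map_add, hmm, h66, h44]
    push_cast at hw ⊢
    linear_combination -e4 * a * d * h2 - 4 * e2 * a * d * h4 - 6 * e2 * e4 * d * hA - 12 * e2 * e4 * a * hd
      - 24 * a * d * h6 - 24 * e6 * d * hA - 48 * e6 * a * hd - 72 * m * e4 ^ 2 * b * d * h4 - 36 * e4 ^ 3 * d * hB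
      - 72 * m * e4 ^ 3 * b * hd - (e2 ^ 2 * e4 * a * d) * hw - 4 * e2 * e6 * a * d * hw - 6 * e2 * e4 ^ 3 * b * d * m * hw
      + 96 * e4 ^ 2 * d * hb
      + 36 * m * (m - 1) * e4 ^ 2 * c * d * hE + 36 * e4 ^ 2 * e6 * d * hc + 36 * e4 ^ 2 * d * (m - 1) * hb

/-- coefficients of the Hasse polynomial -/
def cc (n s k : ℕ) : ℤ := (Nat.choose (2 * n + s) (2 * k + s)) * (Nat.choose (2 * n - 2 * k) (n - k)) * (-432) ^ (n - k)

lemma cc_rec (n s k : ℕ) (hk : k < n) :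
    ((n : ℤ) - k) ^ 2 * cc n s k = -(432 * (2 * k + s + 2) * (2 * k + s + 1)) * cc n s (k + 1) := by
  obtain ⟨p, rfl⟩ : ∃ p, n = k + 1 + p := ⟨n - (k + 1), by omega⟩
  unfold cc
  have e1 : 2 * (k + 1 + p) - 2 * k = 2 * (p + 1) := by omega
  have e2 : k + 1 + p - k = p + 1 := by omega
  have e3 : 2 * (k + 1 + p) - 2 * (k + 1) = 2 * p := by omega
  have e4 : k + 1 + p - (k + 1) = p := by omega
  rw [e1, e2, e3, e4]
  have h1 := Nat.succ_mul_centralBinom_succ p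
  unfold Nat.centralBinom at h1
  have h2 := Nat.choose_succ_right_eq (2 * (k + 1 + p) + s) (2 * k + s)
  have h3 := Nat.choose_succ_right_eq (2 * (k + 1 + p) + s) (2 * k + s + 1)
  rw [show 2 * (k + 1 + p) + s - (2 * k + s) = 2 * p + 2 by omega] at h2
  rw [show 2 * (k + 1 + p) + s - (2 * k + s + 1) = 2 * p + 1 by omega] at h3
  rw [show 2 * (k + 1) + s = 2 * k + s + 1 + 1 by ring]
  zify at h1 h2 h3
  push_cast
  generalize (((2 * (p + 1)).choose (p + 1) : ℕ) : ℤ) = x1 at *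
  generalize (((2 * p).choose p : ℕ) : ℤ) = x2 at *
  generalize ((Nat.choose (2 * (k + 1 + p) + s) (2 * k + s) : ℕ) : ℤ) = y1 at *
  generalize ((Nat.choose (2 * (k + 1 + p) + s) (2 * k + s + 1) : ℕ) : ℤ) = y2 at *
  generalize ((Nat.choose (2 * (k + 1 + p) + s) (2 * k + s + 1 + 1) : ℕ) : ℤ) = y3 at *
  rw [pow_succ (-432 : ℤ) p]
  generalize (-432 : ℤ) ^ p = w at *
  linear_combination (-432 * w * y1 * (p + 1)) * h1 + 432 * w * x2 * ((2 * k + s + 1) * h3 + (2 * p + 1) * h2)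

noncomputable def phi (n r s : ℕ) (e4 e6 D : S) : S :=
  ∑ k ∈ Finset.range (n + 1), (cc n s k : S) * (e4 ^ r * e6 ^ (2 * k + s) * D ^ (n - k))

lemma der2_phi (h4 : 3 * δ e4 = e2 * e4 - e6) (h6 : 2 * δ e6 = e2 * e6 - e4 ^ 2)
    (h2 : 12 * δ e2 = e2 ^ 2 - e4) (hD : δ D = e2 * D) (hE : e4 ^ 3 - e6 ^ 2 = 1728 * D)
    (n r s l : ℕ) (hr : r ≤ 1) (hs : s ≤ 1) (hl : l = 12 * n + 4 * r + 6 * s + 1) (hl0 : (l : S) = 0) :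
    144 * δ (δ (phi n r s e4 e6 D)) = 0 := by
  rw [hl] at hl0
  push_cast at hl0
  unfold phi
  have hcc : ∀ (c : ℤ) (x : S), δ (c * x) = c * δ x := fun c x => by
    have := δ.map_smul_of_tower c x
    simpa using this
  simp only [map_sum, hcc, Finset.mul_sum]
  set A : ℕ → S := fun k => e4 ^ (1 + r) * (cc n s k * ((6 * (2 * k + s : ℕ) + 1 + 4 * r) ^ 2 * e6 ^ (2 * k + s) * D ^ (n - k))) with hAdef
  set B : ℕ → S := fun k => e4 ^ (1 + r) * (cc n s k * (62208 * ((2 * k + s : ℕ) * ((2 * k + s : ℕ) - 1)) * e6 ^ (2 * k + s - 2) * D ^ (n - k + 1))) with hBdef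
  have e : ∀ k ∈ Finset.range (n + 1), 144 * ((cc n s k : S) * δ (δ (e4 ^ r * e6 ^ (2 * k + s) * D ^ (n - k)))) = A k + B k := by
    intro k hk
    have hk' : k ≤ n := by simpa [Nat.lt_succ_iff] using hk
    have := der2_mono δ h4 h6 h2 hD hE r (2 * k + s) (n - k) hr (by push_cast [hk']; linear_combination hl0)
    rw [hAdef, hBdef]
    linear_combination (cc n s k : S) * this
  rw [Finset.sum_congr rfl e, Finset.sum_add_distrib, Finset.sum_range_succ, Finset.sum_range_succ' B]
  have hB0 : B 0 = 0 := by
    rw [hBdef]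
    interval_cases s <;> simp
  have hAn : A n = 0 := by
    rw [hAdef]
    have : (6 * (2 * n + s : ℕ) + 1 + 4 * r : S) = 0 := by push_cast; linear_combination hl0
    simp only [this]; ring
  have hAB : ∀ k ∈ Finset.range n, A k = -B (k + 1) := by
    intro k hk
    have hk' : k < n := by simpa using hk
    have hrec := congrArg (Int.cast : ℤ → S) (cc_rec n s k hk')
    push_cast at hrec
    have h6 : (6 * (2 * k + s : ℕ) + 1 + 4 * r : S) = -12 * (n - k) := by push_cast; linear_combination hl0
    rw [hAdef, hBdef]
    simp only [h6]
    rw [show 2 * (k + 1) + s - 2 = 2 * k + s by omega, show n - (k + 1) + 1 = n - k by omega]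
    push_cast
    linear_combination 144 * e4 ^ (1 + r) * e6 ^ (2 * k + s) * D ^ (n - k) * hrec
  rw [Finset.sum_congr rfl hAB, hB0, hAn, Finset.sum_neg_distrib]
  ring
end

section
variable {k : Type*} [Field k] (l : ℕ) [CharP k l]

lemma phi_eq_one (hp : l.Prime) (h5 : 5 < l) (n r s : ℕ) (hr : r ≤ 1) (hs : s ≤ 1) (hl : l = 12 * n + 4 * r + 6 * s + 1)
    {e2 e4 e6 D : PowerSeries k}
    (h4 : 3 * theta e4 = e2 * e4 - e6) (h6 : 2 * theta e6 = e2 * e6 - e4 ^ 2)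
    (h2 : 12 * theta e2 = e2 ^ 2 - e4) (hE : e4 ^ 3 - e6 ^ 2 = 1728 * (PowerSeries.X * D))
    (h40 : constantCoeff e4 = 1) (h60 : constantCoeff e6 = 1) :
    PowerSeries.X ^ l ∣ phi n r s e4 e6 (PowerSeries.X * D) - 1 := by
  have hn : ∀ m : ℕ, ¬ l ∣ m → (m : PowerSeries k) ≠ 0 := by
    intro m hm h
    apply hm
    rw [← CharP.cast_eq_zero_iff k l]
    have := congrArg PowerSeries.constantCoeff h
    simpa using this
  have h2' : (2 : PowerSeries k) ≠ 0 := by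
    have := hn 2 (fun h => by have := Nat.le_of_dvd (by norm_num) h; omega); simpa using this
  have h3' : (3 : PowerSeries k) ≠ 0 := by
    have := hn 3 (fun h => by have := Nat.le_of_dvd (by norm_num) h; omega); simpa using this
  have h144 : (144 : PowerSeries k) ≠ 0 := by
    rw [show (144 : PowerSeries k) = 2 ^ 4 * 3 ^ 2 by norm_num]
    exact mul_ne_zero (pow_ne_zero _ h2') (pow_ne_zero _ h3')
  have h1728 : (1728 : PowerSeries k) ≠ 0 := by
    rw [show (1728 : PowerSeries k) = 2 ^ 6 * 3 ^ 3 by norm_num]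
    exact mul_ne_zero (pow_ne_zero _ h2') (pow_ne_zero _ h3')
  obtain ⟨δ, hδ⟩ := mkDer (f := theta (R := k)) (fun a b => by simp [theta, mul_add])
    (fun a b => by simp [theta, Derivation.leibniz, mul_add]; ring)
  have hD := der_D δ (e2 := e2) (by rw [hδ]; exact h4) (by rw [hδ]; exact h6) hE
    (fun x y h => mul_left_cancel₀ h1728 h)
  have key := der2_phi δ (e2 := e2) (by rw [hδ]; exact h4) (by rw [hδ]; exact h6) (by rw [hδ]; exact h2) hD hE n r s l hr hs hl (by
    have : ((l : k) : k) = 0 := CharP.cast_eq_zero k l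
    have := congrArg (PowerSeries.C (R := k)) this
    rwa [map_natCast, map_zero] at this)
  have key2 := (mul_eq_zero.mp key).resolve_left h144
  rw [hδ, hδ] at key2
  set φ := phi n r s e4 e6 (PowerSeries.X * D)
  have hth : ∀ (p : PowerSeries k) m, PowerSeries.coeff m (theta p) = m * PowerSeries.coeff m p := by
    intro p m
    unfold theta
    cases m with
    | zero => simp
    | succ m => rw [PowerSeries.coeff_succ_X_mul, PowerSeries.coeff_derivative]; push_cast; ring
  rw [PowerSeries.X_pow_dvd_iff]
  intro m hm
  rcases Nat.eq_zero_or_pos m with rfl | hm0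
  · have : constantCoeff φ = 1 := by
      simp only [φ, phi, map_sum, map_mul, map_pow, h40, h60, constantCoeff_X, zero_mul]
      rw [Finset.sum_range_succ, Finset.sum_eq_zero]
      · simp [cc]
      · intro i hi
        have : n - i ≠ 0 := by have := Finset.mem_range.mp hi; omega
        rw [zero_pow this]; simp
    simpa [sub_eq_zero] using this
  · have h := congrArg (PowerSeries.coeff m) key2
    rw [hth, hth, map_zero] at h
    have hm' : (m : k) ≠ 0 := by
      intro h'
      rw [CharP.cast_eq_zero_iff k l] at h'
      have := Nat.le_of_dvd hm0 h'; omega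
    have := (mul_eq_zero.mp ((mul_eq_zero.mp h).resolve_left hm')).resolve_left hm'
    rw [map_sub, this, PowerSeries.coeff_one, if_neg (by omega)]; simp
end

end HQ
end

section
namespace HQ
open PowerSeries Filter Topology UpperHalfPlane
open scoped MatrixGroups ModularForm Manifold

lemma homog_frac {S K : Type*} [CommRing S] [Field K] [Algebra (PowerSeries S) K]
    (n : ℕ) (P : Polynomial S) (hP : P.natDegree ≤ n) (h : PowerSeries S)
    (hx : algebraMap (PowerSeries S) K PowerSeries.X ≠ 0) :
    algebraMap (PowerSeries S) K (homog n P h) = algebraMap (PowerSeries S) K PowerSeries.X ^ n *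
      P.eval₂ ((algebraMap (PowerSeries S) K).comp PowerSeries.C)
        (algebraMap (PowerSeries S) K h / algebraMap (PowerSeries S) K PowerSeries.X) := by
  rw [Polynomial.eval₂_eq_sum_range' _ (Nat.lt_succ_of_le hP), homog, map_sum, Finset.mul_sum]
  refine Finset.sum_congr rfl fun i hi => ?_
  have hi' : i ≤ n := by simpa [Nat.lt_succ_iff] using hi
  simp only [map_mul, map_pow, RingHom.comp_apply]
  rw [div_pow]
  have : algebraMap (PowerSeries S) K PowerSeries.X ^ n = algebraMap (PowerSeries S) K PowerSeries.X ^ (n - i) *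
    algebraMap (PowerSeries S) K PowerSeries.X ^ i := by rw [← pow_add, Nat.sub_add_cancel hi']
  rw [this]
  field_simp

noncomputable def A0 (k : Type*) [CommRing k] (n s : ℕ) : Polynomial k :=
  ∑ i ∈ Finset.range (n + 1), (cc n s i : Polynomial k) * (Polynomial.X - 1728) ^ i

noncomputable def A12 (k : Type*) [CommRing k] (n r s : ℕ) : Polynomial k :=
  Polynomial.X ^ (4 * r) * (Polynomial.X - 1728) ^ (6 * s) * A0 k n s ^ 12

lemma A12_deg (k : Type*) [CommRing k] (n r s : ℕ) : (A12 k n r s).natDegree ≤ 12 * n + 4 * r + 6 * s := by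
  have h1 : (Polynomial.X - 1728 : Polynomial k).natDegree ≤ 1 := by compute_degree
  have h2 : (A0 k n s).natDegree ≤ n := by
    apply Polynomial.natDegree_sum_le_of_forall_le
    intro i hi
    have hi' : i ≤ n := by simpa [Nat.lt_succ_iff] using hi
    refine Polynomial.natDegree_mul_le.trans ?_
    rw [Polynomial.natDegree_intCast, zero_add]
    refine Polynomial.natDegree_pow_le.trans ?_
    nlinarith
  refine Polynomial.natDegree_mul_le.trans ?_
  have h3 := Polynomial.natDegree_mul_le (p := (Polynomial.X ^ (4 * r) : Polynomial k)) (q := (Polynomial.X - 1728) ^ (6 * s))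
  have h4 := Polynomial.natDegree_pow_le (p := (Polynomial.X - 1728 : Polynomial k)) (n := 6 * s)
  have h5 := Polynomial.natDegree_X_pow_le (R := k) (4 * r)
  have h6 := Polynomial.natDegree_pow_le (p := A0 k n s) (n := 12)
  nlinarith

lemma A12_aux {K : Type*} [Field K] (n r s : ℕ) (x d j i g : K) :
    d ^ (12 * n + 4 * r + 6 * s) * (x ^ (12 * n + 4 * r + 6 * s) * (j ^ (4 * r) * i ^ (6 * s) * g ^ 12)) =
      (x * d * j) ^ (4 * r) * (x * d * i) ^ (6 * s) * ((x * d) ^ n * g) ^ 12 := by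
  ring

lemma A12_homog {k : Type*} [Field k] (n r s : ℕ) {e4 e6 d h : PowerSeries k} (hh : h * d = e4 ^ 3)
    (hE : e4 ^ 3 - e6 ^ 2 = 1728 * (PowerSeries.X * d)) (hd : d ≠ 0) :
    d ^ (12 * n + 4 * r + 6 * s) * homog (12 * n + 4 * r + 6 * s) (A12 k n r s) h =
      phi n r s e4 e6 (PowerSeries.X * d) ^ 12 := by
  let K := FractionRing (PowerSeries k)
  let ι := algebraMap (PowerSeries k) K
  have hinj : Function.Injective ι := IsFractionRing.injective _ _
  apply hinj
  have hx : ι PowerSeries.X ≠ 0 := fun h => PowerSeries.X_ne_zero (hinj (by rw [h, map_zero]))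
  have hd' : ι d ≠ 0 := fun h => hd (hinj (by rw [h, map_zero]))
  rw [map_mul, map_pow, map_pow]
  have e := homog_frac (K := K) (12 * n + 4 * r + 6 * s) _ (A12_deg k n r s) h hx
  change ι _ = ι _ ^ _ * _ at e
  rw [e]
  have hh' := congrArg ι hh
  have hE' := congrArg ι hE
  have e1728 : ι 1728 = 1728 := map_ofNat ι 1728
  simp only [map_mul, map_sub, map_pow, e1728] at hh' hE'
  have hj : ι PowerSeries.X * ι d * (ι h / ι PowerSeries.X) = ι e4 ^ 3 := by
    rw [← hh', mul_assoc, mul_left_comm, mul_div_cancel₀ _ hx, mul_comm]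
  have hj2 : ι PowerSeries.X * ι d * (ι h / ι PowerSeries.X - 1728) = ι e6 ^ 2 := by
    rw [mul_sub, hj]; linear_combination hE'
  simp only [A12, A0, phi, Polynomial.eval₂_mul, Polynomial.eval₂_pow, Polynomial.eval₂_sub, Polynomial.eval₂_X,
    Polynomial.eval₂_finsetSum, map_sum, map_mul, map_pow]
  change _ * (_ * ((ι h / ι PowerSeries.X) ^ (4 * r) * (ι h / ι PowerSeries.X - _) ^ (6 * s) *
    (∑ i ∈ Finset.range (n + 1), _ * (ι h / ι PowerSeries.X - _) ^ i) ^ 12)) = _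
  have e1 : Polynomial.eval₂ ((algebraMap (PowerSeries k) K).comp PowerSeries.C) (ι h / ι PowerSeries.X) 1728 = 1728 :=
    Polynomial.eval₂_ofNat ..
  rw [e1]
  generalize (ι h / ι PowerSeries.X) = j at *
  have e2 : ∀ i : ℕ, Polynomial.eval₂ ((algebraMap (PowerSeries k) K).comp PowerSeries.C) j (cc n s i : Polynomial k) = (cc n s i : K) := by
    intro i; exact map_intCast (Polynomial.eval₂RingHom _ _) _
  simp only [e2]
  have e3 : ∑ i ∈ Finset.range (n + 1), ι (cc n s i : PowerSeries k) * (ι e4 ^ r * ι e6 ^ (2 * i + s) * (ι PowerSeries.X * ι d) ^ (n - i))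
    = ι e4 ^ r * ι e6 ^ s * ((ι PowerSeries.X * ι d) ^ n * ∑ i ∈ Finset.range (n + 1), (cc n s i : K) * (j - 1728) ^ i) := by
    rw [Finset.mul_sum, Finset.mul_sum]
    refine Finset.sum_congr rfl fun i hi => ?_
    have hi' : i ≤ n := by simpa [Nat.lt_succ_iff] using hi
    have : (ι PowerSeries.X * ι d) ^ n = (ι PowerSeries.X * ι d) ^ (n - i) * (ι PowerSeries.X * ι d) ^ i := by
      rw [← pow_add, Nat.sub_add_cancel hi']
    rw [this, pow_add, pow_mul, ← hj2, mul_pow _ (j - 1728), map_intCast]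
    ring
  rw [e3]
  generalize (∑ i ∈ Finset.range (n + 1), (cc n s i : K) * (j - 1728) ^ i) = sg
  generalize ι PowerSeries.X = x at *
  generalize ι d = d' at *
  have f1 : (ι e4 ^ r) ^ 12 = (x * d' * j) ^ (4 * r) := by rw [hj]; ring
  have f2 : (ι e6 ^ s) ^ 12 = (x * d' * (j - 1728)) ^ (6 * s) := by rw [hj2]; ring
  rw [mul_pow, mul_pow, f1, f2]
  exact A12_aux ..

theorem B_eq_A12 {k : Type*} [Field k] (l : ℕ) [CharP k l] (hp : l.Prime) (h5 : 5 < l) (n r s : ℕ) (hr : r ≤ 1) (hs : s ≤ 1)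
    (hl : l = 12 * n + 4 * r + 6 * s + 1) (B : Polynomial k) (hB : B.natDegree ≤ l - 1)
    (h : PowerSeries.map (Int.castRingHom k) dp0 ^ (l - 1) * homog (l - 1) B (PowerSeries.map (Int.castRingHom k) jp) = 1) :
    B = A12 k n r s := by
  set φ := PowerSeries.map (Int.castRingHom k)
  have hth : ∀ p : PowerSeries ℤ, φ (theta p) = theta (φ p) := by
    intro p
    ext m
    simp only [theta, φ]
    cases m with
    | zero => simp
    | succ m => simp [PowerSeries.coeff_succ_X_mul, PowerSeries.coeff_derivative]
  have h4 := congrArg φ ram4_ps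
  have h6 := congrArg φ ram6_ps
  have h2 := congrArg φ ram2_ps
  have hE := congrArg φ del_ps
  have e2 : φ 2 = 2 := map_ofNat φ 2
  have e3 : φ 3 = 3 := map_ofNat φ 3
  have e12 : φ 12 = 12 := map_ofNat φ 12
  have e1728 : φ 1728 = 1728 := map_ofNat φ 1728
  simp only [map_mul, map_sub, map_pow, hth, e2, e3, e12, e1728] at h4 h6 h2 hE
  have eX : φ PowerSeries.X = PowerSeries.X := PowerSeries.map_X _
  rw [eX] at hE
  have hj : jp * dp0 = e4p ^ 3 := by rw [jp]; linear_combination e4p ^ 3 * dp0_inv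
  have hj' := congrArg φ hj
  simp only [map_mul, map_pow] at hj'
  have c0 : ∀ p : PowerSeries ℤ, PowerSeries.constantCoeff p = 1 → PowerSeries.constantCoeff (φ p) = 1 := by
    intro p hp
    rw [← PowerSeries.coeff_zero_eq_constantCoeff_apply] at hp ⊢
    rw [PowerSeries.coeff_map, hp]; simp
  have hd1 := c0 _ dp0_const
  have key := phi_eq_one (k := k) l hp h5 n r s hr hs hl h4 h6 h2 hE (c0 _ e4p_const) (c0 _ e6p_const)
  have hA := A12_homog n r s hj' hE (by intro h0; rw [h0] at hd1; simp at hd1)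
  have hl' : l - 1 = 12 * n + 4 * r + 6 * s := by omega
  rw [← hl'] at hA
  refine homog_inj (c0 _ jp_const) hB (by rw [hl']; exact A12_deg k n r s) ?_
  have hu : IsUnit (φ dp0 ^ (l - 1)) := by
    apply IsUnit.pow
    rw [PowerSeries.isUnit_iff_constantCoeff, hd1]; exact isUnit_one
  rw [← hu.dvd_mul_left, mul_sub, h, hA, Nat.sub_add_cancel hp.one_le, dvd_sub_comm]
  exact key.trans (sub_one_dvd_pow_sub_one _ _)

end HQ
end

section
namespace HQ
open PowerSeries Filter Topology UpperHalfPlane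
open scoped MatrixGroups ModularForm Manifold

/-! ### Matrices of determinant l -/
abbrev M2 := Matrix (Fin 2) (Fin 2) ℤ

noncomputable def mobM (M : M2) (τ : ℍ) : ℍ := mob (M 0 0) (M 0 1) (M 1 0) (M 1 1) τ

lemma det_pos_iff (M : M2) : 0 < M.det ↔ 0 < M 0 0 * M 1 1 - M 0 1 * M 1 0 := by rw [Matrix.det_fin_two]

lemma mobM_mul {M N : M2} (hM : 0 < M.det) (hN : 0 < N.det) (τ : ℍ) :
    mobM M (mobM N τ) = mobM (M * N) τ := by
  unfold mobM
  rw [mob_mob (by rwa [← det_pos_iff]) (by rwa [← det_pos_iff])]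
  simp only [Matrix.mul_apply, Fin.sum_univ_two]

def Mx (l : ℕ) : Option (Fin l) → M2
  | none => !![(l : ℤ), 0; 0, 1]
  | some b => !![1, (b : ℤ); 0, (l : ℤ)]

lemma Mx_det (l : ℕ) (i : Option (Fin l)) : (Mx l i).det = l := by
  cases i <;> simp [Mx, Matrix.det_fin_two]

lemma Mx_lower (l : ℕ) (i : Option (Fin l)) : Mx l i 1 0 = 0 := by
  cases i <;> simp [Mx]

/-- every determinant l matrix is γ * Mx i -/
lemma exists_Mx (l : ℕ) (hl : l.Prime) (N : ℤ) (hN : IsCoprime N l) (M : M2) (hM : M.det = l) (h5 : N ∣ M 1 0) :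
    ∃ i, ∃ γ : M2, γ.det = 1 ∧ N ∣ γ 1 0 ∧ M = γ * Mx l i := by
  have hl0 : (l : ℤ) ≠ 0 := by exact_mod_cast hl.ne_zero
  have hlp : Prime (l : ℤ) := Nat.prime_iff_prime_int.mp hl
  rw [Matrix.det_fin_two] at hM
  by_cases h : (l : ℤ) ∣ M 0 0 ∧ (l : ℤ) ∣ M 1 0
  · obtain ⟨⟨a, ha⟩, ⟨c, hc⟩⟩ := h
    refine ⟨none, !![a, M 0 1; c, M 1 1], ?_, ?_, ?_⟩
    · rw [Matrix.det_fin_two]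
      simp
      rw [ha, hc] at hM
      apply mul_left_cancel₀ hl0
      linear_combination hM
    · simp
      rw [hc] at h5
      exact hN.dvd_of_dvd_mul_left h5
    · ext i j
      fin_cases i <;> fin_cases j <;> simp [Mx, Matrix.mul_apply, Fin.sum_univ_two, ha, hc, mul_comm]
  · -- find b0
    have key : ∃ b0 : ℤ, (l : ℤ) ∣ M 0 1 - M 0 0 * b0 ∧ (l : ℤ) ∣ M 1 1 - M 1 0 * b0 := by
      by_cases ha : (l : ℤ) ∣ M 0 0
      · have hc : ¬ (l : ℤ) ∣ M 1 0 := fun hc => h ⟨ha, hc⟩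
        obtain ⟨u, v, huv⟩ := (hlp.coprime_iff_not_dvd.mpr hc)
        refine ⟨v * M 1 1, ?_, ?_⟩
        · have : (l : ℤ) ∣ M 1 0 * (M 0 1 - M 0 0 * (v * M 1 1)) := by
            refine ⟨-1 + M 0 0 * M 1 1 * u, ?_⟩
            linear_combination -hM - M 0 0 * M 1 1 * huv
          exact (hlp.dvd_or_dvd this).resolve_left hc
        · exact ⟨u * M 1 1, by linear_combination -M 1 1 * huv⟩
      · obtain ⟨u, v, huv⟩ := (hlp.coprime_iff_not_dvd.mpr ha)
        refine ⟨v * M 0 1, ?_, ?_⟩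
        · exact ⟨u * M 0 1, by linear_combination -M 0 1 * huv⟩
        · have : (l : ℤ) ∣ M 0 0 * (M 1 1 - M 1 0 * (v * M 0 1)) := by
            refine ⟨1 + M 1 0 * M 0 1 * u, ?_⟩
            linear_combination hM - M 1 0 * M 0 1 * huv
          exact (hlp.dvd_or_dvd this).resolve_left ha
    obtain ⟨b0, h1, h2⟩ := key
    have hb := Int.emod_nonneg b0 hl0
    have hb' := Int.emod_lt_of_pos b0 (b := (l : ℤ)) (by exact_mod_cast hl.pos)
    have hb2 : ((b0 % l).toNat : ℤ) = b0 % l := Int.toNat_of_nonneg hb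
    have hb3 : b0 % l = b0 - l * (b0 / l) := by have := Int.emod_add_mul_ediv b0 l; linarith
    obtain ⟨x, hx⟩ := h1
    obtain ⟨y, hy⟩ := h2
    refine ⟨some ⟨(b0 % l).toNat, by zify; rw [hb2]; exact hb'⟩,
      !![M 0 0, x + M 0 0 * (b0 / l); M 1 0, y + M 1 0 * (b0 / l)], ?_, ?_, ?_⟩
    · rw [Matrix.det_fin_two]
      simp
      apply mul_left_cancel₀ hl0
      linear_combination hM - M 0 0 * hy + M 1 0 * hx
    · simpa using h5
    · ext i j
      fin_cases i <;> fin_cases j <;> simp [Mx, Matrix.mul_apply, Fin.sum_univ_two, hb2, -Int.ofNat_toNat]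
      · rw [hb3]; linear_combination hx
      · rw [hb3]; linear_combination hy

lemma Mx_unique (l : ℕ) (hl : l.Prime) {i j : Option (Fin l)} {γ : M2} (hγ : γ.det = 1) (h : Mx l i = γ * Mx l j) : i = j := by
  have hl0 : (l : ℤ) ≠ 0 := by exact_mod_cast hl.ne_zero
  have hl1 : (1 : ℤ) < l := by exact_mod_cast hl.one_lt
  rw [Matrix.det_fin_two] at hγ
  have h00 := congrFun (congrFun h 0) 0
  have h01 := congrFun (congrFun h 0) 1
  have h10 := congrFun (congrFun h 1) 0
  have h11 := congrFun (congrFun h 1) 1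
  simp only [Matrix.mul_apply, Fin.sum_univ_two] at h00 h01 h10 h11
  rcases i with _ | b <;> rcases j with _ | b' <;> simp [Mx] at h00 h01 h10 h11 ⊢
  · rw [← h10, ← h00] at hγ
    have : (l : ℤ) ∣ 1 := ⟨γ 1 1, by linarith⟩
    have := Int.le_of_dvd (by norm_num) this
    omega
  · have := Int.le_of_dvd (by norm_num) (⟨γ 0 0, by linarith⟩ : (l : ℤ) ∣ 1)
    omega
  · rw [← h00, ← h10] at *
    have h11' : γ 1 1 = 1 := by apply mul_right_cancel₀ hl0; linarith
    have hb := b.2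
    have hb' := b'.2
    zify at hb hb'
    have h3 : (b : ℤ) - b' = γ 0 1 * l := by linarith
    have h4 : γ 0 1 = 0 := by
      by_contra hne
      rcases lt_or_gt_of_ne hne with h | h
      · nlinarith
      · nlinarith
    rw [h4] at h3
    apply Fin.ext
    zify; linarith

lemma hecke_perm (l : ℕ) (hl : l.Prime) (N : ℤ) (hN : IsCoprime N l) (γ : M2) (hγ : γ.det = 1) (hγN : N ∣ γ 1 0) :
    ∃ σ : Equiv.Perm (Option (Fin l)), ∀ i, ∃ γ' : M2, γ'.det = 1 ∧ N ∣ γ' 1 0 ∧ Mx l i * γ = γ' * Mx l (σ i) := by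
  have h : ∀ i, ∃ j, ∃ γ' : M2, γ'.det = 1 ∧ N ∣ γ' 1 0 ∧ Mx l i * γ = γ' * Mx l j := by
    intro i
    apply exists_Mx l hl N hN
    · rw [Matrix.det_mul, Mx_det, hγ, mul_one]
    · simp only [Matrix.mul_apply, Fin.sum_univ_two, Mx_lower, zero_mul, zero_add]
      exact Dvd.dvd.mul_left hγN _
  choose σ γ' h1 h2 h3 using h
  have hinj : Function.Injective σ := by
    intro i j hij
    apply Mx_unique l hl (γ := γ' i * (γ' j).adjugate)
    · rw [Matrix.det_mul, Matrix.det_adjugate, h1, h1]; simp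
    · have e1 : γ * γ.adjugate = 1 := by rw [Matrix.mul_adjugate, hγ, one_smul]
      have e2 : (γ' j).adjugate * γ' j = 1 := by rw [Matrix.adjugate_mul, h1, one_smul]
      calc Mx l i = Mx l i * γ * γ.adjugate := by rw [mul_assoc, e1, mul_one]
        _ = γ' i * Mx l (σ j) * γ.adjugate := by rw [h3, hij]
        _ = γ' i * ((γ' j).adjugate * (γ' j * Mx l (σ j))) * γ.adjugate := by
            rw [← mul_assoc (γ' j).adjugate, e2, one_mul]
        _ = γ' i * (γ' j).adjugate * Mx l j := by rw [← h3]; simp only [mul_assoc, e1, mul_one]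
  refine ⟨Equiv.ofBijective σ hinj.bijective_of_finite, fun i => ⟨γ' i, h1 i, h2 i, h3 i⟩⟩

lemma sl_mobM (γ : SL(2, ℤ)) (τ : ℍ) : γ • τ = mobM γ.1 τ := sl_smul γ τ

end HQ
end

section
namespace HQ
open PowerSeries Filter Topology UpperHalfPlane
open scoped MatrixGroups ModularForm Manifold

lemma Haupt.mapR {R : Type*} [CommRing R] [Algebra R ℂ] {V : Subalgebra ℂ (ℍ → ℂ)} {h : ℍ → ℂ}
    {hf : ℂ → ℂ} {hp : PowerSeries ℤ} (H : Haupt ℤ V h hf hp) :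
    Haupt R V h hf (PowerSeries.map (Int.castRingHom R) hp) where
  per := H.per
  const := H.const
  mem := H.mem
  eq := H.eq
  ser := H.ser.map _ (fun r => by simp)
  one := by rw [← PowerSeries.coeff_zero_eq_constantCoeff_apply, PowerSeries.coeff_map,
              PowerSeries.coeff_zero_eq_constantCoeff_apply, H.one, map_one]

lemma expand_frob_zmod (l : ℕ) [Fact l.Prime] (p : PowerSeries (ZMod l)) :
    PowerSeries.expand l (Fact.out : l.Prime).ne_zero p = p ^ l := by
  have h := MvPowerSeries.map_frobenius_expand (σ := Unit) (R := ZMod l) (f := p) l (Fact.out : l.Prime).ne_zero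
  rw [ZMod.frobenius_zmod] at h
  have h2 : MvPowerSeries.map (σ := Unit) (RingHom.id (ZMod l)) = RingHom.id _ := by
    ext; simp
  rw [h2] at h
  exact h

lemma expand_frob {k : Type*} [Field k] (l : ℕ) [Fact l.Prime] [CharP k l] (p : PowerSeries ℤ) :
    PowerSeries.expand l (Fact.out : l.Prime).ne_zero (PowerSeries.map (Int.castRingHom k) p) =
      PowerSeries.map (Int.castRingHom k) p ^ l := by
  have h := congrArg (PowerSeries.map (ZMod.castHom (dvd_refl l) k)) (expand_frob_zmod l (PowerSeries.map (Int.castRingHom (ZMod l)) p))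
  have e : (ZMod.castHom (dvd_refl l) k).comp (Int.castRingHom (ZMod l)) = Int.castRingHom k := RingHom.ext_int _ _
  have e2 : PowerSeries.map (ZMod.castHom (dvd_refl l) k) (PowerSeries.map (Int.castRingHom (ZMod l)) p) = PowerSeries.map (Int.castRingHom k) p := by
    rw [← e, PowerSeries.map_comp]; rfl
  rw [map_pow, e2] at h
  rw [← h, ← e2, PowerSeries.map_expand]

lemma expand_inj {k : Type*} [CommRing k] (l : ℕ) (hl : l ≠ 0) : Function.Injective (PowerSeries.expand (R := k) l hl) := by
  intro p q h
  ext n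
  have := congrArg (PowerSeries.coeff (l * n)) h
  simpa [PowerSeries.coeff_expand_mul] using this

lemma homog_mono {S : Type*} [CommRing S] {n i : ℕ} (hi : i ≤ n) (a : S) (h : PowerSeries S) :
    homog n (Polynomial.C a * Polynomial.X ^ i) h = PowerSeries.C a * PowerSeries.X ^ (n - i) * h ^ i := by
  unfold homog
  rw [Finset.sum_eq_single i]
  · simp
  · intro j _ hj
    simp [Polynomial.coeff_C_mul, Polynomial.coeff_X_pow, hj]
  · intro h; simp at h; omega

lemma map_map_int {R k : Type*} [CommRing R] [CommRing k] (π : R →+* k) (p : PowerSeries ℤ) :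
    PowerSeries.map π (PowerSeries.map (Int.castRingHom R) p) = PowerSeries.map (Int.castRingHom k) p := by
  ext; simp

lemma rescale_map {R k : Type*} [CommRing R] [CommRing k] (π : R →+* k) (a : R) (p : PowerSeries R) :
    PowerSeries.map π (PowerSeries.rescale a p) = PowerSeries.rescale (π a) (PowerSeries.map π p) := by
  ext; simp [PowerSeries.coeff_rescale]

/-! ### The tt-correspondence -/
noncomputable def hG (l : ℕ) (τ : ℍ) : ℂ := ∏ i : Option (Fin l), (125 - tt τ * tt (mobM (Mx l i) τ))

lemma mobM_comp_Mx {l : ℕ} (hl : 0 < l) (i : Option (Fin l)) {γ : M2} (hγ : γ.det = 1) {γ' : M2} (hγ' : γ'.det = 1) {j : Option (Fin l)}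
    (h : Mx l i * γ = γ' * Mx l j) (τ : ℍ) : mobM (Mx l i) (mobM γ τ) = mobM γ' (mobM (Mx l j) τ) := by
  have h0 : (0:ℤ) < l := by exact_mod_cast hl
  rw [mobM_mul (by rw [Mx_det]; exact h0) (by rw [hγ]; norm_num), mobM_mul (by rw [hγ']; norm_num) (by rw [Mx_det]; exact h0), h]

lemma tt_mobM {γ : M2} (hγ : γ.det = 1) (h5 : 5 ∣ γ 1 0) (τ : ℍ) : tt (mobM γ τ) = tt τ := by
  obtain ⟨c, hc⟩ := h5
  unfold mobM
  rw [hc]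
  apply tt_mob
  rw [Matrix.det_fin_two, hc] at hγ
  exact hγ

lemma cop5 {l : ℕ} (hl : l.Prime) (h5 : 5 < l) : IsCoprime (5 : ℤ) (l : ℤ) := by
  have : Nat.Coprime 5 l := (Nat.coprime_primes (by norm_num) hl).mpr (by omega)
  exact_mod_cast Nat.isCoprime_iff_coprime.mpr this

/-- conjugation by W -/
def cj (M : M2) : M2 := !![M 1 1, -(M 1 0 / 5); -(5 * M 0 1), M 0 0]

lemma cj_det {M : M2} (h5 : 5 ∣ M 1 0) : (cj M).det = M.det := by
  obtain ⟨c, hc⟩ := h5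
  simp [cj, Matrix.det_fin_two, hc]; ring

lemma cj_W {M : M2} (hM : 0 < M.det) (h5 : 5 ∣ M 1 0) (τ : ℍ) :
    mobM M (mob 0 (-1) 5 0 τ) = mob 0 (-1) 5 0 (mobM (cj M) τ) := by
  have hd : 0 < (cj M).det := by rwa [cj_det h5]
  have hM' := (det_pos_iff _).mp hM
  have hd' := (det_pos_iff _).mp hd
  unfold mobM
  rw [mob_mob hM' (by norm_num), mob_mob (by norm_num) hd']
  obtain ⟨c, hc⟩ := h5
  simp only [cj, hc]
  simp
  congr 1 <;> ring

lemma tendsto_mob {a b d : ℤ} (h : 0 < a * d - b * 0) : Tendsto (mob a b 0 d) atImInfty atImInfty := by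
  unfold atImInfty
  rw [tendsto_comap_iff]
  have h' : 0 < a * d := by simpa using h
  have hd : d ≠ 0 := by rintro rfl; simp at h'
  have hr : (0:ℝ) < (a * d : ℤ) / (d : ℝ)^2 := by
    have : (0:ℝ) < (a * d : ℤ) := by exact_mod_cast h'
    have : (d:ℝ) ≠ 0 := by exact_mod_cast hd
    positivity
  have : (UpperHalfPlane.im ∘ mob a b 0 d) = fun τ : ℍ => ((a * d : ℤ) / (d : ℝ)^2) * τ.im := by
    funext τ
    simp only [Function.comp_apply]
    rw [mob_im' h]
    simp [Complex.normSq_apply]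
    ring
  rw [this]
  exact (tendsto_comap).const_mul_atTop hr

lemma hG_mem (l : ℕ) (hl : l.Prime) (h5 : 5 < l) : hG l ∈ V5 := by
  have h0 : (0:ℤ) < l := by exact_mod_cast hl.pos
  have hMx : ∀ i, 0 < (Mx l i).det := fun i => by rw [Mx_det]; exact h0
  refine ⟨?_, ?_, ?_⟩
  · unfold hG
    apply hol_prod
    intro i _
    exact (hol_const _).sub (hol_tt.mul (hol_tt.comp_mob ((det_pos_iff _).mp (hMx i))))
  · intro γ hγ τ
    unfold hG
    rw [tt_smul γ hγ]
    have hγ' := hγ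
    rw [CongruenceSubgroup.Gamma0_mem, ZMod.intCast_zmod_eq_zero_iff_dvd] at hγ'
    obtain ⟨σ, hσ⟩ := hecke_perm l hl 5 (cop5 hl h5) γ.1 γ.2 (by simpa using hγ')
    rw [← Equiv.prod_comp σ (fun i => 125 - tt τ * tt (mobM (Mx l i) τ))]
    refine Finset.prod_congr rfl fun i _ => ?_
    obtain ⟨γ', h1, h2, h3⟩ := hσ i
    rw [sl_mobM, mobM_comp_Mx hl.pos i γ.2 h1 h3, tt_mobM h1 h2]
  · -- bounded at S
    have key : ∀ i, Tendsto (fun τ : ℍ => 125 - tt (ModularGroup.S • τ) * tt (mobM (Mx l i) (ModularGroup.S • τ))) atImInfty (𝓝 125) := by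
      intro i
      obtain ⟨j, γ, h1, h2, h3⟩ := exists_Mx l hl 5 (cop5 hl h5) (cj (Mx l i)) (by rw [cj_det (by simp [Mx_lower]), Mx_det]) (by
        simp [cj])
      have e : ∀ τ, tt (mobM (Mx l i) (ModularGroup.S • τ)) = 125 * (tt (mobM (Mx l j) (mob 1 0 0 5 τ)))⁻¹ := by
        intro τ
        rw [S_smul_eq, cj_W (hMx i) (by simp [Mx_lower]), h3, ← mobM_mul (by rw [h1]; norm_num) (hMx j)]
        set w := mobM (Mx l j) (mob 1 0 0 5 τ)
        rw [← tt_mobM h1 h2 w, ← tt_W (mobM γ w), mul_assoc, mul_inv_cancel₀ (tt_ne_zero _), mul_one]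
      have l1 : Tendsto (fun τ : ℍ => tt (ModularGroup.S • τ)) atImInfty (𝓝 0) := by
        have := bounded_of_ser ((ser_natCast 125).mul (ser_X.mul tf_inv)) 5 (by norm_num) (F := fun τ => tt (ModularGroup.S • τ)) fun τ => by
          rw [tt_S, tt_eq, mul_inv, inv_inv, show ((5 : ℤ)) = ((5 : ℕ) : ℤ) by norm_num, qq_div_zero 5 (by norm_num)]
          norm_num
        simpa using this
      have l2 : Tendsto (fun τ : ℍ => tt (mobM (Mx l i) (ModularGroup.S • τ))) atImInfty (𝓝 0) := by
        simp only [e]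
        have l3 : Tendsto (fun τ : ℍ => qq (mobM (Mx l j) (mob 1 0 0 5 τ))) atImInfty (𝓝 0) := by
          have t1 := tendsto_zz 1 (by norm_num)
          simp only [funext zz_one] at t1
          refine t1.comp (Tendsto.comp (f := mob 1 0 0 5) (g := mobM (Mx l j)) ?_ (tendsto_mob (by norm_num)))
          have := (det_pos_iff _).mp (hMx j)
          unfold mobM
          rw [Mx_lower] at this ⊢
          exact tendsto_mob this
        have l4 : Tendsto (fun τ : ℍ => 125 * (qq (mobM (Mx l j) (mob 1 0 0 5 τ)) * (tf (qq (mobM (Mx l j) (mob 1 0 0 5 τ))))⁻¹)) atImInfty (𝓝 (125 * (0 * (tf 0)⁻¹))) := by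
          refine tendsto_const_nhds.mul (l3.mul ?_)
          exact (tf_inv.continuousAt.tendsto).comp l3
        simp only [zero_mul, mul_zero] at l4
        refine l4.congr fun τ => ?_
        rw [tt_eq, mul_inv, inv_inv]
      have := (l1.mul l2).const_sub 125
      simpa using this
    apply isBounded_of_tendsto
    exact tendsto_finsetProd _ (fun i _ => key i)

end HQ
end

section
namespace HQ
open PowerSeries Filter Topology UpperHalfPlane
open scoped MatrixGroups ModularForm Manifold

section
variable {R : Type*} [CommRing R] [Algebra R ℂ] [FaithfulSMul R ℂ] {k : Type*} [Field k] (l : ℕ) [Fact l.Prime] [CharP k l]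
  (π : R →+* k) (ζ : R) (hζ : algebraMap R ℂ ζ = Complex.exp (2 * Real.pi * Complex.I / l)) (hζ1 : π ζ = 1)

omit [FaithfulSMul R ℂ] in
include hζ in
lemma zeta_pow : algebraMap R ℂ ζ ^ l = 1 := by
  rw [hζ]; exact (Complex.isPrimitiveRoot_exp l (Fact.out : l.Prime).ne_zero).pow_eq_one

omit [FaithfulSMul R ℂ] in
include hζ in
lemma zeta_norm : ‖algebraMap R ℂ ζ‖ = 1 := 
  Complex.norm_eq_one_of_pow_eq_one (zeta_pow l ζ hζ) (Fact.out : l.Prime).ne_zero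

omit [FaithfulSMul R ℂ] in
include hζ in
lemma qq_some (b : Fin l) (τ : ℍ) : qq (mobM (Mx l (some b)) τ) = algebraMap R ℂ (ζ ^ (b : ℕ)) * zz l τ := by
  have h := qq_div l (Fact.out : l.Prime).ne_zero (b : ℤ) τ
  have e : mobM (Mx l (some b)) τ = mob 1 b 0 l τ := rfl
  rw [e, h, map_pow, hζ, ← Complex.exp_nat_mul]
  congr 2
  push_cast
  ring

omit [Fact l.Prime] in
lemma qq_mul_nat (hl : 0 < l) (τ : ℍ) : qq (mob l 0 0 1 τ) = qq τ ^ l := by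
  unfold qq
  rw [coe_mob (by simpa using hl), ← Complex.exp_nat_mul]
  congr 1
  push_cast
  ring

lemma qq_none (τ : ℍ) : qq (mobM (Mx l none) τ) = zz l τ ^ (l * l) := by
  have hl := (Fact.out : l.Prime)
  have e : mobM (Mx l none) τ = mob l 0 0 1 τ := rfl
  rw [e, qq_mul_nat l hl.pos, ← zz_pow l hl.ne_zero, pow_mul]

include hζ hζ1 in
/-- the correspondence polynomial -/
theorem heckeT (h5 : 5 < l) : ∃ G : R[X], G.natDegree ≤ 2 * l + 2 ∧ (∀ τ, hG l τ = Polynomial.aeval (tt τ) G) ∧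
    G.map π = (Polynomial.C 125 - Polynomial.X ^ (l + 1)) ^ 2 := by
  have hl := (Fact.out : l.Prime)
  have hl0 := hl.ne_zero
  set tpR : PowerSeries R := PowerSeries.map (Int.castRingHom R) tp with htpR
  set tpk : PowerSeries k := PowerSeries.map (Int.castRingHom k) tp with htpk
  have hser : Ser R tf tpR := ser_tf.map _ (fun r => by simp)
  let P : Option (Fin l) → PowerSeries R := fun i => match i with
    | none => PowerSeries.C 125 * PowerSeries.X ^ (l * l + l) - PowerSeries.expand l hl0 tpR * PowerSeries.expand (l * l) (by positivity) tpR
    | some b => PowerSeries.C 125 * PowerSeries.X ^ (l + 1) - PowerSeries.expand l hl0 tpR * (PowerSeries.C (ζ ^ ((l - 1) * b)) * PowerSeries.rescale (ζ ^ (b:ℕ)) tpR)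
  let f : Option (Fin l) → ℂ → ℂ := fun i z => match i with
    | none => algebraMap R ℂ 125 * z ^ (l * l + l) - tf (z ^ l) * tf (z ^ (l * l))
    | some b => algebraMap R ℂ 125 * z ^ (l + 1) - tf (z ^ l) * (algebraMap R ℂ (ζ ^ ((l - 1) * b)) * tf (algebraMap R ℂ (ζ ^ (b:ℕ)) * z))
  have hfP : ∀ i, Ser R (f i) (P i) := by
    intro i
    rcases i with _ | b
    · exact ((ser_C _).mul (ser_X.pow _)).sub ((hser.expand l hl0).mul (hser.expand (l * l) (by positivity)))
    · refine ((ser_C _).mul (ser_X.pow _)).sub ((hser.expand l hl0).mul ((ser_C _).mul (hser.rescale _ ?_)))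
      rw [map_pow, norm_pow, zeta_norm l ζ hζ, one_pow]
  let e : Option (Fin l) → ℕ := fun i => match i with
    | none => l * l + l
    | some b => l + 1
  have hfe : ∀ i τ, zz l τ ^ e i * (125 - tt τ * tt (mobM (Mx l i) τ)) = f i (zz l τ) := by
    intro i τ
    have hz := zz_ne_zero l τ
    rcases i with _ | b
    · simp only [e, f]
      rw [tt_eq, tt_eq (mobM (Mx l none) τ), qq_none, ← zz_pow l hl0 τ, map_ofNat, pow_add]
      field_simp
    · simp only [e, f]
      rw [tt_eq, tt_eq (mobM (Mx l (some b)) τ), qq_some l ζ hζ, ← zz_pow l hl0 τ, map_ofNat, pow_add]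
      have hq : algebraMap R ℂ (ζ ^ ((l - 1) * (b:ℕ))) * algebraMap R ℂ (ζ ^ (b:ℕ)) = 1 := by
        rw [← map_mul, ← pow_add]
        have : (l - 1) * (b:ℕ) + b = l * b := by
          rw [Nat.sub_mul, one_mul]; apply Nat.sub_add_cancel; exact Nat.le_mul_of_pos_left _ hl.pos
        rw [this, pow_mul, map_pow, map_pow, zeta_pow l ζ hζ, one_pow]
      have hw : algebraMap R ℂ (ζ ^ (b:ℕ)) ≠ 0 := right_ne_zero_of_mul_eq_one hq
      rw [eq_inv_of_mul_eq_one_left hq]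
      field_simp
  have hsum : ∑ i, e i = l * (2 * l + 2) := by
    rw [Fintype.sum_option]; simp [e]; ring
  obtain ⟨G, hG1, hG2, hG3⟩ := (haupt5.mapR (R := R)).poly l hl0 (2 * l + 2) (hG l) (hG_mem l hl h5) (fun z => ∏ i, f i z) (∏ i, P i)
    (ser_prod _ _ _ (fun i _ => hfP i)) (fun τ => by
      rw [← hsum, ← Finset.prod_pow_eq_pow_sum, hG, ← Finset.prod_mul_distrib]
      exact Finset.prod_congr rfl fun i _ => hfe i τ)
  refine ⟨G, hG1, hG2, ?_⟩
  have hG4 := congrArg (PowerSeries.map π) hG3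
  rw [PowerSeries.map_expand, homog_map, map_prod, map_map_int] at hG4
  set Y : PowerSeries k := PowerSeries.C 125 * PowerSeries.X ^ (l + 1) - tpk ^ (l + 1) with hY
  have h125 : (125 : k) ^ l = 125 := by
    have : (125 : k) = ZMod.castHom (dvd_refl l) k 125 := by rw [map_ofNat]
    rw [this, ← map_pow, ZMod.pow_card]
  have hYl : Y ^ l = PowerSeries.C 125 * PowerSeries.X ^ (l * l + l) - tpk ^ (l * l + l) := by
    have : CharP (PowerSeries k) l := charP_of_injective_algebraMap (algebraMap k (PowerSeries k)).injective l
    rw [hY, sub_pow_char, mul_pow, ← map_pow, h125, ← pow_mul, ← pow_mul]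
    congr 2 <;> ring
  have hPs : ∀ b, PowerSeries.map π (P (some b)) = Y := by
    intro b
    simp only [P, map_sub, map_mul, map_pow, PowerSeries.map_expand, rescale_map, map_map_int, hζ1, PowerSeries.map_C, PowerSeries.map_X,
      htpR, expand_frob]
    rw [hY, map_ofNat]
    simp [PowerSeries.rescale_one]
    ring
  have hPn : PowerSeries.map π (P none) = Y ^ l := by
    rw [hYl]
    simp only [P, map_sub, map_mul, map_pow, PowerSeries.map_expand, map_map_int, PowerSeries.map_C, PowerSeries.map_X,
      htpR, PowerSeries.expand_mul l hl0 l hl0, expand_frob]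
    rw [map_ofNat]
    ring
  rw [Fintype.prod_option, hPn, Finset.prod_congr rfl (fun b _ => hPs b), Finset.prod_const, Finset.card_univ, Fintype.card_fin] at hG4
  have hYi : Y = PowerSeries.map (Int.castRingHom k) (PowerSeries.C 125 * PowerSeries.X ^ (l + 1) - tp ^ (l + 1)) := by
    rw [map_sub, map_mul, PowerSeries.map_C, map_pow, map_pow, PowerSeries.map_X, hY, htpk, map_ofNat (Int.castRingHom k)]
  have hG5 : Y ^ 2 = homog (2 * l + 2) (G.map π) tpk := by
    apply expand_inj l hl0
    rw [← hG4, map_pow, hYi, expand_frob]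
    ring
  have hY2 : Y ^ 2 = homog (2 * l + 2) ((Polynomial.C 125 - Polynomial.X ^ (l + 1)) ^ 2) tpk := by
    have e1 : ((Polynomial.C 125 - Polynomial.X ^ (l + 1)) ^ 2 : k[X]) = Polynomial.C (125 * 125) * Polynomial.X ^ 0 -
        (Polynomial.C 250 * Polynomial.X ^ (l + 1) - Polynomial.C 1 * Polynomial.X ^ (2 * l + 2)) := by
      have : (250 : k) = 2 * 125 := by norm_num
      rw [this]
      simp only [map_mul, map_one, map_ofNat]
      ring
    rw [e1, homog_sub, homog_sub, homog_mono (by omega), homog_mono (by omega), homog_mono (by omega), hY,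
      show 2 * l + 2 - (l + 1) = l + 1 by omega, show 2 * l + 2 - (2 * l + 2) = 0 by omega]
    have : (250 : k) = 2 * 125 := by norm_num
    rw [this]
    simp only [map_mul, map_one, map_ofNat]
    rw [Nat.sub_zero]
    ring
  refine homog_inj (n := 2 * l + 2) (h := tpk) ?_ ?_ ?_ ?_
  · rw [htpk, ← PowerSeries.coeff_zero_eq_constantCoeff_apply, PowerSeries.coeff_map,
              PowerSeries.coeff_zero_eq_constantCoeff_apply, tp_const, map_one]
  · exact Polynomial.natDegree_map_le.trans hG1
  · refine Polynomial.natDegree_pow_le.trans ?_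
    have : (Polynomial.C 125 - Polynomial.X ^ (l + 1) : k[X]).natDegree ≤ l + 1 := by
      refine (Polynomial.natDegree_sub_le _ _).trans ?_
      simp
    omega
  · rw [← hG5, hY2, sub_self]; exact dvd_zero _

end
end HQ
end

section
namespace HQ
open PowerSeries Filter Topology UpperHalfPlane
open scoped MatrixGroups ModularForm Manifold

/-- automorphy factor -/
noncomputable def au (M : M2) (τ : ℍ) : ℂ := (M 1 0 : ℂ) * τ + (M 1 1 : ℂ)

lemma au_ne_zero {M : M2} (hM : 0 < M.det) (τ : ℍ) : au M τ ≠ 0 := lin_ne_zero ((det_pos_iff _).mp hM) τ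

lemma au_mul {M N : M2} (hN : 0 < N.det) (τ : ℍ) : au (M * N) τ = au M (mobM N τ) * au N τ := by
  have h := au_ne_zero hN τ
  unfold au at *
  unfold mobM
  rw [coe_mob ((det_pos_iff _).mp hN)]
  simp only [Matrix.mul_apply, Fin.sum_univ_two]
  push_cast
  field_simp
  ring

lemma Del_mobM {γ : M2} (h : γ.det = 1) (τ : ℍ) : Del (mobM γ τ) = au γ τ ^ 12 * Del τ := by
  unfold mobM au
  rw [Del_mob (by rw [← Matrix.det_fin_two]; exact h)]

noncomputable def wM (l : ℕ) (M : M2) (τ : ℍ) : ℂ := (l : ℂ) ^ 12 * Del (mobM M τ) / (au M τ ^ 12 * Del τ)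

lemma wM_left (l : ℕ) {γ M : M2} (hγ : γ.det = 1) (hM : 0 < M.det) (τ : ℍ) : wM l (γ * M) τ = wM l M τ := by
  unfold wM
  have h1 := au_ne_zero (M := γ) (by rw [hγ]; norm_num) (mobM M τ)
  rw [← mobM_mul (by rw [hγ]; norm_num) hM, Del_mobM hγ, au_mul hM, mul_pow]
  have h2 := au_ne_zero hM τ
  have h3 := Del_ne_zero τ
  field_simp

lemma wM_right (l : ℕ) {γ M : M2} (hγ : γ.det = 1) (hM : 0 < M.det) (τ : ℍ) : wM l M (mobM γ τ) = wM l (M * γ) τ := by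
  unfold wM
  rw [mobM_mul hM (by rw [hγ]; norm_num), Del_mobM hγ, au_mul (by rw [hγ]; norm_num), mul_pow, mul_assoc]

lemma hol_au_pow (M : M2) (hM : 0 < M.det) : Hol (fun τ => au M τ ^ 12) := by
  apply Hol.pow
  unfold au
  apply hol_of_differentiable (g := fun z => (M 1 0 : ℂ) * z + (M 1 1 : ℂ))
  fun_prop

lemma hol_wM (l : ℕ) {M : M2} (hM : 0 < M.det) : Hol (wM l M) :=
  ((hol_const _).mul (hol_Del.comp_mob ((det_pos_iff _).mp hM))).div ((hol_au_pow M hM).mul hol_Del)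
    (fun τ => mul_ne_zero (pow_ne_zero _ (au_ne_zero hM τ)) (Del_ne_zero τ))

noncomputable def cpoly (l : ℕ) (τ : ℍ) : ℂ[X] := ∏ i : Option (Fin l), (Polynomial.X - Polynomial.C (wM l (Mx l i) τ))

lemma cpoly_inv (l : ℕ) (hl : l.Prime) (γ : SL(2, ℤ)) (τ : ℍ) : cpoly l (γ • τ) = cpoly l τ := by
  have h0 : (0:ℤ) < l := by exact_mod_cast hl.pos
  unfold cpoly
  obtain ⟨σ, hσ⟩ := hecke_perm l hl 1 isCoprime_one_left γ.1 γ.2 (one_dvd _)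
  rw [← Equiv.prod_comp σ (fun i => Polynomial.X - Polynomial.C (wM l (Mx l i) τ))]
  refine Finset.prod_congr rfl fun i _ => ?_
  obtain ⟨γ', h1, h2, h3⟩ := hσ i
  rw [sl_mobM, wM_right l γ.2 (by rw [Mx_det]; exact h0), h3, wM_left l h1 (by rw [Mx_det]; exact h0)]

lemma hol_coeff_prod {ι : Type*} (s : Finset ι) (F : ι → ℍ → ℂ[X]) (h : ∀ i k, Hol (fun τ => (F i τ).coeff k)) :
    ∀ k, Hol (fun τ => (∏ i ∈ s, F i τ).coeff k) := by
  classical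
  induction s using Finset.induction_on with
  | empty => intro k; simp only [Finset.prod_empty]; exact hol_const _
  | insert i s hi ih =>
    intro k
    simp only [Finset.prod_insert hi, Polynomial.coeff_mul]
    exact hol_sum _ _ (fun x _ => (h i x.1).mul (ih x.2))

lemma cpoly_mem (l : ℕ) (hl : l.Prime) (k : ℕ) : (fun τ => (cpoly l τ).coeff k) ∈ V1 := by
  have h0 : (0:ℤ) < l := by exact_mod_cast hl.pos
  refine ⟨hol_coeff_prod _ _ (fun i k => ?_) k, fun γ τ => by simp only [cpoly_inv l hl]⟩
  simp only [Polynomial.coeff_sub, Polynomial.coeff_C]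
  refine (hol_const _).sub ?_
  split_ifs
  · exact hol_wM l (by rw [Mx_det]; exact h0)
  · exact hol_const _

lemma cpoly_eval (l : ℕ) (τ : ℍ) (i : Option (Fin l)) :
    ∑ k ∈ Finset.range (l + 2), (cpoly l τ).coeff k * wM l (Mx l i) τ ^ k = 0 := by
  have hd : (cpoly l τ).natDegree < l + 2 := by
    have : (cpoly l τ).natDegree = l + 1 := by
      unfold cpoly
      rw [Polynomial.natDegree_finsetProd_X_sub_C_eq_card]; simp
    omega
  rw [← Polynomial.eval_eq_sum_range' hd, cpoly, Polynomial.eval_prod]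
  exact Finset.prod_eq_zero (Finset.mem_univ i) (by simp)

lemma cpoly_top (l : ℕ) (τ : ℍ) : (cpoly l τ).coeff (l + 1) = 1 := by
  have h1 : (cpoly l τ).natDegree = l + 1 := by
      unfold cpoly
      rw [Polynomial.natDegree_finsetProd_X_sub_C_eq_card]; simp
  have h2 : (cpoly l τ).Monic := by
    unfold cpoly
    exact Polynomial.monic_prod_of_monic _ _ (fun i _ => Polynomial.monic_X_sub_C _)
  rw [← h1]; exact h2

lemma cpoly_zero (l : ℕ) (τ : ℍ) : (cpoly l τ).coeff 0 = (-1) ^ (l + 1) * ∏ i, wM l (Mx l i) τ := by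
  unfold cpoly
  rw [Polynomial.coeff_zero_prod]
  simp only [Polynomial.coeff_sub, Polynomial.coeff_X_zero, Polynomial.coeff_C_zero, zero_sub]
  rw [Finset.prod_neg]
  simp

section
variable {R : Type*} [CommRing R] [Algebra R ℂ]

def SerP (R : Type*) [CommRing R] [Algebra R ℂ] (f : ℂ → ℂ[X]) (Q : (PowerSeries R)[X]) : Prop :=
  ∀ k, Ser R (fun z => (f z).coeff k) (Q.coeff k)

lemma SerP.mul {f g : ℂ → ℂ[X]} {P Q : (PowerSeries R)[X]} (hf : SerP R f P) (hg : SerP R g Q) :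
    SerP R (fun z => f z * g z) (P * Q) := by
  intro k
  simp only [Polynomial.coeff_mul]
  exact ser_sum _ _ _ (fun x _ => (hf x.1).mul (hg x.2))

lemma SerP.prod {ι : Type*} (s : Finset ι) (f : ι → ℂ → ℂ[X]) (P : ι → (PowerSeries R)[X]) (h : ∀ i, SerP R (f i) (P i)) :
    SerP R (fun z => ∏ i ∈ s, f i z) (∏ i ∈ s, P i) := by
  classical
  induction s using Finset.induction_on with
  | empty =>
    intro k
    simp only [Finset.prod_empty, Polynomial.coeff_one]
    split_ifs
    · exact ser_one
    · have := ser_C (R := R) 0; simpa using this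
  | insert i s hi ih =>
    simp only [Finset.prod_insert hi]
    exact (h i).mul ih

lemma ser_zero' : Ser R (fun _ => (0 : ℂ)) 0 := by
  have := ser_C (R := R) 0; simpa using this

lemma SerP.lin {f g : ℂ → ℂ} {p q : PowerSeries R} (hf : Ser R f p) (hg : Ser R g q) :
    SerP R (fun z => Polynomial.C (f z) * Polynomial.X - Polynomial.C (g z)) (Polynomial.C p * Polynomial.X - Polynomial.C q) := by
  intro k
  simp only [Polynomial.coeff_sub, Polynomial.coeff_C_mul, Polynomial.coeff_X, Polynomial.coeff_C]
  by_cases h1 : k = 1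
  · subst h1; simpa using hf
  by_cases h0 : k = 0
  · subst h0
    simpa using hg.neg
  · have h1' : ¬ (1 = k) := fun h => h1 h.symm
    simpa [h1', h0] using ser_zero'
end

section
variable {R : Type*} [CommRing R] [Algebra R ℂ] [FaithfulSMul R ℂ] {k : Type*} [Field k] (l : ℕ) [Fact l.Prime] [CharP k l]
  (π : R →+* k) (ζ : R) (hζ : algebraMap R ℂ ζ = Complex.exp (2 * Real.pi * Complex.I / l)) (hζ1 : π ζ = 1)

noncomputable abbrev dR (R : Type*) [CommRing R] : PowerSeries R := PowerSeries.map (Int.castRingHom R) dp0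
noncomputable abbrev dI (R : Type*) [CommRing R] : PowerSeries R := PowerSeries.map (Int.castRingHom R) (invOfUnit dp0 1)

lemma dR_dI (R : Type*) [CommRing R] : dR R * dI R = 1 := by
  rw [dR, dI, ← map_mul, dp0_inv, map_one]

noncomputable def df (z : ℂ) : ℂ := euler z ^ 24
lemma df_ne {z : ℂ} (hz : ‖z‖ < 1) : df z ≠ 0 := pow_ne_zero _ (euler_ne_zero hz)
omit [FaithfulSMul R ℂ] in
lemma ser_dR : Ser R df (dR R) := Ser.map _ (fun r => by simp) ser_df
omit [FaithfulSMul R ℂ] in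
lemma ser_dI : Ser R (fun z => (df z)⁻¹) (dI R) :=
  Ser.map _ (fun r => by simp) (Ser.inv ser_df (fun z hz => df_ne hz) dp0_inv)

lemma Del_df (τ : ℍ) : Del τ = qq τ * df (qq τ) := Del_eq τ

/-- q-expansions of the w's -/
noncomputable def wf (ζ : R) : Option (Fin l) → ℂ → ℂ
  | none => fun z => algebraMap R ℂ ((l : R) ^ 12) * z ^ (l * (l - 1)) * df (z ^ (l * l)) * (df (z ^ l))⁻¹
  | some b => fun z => algebraMap R ℂ (ζ ^ (b : ℕ)) * df (algebraMap R ℂ (ζ ^ (b : ℕ)) * z) * (df (z ^ l))⁻¹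

noncomputable def we : Option (Fin l) → ℕ
  | none => 0
  | some _ => l - 1

noncomputable def wp (ζ : R) : Option (Fin l) → PowerSeries R
  | none => PowerSeries.C ((l : R) ^ 12) * PowerSeries.X ^ (l * (l - 1)) *
      PowerSeries.expand (l * l) (mul_ne_zero (Fact.out : l.Prime).ne_zero (Fact.out : l.Prime).ne_zero) (dR R) *
      PowerSeries.expand l (Fact.out : l.Prime).ne_zero (dI R)
  | some b => PowerSeries.C (ζ ^ (b : ℕ)) * PowerSeries.rescale (ζ ^ (b : ℕ)) (dR R) *
      PowerSeries.expand l (Fact.out : l.Prime).ne_zero (dI R)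

omit [FaithfulSMul R ℂ] in
include hζ in
lemma ser_wf (i : Option (Fin l)) : Ser R (wf l ζ i) (wp l ζ i) := by
  have hl := (Fact.out : l.Prime)
  rcases i with _ | b
  · exact (((ser_C _).mul (ser_X.pow _)).mul (ser_dR.expand (l * l) (mul_ne_zero hl.ne_zero hl.ne_zero))).mul (ser_dI.expand l hl.ne_zero)
  · refine ((ser_C _).mul (ser_dR.rescale _ ?_)).mul (ser_dI.expand l hl.ne_zero)
    rw [map_pow, norm_pow, zeta_norm l ζ hζ, one_pow]

omit [FaithfulSMul R ℂ] in
include hζ in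
lemma wf_eq (i : Option (Fin l)) (τ : ℍ) : zz l τ ^ we l i * wM l (Mx l i) τ = wf l ζ i (zz l τ) := by
  have hl := (Fact.out : l.Prime)
  have hz := zz_ne_zero l τ
  have hlc : (l : ℂ) ≠ 0 := by exact_mod_cast hl.ne_zero
  have hd : df (zz l τ ^ l) ≠ 0 := by rw [zz_pow l hl.ne_zero]; exact df_ne (norm_qq_lt_one τ)
  obtain ⟨m, hm⟩ : ∃ m, l = m + 1 := ⟨l - 1, by have := hl.pos; omega⟩
  have hp : zz l τ ^ l = zz l τ ^ (l - 1) * zz l τ := by rw [← pow_succ]; congr 1; have := hl.pos; omega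
  have hp2 : zz l τ ^ (l * l) = zz l τ ^ (l * (l - 1)) * zz l τ ^ l := by
    rw [← pow_add]; congr 1; rw [Nat.mul_sub, mul_one]; have := Nat.le_mul_of_pos_left l hl.pos; omega
  rcases i with _ | b
  · simp only [we, wf, wM]
    have hau : au (Mx l none) τ = 1 := by simp [au, Mx]
    rw [Del_df, Del_df τ, qq_none, hau, ← zz_pow l hl.ne_zero τ]
    simp only [map_pow, map_natCast, pow_zero, one_mul, one_pow]
    have hq : zz l τ ^ (l * l) * df (zz l τ ^ (l * l)) = zz l τ ^ (l * (l - 1)) * zz l τ ^ l * df (zz l τ ^ (l * l)) := by rw [← hp2]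
    rw [hq]
    field_simp
  · simp only [we, wf, wM]
    have hau : au (Mx l (some b)) τ = l := by simp [au, Mx]
    rw [Del_df, Del_df τ, qq_some l ζ hζ, hau, ← zz_pow l hl.ne_zero τ]
    have hq : zz l τ ^ l * df (zz l τ ^ l) = zz l τ ^ (l - 1) * zz l τ * df (zz l τ ^ l) := by rw [← hp]
    rw [hq]
    field_simp

omit [Fact l.Prime] in
lemma we_sum : ∑ i, we l i = l * (l - 1) := by
  rw [Fintype.sum_option]; simp [we]

include hζ in
/-- product of all the w's -/
theorem heckeJ0 : ∃ N : ℕ, ∀ τ, ∏ i, wM l (Mx l i) τ = (l : ℂ) ^ 12 * algebraMap R ℂ ζ ^ N := by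
  have hl := (Fact.out : l.Prime)
  set N := ∑ b : Fin l, (b : ℕ)
  refine ⟨N, ?_⟩
  let f : ℂ → ℂ := fun z => algebraMap R ℂ ((l : R) ^ 12 * ζ ^ N) * (df (z ^ (l * l)) * (df (z ^ l))⁻¹ *
    ∏ b : Fin l, (df (algebraMap R ℂ (ζ ^ (b : ℕ)) * z) * (df (z ^ l))⁻¹))
  have hll := mul_ne_zero hl.ne_zero hl.ne_zero
  let p : PowerSeries R := PowerSeries.C ((l : R) ^ 12 * ζ ^ N) * (PowerSeries.expand (l * l) hll (dR R) *
    PowerSeries.expand l hl.ne_zero (dI R) * ∏ b : Fin l, (PowerSeries.rescale (ζ ^ (b : ℕ)) (dR R) * PowerSeries.expand l hl.ne_zero (dI R)))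
  have hs : Ser R f p := by
    refine (ser_C _).mul (((ser_dR.expand (l * l) hll).mul (ser_dI.expand l hl.ne_zero)).mul (ser_prod _ _ _ fun b _ => (ser_dR.rescale _ ?_).mul (ser_dI.expand l hl.ne_zero)))
    rw [map_pow, norm_pow, zeta_norm l ζ hζ, one_pow]
  have hF : (fun τ => ∏ i, wM l (Mx l i) τ) ∈ V1 := by
    have := V1.smul_mem (cpoly_mem l hl 0) ((-1 : ℂ) ^ (l + 1))
    convert this using 1
    funext τ
    simp only [Pi.smul_apply, smul_eq_mul, cpoly_zero]
    rw [← mul_assoc, ← mul_pow]; simp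
  have hFf : ∀ τ, zz l τ ^ (l * 0) * ∏ i, wM l (Mx l i) τ = f (zz l τ) := by
    intro τ
    have hz := zz_ne_zero l τ
    have h1 : zz l τ ^ (l * (l - 1)) * ∏ i, wM l (Mx l i) τ = ∏ i, wf l ζ i (zz l τ) := by
      rw [← we_sum, ← Finset.prod_pow_eq_pow_sum, ← Finset.prod_mul_distrib]
      exact Finset.prod_congr rfl fun i _ => wf_eq l ζ hζ i τ
    rw [mul_zero, pow_zero, one_mul]
    apply mul_left_cancel₀ (pow_ne_zero (l * (l - 1)) hz)
    rw [h1, Fintype.prod_option]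
    simp only [wf, f]
    have h2 : ∏ b : Fin l, (algebraMap R ℂ (ζ ^ (b : ℕ)) * df (algebraMap R ℂ (ζ ^ (b : ℕ)) * zz l τ) * (df (zz l τ ^ l))⁻¹) =
        algebraMap R ℂ (ζ ^ N) * ∏ b : Fin l, (df (algebraMap R ℂ (ζ ^ (b : ℕ)) * zz l τ) * (df (zz l τ ^ l))⁻¹) := by
      rw [map_pow, ← Finset.prod_pow_eq_pow_sum, ← Finset.prod_mul_distrib]
      refine Finset.prod_congr rfl fun b _ => ?_
      rw [map_pow, mul_assoc]
    rw [h2, map_mul]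
    ring
  obtain ⟨P, hP1, hP2, hP3⟩ := (haupt1.mapR (R := R)).poly l hl.ne_zero 0 _ hF f p hs hFf
  intro τ
  have h4 := hP2 τ
  rw [h4, Polynomial.eq_C_of_natDegree_le_zero hP1, Polynomial.aeval_C]
  have h5 := congrArg PowerSeries.constantCoeff hP3
  have cR : PowerSeries.constantCoeff (dR R) = 1 := by
    rw [← PowerSeries.coeff_zero_eq_constantCoeff_apply, PowerSeries.coeff_map, PowerSeries.coeff_zero_eq_constantCoeff_apply, dp0_const, map_one]
  have cI : PowerSeries.constantCoeff (dI R) = 1 := by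
    have := congrArg PowerSeries.constantCoeff (dR_dI R)
    rwa [map_mul, cR, one_mul, map_one] at this
  have cr : ∀ a : R, PowerSeries.constantCoeff (PowerSeries.rescale a (dR R)) = 1 := by
    intro a
    rw [← PowerSeries.coeff_zero_eq_constantCoeff_apply, PowerSeries.coeff_rescale, PowerSeries.coeff_zero_eq_constantCoeff_apply, cR]; simp
  simp only [p, map_mul, map_prod, PowerSeries.constantCoeff_C, PowerSeries.constantCoeff_expand, cR, cI, cr, homog] at h5
  simp at h5
  rw [← h5]
  simp

include hζ hζ1 in
theorem heckeJ (h5 : 5 < l) (n r s : ℕ) (hr : r ≤ 1) (hs : s ≤ 1) (hln : l = 12 * n + 4 * r + 6 * s + 1) :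
    ∃ c : ℕ → R[X], (∀ j τ, (cpoly l τ).coeff j = Polynomial.aeval (jj τ) (c j)) ∧
      (∀ j, j ≠ 1 → j ≠ l + 1 → (c j).map π = 0) ∧ (c 1).map π = - A12 k n r s := by
  have hl := (Fact.out : l.Prime)
  have hl0 := hl.ne_zero
  let Q : Option (Fin l) → (PowerSeries R)[X] := fun i => Polynomial.C (PowerSeries.X ^ (we l i)) * Polynomial.X - Polynomial.C (wp l ζ i)
  let f : Option (Fin l) → ℂ → ℂ[X] := fun i z => Polynomial.C (z ^ (we l i)) * Polynomial.X - Polynomial.C (wf l ζ i z)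
  have hfQ : ∀ i, SerP R (f i) (Q i) := fun i => SerP.lin (ser_X.pow _) (ser_wf l ζ hζ i)
  have hser := SerP.prod Finset.univ f Q hfQ
  have hcz : ∀ j τ, zz l τ ^ (l * (l - 1)) * (cpoly l τ).coeff j = (∏ i, f i (zz l τ)).coeff j := by
    intro j τ
    rw [← we_sum, ← Polynomial.coeff_C_mul]
    congr 1
    rw [cpoly, ← Finset.prod_pow_eq_pow_sum, map_prod, ← Finset.prod_mul_distrib]
    refine Finset.prod_congr rfl fun i _ => ?_
    simp only [f]
    rw [← wf_eq l ζ hζ, mul_sub, ← map_mul]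
  have hex : ∀ j, ∃ P : R[X], P.natDegree ≤ l - 1 ∧ (∀ τ, (cpoly l τ).coeff j = Polynomial.aeval (jj τ) P) ∧
      (∏ i, Q i).coeff j = PowerSeries.expand l hl0 (homog (l - 1) P (PowerSeries.map (Int.castRingHom R) jp)) := by
    intro j
    exact (haupt1.mapR (R := R)).poly l hl0 (l - 1) _ (cpoly_mem l hl j) _ _ (hser j) (hcz j)
  choose c hc1 hc2 hc3 using hex
  set jk : PowerSeries k := PowerSeries.map (Int.castRingHom k) jp with hjk
  have hjk1 : PowerSeries.constantCoeff jk = 1 := by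
    rw [hjk, ← PowerSeries.coeff_zero_eq_constantCoeff_apply, PowerSeries.coeff_map, PowerSeries.coeff_zero_eq_constantCoeff_apply, jp_const, map_one]
  -- reduction of the product
  have hred : (∏ i, Q i).map (PowerSeries.map π) =
      Polynomial.C (PowerSeries.X ^ (l * (l - 1))) * Polynomial.X ^ (l + 1) - Polynomial.C (PowerSeries.expand l hl0 (dI k ^ (l - 1))) * Polynomial.X ^ 1 := by
    have hlk : π (l : R) = 0 := by rw [map_natCast]; exact CharP.cast_eq_zero k l
    have hwn : PowerSeries.map π (wp l ζ none) = 0 := by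
      rw [wp, map_mul, map_mul, map_mul, PowerSeries.map_C, map_pow, hlk, zero_pow (by norm_num), map_zero, zero_mul, zero_mul, zero_mul]
    have hws : ∀ b, PowerSeries.map π (wp l ζ (some b)) = dI k ^ (l - 1) := by
      intro b
      have e : dI k ^ l = dI k * dI k ^ (l - 1) := by rw [← pow_succ']; congr 1; have := hl.pos; omega
      rw [wp, map_mul, map_mul, PowerSeries.map_C, map_pow, hζ1, one_pow, map_one, one_mul, rescale_map, map_pow, hζ1, one_pow, PowerSeries.rescale_one,
        RingHom.id_apply, PowerSeries.map_expand, map_map_int, map_map_int, expand_frob, e, ← mul_assoc, dR_dI, one_mul]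
    have h1 : (Q none).map (PowerSeries.map π) = Polynomial.X := by
      simp only [Q, we, Polynomial.map_sub, Polynomial.map_mul, Polynomial.map_C, Polynomial.map_X, hwn]
      simp
    have h2 : ∀ b, (Q (some b)).map (PowerSeries.map π) = Polynomial.C (PowerSeries.X ^ (l - 1)) * Polynomial.X - Polynomial.C (dI k ^ (l - 1)) := by
      intro b
      simp only [Q, we, Polynomial.map_sub, Polynomial.map_mul, Polynomial.map_C, Polynomial.map_X, hws]
      rw [map_pow (PowerSeries.map π), PowerSeries.map_X]
    have : CharP (PowerSeries k) l := charP_of_injective_algebraMap (algebraMap k (PowerSeries k)).injective l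
    have : CharP ((PowerSeries k)[X]) l := inferInstance
    rw [Polynomial.map_prod, Fintype.prod_option, h1, Finset.prod_congr rfl (fun b _ => h2 b), Finset.prod_const, Finset.card_univ, Fintype.card_fin,
      sub_pow_char, mul_pow, ← map_pow, ← map_pow, ← pow_mul, map_pow (PowerSeries.expand l hl0), expand_frob, mul_comm l (l - 1), ← pow_mul, ← pow_mul, mul_comm l (l-1)]
    ring
  have hcoef : ∀ j, PowerSeries.map π ((∏ i, Q i).coeff j) = PowerSeries.expand l hl0 (homog (l - 1) ((c j).map π) jk) := by
    intro j
    rw [hc3, PowerSeries.map_expand, homog_map, map_map_int]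
  have hcoef2 : ∀ j, PowerSeries.expand l hl0 (homog (l - 1) ((c j).map π) jk) = (Polynomial.C (PowerSeries.X ^ (l * (l - 1))) * Polynomial.X ^ (l + 1) - Polynomial.C (PowerSeries.expand l hl0 (dI k ^ (l - 1))) * Polynomial.X ^ 1 : (PowerSeries k)[X]).coeff j := by
    intro j
    rw [← hcoef, ← hred, Polynomial.coeff_map]
  refine ⟨c, hc2, ?_, ?_⟩
  · intro j hj1 hjl
    have h := hcoef2 j
    rw [Polynomial.coeff_sub, Polynomial.coeff_C_mul, Polynomial.coeff_C_mul, Polynomial.coeff_X_pow, Polynomial.coeff_X_pow, if_neg hjl, if_neg hj1] at h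
    have h' : homog (l - 1) ((c j).map π) jk = 0 := by
      apply expand_inj l hl0
      rw [h]; simp
    refine homog_eq_zero (l - 1) _ jk hjk1 (Polynomial.natDegree_map_le.trans (hc1 j)) ?_
    rw [h']; exact dvd_zero _
  · have h := hcoef2 1
    have hl1 : (1 : ℕ) ≠ l + 1 := by have := hl.pos; omega
    rw [Polynomial.coeff_sub, Polynomial.coeff_C_mul, Polynomial.coeff_C_mul, Polynomial.coeff_X_pow, Polynomial.coeff_X_pow, if_neg hl1, if_pos rfl] at h
    have h' : homog (l - 1) ((c 1).map π) jk = - dI k ^ (l - 1) := by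
      apply expand_inj l hl0
      rw [h, map_neg]; simp
    rw [← B_eq_A12 l hl h5 n r s hr hs hln (-(c 1).map π) (by rw [Polynomial.natDegree_neg]; exact Polynomial.natDegree_map_le.trans (hc1 1)), neg_neg]
    have hneg : homog (l - 1) (-(c 1).map π) jk = - homog (l - 1) ((c 1).map π) jk := by
      have := homog_sub (l - 1) 0 ((c 1).map π) jk
      rw [zero_sub] at this
      rw [this]
      simp [homog]
    rw [hneg, h', neg_neg, ← mul_pow, dR_dI, one_pow]

end
end HQ
end

section
namespace HQ
open PowerSeries Filter Topology UpperHalfPlane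
open scoped MatrixGroups ModularForm Manifold

lemma exists_valuation (l : ℕ) (hl : l.Prime) : ∃ A : ValuationSubring ℂ, (l : ℂ) ∈ A.nonunits := by
  let B : Subring ℂ := (Int.castRingHom ℂ).range
  let lB : B := ⟨(l : ℂ), ⟨(l : ℤ), by simp⟩⟩
  let I : Ideal B := Ideal.span {lB}
  have hI : I ≠ ⊤ := by
    intro h
    rw [Ideal.span_singleton_eq_top] at h
    obtain ⟨⟨y, ⟨m, hm⟩⟩, hy⟩ := h.exists_right_inv
    have h2 := congrArg Subtype.val hy
    simp [lB, ← hm] at h2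
    have h3 : (l : ℤ) * m = 1 := by exact_mod_cast h2
    have := Int.isUnit_iff.mp (IsUnit.of_mul_eq_one _ h3)
    have := hl.two_le
    omega
  obtain ⟨A, -, hA⟩ := Ideal.image_subset_nonunits_valuationSubring I hI
  exact ⟨A, hA ⟨lB, Ideal.subset_span rfl, rfl⟩⟩

variable (A : ValuationSubring ℂ)

lemma residue_zero_iff (x : A) : IsLocalRing.residue A x = 0 ↔ (x : ℂ) ∈ A.nonunits := by
  rw [IsLocalRing.residue_eq_zero_iff, ValuationSubring.mem_nonunits_iff_exists_mem_maximalIdeal]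
  exact ⟨fun h => ⟨x.2, h⟩, fun ⟨_, h⟩ => h⟩

lemma charP_residue (l : ℕ) (hl : l.Prime) (h : (l : ℂ) ∈ A.nonunits) : CharP (IsLocalRing.ResidueField A) l := by
  obtain ⟨p, hp⟩ := CharP.exists (IsLocalRing.ResidueField A)
  have h0 : ((l : ℕ) : IsLocalRing.ResidueField A) = 0 := by
    have : IsLocalRing.residue A (l : A) = 0 := (residue_zero_iff A _).mpr (by simpa using h)
    rwa [map_natCast] at this
  have h1 := (CharP.cast_eq_zero_iff (IsLocalRing.ResidueField A) p l).mp h0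
  rcases (Nat.dvd_prime hl).mp h1 with h2 | h2
  · subst h2
    have := CharP.cast_eq_zero (IsLocalRing.ResidueField A) 1
    rw [Nat.cast_one] at this
    exact absurd this one_ne_zero
  · rwa [← h2]

lemma mem_of_monic (p : A[X]) (hp : p.Monic) (z : ℂ) (hz : Polynomial.aeval z p = 0) : ∃ x : A, (x : ℂ) = z := by
  have hi : IsIntegral A z := ⟨p, hp, by rwa [← Polynomial.aeval_def]⟩
  obtain ⟨x, hx⟩ := IsIntegrallyClosed.isIntegral_iff.mp hi
  exact ⟨x, hx⟩

lemma residue_surj : Function.Surjective (IsLocalRing.residue A) := IsLocalRing.residue_surjective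

instance algClosed_residue : IsAlgClosed (IsLocalRing.ResidueField A) := by
  apply IsAlgClosed.of_exists_root
  intro p hp hirr
  have hlift : p ∈ Polynomial.lifts (IsLocalRing.residue A) :=
    Polynomial.mem_lifts _ |>.mpr (Polynomial.map_surjective _ (residue_surj A) p)
  obtain ⟨q, hq1, hq2, hq3⟩ := Polynomial.lifts_and_natDegree_eq_and_monic hlift hp
  have hdeg : (q.map (algebraMap A ℂ)).degree ≠ 0 := by
    rw [hq3.degree_map]
    have := hirr.natDegree_pos
    rw [← hq2] at this
    rw [Polynomial.degree_eq_natDegree hq3.ne_zero]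
    exact_mod_cast this.ne'
  obtain ⟨z, hz⟩ := IsAlgClosed.exists_root _ hdeg
  have hz' : Polynomial.aeval z q = 0 := by
    rw [Polynomial.aeval_def, ← Polynomial.eval_map]; exact hz
  obtain ⟨x, rfl⟩ := mem_of_monic A q hq3 z hz'
  refine ⟨IsLocalRing.residue A x, ?_⟩
  rw [← hq1, Polynomial.eval_map, Polynomial.eval₂_hom]
  have : Polynomial.aeval x q = 0 := by
    apply FaithfulSMul.algebraMap_injective A ℂ
    rw [map_zero, ← Polynomial.aeval_algebraMap_apply]; exact hz'
  rw [Polynomial.coe_aeval_eq_eval] at this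
  rw [this, map_zero]

lemma exists_zeta (l : ℕ) (hl : l.Prime) (h : (l : ℂ) ∈ A.nonunits) : ∃ ζ : A, algebraMap A ℂ ζ = Complex.exp (2 * Real.pi * Complex.I / l) ∧
    IsLocalRing.residue A ζ = 1 := by
  have hpr := (Complex.isPrimitiveRoot_exp l hl.ne_zero).pow_eq_one
  obtain ⟨ζ, hζ⟩ := mem_of_monic A (Polynomial.X ^ l - Polynomial.C 1) (Polynomial.monic_X_pow_sub_C _ hl.ne_zero) (Complex.exp (2 * Real.pi * Complex.I / l)) (by
    simp [hpr])
  refine ⟨ζ, hζ, ?_⟩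
  have := charP_residue A l hl h
  have : Fact l.Prime := ⟨hl⟩
  have h1 : ζ ^ l = 1 := by
    apply Subtype.ext
    push_cast
    rw [hζ, hpr]
  have h2 : (IsLocalRing.residue A ζ - 1) ^ l = 0 := by
    rw [sub_pow_char, ← map_pow, h1, map_one, one_pow, sub_self]
  exact sub_eq_zero.mp (pow_eq_zero_iff hl.ne_zero |>.mp h2)

end HQ
end

section
namespace HQ
open PowerSeries Filter Topology UpperHalfPlane
open scoped MatrixGroups ModularForm Manifold

section topo
variable {Q : Type*} [TopologicalSpace Q] (f : Q → ℂ)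

theorem topo_inj [T2Space Q] (hc : Continuous f) (ho : IsOpenMap f)
    (hp : ∀ c ≠ 0, ∃ V ∈ 𝓝 c, ∃ K : Set Q, IsCompact K ∧ f ⁻¹' V ⊆ K)
    (R : Set ℂ) (hR : R.Countable) (hR' : ∀ q, f q ∉ R → ∃ N ∈ 𝓝 q, Set.InjOn f N)
    (h0 : ∀ q, f q ≠ 0)
    (C : ℝ) (hC : ∀ q₁ q₂, C < ‖f q₁‖ → f q₁ = f q₂ → q₁ = q₂) : Function.Injective f := by
  set S : Set ℂ := {c | ∃ q₁ q₂, q₁ ≠ q₂ ∧ f q₁ = c ∧ f q₂ = c} with hS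
  have hSo : IsOpen S := by
    rw [isOpen_iff_mem_nhds]
    rintro c ⟨q₁, q₂, hne, h1, h2⟩
    obtain ⟨U, V, hU, hV, hqU, hqV, hd⟩ := t2_separation hne
    have a1 : f '' U ∈ 𝓝 c := (ho U hU).mem_nhds ⟨q₁, hqU, h1⟩
    have a2 : f '' V ∈ 𝓝 c := (ho V hV).mem_nhds ⟨q₂, hqV, h2⟩
    filter_upwards [a1, a2]
    rintro x ⟨u, hu, rfl⟩ ⟨v, hv, hvu⟩
    exact ⟨u, v, fun h => Set.disjoint_left.mp hd hu (h ▸ hv), rfl, hvu⟩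
  have hcount : (insert 0 R : Set ℂ).Countable := hR.insert 0
  set U : Set ℂ := (insert 0 R)ᶜ with hU
  have hUc : IsPreconnected U :=
    (hcount.isPathConnected_compl_of_one_lt_rank (by simp [Complex.rank_real_complex])).isConnected.isPreconnected
  have hUd : Dense U := hcount.dense_compl ℝ
  -- complement nbhd
  have hcl : ∀ c ∈ U, c ∉ S → ∃ V ∈ 𝓝 c, V ∩ S = ∅ := by
    intro c hcU hcS
    have hc0 : c ≠ 0 := fun h => hcU (by simp [h])
    have hcR : c ∉ R := fun h => hcU (by simp [h])
    obtain ⟨V, hV, K, hK, hVK⟩ := hp c hc0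
    by_cases hex : ∃ q, f q = c
    · obtain ⟨q, hq⟩ := hex
      obtain ⟨N, hN, hinj⟩ := hR' q (hq ▸ hcR)
      obtain ⟨N', hN', hN'o, hqN'⟩ := mem_nhds_iff.mp hN
      have hKN : IsCompact (K \ N') := hK.diff hN'o
      have hcl : IsClosed (f '' (K \ N')) := (hKN.image hc).isClosed
      have hcn : c ∉ f '' (K \ N') := by
        rintro ⟨x, hx, hxc⟩
        exact hcS ⟨x, q, fun h => hx.2 (h ▸ hqN'), hxc, hq⟩
      refine ⟨V ∩ (f '' (K \ N'))ᶜ, inter_mem hV (hcl.isOpen_compl.mem_nhds hcn), ?_⟩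
      rw [Set.eq_empty_iff_forall_notMem]
      rintro x ⟨⟨hxV, hxn⟩, q₁, q₂, hne, h1, h2⟩
      have key : ∀ p, f p = x → p ∈ N' := by
        intro p hpx
        by_contra hpN
        exact hxn ⟨p, ⟨hVK (by simpa [hpx] using hxV), hpN⟩, hpx⟩
      exact hne (hinj (hN' (key _ h1)) (hN' (key _ h2)) (h1.trans h2.symm))
    · have hcl : IsClosed (f '' K) := (hK.image hc).isClosed
      refine ⟨V ∩ (f '' K)ᶜ, inter_mem hV (hcl.isOpen_compl.mem_nhds ?_), ?_⟩
      · rintro ⟨x, -, hx⟩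
        exact hex ⟨x, hx⟩
      rw [Set.eq_empty_iff_forall_notMem]
      rintro x ⟨⟨hxV, hxn⟩, q₁, q₂, hne, h1, h2⟩
      exact hxn ⟨q₁, hVK (by simpa [h1] using hxV), h1⟩
  have hUS : U ∩ S = ∅ := by
    by_contra hne
    have hne : (U ∩ S).Nonempty := Set.nonempty_iff_ne_empty.mpr hne
    -- other open set
    set O : Set ℂ := interior Sᶜ with hO
    have hcover : U ⊆ S ∪ O := by
      intro c hcU
      by_cases hcS : c ∈ S
      · exact Or.inl hcS
      · right
        obtain ⟨V, hV, hVS⟩ := hcl c hcU hcS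
        rw [hO, mem_interior_iff_mem_nhds]
        filter_upwards [hV] with x hx hxS
        have : x ∈ V ∩ S := ⟨hx, hxS⟩
        rw [hVS] at this
        exact this
    have hUO : (U ∩ O).Nonempty := by
      have hopen : IsOpen {c : ℂ | C < ‖c‖} := isOpen_lt continuous_const continuous_norm
      obtain ⟨c, hc1, hc2⟩ := hUd.inter_open_nonempty _ hopen
        ⟨((|C| + 1 : ℝ) : ℂ), by
          simp only [Set.mem_ofPred_eq, Complex.norm_real, Real.norm_eq_abs]
          rw [abs_of_pos (by positivity)]
          linarith [le_abs_self C]⟩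
      refine ⟨c, hc2, ?_⟩
      rw [hO, mem_interior_iff_mem_nhds]
      filter_upwards [hopen.mem_nhds hc1]
      rintro x hx ⟨q₁, q₂, hne, h1, h2⟩
      exact hne (hC _ _ (by rw [h1]; exact hx) (h1.trans h2.symm))
    obtain ⟨x, hxU, hxS, hxO⟩ := hUc S O hSo isOpen_interior hcover hne hUO
    exact interior_subset hxO hxS
  intro q₁ q₂ h
  by_contra hne
  obtain ⟨c, hc1, hc2⟩ := hUd.inter_open_nonempty S hSo ⟨f q₁, q₁, q₂, hne, rfl, h.symm⟩
  have : c ∈ U ∩ S := ⟨hc2, hc1⟩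
  rw [hUS] at this
  exact this

theorem topo_surj [Nonempty Q] (hc : Continuous f) (ho : IsOpenMap f)
    (hp : ∀ c ≠ 0, ∃ V ∈ 𝓝 c, ∃ K : Set Q, IsCompact K ∧ f ⁻¹' V ⊆ K)
    (h0 : ∀ q, f q ≠ 0) (c : ℂ) (hc0 : c ≠ 0) : ∃ q, f q = c := by
  have hpre : IsPreconnected ({0}ᶜ : Set ℂ) :=
    (isPathConnected_compl_singleton_of_one_lt_rank (by simp [Complex.rank_real_complex]) 0).isConnected.isPreconnected
  by_contra hno
  push Not at hno
  have hcover : ({0}ᶜ : Set ℂ) ⊆ Set.range f ∪ interior (Set.range f)ᶜ := by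
    intro x hx
    by_cases hxr : x ∈ Set.range f
    · exact Or.inl hxr
    right
    obtain ⟨V, hV, K, hK, hVK⟩ := hp x hx
    rw [mem_interior_iff_mem_nhds]
    have hcl : IsClosed (f '' K) := (hK.image hc).isClosed
    have : (f '' K)ᶜ ∈ 𝓝 x := hcl.isOpen_compl.mem_nhds (by
      rintro ⟨y, -, hy⟩
      exact hxr ⟨y, hy⟩)
    filter_upwards [hV, this]
    rintro y hyV hyK ⟨q, hq⟩
    exact hyK ⟨q, hVK (by simpa [hq] using hyV), hq⟩
  obtain ⟨q⟩ := ‹Nonempty Q›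
  have hin : c ∈ interior (Set.range f)ᶜ := by
    rcases hcover (show c ∈ ({0}ᶜ : Set ℂ) from hc0) with h | h
    · obtain ⟨q, hq⟩ := h
      exact absurd hq (hno q)
    · exact h
  obtain ⟨x, -, hx1, hx2⟩ := hpre (Set.range f) _ ho.isOpen_range isOpen_interior hcover
    ⟨f q, h0 q, q, rfl⟩ ⟨c, hc0, hin⟩
  exact interior_subset hx2 hx1
end topo

end HQ
end

section
namespace HQ
open PowerSeries Filter Topology UpperHalfPlane
open scoped MatrixGroups ModularForm Manifold

lemma locinj {f : ℂ → ℂ} {z : ℂ} (hf : AnalyticAt ℂ f z) (h : deriv f z ≠ 0) :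
    ∃ N ∈ 𝓝 z, Set.InjOn f N := by
  have hs : HasStrictDerivAt f (deriv f z) z := hf.hasStrictDerivAt
  have hs' := hs.hasStrictFDerivAt_equiv h
  have := hs'.eventually_left_inverse
  refine ⟨_, this, ?_⟩
  intro x hx y hy hxy
  simp only [Set.mem_ofPred_eq] at hx hy
  rw [← hx, ← hy, hxy]

noncomputable abbrev TT : ℂ → ℂ := tt ∘ ofComplex
abbrev UU : Set ℂ := {z : ℂ | 0 < z.im}
lemma UU_open : IsOpen UU := isOpen_lt continuous_const Complex.continuous_im
lemma UU_pre : IsPreconnected UU := (convex_halfSpace_im_gt 0).isPreconnected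

lemma TT_coe (τ : ℍ) : TT τ = tt τ := by simp [TT]

lemma Hol.analyticOnNhd {F : ℍ → ℂ} (hF : Hol F) : AnalyticOnNhd ℂ (F ∘ ofComplex) UU := by
  refine DifferentiableOn.analyticOnNhd ?_ UU_open
  intro z hz
  exact (hF ⟨z, hz⟩).differentiableWithinAt

lemma TT_an : AnalyticOnNhd ℂ TT UU := hol_tt.analyticOnNhd

lemma inv_small (ε : ℝ) (hε : 0 < ε) : ∃ Y : ℝ, ∀ w : ℍ, Y < w.im → ‖(tt w)⁻¹‖ < ε := by
  have h1 : ContinuousAt (fun z : ℂ => z * (tf z)⁻¹) 0 := continuousAt_id.mul tf_inv.continuousAt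
  have h2 : Tendsto (fun w : ℍ => (tt w)⁻¹) atImInfty (𝓝 0) := by
    have := h1.tendsto.comp (tendsto_zz 1 one_ne_zero)
    rw [zero_mul] at this
    refine this.congr fun w => ?_
    simp only [Function.comp_apply, zz_one]
    rw [tt_eq, mul_inv, inv_inv]
  have h3 := (Metric.tendsto_nhds.mp h2) ε hε
  rw [Filter.Eventually, atImInfty_mem] at h3
  obtain ⟨A, hA⟩ := h3
  refine ⟨A, fun w hw => ?_⟩
  simpa [dist_eq_norm] using hA w hw.le

lemma inv_bdd : ∃ B : ℝ, ∀ w : ℍ, 1 / 10 ≤ w.im → ‖(tt w)⁻¹‖ ≤ B := by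
  have hc : ContinuousOn (fun z : ℂ => z * (tf z)⁻¹) (Metric.closedBall 0 (Real.exp (-2 * Real.pi * (1/10)))) := by
    refine ContinuousOn.mono (s := Metric.ball 0 1) (continuousOn_id.mul tf_inv.differentiableOn.continuousOn) ?_
    intro z hz
    simp only [Metric.mem_closedBall, Metric.mem_ball, dist_zero_right] at *
    refine lt_of_le_of_lt hz ?_
    rw [Real.exp_lt_one_iff]
    have := Real.pi_pos
    linarith
  obtain ⟨B, hB⟩ := (isCompact_closedBall _ _).exists_bound_of_continuousOn hc
  refine ⟨B, fun w hw => ?_⟩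
  rw [tt_eq, mul_inv, inv_inv]
  refine hB _ ?_
  rw [Metric.mem_closedBall, dist_zero_right, norm_qq]
  rw [Real.exp_le_exp]
  have := Real.pi_pos
  nlinarith

lemma im_five' (w : ℍ) : (mob 1 0 0 5 w).im = w.im / 5 := by
  rw [mob_im' (by norm_num)]
  norm_num [Complex.normSq]
  ring

lemma tt_inv_injOn : ∃ Y : ℝ, ∀ w₁ w₂ : ℍ, Y < w₁.im → Y < w₂.im → tt w₁ = tt w₂ → qq w₁ = qq w₂ := by
  have hd : AnalyticAt ℂ (fun z : ℂ => z * (tf z)⁻¹) 0 := by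
    refine DifferentiableOn.analyticAt (s := Metric.ball 0 1) (differentiableOn_id.mul tf_inv.differentiableOn) (Metric.ball_mem_nhds _ one_pos)
  have hd1 : DifferentiableAt ℂ (fun z : ℂ => (tf z)⁻¹) 0 := 
    (tf_inv.differentiableOn).differentiableAt (Metric.ball_mem_nhds _ one_pos)
  have hder : deriv (fun z : ℂ => z * (tf z)⁻¹) 0 = (tf 0)⁻¹ := by
    have := (hasDerivAt_id (0:ℂ)).mul hd1.hasDerivAt
    have h2 := this.deriv
    simp only [id, zero_mul, add_zero, one_mul] at h2
    exact h2
  have h0 : (tf 0)⁻¹ ≠ 0 := inv_ne_zero (tf_ne_zero (by simp))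
  obtain ⟨N, hN, hinj⟩ := locinj hd (by rw [hder]; exact h0)
  have h3 := (tendsto_zz 1 one_ne_zero) hN
  rw [Filter.mem_map, atImInfty_mem] at h3
  obtain ⟨A, hA⟩ := h3
  refine ⟨A, fun w₁ w₂ h₁ h₂ h => ?_⟩
  have m1 := hA w₁ h₁.le
  have m2 := hA w₂ h₂.le
  simp only [Set.mem_preimage, zz_one] at m1 m2
  refine hinj m1 m2 ?_
  have e : ∀ w, qq w * (tf (qq w))⁻¹ = (tt w)⁻¹ := fun w => by rw [tt_eq, mul_inv, inv_inv]
  simp only [e, h]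

lemma qq_inj {w₁ w₂ : ℍ} (h : qq w₁ = qq w₂) : ∃ n : ℤ, w₁ = mob 1 n 0 1 w₂ := by
  rw [qq, qq, Complex.exp_eq_exp_iff_exists_int] at h
  obtain ⟨n, hn⟩ := h
  refine ⟨n, ?_⟩
  ext1
  rw [coe_mob (by norm_num)]
  have h2 : (2 * Real.pi * Complex.I : ℂ) ≠ 0 := by simp [Real.pi_ne_zero]
  have : (w₁ : ℂ) = w₂ + n := by
    apply mul_left_cancel₀ h2
    linear_combination hn
  rw [this]
  push_cast
  ring

lemma cover (τ : ℍ) : ∃ δ ∈ CongruenceSubgroup.Gamma0 5, ∃ w ∈ ModularGroup.fd,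
    (δ • τ = w ∨ ∃ j : ℤ, 0 ≤ j ∧ j < 5 ∧ δ • τ = ModularGroup.S • ModularGroup.T ^ j • w) := by
  obtain ⟨g, hg⟩ := ModularGroup.exists_smul_mem_fd τ
  rcases exists_coset g⁻¹ with h | ⟨j, h0, h5, δ, hδ, h⟩
  · exact ⟨g, by simpa using inv_mem h, _, hg, Or.inl rfl⟩
  · refine ⟨δ⁻¹, inv_mem hδ, _, hg, Or.inr ⟨j, h0, h5, ?_⟩⟩
    have : g = (ModularGroup.S * ModularGroup.T ^ j)⁻¹ * δ⁻¹ := by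
      rw [← mul_inv_rev, ← h, inv_inv]
    rw [this, ← mul_smul, ← mul_smul]
    simp [mul_assoc]

lemma fd_im {w : ℍ} (hw : w ∈ ModularGroup.fd) : 1 / 2 ≤ w.im := by
  have := ModularGroup.three_le_four_mul_im_sq_of_mem_fd hw
  have := w.im_pos
  nlinarith

lemma T_im (j : ℤ) (w : ℍ) : (ModularGroup.T ^ j • w).im = w.im := by
  rw [UpperHalfPlane.modular_T_zpow_smul]
  simp

lemma norm_tt_S (w : ℍ) : ‖tt (ModularGroup.S • w)‖ = 125 * ‖(tt (mob 1 0 0 5 w))⁻¹‖ := by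
  rw [tt_S, norm_mul]; norm_num

lemma large : ∃ C : ℝ, ∀ τ₁ τ₂ : ℍ, C < ‖tt τ₁‖ → tt τ₁ = tt τ₂ → ∃ δ ∈ CongruenceSubgroup.Gamma0 5, δ • τ₁ = τ₂ := by
  obtain ⟨Y, hY⟩ := tt_inv_injOn
  obtain ⟨B, hB⟩ := inv_bdd
  obtain ⟨B', hB'⟩ := (ModularGroup.isCompact_truncatedFundamentalDomain Y).exists_bound_of_continuousOn
    hol_tt.continuous.continuousOn
  have key : ∀ τ, max (125 * B) B' < ‖tt τ‖ → ∃ δ ∈ CongruenceSubgroup.Gamma0 5, Y < (δ • τ).im := by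
    intro τ hτ
    obtain ⟨δ, hδ, w, hw, h | ⟨j, -, -, h⟩⟩ := cover τ
    · refine ⟨δ, hδ, ?_⟩
      rw [h]
      by_contra hc
      have := hB' w ⟨hw, not_lt.mp hc⟩
      rw [← h, tt_smul _ hδ] at this
      exact absurd (lt_of_le_of_lt (le_max_right _ _) hτ) (not_lt.mpr this)
    · exfalso
      have h1 := tt_smul _ hδ τ
      rw [h] at h1
      rw [← h1, norm_tt_S] at hτ
      have := hB (mob 1 0 0 5 (ModularGroup.T ^ j • w)) (by
        rw [im_five', T_im]; linarith [fd_im hw])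
      have h2 := lt_of_le_of_lt (le_max_left _ _) hτ
      linarith
  refine ⟨max (125 * B) B', fun τ₁ τ₂ h h12 => ?_⟩
  obtain ⟨δ₁, hδ₁, h1⟩ := key τ₁ h
  obtain ⟨δ₂, hδ₂, h2⟩ := key τ₂ (h12 ▸ h)
  obtain ⟨n, hn⟩ := qq_inj (hY _ _ h1 h2 (by rw [tt_smul _ hδ₁, tt_smul _ hδ₂, h12]))
  rw [← show (mkSL 1 n 0 1 (by norm_num)) • (δ₂ • τ₂) = mob 1 n 0 1 (δ₂ • τ₂) from mkSL_smul _ _ _ _ _ _, ← mul_smul] at hn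
  refine ⟨(mkSL 1 n 0 1 (by norm_num) * δ₂)⁻¹ * δ₁, mul_mem (inv_mem (mul_mem ?_ hδ₂)) hδ₁, ?_⟩
  · rw [CongruenceSubgroup.Gamma0_mem]
    simp [mkSL]
  · rw [mul_smul, hn, inv_smul_smul]

end HQ
end

section
namespace HQ
open PowerSeries Filter Topology UpperHalfPlane
open scoped MatrixGroups ModularForm Manifold

abbrev GG : Subgroup (GL (Fin 2) ℝ) := (CongruenceSubgroup.Gamma0 5).map (Matrix.SpecialLinearGroup.mapGL ℝ)
abbrev QQuot := MulAction.orbitRel.Quotient GG ℍ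

lemma orb_iff (a b : ℍ) : (MulAction.orbitRel GG ℍ) a b ↔ ∃ γ ∈ CongruenceSubgroup.Gamma0 5, γ • b = a := by
  rw [MulAction.orbitRel_apply, MulAction.mem_orbit_iff]
  constructor
  · rintro ⟨⟨g, γ, hγ, rfl⟩, h⟩
    exact ⟨γ, hγ, h⟩
  · rintro ⟨γ, hγ, h⟩
    exact ⟨⟨_, γ, hγ, rfl⟩, h⟩

noncomputable def tbar : QQuot → ℂ := Quotient.lift tt (by
  intro a b h
  obtain ⟨γ, hγ, rfl⟩ := (orb_iff a b).mp h
  exact tt_smul γ hγ b)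

noncomputable def qmk (τ : ℍ) : QQuot := Quotient.mk _ τ
lemma tbar_mk (τ : ℍ) : tbar (qmk τ) = tt τ := rfl
lemma qmk_eq (a b : ℍ) : qmk a = qmk b ↔ ∃ γ ∈ CongruenceSubgroup.Gamma0 5, γ • b = a := by
  rw [← orb_iff]
  exact Quotient.eq (r := MulAction.orbitRel GG ℍ)

lemma qmk_cont : Continuous qmk := continuous_quotient_mk'
lemma qmk_open : IsOpenMap qmk := isOpenMap_quotient_mk'_mul
lemma qmk_surj (q : QQuot) : ∃ τ, qmk τ = q := Quotient.exists_rep q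
lemma tbar_cont : Continuous tbar := Continuous.quotient_lift hol_tt.continuous _

lemma TT_not_const (w : ℂ) : ¬ ∀ z ∈ UU, TT z = w := by
  intro h
  have hw : ∀ τ : ℍ, tt τ = w := fun τ => by rw [← TT_coe]; exact h _ τ.im_pos
  have h0 : w ≠ 0 := by rw [← hw I]; exact tt_ne_zero I
  obtain ⟨Y, hY⟩ := inv_small (‖w⁻¹‖) (by simpa using h0)
  have := hY ⟨⟨0, |Y| + 1⟩, by positivity⟩ (by 
    show Y < |Y| + 1
    linarith [le_abs_self Y])
  rw [hw] at this
  exact lt_irrefl _ this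

lemma tt_open : IsOpenMap tt := by
  intro s hs
  rcases TT_an.is_constant_or_isOpen UU_pre with ⟨w, h⟩ | h
  · exact absurd h (TT_not_const w)
  · have := h ((↑) '' s : Set ℂ) (by rintro _ ⟨τ, -, rfl⟩; exact τ.im_pos)
      (UpperHalfPlane.isOpenEmbedding_coe.isOpenMap s hs)
    rw [Set.image_image] at this
    simpa [TT] using this

lemma tbar_open : IsOpenMap tbar := by
  intro s hs
  have : tbar '' s = tt '' (qmk ⁻¹' s) := by
    ext x
    constructor
    · rintro ⟨q, hq, rfl⟩
      obtain ⟨τ, rfl⟩ := qmk_surj q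
      exact ⟨τ, hq, rfl⟩
    · rintro ⟨τ, hτ, rfl⟩
      exact ⟨_, hτ, rfl⟩
  rw [this]
  exact tt_open _ (hs.preimage qmk_cont)

lemma sl_cont (γ : SL(2, ℤ)) : Continuous (fun w : ℍ => γ • w) :=
  continuous_const_smul (Matrix.SpecialLinearGroup.mapGL ℝ γ)

lemma tbar_proper (c : ℂ) (hc : c ≠ 0) : ∃ V ∈ 𝓝 c, ∃ K : Set QQuot, IsCompact K ∧ tbar ⁻¹' V ⊆ K := by
  have hc' : 0 < ‖c‖ := norm_pos_iff.mpr hc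
  obtain ⟨Y1, hY1⟩ := inv_small ((2 * ‖c‖)⁻¹) (by positivity)
  obtain ⟨Y2, hY2⟩ := inv_small (‖c‖ / 250) (by positivity)
  set Y := max Y1 (5 * Y2) with hY
  set D := ModularGroup.truncatedFundamentalDomain Y with hD
  have hDc : IsCompact D := ModularGroup.isCompact_truncatedFundamentalDomain Y
  refine ⟨{x | ‖c‖ / 2 < ‖x‖ ∧ ‖x‖ < 2 * ‖c‖}, ?_, 
    qmk '' D ∪ ⋃ j ∈ Finset.Ico (0:ℤ) 5, qmk '' ((fun w => ModularGroup.S • ModularGroup.T ^ j • w) '' D), ?_, ?_⟩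
  · refine IsOpen.mem_nhds ?_ ⟨by linarith, by linarith⟩
    exact (isOpen_lt continuous_const continuous_norm).inter (isOpen_lt continuous_norm continuous_const)
  · refine (hDc.image qmk_cont).union ((Finset.Ico (0:ℤ) 5).isCompact_biUnion fun j _ => (hDc.image ?_).image qmk_cont)
    exact (sl_cont _).comp (sl_cont _)
  · intro q hq
    obtain ⟨τ, rfl⟩ := qmk_surj q
    obtain ⟨h1, h2⟩ : ‖c‖ / 2 < ‖tt τ‖ ∧ ‖tt τ‖ < 2 * ‖c‖ := hq
    obtain ⟨δ, hδ, w, hw, h | ⟨j, j0, j5, h⟩⟩ := cover τ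
    · left
      refine ⟨w, ⟨hw, ?_⟩, (qmk_eq _ _).mpr ⟨δ, hδ, h⟩⟩
      by_contra hlt
      have := hY1 w (lt_of_le_of_lt (le_max_left _ _) (not_le.mp hlt))
      rw [← h, tt_smul _ hδ, norm_inv] at this
      have h0 : 0 < ‖tt τ‖ := norm_pos_iff.mpr (tt_ne_zero τ)
      rw [inv_lt_inv₀ h0 (by positivity)] at this
      linarith
    · right
      simp only [Set.mem_iUnion]
      refine ⟨j, by simp [j0, j5], _, ⟨w, ⟨hw, ?_⟩, rfl⟩, (qmk_eq _ _).mpr ⟨δ, hδ, h⟩⟩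
      by_contra hlt
      have h3 : 5 * Y2 < w.im := lt_of_le_of_lt (le_max_right _ _) (not_le.mp hlt)
      have := hY2 (mob 1 0 0 5 (ModularGroup.T ^ j • w)) (by rw [im_five', T_im]; linarith)
      have e := norm_tt_S (ModularGroup.T ^ j • w)
      rw [← h, tt_smul _ hδ] at e
      linarith

def Rcrit : Set ℂ := TT '' {z | z ∈ UU ∧ deriv TT z = 0}

lemma Rcrit_count : Rcrit.Countable := by
  refine Set.Countable.image ?_ _
  set Z := {z | z ∈ UU ∧ deriv TT z = 0} with hZ
  have han : AnalyticOnNhd ℂ (deriv TT) UU := TT_an.deriv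
  have key : ∀ z ∈ Z, ∃ N ∈ 𝓝 z, N ∩ Z ⊆ {z} := by
    intro z hz
    have hnf : ¬ ∃ᶠ x in 𝓝[≠] z, deriv TT x = 0 := by
      intro hf
      have h0 := han.eqOn_zero_of_preconnected_of_frequently_eq_zero UU_pre hz.1 hf
      refine TT_not_const (TT z) fun x hx => ?_
      exact UU_open.is_const_of_deriv_eq_zero UU_pre 
        (fun y hy => (TT_an y hy).differentiableAt.differentiableWithinAt) h0 hx hz.1
    rw [Filter.not_frequently, eventually_nhdsWithin_iff] at hnf
    refine ⟨_, hnf, ?_⟩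
    rintro x ⟨hx, hxZ⟩
    by_contra hne
    exact hx hne hxZ.2
  choose! N hN hNZ using key
  obtain ⟨t, hts, htc, ht⟩ := TopologicalSpace.countable_cover_nhdsWithin (f := N) (s := Z)
    (fun x hx => mem_nhdsWithin_of_mem_nhds (hN x hx))
  refine Set.Countable.mono (s₂ := t) ?_ htc
  intro x hx
  obtain ⟨y, hy, hxy⟩ := Set.mem_iUnion₂.mp (ht hx)
  by_cases hyZ : y ∈ Z
  · have := hNZ y hyZ ⟨hxy, hx⟩
    rw [Set.mem_singleton_iff] at this
    rwa [this]
  · exact absurd (hts hy) hyZ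

lemma tbar_loc (q : QQuot) (h : tbar q ∉ Rcrit) : ∃ N ∈ 𝓝 q, Set.InjOn tbar N := by
  obtain ⟨τ, rfl⟩ := qmk_surj q
  have hd : deriv TT τ ≠ 0 := fun h0 => h ⟨τ, ⟨τ.im_pos, h0⟩, TT_coe τ⟩
  obtain ⟨N, hN, hinj⟩ := locinj (TT_an τ τ.im_pos) hd
  refine ⟨qmk '' (UpperHalfPlane.coe ⁻¹' N), qmk_open.image_mem_nhds (UpperHalfPlane.continuous_coe.continuousAt hN), ?_⟩
  rintro _ ⟨a, ha, rfl⟩ _ ⟨b, hb, rfl⟩ hab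
  have : (a : ℂ) = b := hinj ha hb (by rw [TT_coe, TT_coe]; exact hab)
  rw [UpperHalfPlane.ext this]

theorem tt_inj {τ₁ τ₂ : ℍ} (h : tt τ₁ = tt τ₂) : ∃ γ ∈ CongruenceSubgroup.Gamma0 5, γ • τ₁ = τ₂ := by
  obtain ⟨C, hC⟩ := large
  have := topo_inj tbar tbar_cont tbar_open tbar_proper Rcrit Rcrit_count tbar_loc
    (fun q => by obtain ⟨τ, rfl⟩ := qmk_surj q; exact tt_ne_zero τ) C (by
      intro q₁ q₂ h1 h2
      obtain ⟨τ₁, rfl⟩ := qmk_surj q₁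
      obtain ⟨τ₂, rfl⟩ := qmk_surj q₂
      exact ((qmk_eq _ _).mpr (hC τ₁ τ₂ h1 h2)).symm)
  exact (qmk_eq _ _).mp (this (show tbar (qmk τ₂) = tbar (qmk τ₁) from h.symm))

theorem tt_surj (c : ℂ) (hc : c ≠ 0) : ∃ τ, tt τ = c := by
  have : Nonempty QQuot := ⟨qmk I⟩
  obtain ⟨q, hq⟩ := topo_surj tbar tbar_cont tbar_open tbar_proper 
    (fun q => by obtain ⟨τ, rfl⟩ := qmk_surj q; exact tt_ne_zero τ) c hc
  obtain ⟨τ, rfl⟩ := qmk_surj q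
  exact ⟨τ, hq⟩

end HQ
end

section
namespace HQ
open PowerSeries Filter Topology UpperHalfPlane
open scoped MatrixGroups ModularForm Manifold

lemma deriv_ne_of_injOn {f : ℂ → ℂ} {z : ℂ} (hf : AnalyticAt ℂ f z) {N : Set ℂ} (hN : N ∈ 𝓝 z)
    (hinj : Set.InjOn f N) : deriv f z ≠ 0 := by
  intro hd
  set F : ℂ → ℂ := fun x => f x - f z with hF
  have hFa : AnalyticAt ℂ F z := hf.sub analyticAt_const
  have htop : analyticOrderAt F z ≠ ⊤ := by
    rw [Ne, analyticOrderAt_eq_top]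
    intro h
    have h1 : ∀ᶠ x in 𝓝 z, x = z := by
      filter_upwards [h, hN] with x hx hxN
      exact hinj hxN (mem_of_mem_nhds hN) (sub_eq_zero.mp hx)
    have h2 : ∀ᶠ x in 𝓝[≠] z, x = z := h1.filter_mono nhdsWithin_le_nhds
    have h3 : ∀ᶠ x in 𝓝[≠] z, x ≠ z := self_mem_nhdsWithin
    obtain ⟨x, hx1, hx2⟩ := (h2.and h3).exists
    exact hx2 hx1
  obtain ⟨g, hg, hg0, hgF⟩ := hFa.analyticOrderAt_ne_top.mp htop
  set n := analyticOrderNatAt F z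
  have hFz : F z = 0 := by simp [hF]
  have hgF' := hgF.self_of_nhds
  have hn0 : n ≠ 0 := by
    intro h
    rw [h, hFz] at hgF'
    simp at hgF'
    exact hg0 hgF'.symm
  have hn1 : n ≠ 1 := by
    intro h
    have e : F =ᶠ[𝓝 z] fun x => (x - z) * g x := by
      filter_upwards [hgF] with x hx
      rw [hx, h]; simp
    have hder : deriv F z = g z := by
      rw [e.deriv_eq]
      have := ((hasDerivAt_id z).sub_const z).mul hg.differentiableAt.hasDerivAt
      have h2 := this.deriv
      simp only [id, sub_self, zero_mul, add_zero, one_mul] at h2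
      exact h2
    have : deriv F z = 0 := by
      rw [hF, deriv_sub_const, hd]
    exact hg0 (by rw [← hder, this])
  set u : ℂ → ℂ := fun x => Complex.exp (Complex.log (g x / g z) / n) with hu
  have hua : AnalyticAt ℂ u z := by
    refine AnalyticAt.cexp ?_
    refine AnalyticAt.div ?_ analyticAt_const (by simpa using hn0)
    refine AnalyticAt.clog (hg.div analyticAt_const hg0) ?_
    rw [div_self hg0]
    exact Complex.one_mem_slitPlane
  have huz : u z = 1 := by simp [hu, div_self hg0]
  set h : ℂ → ℂ := fun x => (x - z) * u x with hh
  have hha : AnalyticAt ℂ h z := (analyticAt_id.sub analyticAt_const).mul hua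
  have hhd : deriv h z = 1 := by
    have := ((hasDerivAt_id z).sub_const z).mul hua.differentiableAt.hasDerivAt
    have h2 := this.deriv
    simp only [id, sub_self, zero_mul, add_zero, one_mul, huz] at h2
    exact h2
  have hmap := hha.hasStrictDerivAt.map_nhds_eq (by rw [hhd]; exact one_ne_zero)
  have hhz : h z = 0 := by simp [hh]
  have hpow : ∀ᶠ x in 𝓝 z, F x = g z * h x ^ n := by
    filter_upwards [hgF, hg.continuousAt.eventually_ne hg0] with x hx hgx
    rw [hx, hh]
    simp only [smul_eq_mul, mul_pow, hu]
    rw [← Complex.exp_nat_mul, mul_div_cancel₀ _ (by exact_mod_cast hn0), Complex.exp_log (div_ne_zero hgx hg0)]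
    field_simp
  set N' := N ∩ {x | F x = g z * h x ^ n}
  have hN' : N' ∈ 𝓝 z := inter_mem hN hpow
  have him : h '' N' ∈ 𝓝 (0:ℂ) := by
    rw [← hhz, ← hmap]
    exact image_mem_map hN'
  obtain ⟨r, hr, hball⟩ := Metric.mem_nhds_iff.mp him
  have hprim := Complex.isPrimitiveRoot_exp n hn0
  set ζ := Complex.exp (2 * Real.pi * Complex.I / n)
  have hζn : ζ ^ n = 1 := hprim.pow_eq_one
  have hζ1 : ζ ≠ 1 := hprim.ne_one (by omega)
  have hζnorm : ‖ζ‖ = 1 := Complex.norm_eq_one_of_pow_eq_one hζn hn0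
  set w : ℂ := ((r / 2 : ℝ) : ℂ)
  have hw0 : w ≠ 0 := by simp [w, hr.ne']
  have hwn : ‖w‖ < r := by
    simp only [w, Complex.norm_real, Real.norm_eq_abs]
    rw [abs_of_pos (by linarith)]; linarith
  obtain ⟨x, hx, hxw⟩ := hball (show w ∈ Metric.ball 0 r by simpa using hwn)
  obtain ⟨y, hy, hyw⟩ := hball (show ζ * w ∈ Metric.ball 0 r by
    rw [Metric.mem_ball, dist_zero_right, norm_mul, hζnorm, one_mul]; exact hwn)
  have hFxy : F x = F y := by
    rw [hx.2, hy.2, hxw, hyw, mul_pow, hζn, one_mul]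
  have hxy : x = y := hinj hx.1 hy.1 (by simpa [hF] using hFxy)
  rw [hxy, hyw] at hxw
  exact hζ1 (mul_right_cancel₀ hw0 (by rw [hxw, one_mul]))

theorem tt_deriv_ne (τ : ℍ) (h : ∀ γ ∈ CongruenceSubgroup.Gamma0 5, γ • τ = τ → ∀ w : ℍ, γ • w = w) :
    deriv TT τ ≠ 0 := by
  obtain ⟨U, hU, hdis⟩ := ProperlyDiscontinuousSMul.exists_nhds_disjoint_image GG τ
  have hU' : UpperHalfPlane.coe '' U ∈ 𝓝 (τ : ℂ) := UpperHalfPlane.isOpenEmbedding_coe.image_mem_nhds.mpr hU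
  refine deriv_ne_of_injOn (TT_an τ τ.im_pos) hU' ?_
  rintro _ ⟨a, ha, rfl⟩ _ ⟨b, hb, rfl⟩ hab
  have hab : TT (a:ℂ) = TT (b:ℂ) := hab
  rw [TT_coe, TT_coe] at hab
  obtain ⟨γ, hγ, rfl⟩ := tt_inj hab
  by_cases hfix : γ • τ = τ
  · rw [h γ hγ hfix]
  · have := hdis ⟨Matrix.SpecialLinearGroup.mapGL ℝ γ, γ, hγ, rfl⟩ hfix
    exact absurd hb (Set.disjoint_left.mp this ⟨a, ha, rfl⟩)

end HQ
end

section
namespace HQ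
open PowerSeries Filter Topology UpperHalfPlane
open scoped MatrixGroups ModularForm Manifold

structure CM (l : ℕ) (τ : ℍ) (a b c d : ℤ) : Prop where
  det : 5 * a * d - b * c = l
  fix : 5 * (c : ℂ) * (τ : ℂ) ^ 2 + 5 * ((d : ℂ) - a) * τ - b = 0

def M0 (a b c d : ℤ) : M2 := !![-c, -d; 5 * a, b]

lemma M0_det {l : ℕ} {τ : ℍ} {a b c d : ℤ} (h : CM l τ a b c d) : (M0 a b c d).det = l := by
  rw [M0, Matrix.det_fin_two_of, ← h.det]; ring

lemma mobM_M0 {l : ℕ} (hl : 0 < l) {τ : ℍ} {a b c d : ℤ} (h : CM l τ a b c d) :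
    mobM (M0 a b c d) τ = mob 0 (-1) 5 0 τ := by
  have hdet : 0 < (-c) * b - (-d) * (5 * a) := by
    have := h.det
    have h2 : (0:ℤ) < l := by exact_mod_cast hl
    linarith
  ext1
  have hne := lin_ne_zero hdet τ
  rw [mobM, show mob (M0 a b c d 0 0) (M0 a b c d 0 1) (M0 a b c d 1 0) (M0 a b c d 1 1) τ = mob (-c) (-d) (5*a) b τ from rfl,
    coe_mob hdet, coe_mob (by norm_num)]
  have h0 : (τ : ℂ) ≠ 0 := τ.ne_zero
  have hf := h.fix
  push_cast at hne ⊢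
  generalize (τ : ℂ) = z at *
  rw [div_eq_div_iff hne (by simpa using h0)]
  linear_combination -hf

lemma fac_zero_iff (l : ℕ) (hl : l.Prime) (i : Option (Fin l)) (τ : ℍ) :
    125 - tt τ * tt (mobM (Mx l i) τ) = 0 ↔
      ∃ a b c d, ∃ γ : M2, CM l τ a b c d ∧ γ.det = 1 ∧ 5 ∣ γ 1 0 ∧ M0 a b c d = γ * Mx l i := by
  have hlpos : (0:ℤ) < l := by exact_mod_cast hl.pos
  have hMx : 0 < (Mx l i).det := by rw [Mx_det]; exact hlpos
  have hW := tt_W τ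
  have ht := tt_ne_zero τ
  constructor
  · intro h
    have h1 : tt (mobM (Mx l i) τ) = tt (mob 0 (-1) 5 0 τ) := by
      apply mul_left_cancel₀ ht
      linear_combination -hW - h
    obtain ⟨γ, hγ, hγτ⟩ := tt_inj h1
    have hd1 : γ.1.det = 1 := γ.2
    have hd5 : 5 ∣ γ.1 1 0 := by
      rw [CongruenceSubgroup.Gamma0_mem] at hγ
      exact (ZMod.intCast_zmod_eq_zero_iff_dvd _ 5).mp hγ
    rw [sl_mobM, mobM_mul (by rw [hd1]; exact one_pos) hMx] at hγτ
    set P : M2 := γ.1 * Mx l i with hP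
    have hPdet : P.det = l := by rw [hP, Matrix.det_mul, hd1, Mx_det, one_mul]
    have hP5 : 5 ∣ P 1 0 := by
      rw [hP, Matrix.mul_apply, Fin.sum_univ_two, Mx_lower, mul_zero, add_zero]
      exact hd5.mul_right _
    obtain ⟨r, hr⟩ := hP5
    rw [Matrix.det_fin_two] at hPdet
    refine ⟨r, P 1 1, - P 0 0, -P 0 1, γ.1, ⟨?_, ?_⟩, hd1, hd5, ?_⟩
    · rw [← hPdet, hr]; ring
    · have h2 := congrArg UpperHalfPlane.coe hγτ
      have hdet : 0 < P 0 0 * P 1 1 - P 0 1 * P 1 0 := by rw [hPdet]; exact hlpos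
      have hne := lin_ne_zero hdet τ
      rw [mobM, coe_mob hdet, coe_mob (by norm_num)] at h2
      have h0 : (τ : ℂ) ≠ 0 := τ.ne_zero
      rw [hr] at h2 hne
      push_cast at h2 hne ⊢
      generalize (τ : ℂ) = z at *
      rw [div_eq_div_iff hne (by simpa using h0)] at h2
      linear_combination -h2
    · rw [← hP]
      ext i j
      fin_cases i <;> fin_cases j <;> simp [M0, hr]
  · rintro ⟨a, b, c, d, γ, h, h1, h5, hM⟩
    have := mobM_M0 hl.pos h
    rw [hM, ← mobM_mul (by rw [h1]; exact one_pos) hMx] at this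
    have h2 := congrArg tt this
    rw [tt_mobM h1 h5] at h2
    rw [h2]
    linear_combination -hW

lemma hG_zero_iff (l : ℕ) (hl : l.Prime) (h5 : 5 < l) (τ : ℍ) :
    hG l τ = 0 ↔ ∃ a b c d, CM l τ a b c d := by
  rw [hG, Finset.prod_eq_zero_iff]
  constructor
  · rintro ⟨i, -, hi⟩
    obtain ⟨a, b, c, d, -, h, -⟩ := (fac_zero_iff l hl i τ).mp hi
    exact ⟨a, b, c, d, h⟩
  · rintro ⟨a, b, c, d, h⟩
    obtain ⟨i, γ, h1, h5, hM⟩ := exists_Mx l hl 5 (cop5 hl h5) (M0 a b c d) (M0_det h) (by simp [M0])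
    exact ⟨i, Finset.mem_univ _, (fac_zero_iff l hl i τ).mpr ⟨a, b, c, d, γ, h, h1, h5, hM⟩⟩

/-- the multiplier -/
lemma CM.alpha {l : ℕ} {τ : ℍ} {a b c d : ℤ} (h : CM l τ a b c d) :
    (5 * c * τ + 5 * d : ℂ) ^ 2 - 5 * (a + d) * (5 * c * τ + 5 * d) + 5 * l = 0 := by
  have hd : (5 * a * d - b * c : ℂ) = l := by exact_mod_cast congrArg (Int.cast : ℤ → ℂ) h.det
  rw [← hd]
  linear_combination 5 * (c:ℂ) * h.fix

lemma CM.adj {l : ℕ} {τ : ℍ} {a b c d : ℤ} (h : CM l τ a b c d) : CM l τ d (-b) (-c) a := by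
  refine ⟨?_, ?_⟩
  · rw [← h.det]; ring
  · push_cast
    linear_combination -h.fix

lemma CM.wM_eq {l : ℕ} (hl : l.Prime) {τ : ℍ} {a b c d : ℤ} (h : CM l τ a b c d) :
    ∃ i, wM l (Mx l i) (mob 5 0 0 1 τ) = (l / (5 * c * τ + 5 * d) : ℂ) ^ 12 * tt τ ^ 4 := by
  have hlpos : (0:ℤ) < l := by exact_mod_cast hl.pos
  set M : M2 := !![a, b; c, 5 * d] with hM
  have hdet : M.det = l := by rw [hM, Matrix.det_fin_two_of, ← h.det]; ring
  obtain ⟨i, γ, h1, -, hMγ⟩ := exists_Mx l hl 1 isCoprime_one_left M hdet (one_dvd _)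
  have hMx : 0 < (Mx l i).det := by rw [Mx_det]; exact hlpos
  refine ⟨i, ?_⟩
  have h2 := wM_left l h1 hMx (mob 5 0 0 1 τ)
  rw [← h2, ← hMγ, wM, tt_pow_four]
  have h5τ : ((mob 5 0 0 1 τ : ℍ) : ℂ) = 5 * τ := by rw [coe_mob (by norm_num)]; simp
  have hau : au M (mob 5 0 0 1 τ) = 5 * c * τ + 5 * d := by
    rw [au, h5τ]; simp [hM]; ring
  have hmob : mobM M (mob 5 0 0 1 τ) = τ := by
    have e : mobM M (mob 5 0 0 1 τ) = mob a b c (5 * d) (mob 5 0 0 1 τ) := rfl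
    have hd1 : 0 < a * (5 * d) - b * c := by linarith [h.det]
    rw [e, mob_mob hd1 (by norm_num)]
    refine ext_mob ?_ τ ?_
    · nlinarith
    · push_cast
      linear_combination h.fix
  rw [hau, hmob, div_pow]
  rw [div_mul_div_comm]

lemma CM.disc {l : ℕ} (hl : l.Prime) (h5 : 5 < l) {τ : ℍ} {a b c d : ℤ} (h : CM l τ a b c d) :
    5 * (a + d) ^ 2 < 4 * l := by
  have him := congrArg Complex.im h.fix
  have hre := congrArg Complex.re h.fix
  have hpos := τ.im_pos
  simp [pow_two] at him hre
  set x := τ.re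
  set y := τ.im
  have him' : y * (10 * c * x + 5 * (d - a)) = 0 := by linarith
  have h1 : 10 * c * x + 5 * ((d:ℝ) - a) = 0 := by
    rcases mul_eq_zero.mp him' with h | h
    · exact absurd h hpos.ne'
    · exact h
  have hc : c ≠ 0 := by
    rintro rfl
    simp at h1 hre
    have hda : d = a := by
      have : (d:ℝ) = a := by linarith
      exact_mod_cast this
    have hdet := h.det
    rw [hda] at hdet
    have : (5:ℤ) ∣ l := ⟨a * a, by linarith⟩
    have h5' : 5 ∣ l := by exact_mod_cast this
    rcases (Nat.dvd_prime hl).mp h5' with h | h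
    · omega
    · omega
  have hdetR : (5 * a * d - b * c : ℝ) = l := by exact_mod_cast congrArg (Int.cast : ℤ → ℝ) h.det
  have hc2 : (0:ℝ) < c ^ 2 := by positivity
  have key : (5 * ((a:ℝ) + d) ^ 2) * 5 = 4 * l * 5 - 100 * c ^ 2 * y ^ 2 := by
    have e : (b : ℝ) = 5 * c * (x ^ 2 - y ^ 2) + 5 * (d - a) * x := by linarith
    have e2 : 5 * ((d:ℝ) - a) = - 10 * c * x := by linarith
    rw [← hdetR, e]
    have e3 : (25:ℝ) * (d - a) ^ 2 = 100 * c ^ 2 * x ^ 2 := by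
      have : (5 * ((d:ℝ) - a)) ^ 2 = (- 10 * c * x) ^ 2 := by rw [e2]
      linarith
    have e4 : (5 * ((d:ℝ) - a)) * (c * x) = - 10 * c * x * (c * x) := by rw [e2]
    linarith
  have : (5 * ((a:ℝ) + d) ^ 2) < 4 * l := by
    have : 0 < 100 * (c:ℝ) ^ 2 * y ^ 2 := by positivity
    linarith
  exact_mod_cast this

end HQ
end

section
namespace HQ
open PowerSeries Filter Topology UpperHalfPlane
open scoped MatrixGroups ModularForm Manifold

/-- supersingularity in terms of the level five parameter -/
def ss {k : Type*} [Field k] (n r s : ℕ) (x : k) : Prop :=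
  (A12 k n r s).eval ((x ^ 2 + 10 * x + 5) ^ 3 / x) = 0

section
variable (A : ValuationSubring ℂ) (l : ℕ) [Fact l.Prime]

lemma hecke_w (hA : (l : ℂ) ∈ A.nonunits) (h5 : 5 < l) (n r s : ℕ) (hr : r ≤ 1) (hs : s ≤ 1)
    (hln : l = 12 * n + 4 * r + 6 * s + 1) (τ : ℍ) (t : A) (ht : (t : ℂ) = tt τ) (htu : (IsLocalRing.residue A) t ≠ 0) :
    ∃ C : ℕ → A, C (l + 1) = 1 ∧ (∃ u : A, C 0 = u * (l : A) ^ 12) ∧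
      ((IsLocalRing.residue A) (C 1) = 0 ↔ ss n r s ((IsLocalRing.residue A) t)) ∧ (∀ k, k ≠ 1 → k ≠ l + 1 → (IsLocalRing.residue A) (C k) = 0) ∧
      ∀ i, ∑ k ∈ Finset.range (l + 2), (C k : ℂ) * wM l (Mx l i) (mob 5 0 0 1 τ) ^ k = 0 := by
  have hl : l.Prime := Fact.out
  have : CharP (IsLocalRing.ResidueField A) l := charP_residue A l hl hA
  obtain ⟨ζ, hζ, hζ1⟩ := exists_zeta A l hl hA
  obtain ⟨c, hc, hc0, hc1⟩ := heckeJ l (IsLocalRing.residue A) ζ hζ hζ1 h5 n r s hr hs hln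
  obtain ⟨N, hN⟩ := heckeJ0 l ζ hζ
  have htunit : IsUnit t := (IsLocalRing.residue_ne_zero_iff_isUnit t).mp htu
  obtain ⟨v, rfl⟩ := htunit
  set J : A := ((v : A) ^ 2 + 10 * v + 5) ^ 3 * (v⁻¹ : Aˣ) with hJ
  have hJC : (J : ℂ) = jj (mob 5 0 0 1 τ) := by
    have h1 := tj_eq τ
    rw [← ht] at h1
    have hv : ((v : A) : ℂ) * ((v⁻¹ : Aˣ) : A) = 1 := by
      exact congrArg (Subtype.val) (v.mul_inv)
    have : (J : ℂ) = (((v : A) : ℂ) ^ 2 + 10 * ((v:A):ℂ) + 5) ^ 3 * (((v⁻¹ : Aˣ) : A) : ℂ) := by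
      rw [hJ]; push_cast; rfl
    rw [this, ← h1]
    linear_combination jj (mob 5 0 0 1 τ) * hv
  have hJp : (IsLocalRing.residue A) J = (((IsLocalRing.residue A) v) ^ 2 + 10 * (IsLocalRing.residue A) v + 5) ^ 3 / (IsLocalRing.residue A) v := by
    rw [hJ, map_mul, map_pow, map_add, map_add, map_mul, map_pow, map_ofNat, map_ofNat, div_eq_mul_inv]
    congr 1
    refine eq_inv_of_mul_eq_one_left ?_
    rw [← map_mul, Units.inv_mul, map_one]
  have hev : ∀ j, (((c j).eval J : A) : ℂ) = (cpoly l (mob 5 0 0 1 τ)).coeff j := by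
    intro j
    rw [hc, ← hJC]
    have := (Polynomial.aeval_algebraMap_apply ℂ J (c j))
    rw [show ((J : A) : ℂ) = algebraMap A ℂ J from rfl, this]
    rfl
  have hpe : ∀ j, (IsLocalRing.residue A) ((c j).eval J) = ((c j).map (IsLocalRing.residue A)).eval ((IsLocalRing.residue A) J) := by
    intro j
    rw [Polynomial.eval_map, Polynomial.eval₂_at_apply]
  refine ⟨fun j => (c j).eval J, ?_, ⟨(-1) ^ (l + 1) * ζ ^ N, ?_⟩, ?_, ?_, ?_⟩
  · apply Subtype.ext
    rw [hev, cpoly_top]; rfl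
  · apply Subtype.ext
    rw [hev, cpoly_zero, hN]
    push_cast
    rw [show algebraMap A ℂ ζ = (ζ : ℂ) from rfl]
    ring
  · simp only [hpe, hc1]
    rw [Polynomial.eval_neg, neg_eq_zero, hJp, ss]
  · intro k h1 h2
    simp only [hpe, hc0 k h1 h2, Polynomial.eval_zero]
  · intro i
    simp only [hev]
    exact cpoly_eval l _ i

lemma sum_split {R : Type*} [CommRing R] (l : ℕ) (C : ℕ → R) (w : R) :
    ∃ y, ∑ k ∈ Finset.range (l + 2), C k * w ^ k = C 0 + w * C 1 + w * (w * y) := by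
  refine ⟨∑ k ∈ Finset.range l, C (k + 2) * w ^ k, ?_⟩
  rw [Finset.sum_range_succ', Finset.sum_range_succ']
  simp only [Finset.mul_sum]
  have : ∀ k, C (k + 1 + 1) * w ^ (k + 1 + 1) = w * (w * (C (k + 2) * w ^ k)) := fun k => by ring
  simp only [this]
  ring

lemma isUnit_five (hA : (l : ℂ) ∈ A.nonunits) (h5 : 5 < l) : (IsLocalRing.residue A) (5 : A) ≠ 0 := by
  have hl : l.Prime := Fact.out
  have : CharP (IsLocalRing.ResidueField A) l := charP_residue A l hl hA
  rw [map_ofNat]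
  intro h
  have : ((5 : ℕ) : (IsLocalRing.ResidueField A)) = 0 := by exact_mod_cast h
  rw [CharP.cast_eq_zero_iff (IsLocalRing.ResidueField A) l] at this
  exact absurd (Nat.le_of_dvd (by norm_num) this) (by omega)

lemma pp_l (hA : (l : ℂ) ∈ A.nonunits) : (IsLocalRing.residue A) (l : A) = 0 := by
  have : CharP (IsLocalRing.ResidueField A) l := charP_residue A l Fact.out hA
  rw [map_natCast, CharP.cast_eq_zero]

theorem ss_of_trace_zero (hA : (l : ℂ) ∈ A.nonunits) (h5 : 5 < l) (n r s : ℕ) (hr : r ≤ 1) (hs : s ≤ 1)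
    (hln : l = 12 * n + 4 * r + 6 * s + 1) (τ : ℍ) (t : A) (ht : (t : ℂ) = tt τ) (htu : (IsLocalRing.residue A) t ≠ 0)
    {a b c : ℤ} (h : CM l τ a b c (-a)) : ss n r s ((IsLocalRing.residue A) t) := by
  have hl : l.Prime := Fact.out
  obtain ⟨C, -, ⟨u, hu⟩, hss, -, hC⟩ := hecke_w A l hA h5 n r s hr hs hln τ t ht htu
  rw [← hss]
  obtain ⟨i, hi⟩ := h.wM_eq hl
  obtain ⟨f, hf⟩ := (IsLocalRing.residue_ne_zero_iff_isUnit _).mp (isUnit_five A l hA h5)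
  obtain ⟨v, hv⟩ := (IsLocalRing.residue_ne_zero_iff_isUnit _).mp htu
  have hal := h.alpha
  have hl0 : (l : ℂ) ≠ 0 := by exact_mod_cast hl.ne_zero
  have hfC : (((f⁻¹ : Aˣ) : A) : ℂ) = 5⁻¹ := by
    have h1 : (((f⁻¹ : Aˣ) : A) : ℂ) * ((f : A) : ℂ) = 1 := by
      exact congrArg (Subtype.val) (f.inv_mul)
    rw [hf] at h1
    exact eq_inv_of_mul_eq_one_left h1
  set w : A := (l : A) ^ 6 * ((f⁻¹ : Aˣ) : A) ^ 6 * t ^ 4 with hw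
  have hwC : wM l (Mx l i) (mob 5 0 0 1 τ) = w := by
    rw [hi, ← ht]
    have e : (w : ℂ) = (l : ℂ) ^ 6 * (5⁻¹) ^ 6 * (t:ℂ) ^ 4 := by
      rw [hw]; push_cast; rw [hfC]
    rw [e]
    congr 1
    have e2 : (5 * c * τ + 5 * ((-a : ℤ) : ℂ) : ℂ) ^ 2 = - 5 * l := by
      push_cast at hal ⊢
      linear_combination hal
    rw [div_pow, show (5 * c * τ + 5 * ((-a : ℤ) : ℂ) : ℂ) ^ 12 = ((5 * c * τ + 5 * ((-a : ℤ) : ℂ) : ℂ) ^ 2) ^ 6 by ring, e2]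
    field_simp
  have hsum : ∑ k ∈ Finset.range (l + 2), C k * w ^ k = 0 := by
    apply Subtype.ext
    have := hC i
    rw [hwC] at this
    push_cast
    exact this
  obtain ⟨y, hy⟩ := sum_split l C w
  rw [hy] at hsum
  have hw0 : w ≠ 0 := by
    intro h0
    have : (w : ℂ) = 0 := by rw [h0]; rfl
    rw [hw] at this
    push_cast at this
    rw [hfC, ht] at this
    have h1 := tt_ne_zero τ
    simp [hl0, h1] at this
  have hC0 : C 0 = w * ((l : A) ^ 6 * (u * (5 : A) ^ 6 * ((v⁻¹ : Aˣ) : A) ^ 4)) := by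
    rw [hu, hw, ← hf, ← hv]
    have e1 := f.inv_mul
    have e2 := v.mul_inv
    calc u * (l : A) ^ 12 = u * (l:A) ^ 12 * (((f⁻¹ : Aˣ) : A) * f) ^ 6 * ((v : A) * ((v⁻¹ : Aˣ) : A)) ^ 4 := by
          rw [e1, e2]; ring
      _ = _ := by ring
  have h2 : w * ((l : A) ^ 6 * (u * (5 : A) ^ 6 * ((v⁻¹ : Aˣ) : A) ^ 4) + C 1 + w * y) = 0 := by
    rw [← hsum, hC0]; ring
  have h3 := (mul_eq_zero.mp h2).resolve_left hw0
  have h4 := congrArg ((IsLocalRing.residue A)) h3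
  have hpl := pp_l A l hA
  have hpw : (IsLocalRing.residue A) w = 0 := by rw [hw]; simp [hpl]
  simpa [hpl, hpw] using h4

theorem not_ss_of_trace (hA : (l : ℂ) ∈ A.nonunits) (h5 : 5 < l) (n r s : ℕ) (hr : r ≤ 1) (hs : s ≤ 1)
    (hln : l = 12 * n + 4 * r + 6 * s + 1) (τ : ℍ) (t : A) (ht : (t : ℂ) = tt τ) (htu : (IsLocalRing.residue A) t ≠ 0)
    {a b c d : ℤ} (h : CM l τ a b c d) (had : a + d ≠ 0) : ¬ ss n r s ((IsLocalRing.residue A) t) := by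
  have hl : l.Prime := Fact.out
  have : CharP (IsLocalRing.ResidueField A) l := charP_residue A l hl hA
  obtain ⟨C, hC1, -, hss, hC0, hC⟩ := hecke_w A l hA h5 n r s hr hs hln τ t ht htu
  rw [← hss]
  intro hCone
  obtain ⟨f, hf⟩ := (IsLocalRing.residue_ne_zero_iff_isUnit _).mp (isUnit_five A l hA h5)
  have hfC : (((f⁻¹ : Aˣ) : A) : ℂ) = 5⁻¹ := by
    have h1 : (((f⁻¹ : Aˣ) : A) : ℂ) * ((f : A) : ℂ) = 1 := by
      exact congrArg (Subtype.val) (f.inv_mul)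
    rw [hf] at h1
    exact eq_inv_of_mul_eq_one_left h1
  have hl0 : (l : ℂ) ≠ 0 := by exact_mod_cast hl.ne_zero
  -- every relevant beta reduces to zero
  have key : ∀ {a b c d : ℤ} (h : CM l τ a b c d) (β : A), (β : ℂ) = l / (5 * c * τ + 5 * d) → (IsLocalRing.residue A) β = 0 := by
    intro a b c d h β hβ
    obtain ⟨i, hi⟩ := h.wM_eq hl
    rw [← hβ, ← ht] at hi
    have hwC : wM l (Mx l i) (mob 5 0 0 1 τ) = ((β ^ 12 * t ^ 4 : A) : ℂ) := by rw [hi]; push_cast; rfl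
    have hsum : ∑ k ∈ Finset.range (l + 2), C k * (β ^ 12 * t ^ 4) ^ k = 0 := by
      apply Subtype.ext
      have := hC i
      rw [hwC] at this
      push_cast at this ⊢
      exact this
    have h4 := congrArg ((IsLocalRing.residue A)) hsum
    rw [map_sum, Finset.sum_range_succ, Finset.sum_eq_zero, zero_add, hC1, one_mul, map_zero, map_pow, map_mul] at h4
    · have h5 := pow_eq_zero_iff (by omega) |>.mp h4
      rcases mul_eq_zero.mp h5 with h6 | h6
      · rw [map_pow] at h6
        exact pow_eq_zero_iff (by norm_num) |>.mp h6
      · rw [map_pow] at h6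
        exact absurd (pow_eq_zero_iff (by norm_num) |>.mp h6) htu
    · intro k hk
      rw [Finset.mem_range] at hk
      rw [map_mul]
      by_cases hk1 : k = 1
      · rw [hk1, hCone, zero_mul]
      · rw [hC0 k hk1 (by omega), zero_mul]
  set α : ℂ := 5 * c * τ + 5 * d with hα
  have hal := h.alpha
  rw [← hα] at hal
  have hα0 : α ≠ 0 := by
    intro h0
    rw [h0] at hal
    simp [hl0] at hal
  set β : ℂ := l / α with hβ
  have hβeq : β ^ 2 - (a + d) * β + l * 5⁻¹ = 0 := by
    rw [hβ]
    field_simp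
    linear_combination (l:ℂ) * hal
  obtain ⟨B, hB⟩ : ∃ x : A, (x : ℂ) = β := by
    refine mem_of_monic A (Polynomial.X ^ 2 - Polynomial.C ((a + d : ℤ) : A) * Polynomial.X + Polynomial.C ((l : A) * ((f⁻¹ : Aˣ) : A))) ?_ β ?_
    · monicity!
    · simp only [map_add, map_sub, map_pow, map_mul, Polynomial.aeval_X, Polynomial.aeval_C]
      rw [show algebraMap A ℂ ((f⁻¹ : Aˣ) : A) = (((f⁻¹ : Aˣ) : A) : ℂ) from rfl, hfC]
      rw [map_natCast, map_intCast, ← hβeq]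
      push_cast
      ring
  have hB1 := key h B (by rw [hB, hβ, hα])
  have hB2 := key h.adj (((a + d : ℤ) : A) - B) (by
    push_cast
    rw [hB]
    have e : (5 * (-(c:ℂ)) * τ + 5 * a : ℂ) = 5 * β := by
      rw [hβ, mul_div_assoc', eq_div_iff hα0]
      rw [hα] at hal ⊢
      linear_combination -hal
    rw [e]
    have hβ0 : β ≠ 0 := div_ne_zero hl0 hα0
    rw [eq_div_iff (mul_ne_zero (by norm_num) hβ0)]
    linear_combination (-5 : ℂ) * hβeq)
  rw [map_sub, hB1, sub_zero, map_intCast, CharP.intCast_eq_zero_iff (IsLocalRing.ResidueField A) l] at hB2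
  have hdisc := h.disc hl h5
  obtain ⟨m, hm⟩ := hB2
  have hm0 : m ≠ 0 := by rintro rfl; simp at hm; exact had hm
  rw [hm] at hdisc
  have hm2 : 1 ≤ m ^ 2 := by have := sq_nonneg m; have : m ^ 2 ≠ 0 := pow_ne_zero 2 hm0; omega
  have hl5 : (5:ℤ) < l := by exact_mod_cast h5
  nlinarith [mul_le_mul_of_nonneg_left hm2 (sq_nonneg (l:ℤ))]

end

end HQ
end

section
namespace HQ
open PowerSeries Filter Topology UpperHalfPlane
open scoped MatrixGroups ModularForm Manifold

lemma CM.c_ne {l : ℕ} (hl : l.Prime) {τ : ℍ} {a b c : ℤ} (h : CM l τ a b c (-a)) : c ≠ 0 := by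
  rintro rfl
  have := h.det
  have h2 : (0:ℤ) < l := by exact_mod_cast hl.pos
  nlinarith [sq_nonneg a]

lemma CM.uniq0 {l : ℕ} (hl : l.Prime) {τ : ℍ} {a b c a' b' c' : ℤ} (h : CM l τ a b c (-a))
    (h' : CM l τ a' b' c' (-a')) : ∃ ε : ℤ, ε * ε = 1 ∧ a' = ε * a ∧ b' = ε * b ∧ c' = ε * c := by
  have hc := h.c_ne hl
  have hl0 : (l : ℤ) ≠ 0 := by exact_mod_cast hl.ne_zero
  have e : (-10 * (a * c' - a' * c) : ℂ) * τ - (b * c' - b' * c) = 0 := by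
    have h1 := h.fix
    have h2 := h'.fix
    push_cast at h1 h2
    linear_combination (c' : ℂ) * h1 - (c : ℂ) * h2
  have him := congrArg Complex.im e
  simp at him
  have hac : a * c' = a' * c := by
    have h1 : ((a:ℝ) * c' - a' * c) = 0 := him.resolve_right τ.im_pos.ne'
    have h2 : (a * c' : ℝ) = a' * c := by linarith
    exact_mod_cast h2
  have hbc : b * c' = b' * c := by
    have h0 : (a * c' : ℂ) = a' * c := by exact_mod_cast congrArg (Int.cast : ℤ → ℂ) hac
    have h2 : (b * c' : ℂ) = b' * c := by linear_combination -e - 10 * (τ:ℂ) * h0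
    exact_mod_cast h2
  have hd := h.det
  have hd' := h'.det
  have hcc : c' * c' = c * c := by
    have : (l : ℤ) * (c' * c') = l * (c * c) := by
      calc (l : ℤ) * (c' * c') = (5 * a * (-a) - b * c) * (c' * c') := by rw [hd]
        _ = -5 * (a * c') * (a * c') - (b * c') * (c' * c) := by ring
        _ = -5 * (a' * c) * (a' * c) - (b' * c) * (c' * c) := by rw [hac, hbc]
        _ = (5 * a' * (-a') - b' * c') * (c * c) := by ring
        _ = _ := by rw [hd']
    exact mul_left_cancel₀ hl0 this
  rcases mul_self_eq_mul_self_iff.mp hcc with h1 | h1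
  · refine ⟨1, by norm_num, ?_, ?_, by rw [h1]; ring⟩
    · rw [h1] at hac; rw [one_mul]; exact (mul_right_cancel₀ hc hac).symm
    · rw [h1] at hbc; rw [one_mul]; exact (mul_right_cancel₀ hc hbc).symm
  · refine ⟨-1, by norm_num, ?_, ?_, by rw [h1]; ring⟩
    · rw [h1] at hac; apply mul_right_cancel₀ hc; rw [← hac]; ring
    · rw [h1] at hbc; apply mul_right_cancel₀ hc; rw [← hbc]; ring

section
variable (A : ValuationSubring ℂ) (l : ℕ) [Fact l.Prime]

lemma heckeT_split (hA : (l : ℂ) ∈ A.nonunits) (h5 : 5 < l) :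
    ∃ (G : ℂ[X]) (S : Multiset A), (∀ τ, hG l τ = G.eval (tt τ)) ∧ G ≠ 0 ∧ G.roots = S.map (algebraMap A ℂ) ∧
      S.map ((IsLocalRing.residue A)) = 2 • (Polynomial.X ^ (l + 1) - Polynomial.C (125 : (IsLocalRing.ResidueField A))).roots := by
  have hl : l.Prime := Fact.out
  have : CharP (IsLocalRing.ResidueField A) l := charP_residue A l hl hA
  obtain ⟨ζ, hζ, hζ1⟩ := exists_zeta A l hl hA
  obtain ⟨G, hdeg, hG, hGm⟩ := heckeT l (IsLocalRing.residue A) ζ hζ hζ1 h5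
  set P : (IsLocalRing.ResidueField A)[X] := Polynomial.X ^ (l + 1) - Polynomial.C 125 with hP
  have hPm : P.Monic := Polynomial.monic_X_pow_sub_C _ (by omega)
  have hPd : P.natDegree = l + 1 := Polynomial.natDegree_X_pow_sub_C
  have hGP : G.map (IsLocalRing.residue A) = P ^ 2 := by rw [hGm, hP]; ring
  have hP2d : (P ^ 2).natDegree = 2 * l + 2 := by rw [hPm.natDegree_pow, hPd]; ring
  have hGd : G.natDegree = 2 * l + 2 := by
    apply le_antisymm hdeg
    rw [← hP2d, ← hGP]
    exact Polynomial.natDegree_map_le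
  have hlead : (IsLocalRing.residue A) G.leadingCoeff = 1 := by
    have h1 := (hPm.pow 2).leadingCoeff
    rw [Polynomial.leadingCoeff, hP2d, ← hGP, Polynomial.coeff_map, ← hGd] at h1
    exact h1
  obtain ⟨u, hu⟩ := (IsLocalRing.residue_ne_zero_iff_isUnit _).mp (by rw [hlead]; exact one_ne_zero)
  set Gc := G.map (algebraMap A ℂ) with hGc
  have hG0 : G ≠ 0 := by
    rintro rfl
    simp at hGd
  have hinj : Function.Injective (algebraMap A ℂ) := Subtype.val_injective
  have hGc0 : Gc ≠ 0 := (Polynomial.map_ne_zero_iff hinj).mpr hG0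
  have hmem : ∀ z ∈ Gc.roots, ∃ x : A, algebraMap A ℂ x = z := by
    intro z hz
    refine mem_of_monic A (Polynomial.C ((u⁻¹ : Aˣ) : A) * G) ?_ z ?_
    · rw [Polynomial.Monic, Polynomial.leadingCoeff_mul, Polynomial.leadingCoeff_C, ← hu, Units.inv_mul]
    · rw [Polynomial.mem_roots hGc0, Polynomial.IsRoot, hGc, Polynomial.eval_map_algebraMap] at hz
      rw [map_mul, hz, mul_zero]
  obtain ⟨S, hS⟩ : ∃ S : Multiset A, S.map (algebraMap A ℂ) = Gc.roots := by
    have key : ∀ m : Multiset ℂ, (∀ z ∈ m, ∃ x : A, algebraMap A ℂ x = z) → ∃ S : Multiset A, S.map (algebraMap A ℂ) = m := by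
      intro m
      induction m using Multiset.induction with
      | empty => intro _; exact ⟨0, rfl⟩
      | cons a m ih =>
        intro h
        obtain ⟨S, hS⟩ := ih (fun z hz => h z (Multiset.mem_cons_of_mem hz))
        obtain ⟨x, hx⟩ := h a (Multiset.mem_cons_self a m)
        exact ⟨x ::ₘ S, by rw [Multiset.map_cons, hx, hS]⟩
    exact key _ hmem
  refine ⟨Gc, S, ?_, hGc0, hS.symm, ?_⟩
  · intro τ
    rw [hG, hGc, Polynomial.eval_map_algebraMap]
  · have hfac : G = Polynomial.C (u : A) * (S.map (fun a => Polynomial.X - Polynomial.C a)).prod := by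
      apply Polynomial.map_injective _ hinj
      have h1 := (IsAlgClosed.splits Gc).eq_prod_roots
      rw [← hS, hGc, Polynomial.leadingCoeff_map_of_injective hinj, ← hu] at h1
      rw [h1, Polynomial.map_mul, Polynomial.map_C, Polynomial.map_multiset_prod, Multiset.map_map, Multiset.map_map]
      congr 3
      ext a
      simp
    have h2 := congrArg (Polynomial.map (IsLocalRing.residue A)) hfac
    rw [hGP, Polynomial.map_mul, Polynomial.map_C, Polynomial.map_multiset_prod, Multiset.map_map, hu, hlead,
      Polynomial.C_1, one_mul] at h2
    have h3 := congrArg Polynomial.roots h2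
    rw [Polynomial.roots_pow] at h3
    rw [h3]
    have e : (S.map (Polynomial.map (IsLocalRing.residue A) ∘ fun a => Polynomial.X - Polynomial.C a)) = 
        (S.map (IsLocalRing.residue A)).map (fun a => Polynomial.X - Polynomial.C a) := by
      rw [Multiset.map_map]
      congr 1
      ext a
      simp
    rw [e, Polynomial.roots_multiset_prod_X_sub_C]

end

end HQ
end

section
namespace HQ
open PowerSeries Filter Topology UpperHalfPlane
open scoped MatrixGroups ModularForm Manifold

lemma CM.stab {l : ℕ} (hl : l.Prime) {τ : ℍ} {a b c : ℤ} (h : CM l τ a b c (-a))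
    (hu : ∀ a' b' c' d', CM l τ a' b' c' d' → a' + d' = 0)
    (γ : SL(2, ℤ)) (hγ : γ ∈ CongruenceSubgroup.Gamma0 5) (hγτ : γ • τ = τ) (w : ℍ) : γ • w = w := by
  have hl0 : (l : ℤ) ≠ 0 := by exact_mod_cast hl.ne_zero
  have hd5 : 5 ∣ γ 1 0 := by
    rw [CongruenceSubgroup.Gamma0_mem] at hγ
    exact (ZMod.intCast_zmod_eq_zero_iff_dvd _ 5).mp hγ
  obtain ⟨r, hr⟩ := hd5
  have hdet := sl_det γ
  rw [sl_smul] at hγτ ⊢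
  rw [hr] at hdet hγτ ⊢
  set p := γ 0 0
  set q := γ 0 1
  set s := γ 1 1
  have hpos : 0 < p * s - q * (5 * r) := by rw [hdet]; exact one_pos
  have F1 : (5 * r * τ ^ 2 + (s - p) * τ - q : ℂ) = 0 := by
    have h1 := congrArg UpperHalfPlane.coe hγτ
    have hne := lin_ne_zero hpos τ
    rw [coe_mob hpos, div_eq_iff hne] at h1
    push_cast at h1
    linear_combination -h1
  have F2 := h.fix
  push_cast at F2
  have hcm : CM l τ (p * a + q * c) (p * b - 5 * q * a) (5 * r * a + s * c) (r * b - s * a) := by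
    refine ⟨?_, ?_⟩
    · rw [← h.det]
      linear_combination (-5 * a * a - b * c) * hdet
    · push_cast
      linear_combination (5 * c * τ - 5 * a : ℂ) * F1 - (5 * r * τ - p : ℂ) * F2
  have htr := hu _ _ _ _ hcm
  have hcm' : CM l τ (p * a + q * c) (p * b - 5 * q * a) (5 * r * a + s * c) (-(p * a + q * c)) := by
    rw [show -(p * a + q * c) = r * b - s * a by linarith]; exact hcm
  obtain ⟨ε, hε, e1, e2, e3⟩ := h.uniq0 hl hcm'
  have hd := h.det
  have hdd : r * b - s * a = - (ε * a) := by linarith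
  have hp : p = ε := by
    apply mul_right_cancel₀ hl0
    rw [← hd]
    linear_combination (-5 * a) * e1 - c * e2
  have hq : q = 0 := by
    apply mul_right_cancel₀ hl0
    rw [← hd]
    linear_combination (-b) * e1 + a * e2
  have hr0 : r = 0 := by
    apply mul_right_cancel₀ hl0
    rw [← hd]
    linear_combination (-a) * e3 - c * hdd
  have hs : s = ε := by
    apply mul_right_cancel₀ hl0
    rw [← hd]
    linear_combination (-b) * e3 + 5 * a * hdd
  apply ext_mob hpos
  rw [hp, hq, hr0, hs]
  simp

lemma CM.simple {l : ℕ} (hl : l.Prime) (h5 : 5 < l) {τ : ℍ} {a b c : ℤ} (h : CM l τ a b c (-a))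
    (hu : ∀ a' b' c' d', CM l τ a' b' c' d' → a' + d' = 0)
    (G : ℂ[X]) (hG' : ∀ τ, hG l τ = G.eval (tt τ)) : (Polynomial.derivative G).eval (tt τ) ≠ 0 := by
  have hlpos : (0:ℤ) < l := by exact_mod_cast hl.pos
  have hder := tt_deriv_ne τ (h.stab hl hu)
  have hTd : HasDerivAt TT (deriv TT τ) τ := ((TT_an τ τ.im_pos).differentiableAt).hasDerivAt
  set T' := deriv TT (τ:ℂ)
  obtain ⟨i, γ, h1, h5', hM⟩ := exists_Mx l hl 5 (cop5 hl h5) (M0 a b c (-a)) (M0_det h) (by simp [M0])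
  have hMx : ∀ j, 0 < (Mx l j).det := fun j => by rw [Mx_det]; exact hlpos
  -- other factors
  have hother : ∀ j ≠ i, 125 - tt τ * tt (mobM (Mx l j) τ) ≠ 0 := by
    intro j hj h0
    obtain ⟨a', b', c', d', γ', hcm, hγ', -, hM'⟩ := (fac_zero_iff l hl j τ).mp h0
    have hd' : d' = -a' := by linarith [hu _ _ _ _ hcm]
    subst hd'
    obtain ⟨ε, hε, e1, e2, e3⟩ := h.uniq0 hl hcm
    have hMM : M0 a' b' c' (-a') = ε • M0 a b c (-a) := by
      rw [e1, e2, e3]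
      ext x y
      fin_cases x <;> fin_cases y <;> simp [M0] <;> ring
    rw [hM', hM] at hMM
    apply hj
    have hdet' : γ'.adjugate.det = 1 := by rw [Matrix.det_adjugate, hγ', one_pow]
    refine Mx_unique l hl (γ := γ'.adjugate * (ε • γ)) ?_ ?_
    · rw [Matrix.det_mul, hdet', Matrix.det_smul, h1]
      simp [pow_two, hε]
    · have : γ'.adjugate * (γ' * Mx l j) = γ'.adjugate * (ε • (γ * Mx l i)) := by rw [hMM]
      rw [← Matrix.mul_assoc, Matrix.adjugate_mul, hγ', one_smul, Matrix.one_mul] at this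
      rw [this, Matrix.mul_assoc, Matrix.smul_mul]
  -- derivative of the special factor
  have hdM0 : 0 < (M0 a b c (-a)).det := by rw [M0_det h]; exact hlpos
  have hNdet : 0 < (-(5 * a)) * (5 * a) - (-b) * (-(5 * c)) := by
    have := h.det
    nlinarith
  have hN : ∀ w, tt (mobM (Mx l i) w) * tt (mob (-(5*a)) (-b) (-(5*c)) (5*a) w) = 125 := by
    intro w
    have e1 : tt (mobM (Mx l i) w) = tt (mobM (M0 a b c (-a)) w) := by
      rw [hM, ← mobM_mul (by rw [h1]; exact one_pos) (hMx i), tt_mobM h1 h5']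
    have e2 : mob (-(5*a)) (-b) (-(5*c)) (5*a) w = mob 0 (-1) 5 0 (mobM (M0 a b c (-a)) w) := by
      have e : mobM (M0 a b c (-a)) w = mob (-c) (-(-a)) (5 * a) b w := rfl
      have hdd : 0 < (-c) * b - (-(-a)) * (5 * a) := by nlinarith
      rw [e, mob_mob (by norm_num) hdd]
      congr 1 <;> ring
    rw [e1, e2, mul_comm]
    exact tt_W _
  have hNτ : mob (-(5*a)) (-b) (-(5*c)) (5*a) τ = τ := by
    apply ext_mob hNdet
    have := h.fix
    push_cast at this ⊢
    linear_combination - this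
  set Fi : ℍ → ℂ := fun w => 125 - tt w * tt (mobM (Mx l i) w) with hFi
  have hFhol : ∀ j, Hol (fun w => 125 - tt w * tt (mobM (Mx l j) w)) := fun j =>
    (hol_const 125).sub (hol_tt.mul (hol_tt.comp_mob ((det_pos_iff _).mp (hMx j))))
  have hFd := (hFhol i τ).hasDerivAt
  set F' := deriv (Fi ∘ ofComplex) (τ:ℂ) with hF'
  have hFτ : Fi τ = 0 := by
    have := hN τ
    rw [hNτ] at this
    rw [hFi]
    linear_combination -this
  -- derivative of tt ∘ N
  have hNd : HasDerivAt ((fun w => tt (mob (-(5*a)) (-b) (-(5*c)) (5*a) w)) ∘ ofComplex) (-T') τ := by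
    refine HasDerivAt.congr_of_eventuallyEq ?_ (comp_mob_eventuallyEq hNdet tt τ)
    have hm := mob_differentiableAt hNdet τ
    have hval : ((((-(5 * a)) * (5 * a) - (-b) * (-(5 * c)) : ℤ) : ℂ) / (((-(5*c) : ℤ):ℂ) * τ + ((5*a:ℤ):ℂ)) ^ 2) = -1 := by
      rw [div_eq_iff (pow_ne_zero 2 (lin_ne_zero hNdet τ))]
      have hal := h.alpha
      have hd : (5 * a * (-a) - b * c : ℂ) = l := by exact_mod_cast congrArg (Int.cast : ℤ → ℂ) h.det
      push_cast at hal ⊢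
      linear_combination 5 * hd + hal
    rw [hval] at hm
    have hpt : (((-(5*a) : ℤ) : ℂ) * τ + ((-b:ℤ):ℂ)) / (((-(5*c) : ℤ):ℂ) * τ + ((5*a:ℤ):ℂ)) = τ := by
      rw [← coe_mob hNdet, hNτ]
    have hT2 : HasDerivAt (tt ∘ ofComplex) T' ((fun z : ℂ => (((-(5*a) : ℤ) : ℂ) * z + ((-b:ℤ):ℂ)) / (((-(5*c) : ℤ):ℂ) * z + ((5*a:ℤ):ℂ))) τ) := by
      simp only [hpt]; exact hTd
    have := hT2.comp (τ:ℂ) hm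
    rw [mul_neg_one] at this
    exact this
  have hprod : F' * tt τ = -250 * T' := by
    have hL := hFd.mul hNd
    have hR : HasDerivAt (fun z => 125 * (((fun w => tt (mob (-(5*a)) (-b) (-(5*c)) (5*a) w)) ∘ ofComplex) z - TT z)) (125 * (-T' - T')) τ :=
      (hNd.sub hTd).const_mul 125
    have heq : ((Fi ∘ ofComplex) * ((fun w => tt (mob (-(5*a)) (-b) (-(5*c)) (5*a) w)) ∘ ofComplex)) =
        (fun z => 125 * (((fun w => tt (mob (-(5*a)) (-b) (-(5*c)) (5*a) w)) ∘ ofComplex) z - TT z)) := by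
      ext z
      have := hN (ofComplex z)
      simp only [Pi.mul_apply, Function.comp_apply, hFi]
      linear_combination (-tt (ofComplex z)) * this
    rw [heq] at hL
    have huq := hL.unique hR
    simp only [Function.comp_apply, ofComplex_apply, hNτ] at huq
    linear_combination huq + hFτ * T'
  have hF'0 : F' ≠ 0 := by
    intro h0
    rw [h0, zero_mul] at hprod
    exact hder (by linear_combination (1/250) * hprod)
  -- product
  set R : ℍ → ℂ := fun w => ∏ j ∈ Finset.univ.erase i, (125 - tt w * tt (mobM (Mx l j) w)) with hR
  have hRhol : Hol R := hol_prod _ _ (fun j _ => hFhol j)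
  have hRτ : R τ ≠ 0 := by
    rw [hR]
    exact Finset.prod_ne_zero_iff.mpr (fun j hj => hother j (Finset.ne_of_mem_erase hj))
  have hsplit : ∀ w, hG l w = Fi w * R w := by
    intro w
    rw [hG, hFi, hR]
    exact (Finset.mul_prod_erase _ _ (Finset.mem_univ i)).symm
  intro hzero
  have hL := hFd.mul ((hRhol τ).hasDerivAt)
  have hpoly : HasDerivAt (fun z => G.eval (TT z)) ((Polynomial.derivative G).eval (TT τ) * T') τ :=
    (G.hasDerivAt (TT τ)).comp (τ:ℂ) hTd
  have heq : ((Fi ∘ ofComplex) * (R ∘ ofComplex)) = (fun z => G.eval (TT z)) := by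
    ext z
    have := hsplit (ofComplex z)
    rw [hG'] at this
    exact this.symm
  rw [heq] at hL
  have huq := hL.unique hpoly
  rw [TT_coe, hzero, zero_mul] at huq
  simp only [Function.comp_apply, ofComplex_apply] at huq
  have hFτ' : 125 - tt τ * tt (mobM (Mx l i) τ) = 0 := hFτ
  rw [hFτ', zero_mul, add_zero] at huq
  exact (mul_ne_zero hF'0 hRτ) huq

section
variable (A : ValuationSubring ℂ) (l : ℕ) [Fact l.Prime]

theorem count_T (hA : (l : ℂ) ∈ A.nonunits) (h5 : 5 < l) (n r s : ℕ) (hr : r ≤ 1) (hs : s ≤ 1)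
    (hln : l = 12 * n + 4 * r + 6 * s + 1) :
    2 * {x : (IsLocalRing.ResidueField A) | x ^ (l + 1) = 125 ∧ ss n r s x}.ncard =
      {z : ℂ | ∃ τ a b c, CM l τ a b c (-a) ∧ tt τ = z}.ncard := by
  classical
  have hl : l.Prime := Fact.out
  have : CharP (IsLocalRing.ResidueField A) l := charP_residue A l hl hA
  obtain ⟨G, S, hG1, hG0, hGr, hS⟩ := heckeT_split A l hA h5
  have h5k := isUnit_five A l hA h5
  have h125 : (125 : (IsLocalRing.ResidueField A)) ≠ 0 := by
    have e : (125 : (IsLocalRing.ResidueField A)) = (IsLocalRing.residue A) 5 ^ 3 := by rw [map_ofNat]; norm_num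
    rw [e]; exact pow_ne_zero 3 h5k
  set P : (IsLocalRing.ResidueField A)[X] := Polynomial.X ^ (l + 1) - Polynomial.C (125 : (IsLocalRing.ResidueField A)) with hP
  have hP0 : P ≠ 0 := Polynomial.X_pow_sub_C_ne_zero (by omega) _
  have hPn : P.roots.Nodup := by
    apply Polynomial.nodup_roots
    apply Polynomial.separable_X_pow_sub_C _ _ h125
    simp [CharP.cast_eq_zero]
  have hPmem : ∀ x : (IsLocalRing.ResidueField A), x ∈ P.roots ↔ x ^ (l+1) = 125 := by
    intro x
    rw [Polynomial.mem_roots hP0, hP]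
    simp [sub_eq_zero]
  have hSmem : ∀ t ∈ S, (IsLocalRing.residue A) t ≠ 0 := by
    intro t ht h0
    have : (IsLocalRing.residue A) t ∈ S.map (IsLocalRing.residue A) := Multiset.mem_map_of_mem _ ht
    rw [hS, Multiset.mem_nsmul_of_ne_zero (by norm_num), hPmem, h0, zero_pow (by omega)] at this
    exact h125 this.symm
  have hex : ∀ τ a b c d, CM l τ a b c d → ∃ t ∈ S, (t : ℂ) = tt τ := by
    intro τ a b c d h
    have h0 : G.eval (tt τ) = 0 := by rw [← hG1, hG_zero_iff l hl h5]; exact ⟨a, b, c, d, h⟩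
    have : tt τ ∈ G.roots := (Polynomial.mem_roots hG0).mpr h0
    rw [hGr] at this
    obtain ⟨t, ht, hte⟩ := Multiset.mem_map.mp this
    exact ⟨t, ht, hte⟩
  have huniq : ∀ τ a b c, CM l τ a b c (-a) → ∀ a' b' c' d', CM l τ a' b' c' d' → a' + d' = 0 := by
    intro τ a b c h a' b' c' d' h'
    obtain ⟨t, ht, hte⟩ := hex τ _ _ _ _ h
    by_contra hne
    exact not_ss_of_trace A l hA h5 n r s hr hs hln τ t hte (hSmem t ht) h' hne
      (ss_of_trace_zero A l hA h5 n r s hr hs hln τ t hte (hSmem t ht) h)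
  have hcl : ∀ t ∈ S, (ss n r s ((IsLocalRing.residue A) t) ↔ ∃ τ a b c, CM l τ a b c (-a) ∧ tt τ = t) := by
    intro t ht
    constructor
    · intro hss
      have ht0 : (t : ℂ) ≠ 0 := by
        intro h0
        have : t = 0 := Subtype.ext h0
        exact hSmem t ht (by rw [this, map_zero])
      obtain ⟨τ, hτ⟩ := tt_surj (t:ℂ) ht0
      have hroot : (t : ℂ) ∈ G.roots := by rw [hGr]; exact Multiset.mem_map_of_mem _ ht
      have h0 := (Polynomial.mem_roots hG0).mp hroot
      rw [Polynomial.IsRoot, ← hτ, ← hG1, hG_zero_iff l hl h5] at h0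
      obtain ⟨a, b, c, d, h⟩ := h0
      by_cases hd : a + d = 0
      · refine ⟨τ, a, b, c, ?_, hτ⟩
        rw [show -a = d by linarith]; exact h
      · exact absurd hss (not_ss_of_trace A l hA h5 n r s hr hs hln τ t hτ.symm (hSmem t ht) h hd)
    · rintro ⟨τ, a, b, c, h, hτ⟩
      exact ss_of_trace_zero A l hA h5 n r s hr hs hln τ t hτ.symm (hSmem t ht) h
  set Z : Multiset ℂ := (S.filter (fun t => ss n r s ((IsLocalRing.residue A) t))).map (algebraMap A ℂ) with hZ
  have hinj : Function.Injective (algebraMap A ℂ) := Subtype.val_injective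
  have hZmem : ∀ z, z ∈ Z ↔ ∃ τ a b c, CM l τ a b c (-a) ∧ tt τ = z := by
    intro z
    rw [hZ, Multiset.mem_map]
    constructor
    · rintro ⟨t, ht, rfl⟩
      rw [Multiset.mem_filter] at ht
      exact (hcl t ht.1).mp ht.2
    · rintro ⟨τ, a, b, c, h, rfl⟩
      obtain ⟨t, ht, hte⟩ := hex τ _ _ _ _ h
      refine ⟨t, ?_, hte⟩
      rw [Multiset.mem_filter]
      exact ⟨ht, (hcl t ht).mpr ⟨τ, a, b, c, h, hte.symm⟩⟩
  have hZle : Z ≤ G.roots := by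
    rw [hZ, hGr]; exact Multiset.map_le_map (Multiset.filter_le _ _)
  have hZn : Z.Nodup := by
    rw [Multiset.nodup_iff_count_le_one]
    intro z
    by_cases hz : z ∈ Z
    · obtain ⟨τ, a, b, c, h, rfl⟩ := (hZmem z).mp hz
      refine (Multiset.count_le_of_le _ hZle).trans ?_
      rw [Polynomial.count_roots]
      by_contra hlt
      push Not at hlt
      have := (Polynomial.one_lt_rootMultiplicity_iff_isRoot hG0).mp hlt
      exact h.simple hl h5 (huniq τ a b c h) G hG1 this.2
    · rw [Multiset.count_eq_zero_of_notMem hz]; exact zero_le_one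
  have hc1 : {z : ℂ | ∃ τ a b c, CM l τ a b c (-a) ∧ tt τ = z}.ncard = Z.card := by
    have e : {z : ℂ | ∃ τ a b c, CM l τ a b c (-a) ∧ tt τ = z} = ((⟨Z, hZn⟩ : Finset ℂ) : Set ℂ) := by
      ext z
      exact (hZmem z).symm
    rw [e, Set.ncard_coe_finset, Finset.card_mk]
  have hc2 : {x : (IsLocalRing.ResidueField A) | x ^ (l + 1) = 125 ∧ ss n r s x}.ncard = (P.roots.filter (fun x => ss n r s x)).card := by
    have e : {x : (IsLocalRing.ResidueField A) | x ^ (l + 1) = 125 ∧ ss n r s x} = ((⟨P.roots.filter (fun x => ss n r s x), hPn.filter _⟩ : Finset (IsLocalRing.ResidueField A)) : Set (IsLocalRing.ResidueField A)) := by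
      ext x
      rw [Finset.mem_coe, Finset.mem_mk, Multiset.mem_filter, hPmem]
      rfl
    rw [e, Set.ncard_coe_finset, Finset.card_mk]
  rw [hc1, hc2, hZ, Multiset.card_map]
  have h3 : ((S.map (IsLocalRing.residue A)).filter (fun x => ss n r s x)).card = (S.filter (fun t => ss n r s ((IsLocalRing.residue A) t))).card := by
    rw [Multiset.filter_map, Multiset.card_map]; rfl
  rw [← h3, hS, Multiset.filter_nsmul, Multiset.card_nsmul]

end

end HQ
end

section
namespace HQ
open PowerSeries Filter Topology UpperHalfPlane
open scoped MatrixGroups ModularForm Manifold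

section
variable {O : Type*} [CommRing O]

/-- the lattice spanned by two elements -/
def lat (v w : O) : AddSubgroup O := AddSubgroup.closure {v, w}

lemma mem_lat {v w z : O} : z ∈ lat v w ↔ ∃ m n : ℤ, (m : O) * v + n * w = z := by
  rw [lat, AddSubgroup.mem_closure_pair]
  simp only [zsmul_eq_mul]

lemma lat_le {v w : O} {L : AddSubgroup O} (hv : v ∈ L) (hw : w ∈ L) : lat v w ≤ L := by
  rw [lat, AddSubgroup.closure_le]
  rintro z (rfl | rfl) <;> assumption

lemma left_mem_lat (v w : O) : v ∈ lat v w := mem_lat.mpr ⟨1, 0, by simp⟩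
lemma right_mem_lat (v w : O) : w ∈ lat v w := mem_lat.mpr ⟨0, 1, by simp⟩

lemma lat_map (x v w : O) : (lat v w).map (AddMonoidHom.mulLeft x) = lat (x * v) (x * w) := by
  rw [lat, lat, AddMonoidHom.map_closure, Set.image_pair]; rfl

lemma lat_change (v w : O) (α β γ δ : ℤ) (h : α * δ - β * γ = 1) :
    lat (γ * w + δ * v : O) (α * w + β * v : O) = lat v w := by
  have hO : (α * δ - β * γ : O) = 1 := by exact_mod_cast congrArg (Int.cast : ℤ → O) h
  apply le_antisymm
  · exact lat_le (mem_lat.mpr ⟨δ, γ, by ring⟩) (mem_lat.mpr ⟨β, α, by ring⟩)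
  · refine lat_le (mem_lat.mpr ⟨α, -γ, ?_⟩) (mem_lat.mpr ⟨-β, δ, ?_⟩)
    · push_cast; linear_combination v * hO
    · push_cast; linear_combination w * hO

variable (θ : O) (σ : O →+* ℂ) (l : ℕ)

def Rep (L : AddSubgroup O) (τ : ℍ) : Prop :=
  ∃ (v w : O) (a b c : ℤ), v ≠ 0 ∧ L = lat v w ∧ 0 < c ∧ c * b = 5 * a ^ 2 + l ∧
    θ * v = -5 * a * v + 5 * c * w ∧ θ * w = 5 * a * w - b * v ∧ σ w = τ * σ v

variable {θ σ l}

lemma indep_of_tau (hσ : Function.Injective σ) {v w : O} (hv : v ≠ 0) {τ : ℍ} (hw : σ w = τ * σ v) (m n : ℤ)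
    (h : (m : O) * v + n * w = 0) : m = 0 ∧ n = 0 := by
  have h1 := congrArg σ h
  rw [map_add, map_mul, map_mul, map_intCast, map_intCast, hw, map_zero] at h1
  have hv' : σ v ≠ 0 := by rwa [Ne, map_eq_zero_iff σ hσ]
  have h2 : (m + n * τ : ℂ) = 0 := by
    apply mul_right_cancel₀ hv'
    linear_combination h1
  have h3 := congrArg Complex.im h2
  simp [τ.im_pos.ne'] at h3
  subst h3
  simp at h2
  exact ⟨h2, rfl⟩

lemma Rep.cm {L : AddSubgroup O} {τ : ℍ} (hσ : Function.Injective σ) (h : Rep θ σ l L τ) :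
    ∃ a b c, CM l τ a b c (-a) := by
  obtain ⟨v, w, a, b, c, hv, -, hc, hcb, h1, h2, h3⟩ := h
  have hv' : σ v ≠ 0 := by rwa [Ne, map_eq_zero_iff σ hσ]
  refine ⟨a, -b, c, ?_, ?_⟩
  · linarith
  · have e1 := congrArg σ h1
    have e2 := congrArg σ h2
    simp only [map_mul, map_add, map_sub, map_neg, map_intCast, map_ofNat, h3] at e1 e2
    apply mul_right_cancel₀ hv'
    push_cast
    linear_combination e2 - (τ:ℂ) * e1

lemma Rep.stable {L : AddSubgroup O} {τ : ℍ} (h : Rep θ σ l L τ) : ∀ z ∈ L, θ * z ∈ L := by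
  obtain ⟨v, w, a, b, c, hv, rfl, hc, hcb, h1, h2, h3⟩ := h
  intro z hz
  obtain ⟨m, n, rfl⟩ := mem_lat.mp hz
  refine mem_lat.mpr ⟨-5 * a * m - b * n, 5 * c * m + 5 * a * n, ?_⟩
  push_cast
  linear_combination -(m:O) * h1 - (n:O) * h2

lemma Rep.ne_bot {L : AddSubgroup O} {τ : ℍ} (h : Rep θ σ l L τ) : ∃ z ∈ L, z ≠ 0 := by
  obtain ⟨v, w, a, b, c, hv, rfl, hc, hcb, h1, h2, h3⟩ := h
  exact ⟨v, left_mem_lat v w, hv⟩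

lemma Rep.homothety [IsDomain O] (hσ : Function.Injective σ) {L L' : AddSubgroup O} {τ τ' : ℍ} (h : Rep θ σ l L τ)
    (h' : Rep θ σ l L' τ') (ht : tt τ = tt τ') :
    ∃ x y : O, x ≠ 0 ∧ y ≠ 0 ∧ L.map (AddMonoidHom.mulLeft x) = L'.map (AddMonoidHom.mulLeft y) := by
  obtain ⟨v, w, a, b, c, hv, rfl, hc, hcb, h1, h2, h3⟩ := h
  obtain ⟨v', w', a', b', c', hv', rfl, hc', hcb', h1', h2', h3'⟩ := h'
  obtain ⟨γ, hγ, rfl⟩ := tt_inj ht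
  have hdet := sl_det γ
  have hpos := sl_det_pos γ
  rw [sl_smul, coe_mob hpos] at h3'
  have hne := lin_ne_zero hpos τ
  have hv0 : σ v ≠ 0 := by rwa [Ne, map_eq_zero_iff σ hσ]
  refine ⟨v', (γ 1 0 : ℤ) * w + (γ 1 1 : ℤ) * v, hv', ?_, ?_⟩
  · rw [Ne, ← map_eq_zero_iff σ hσ]
    simp only [map_mul, map_add, map_intCast, h3]
    intro h0
    apply hne
    apply mul_right_cancel₀ hv0
    linear_combination h0
  · rw [lat_map, lat_map, ← lat_change (v' * v) (v' * w) (γ 0 0) (γ 0 1) (γ 1 0) (γ 1 1) hdet]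
    congr 1
    · ring
    · apply hσ
      have hw : σ w' * ((γ 1 0 : ℤ) * τ + (γ 1 1 : ℤ)) = ((γ 0 0 : ℤ) * τ + (γ 0 1 : ℤ)) * σ v' := by
        rw [h3', div_mul_eq_mul_div, div_mul_cancel₀ _ hne]
      simp only [map_mul, map_add, map_intCast, h3]
      linear_combination -(σ v) * hw

lemma Rep.tt_eq [IsDomain O] (hσ : Function.Injective σ) (h5l : ¬ 5 ∣ l) {L L' : AddSubgroup O} {τ τ' : ℍ} (h : Rep θ σ l L τ)
    (h' : Rep θ σ l L' τ') {x y : O} (hx : x ≠ 0) (hy : y ≠ 0)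
    (hxy : L.map (AddMonoidHom.mulLeft x) = L'.map (AddMonoidHom.mulLeft y)) : tt τ = tt τ' := by
  obtain ⟨v, w, a, b, c, hv, rfl, hc, hcb, h1, h2, h3⟩ := h
  obtain ⟨v', w', a', b', c', hv', rfl, hc', hcb', h1', h2', h3'⟩ := h'
  rw [lat_map, lat_map] at hxy
  have m1 : y * v' ∈ lat (x * v) (x * w) := by rw [hxy]; exact left_mem_lat _ _
  have m2 : y * w' ∈ lat (x * v) (x * w) := by rw [hxy]; exact right_mem_lat _ _
  have m3 : x * v ∈ lat (y * v') (y * w') := by rw [← hxy]; exact left_mem_lat _ _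
  have m4 : x * w ∈ lat (y * v') (y * w') := by rw [← hxy]; exact right_mem_lat _ _
  obtain ⟨δ, γ, e1⟩ := mem_lat.mp m1
  obtain ⟨β, α, e2⟩ := mem_lat.mp m2
  obtain ⟨D, C, e3⟩ := mem_lat.mp m3
  obtain ⟨B, A, e4⟩ := mem_lat.mp m4
  have hxv : x * v ≠ 0 := mul_ne_zero hx hv
  have hxw : σ (x * w) = τ * σ (x * v) := by rw [map_mul, map_mul, h3]; ring
  have ind := indep_of_tau hσ hxv hxw
  obtain ⟨i1, i2⟩ := ind (D * δ + C * β - 1) (D * γ + C * α) (by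
    push_cast; linear_combination e3 + (D:O) * e1 + (C:O) * e2)
  obtain ⟨i3, i4⟩ := ind (B * δ + A * β) (B * γ + A * α - 1) (by
    push_cast; linear_combination e4 + (B:O) * e1 + (A:O) * e2)
  have hdd : (A * D - B * C) * (α * δ - β * γ) = 1 := by
    linear_combination (A * α + B * γ) * i1 - (D * γ + C * α) * i3 + i4
  -- positivity
  have hv'0 : σ v' ≠ 0 := by rwa [Ne, map_eq_zero_iff σ hσ]
  have hv0 : σ v ≠ 0 := by rwa [Ne, map_eq_zero_iff σ hσ]
  have hy0 : σ y ≠ 0 := by rwa [Ne, map_eq_zero_iff σ hσ]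
  have hx0 : σ x ≠ 0 := by rwa [Ne, map_eq_zero_iff σ hσ]
  have s1 := congrArg σ e1
  have s2 := congrArg σ e2
  simp only [map_mul, map_add, map_intCast, h3, h3'] at s1 s2
  have hkey : (τ' : ℂ) * (γ * τ + δ) = α * τ + β := by
    apply mul_right_cancel₀ (mul_ne_zero hx0 hv0)
    linear_combination (τ':ℂ) * s1 - s2
  have hgd : (γ * τ + δ : ℂ) ≠ 0 := by
    intro h0
    have : σ y * σ v' = 0 := by rw [← s1]; linear_combination (σ x * σ v) * h0
    exact mul_ne_zero hy0 hv'0 this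
  have him : (0:ℝ) < (α * δ - β * γ : ℤ) := by
    have hre := congrArg Complex.re hkey
    have him := congrArg Complex.im hkey
    simp at hre him
    have e : τ'.im * ((γ * τ.re + δ) ^ 2 + (γ * τ.im) ^ 2) = ((α * δ - β * γ : ℤ) : ℝ) * τ.im := by
      push_cast
      linear_combination (γ * τ.re + δ) * him - (γ * τ.im) * hre
    have hp : 0 < (γ * τ.re + δ) ^ 2 + (γ * τ.im) ^ 2 := by
      have : Complex.normSq (γ * τ + δ : ℂ) = (γ * τ.re + δ) ^ 2 + (γ * τ.im) ^ 2 := by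
        rw [Complex.normSq_apply]; simp; ring
      rw [← this]
      exact Complex.normSq_pos.mpr hgd
    have h0 : 0 < ((α * δ - β * γ : ℤ) : ℝ) * τ.im := by
      rw [← e]; exact mul_pos τ'.im_pos hp
    exact pos_of_mul_pos_left h0 τ.im_pos.le
  have himZ : 0 < α * δ - β * γ := by exact_mod_cast him
  have hdet : α * δ - β * γ = 1 := by
    rcases Int.eq_one_or_neg_one_of_mul_eq_one (by rw [mul_comm] at hdd; exact hdd) with h | h
    · exact h
    · omega
  -- 5 ∣ γ
  obtain ⟨j1, -⟩ := ind (-γ * b - 5 * a * δ + 5 * a' * δ - 5 * c' * β) (5 * a * γ + 5 * c * δ + 5 * a' * γ - 5 * c' * α) (by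
    push_cast
    linear_combination -(γ * x : O) * h2 - (δ * x : O) * h1 + (θ:O) * e1 + (y:O) * h1' + (5 * a' : O) * e1 - 5 * (c':O) * e2)
  have h5b : ¬ (5:ℤ) ∣ b := by
    rintro ⟨k, rfl⟩
    apply h5l
    have : (5:ℤ) ∣ l := ⟨c * k - a ^ 2, by linarith⟩
    exact_mod_cast this
  have h5γ : (5:ℤ) ∣ γ := by
    have : (5:ℤ) ∣ γ * b := ⟨- a * δ + a' * δ - c' * β, by linarith⟩
    exact ((Nat.prime_iff_prime_int.mp Nat.prime_five).dvd_or_dvd this).resolve_right h5b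
  obtain ⟨g, rfl⟩ := h5γ
  have hmob : mob α β (5 * g) δ τ = τ' := by
    ext1
    rw [coe_mob (by rw [hdet]; exact one_pos), ← hkey]
    field_simp
  rw [← hmob]
  exact (tt_mob hdet τ).symm

end

end HQ
end

section
namespace HQ
open PowerSeries Filter Topology UpperHalfPlane
open scoped MatrixGroups ModularForm Manifold

section
variable {O : Type*} [CommRing O] {θ : O} {σ : O →+* ℂ} {l : ℕ}

lemma tau_exists (hl : 0 < l) (hθ : σ θ = Complex.I * (√(5 * l : ℝ) : ℝ)) (a c : ℤ) (hc : 0 < c) :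
    ∃ τ : ℍ, (τ : ℂ) * (5 * c) = 5 * a + σ θ := by
  have hcR : (0:ℝ) < 5 * c := by have : (0:ℝ) < c := by exact_mod_cast hc
                                 linarith
  have hs : 0 < √(5 * l : ℝ) := Real.sqrt_pos.mpr (by have : (0:ℝ) < l := by exact_mod_cast hl
                                                      linarith)
  set z : ℂ := ⟨5 * a / (5 * c), √(5 * l : ℝ) / (5 * c)⟩ with hz
  refine ⟨⟨z, ?_⟩, ?_⟩
  · exact div_pos hs hcR
  · rw [hθ]
    show z * (5 * c) = _
    apply Complex.ext
    · simp [hz]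
      have : (c : ℝ) ≠ 0 := by intro h; rw [h] at hcR; simp at hcR
      field_simp
    · simp [hz]
      have : (c : ℝ) ≠ 0 := by intro h; rw [h] at hcR; simp at hcR
      field_simp

lemma theta_not_int (hl : 0 < l) (hθ : σ θ = Complex.I * (√(5 * l : ℝ) : ℝ)) (p : ℤ) : σ θ ≠ p := by
  intro h
  have h1 := congrArg Complex.im h
  rw [hθ] at h1
  simp at h1
  omega

lemma theta_sq (hσ : Function.Injective σ) (hθ : σ θ = Complex.I * (√(5 * l : ℝ) : ℝ)) : θ ^ 2 = -(5 * l : O) := by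
  apply hσ
  rw [map_pow, hθ, mul_pow, Complex.I_sq, ← Complex.ofReal_pow, Real.sq_sqrt (by positivity)]
  rw [map_neg, map_mul, map_natCast, map_ofNat]
  push_cast
  ring

/-- action of `θ` on a basis -/
lemma theta_matrix [IsDomain O] [CharZero O] (hl : 0 < l) (hσ : Function.Injective σ) (hθ : σ θ = Complex.I * (√(5 * l : ℝ) : ℝ))
    {v w : O} (hi : ∀ m n : ℤ, (m : O) * v + n * w = 0 → m = 0 ∧ n = 0)
    {p q r s : ℤ} (h1 : θ * v = p * v + r * w) (h2 : θ * w = q * v + s * w) :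
    r ≠ 0 ∧ s = -p ∧ p ^ 2 + q * r = -(5 * l) := by
  have h0 := theta_sq hσ hθ
  obtain ⟨e1, e2⟩ := hi (p ^ 2 + q * r + 5 * l) (r * (p + s)) (by
    push_cast
    linear_combination v * h0 - θ * h1 - (p:O) * h1 - (r:O) * h2)
  have hv : v ≠ 0 := by
    rintro rfl
    have := hi 1 0 (by simp)
    simp at this
  have hr : r ≠ 0 := by
    rintro rfl
    apply theta_not_int hl hθ p
    have : θ = p := by
      apply mul_right_cancel₀ hv
      rw [h1]; simp
    rw [this, map_intCast]
  refine ⟨hr, ?_, by linarith⟩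
  have := (mul_eq_zero.mp e2).resolve_left hr
  linarith

lemma rep_of_good [IsDomain O] [CharZero O] (hl : 0 < l) (hσ : Function.Injective σ) (hθ : σ θ = Complex.I * (√(5 * l : ℝ) : ℝ))
    {v w : O} (hi : ∀ m n : ℤ, (m : O) * v + n * w = 0 → m = 0 ∧ n = 0)
    (hst : ∀ z ∈ lat v w, θ * z ∈ lat v w) (a c : ℤ) (h1 : θ * v = -5 * a * v + 5 * c * w) :
    ∃ τ, Rep θ σ l (lat v w) τ := by
  have main : ∀ (v w : O), (∀ m n : ℤ, (m : O) * v + n * w = 0 → m = 0 ∧ n = 0) →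
    (∀ z ∈ lat v w, θ * z ∈ lat v w) → ∀ a c : ℤ, 0 < c → (θ * v = -5 * a * v + 5 * c * w) →
    ∃ τ, Rep θ σ l (lat v w) τ := by
    intro v w hi hst a c hc h1
    obtain ⟨τ, hτ⟩ := tau_exists hl hθ a c hc
    have hv : v ≠ 0 := by
      rintro rfl
      have := hi 1 0 (by simp)
      simp at this
    obtain ⟨q, s, h2⟩ := mem_lat.mp (hst w (right_mem_lat v w))
    obtain ⟨-, hs, hd⟩ := theta_matrix hl hσ hθ hi (p := -5 * a) (r := 5 * c) (q := q) (s := s)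
      (by push_cast; exact h1) h2.symm
    refine ⟨τ, v, w, a, -q, c, hv, rfl, hc, by linarith, h1, ?_, ?_⟩
    · rw [← h2, hs]; push_cast; ring
    · have hc' : (5 * c : ℂ) ≠ 0 := by
        have : (c:ℂ) ≠ 0 := by exact_mod_cast hc.ne'
        simpa using this
      apply mul_left_cancel₀ hc'
      have e := congrArg σ h1
      simp only [map_mul, map_add, map_neg, map_intCast, map_ofNat] at e
      linear_combination -e - σ v * hτ
  rcases lt_trichotomy c 0 with hc | rfl | hc
  · have e : lat v (-w) = lat v w := by
      apply le_antisymm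
      · exact lat_le (left_mem_lat v w) (neg_mem (right_mem_lat v w))
      · refine lat_le (left_mem_lat _ _) ?_
        rw [← neg_neg w, neg_neg (-w)]
        exact neg_mem (right_mem_lat v (-w))
    rw [← e]
    refine main v (-w) ?_ ?_ a (-c) (by omega) ?_
    · intro m n h
      obtain ⟨h1, h2⟩ := hi m (-n) (by push_cast; linear_combination h)
      exact ⟨h1, by omega⟩
    · rw [e]; exact hst
    · push_cast; rw [h1]; ring
  · exfalso
    obtain ⟨q, s, h2⟩ := mem_lat.mp (hst w (right_mem_lat v w))
    obtain ⟨h, -⟩ := theta_matrix hl hσ hθ hi (p := -5 * a) (r := 0) (q := q) (s := s)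
      (by rw [h1]; push_cast; ring) h2.symm
    exact h rfl
  · exact main v w hi hst a c hc h1

lemma rep_exists [IsDomain O] [CharZero O] (hl : 0 < l) (hσ : Function.Injective σ) (hθ : σ θ = Complex.I * (√(5 * l : ℝ) : ℝ))
    {v w : O} (hi : ∀ m n : ℤ, (m : O) * v + n * w = 0 → m = 0 ∧ n = 0)
    (hst : ∀ z ∈ lat v w, θ * z ∈ lat v w) : ∃ τ, Rep θ σ l (lat v w) τ := by
  obtain ⟨p, r, h1⟩ := mem_lat.mp (hst v (left_mem_lat v w))
  obtain ⟨q, s, h2⟩ := mem_lat.mp (hst w (right_mem_lat v w))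
  obtain ⟨hr, rfl, hd⟩ := theta_matrix hl hσ hθ hi h1.symm h2.symm
  have hp5 : Prime (5:ℤ) := Nat.prime_iff_prime_int.mp Nat.prime_five
  by_cases h5 : (5:ℤ) ∣ r
  · have h5p : (5:ℤ) ∣ p := by
      obtain ⟨k, hk⟩ := h5
      apply hp5.dvd_of_dvd_pow (n := 2)
      exact ⟨-q * k - l, by rw [hk] at hd; linarith⟩
    obtain ⟨c, rfl⟩ := h5
    obtain ⟨a, rfl⟩ := h5p
    refine rep_of_good hl hσ hθ hi hst (-a) c ?_
    rw [← h1]; push_cast; ring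
  · have hr4 : (5:ℤ) ∣ r ^ 4 - 1 := by
      refine (ZMod.intCast_zmod_eq_zero_iff_dvd (r ^ 4 - 1) 5).mp ?_
      have : (r : ZMod 5) ≠ 0 := fun h => h5 ((ZMod.intCast_zmod_eq_zero_iff_dvd r 5).mp h)
      push_cast
      generalize (r : ZMod 5) = x at this
      revert x; decide
    obtain ⟨j, hj⟩ := hr4
    set k := p * r ^ 3 with hk
    have hkr : k * r - p = 5 * (p * j) := by rw [hk]; linear_combination p * hj
    have h5c : (5:ℤ) ∣ q + 2 * k * p - k ^ 2 * r := by
      have : (5:ℤ) ∣ (q + 2 * k * p - k ^ 2 * r) * r := by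
        refine ⟨-(5 * (p * j) ^ 2) - l, ?_⟩
        linear_combination hd - (k * r - p + 5 * (p * j)) * hkr
      exact (hp5.dvd_or_dvd this).resolve_right h5
    obtain ⟨c, hc⟩ := h5c
    have e : lat ((k:O) * v + w) v = lat v w := by
      apply le_antisymm
      · exact lat_le (mem_lat.mpr ⟨k, 1, by simp⟩) (left_mem_lat v w)
      · exact lat_le (right_mem_lat _ _) (mem_lat.mpr ⟨1, -k, by push_cast; ring⟩)
    rw [← e]
    refine rep_of_good hl hσ hθ ?_ (by rw [e]; exact hst) (-(p * j)) c ?_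
    · intro m n h
      obtain ⟨i1, i2⟩ := hi (m * k + n) m (by push_cast; linear_combination h)
      subst i2
      exact ⟨rfl, by simpa using i1⟩
    · have hcO : (q + 2 * k * p - k ^ 2 * r : O) = 5 * c := by exact_mod_cast congrArg (Int.cast : ℤ → O) hc
      have hkO : (k * r - p : O) = 5 * (p * j) := by exact_mod_cast congrArg (Int.cast : ℤ → O) hkr
      push_cast at h2 ⊢
      linear_combination -(k:O) * h1 - h2 + v * hcO + ((k:O) * v + w) * hkO

lemma rep_of_cm [IsDomain O] [CharZero O] (hl : l.Prime) (hσ : Function.Injective σ) (hθ : σ θ = Complex.I * (√(5 * l : ℝ) : ℝ))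
    {τ : ℍ} {a b c : ℤ} (h : CM l τ a b c (-a)) : ∃ L, Rep θ σ l L τ := by
  have main : ∀ a b c : ℤ, 0 < c → CM l τ a b c (-a) → ∃ L, Rep θ σ l L τ := by
    intro a b c hc h
    have h0 := theta_sq hσ hθ
    have hd := h.det
    have hcO : (c : O) ≠ 0 := by exact_mod_cast hc.ne'
    have hdO : (5 * a * (-a) - b * c : O) = l := by exact_mod_cast congrArg (Int.cast : ℤ → O) hd
    refine ⟨lat (5 * c : O) (5 * a + θ : O), 5 * c, 5 * a + θ, a, -b, c, ?_, rfl, hc, by linarith, by ring, ?_, ?_⟩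
    · exact mul_ne_zero (by norm_num) hcO
    · push_cast
      linear_combination h0 + 5 * hdO
    · -- the value of τ
      have hcC : (c : ℂ) ≠ 0 := by exact_mod_cast hc.ne'
      simp only [map_mul, map_add, map_intCast, map_ofNat]
      obtain ⟨τ', hτ'⟩ := tau_exists hl.pos hθ a c hc
      have hf := h.fix
      have hs := congrArg σ h0
      simp only [map_mul, map_pow, map_neg, map_natCast, map_ofNat] at hs
      have hdC : (5 * a * (-a) - b * c : ℂ) = l := by exact_mod_cast congrArg (Int.cast : ℤ → ℂ) hd
      have hq : ((τ:ℂ) * (5 * c) - 5 * a - σ θ) * ((τ:ℂ) * (5 * c) - 5 * a + σ θ) = 0 := by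
        push_cast at hf
        linear_combination 5 * (c:ℂ) * hf - hs - 5 * hdC
      rcases mul_eq_zero.mp hq with h1 | h1
      · linear_combination -h1
      · exfalso
        have h2 : ((τ:ℂ) + τ') * (5 * c) = 10 * a := by linear_combination h1 + hτ'
        have h3 := congrArg Complex.im h2
        simp at h3
        have := τ.im_pos
        have := τ'.im_pos
        rcases h3 with h3 | h3
        · linarith
        · exact hc.ne' h3
  rcases lt_trichotomy c 0 with hc | hc | hc
  · refine main (-a) (-b) (-c) (by omega) ⟨?_, ?_⟩
    · rw [← h.det]; ring
    · have := h.fix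
      push_cast at this ⊢
      linear_combination -this
  · exact absurd hc (h.c_ne hl)
  · exact main a b c hc h

end

end HQ
end

section
namespace HQ
open PowerSeries Filter Topology UpperHalfPlane
open scoped MatrixGroups ModularForm Manifold NumberField

section
variable {K : Type} [Field K] [NumberField K] {θ : K} {l : ℕ}

lemma exists_sigma (hθ : θ ^ 2 = -((5 * l : ℕ) : K)) :
    ∃ σ : K →+* ℂ, σ θ = Complex.I * (√(5 * l : ℝ) : ℝ) := by
  obtain ⟨φ⟩ : Nonempty (K →+* ℂ) := inferInstance
  have h1 := congrArg φ hθ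
  rw [map_pow, map_neg, map_natCast] at h1
  have h2 : (Complex.I * (√(5 * l : ℝ) : ℝ)) ^ 2 = -(((5 * l : ℕ)) : ℂ) := by
    rw [mul_pow, Complex.I_sq, ← Complex.ofReal_pow, Real.sq_sqrt (by positivity)]
    push_cast; ring
  rw [← h2] at h1
  rcases sq_eq_sq_iff_eq_or_eq_neg.mp h1 with h | h
  · exact ⟨φ, h⟩
  · refine ⟨(starRingEnd ℂ).comp φ, ?_⟩
    rw [RingHom.comp_apply, h, map_neg, map_mul, Complex.conj_I, Complex.conj_ofReal]
    ring

lemma exists_coords (hl : 0 < l) (hK : Module.finrank ℚ K = 2) {σ : K →+* ℂ} (hσ : σ θ = Complex.I * (√(5 * l : ℝ) : ℝ)) (x : K) :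
    ∃ u v : ℚ, x = u + v * θ := by
  have hs : √(5 * l : ℝ) ≠ 0 := (Real.sqrt_pos.mpr (by have : (0:ℝ) < l := by exact_mod_cast hl
                                                       linarith)).ne'
  have hli : LinearIndependent ℚ ![(1:K), θ] := by
    rw [LinearIndependent.pair_iff]
    intro s t h
    have h1 := congrArg σ h
    simp only [Algebra.smul_def, map_add, map_mul, map_zero, eq_ratCast, map_ratCast, map_one, hσ] at h1
    have h2 := congrArg Complex.im h1
    have h3 := congrArg Complex.re h1
    simp only [Complex.add_im, Complex.mul_im, Complex.mul_re, Complex.add_re, Complex.I_re, Complex.I_im, Complex.ofReal_re,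
      Complex.ofReal_im, Complex.ratCast_re, Complex.ratCast_im, Complex.one_re, Complex.one_im, Complex.zero_im, Complex.zero_re] at h2 h3
    have ht : (t:ℝ) * √(5 * l : ℝ) = 0 := by linarith
    have ht' : (t:ℝ) = 0 := (mul_eq_zero.mp ht).resolve_right hs
    have hs' : (s:ℝ) = 0 := by linarith
    exact ⟨by exact_mod_cast hs', by exact_mod_cast ht'⟩
  have hsp := hli.span_eq_top_of_card_eq_finrank' (by simp [hK])
  have hx : x ∈ Submodule.span ℚ (Set.range ![(1:K), θ]) := by rw [hsp]; trivial
  rw [Matrix.range_cons, Matrix.range_cons, Matrix.range_empty, Set.union_empty, Set.singleton_union,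
    Submodule.mem_span_pair] at hx
  obtain ⟨u, v, h⟩ := hx
  refine ⟨u, v, ?_⟩
  rw [← h, Algebra.smul_def, Algebra.smul_def]; simp

lemma rat_int_of_isIntegral (q : ℚ) (h : IsIntegral ℤ (q : ℂ)) : ∃ m : ℤ, (m : ℚ) = q := by
  have h1 : IsIntegral ℤ q := by
    have : IsIntegral ℤ (algebraMap ℚ ℂ q) := by simpa using h
    exact (isIntegral_algebraMap_iff (algebraMap ℚ ℂ).injective).mp this
  obtain ⟨m, hm⟩ := IsIntegrallyClosed.isIntegral_iff.mp h1
  exact ⟨m, by simpa using hm⟩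

lemma rat_sq_int (D : ℕ) (hD : Squarefree D) (q : ℚ) (m : ℤ) (h : (m : ℚ) = D * q ^ 2) : ∃ n : ℤ, (n:ℚ) = q := by
  have hq : (q.den : ℚ) ≠ 0 := by exact_mod_cast q.den_ne_zero
  have h1 : (m : ℚ) * q.den ^ 2 = D * q.num ^ 2 := by
    rw [h]
    nth_rewrite 1 [← Rat.num_div_den q]
    field_simp
  have h2 : m * (q.den:ℤ) ^ 2 = D * q.num ^ 2 := by exact_mod_cast h1
  have h3 : ((q.den : ℤ)) ^ 2 ∣ D * q.num ^ 2 := ⟨m, by linarith⟩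
  have hc : IsCoprime ((q.den : ℤ) ^ 2) (q.num ^ 2) := by
    apply IsCoprime.pow
    rw [Int.isCoprime_iff_nat_coprime]
    exact q.reduced.symm
  have h4 : ((q.den : ℤ)) ^ 2 ∣ (D:ℤ) := hc.dvd_of_dvd_mul_right h3
  have h5 : q.den * q.den ∣ D := by rw [← pow_two]; exact_mod_cast h4
  have h6 : q.den = 1 := Nat.isUnit_iff.mp (hD _ h5)
  refine ⟨q.num, ?_⟩
  nth_rewrite 2 [← Rat.num_div_den q]
  rw [h6]; simp

lemma squarefree_five_mul (hl : l.Prime) (h5 : 5 < l) : Squarefree (5 * l) := by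
  rw [Nat.squarefree_mul_iff]
  refine ⟨?_, Nat.prime_five.squarefree, hl.squarefree⟩
  exact (Nat.coprime_primes Nat.prime_five hl).mpr (by omega)

lemma integer_rep (hl : l.Prime) (h5 : 5 < l) (hK : Module.finrank ℚ K = 2) {σ : K →+* ℂ} (hσ : σ θ = Complex.I * (√(5 * l : ℝ) : ℝ))
    (x : K) (hx : IsIntegral ℤ x) : ∃ U V W : ℤ, 2 * x = U + V * θ ∧ U ^ 2 + 5 * l * V ^ 2 = 4 * W := by
  obtain ⟨u, v, rfl⟩ := exists_coords hl.pos hK hσ x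
  have hi1 : IsIntegral ℤ (σ (u + v * θ)) := hx.map σ.toIntAlgHom
  have hi2 : IsIntegral ℤ (starRingEnd ℂ (σ (u + v * θ))) := hi1.map (starRingEnd ℂ).toIntAlgHom
  have e1 : σ (u + v * θ) = u + v * (Complex.I * (√(5 * l : ℝ) : ℝ)) := by
    rw [map_add, map_mul, map_ratCast, map_ratCast, hσ]
  have e2 : starRingEnd ℂ (σ (u + v * θ)) = u - v * (Complex.I * (√(5 * l : ℝ) : ℝ)) := by
    rw [e1, map_add, map_mul, map_ratCast, map_ratCast, map_mul, Complex.conj_I, Complex.conj_ofReal]; ring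
  have hsq : (Complex.I * (√(5 * l : ℝ) : ℝ)) ^ 2 = -(5 * l : ℂ) := by
    rw [mul_pow, Complex.I_sq, ← Complex.ofReal_pow, Real.sq_sqrt (by positivity)]
    push_cast; ring
  obtain ⟨U, hU⟩ := rat_int_of_isIntegral (2 * u) (by
    have := hi1.add hi2
    rw [e2, e1] at this
    have e : ((2 * u : ℚ) : ℂ) = (u + v * (Complex.I * (√(5 * l : ℝ) : ℝ))) + (u - v * (Complex.I * (√(5 * l : ℝ) : ℝ))) := by
      push_cast; ring
    rw [e]; exact this)
  obtain ⟨W, hW⟩ := rat_int_of_isIntegral (u ^ 2 + 5 * l * v ^ 2) (by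
    have := hi1.mul hi2
    rw [e2, e1] at this
    have e : ((u ^ 2 + 5 * l * v ^ 2 : ℚ) : ℂ) = (u + v * (Complex.I * (√(5 * l : ℝ) : ℝ))) * (u - v * (Complex.I * (√(5 * l : ℝ) : ℝ))) := by
      push_cast; linear_combination (v:ℂ) ^ 2 * hsq
    rw [e]; exact this)
  obtain ⟨V, hV⟩ := rat_sq_int (5 * l) (squarefree_five_mul hl h5) (2 * v) (4 * W - U ^ 2) (by
    push_cast
    rw [hU, hW]; ring)
  refine ⟨U, V, W, ?_, ?_⟩
  · have hUK : (U : K) = 2 * u := by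
      have := congrArg (Rat.cast : ℚ → K) hU
      push_cast at this; exact this
    have hVK : (V : K) = 2 * v := by
      have := congrArg (Rat.cast : ℚ → K) hV
      push_cast at this; exact this
    rw [hUK, hVK]; ring
  · have : (U ^ 2 + 5 * l * V ^ 2 : ℚ) = 4 * W := by
      rw [hU, hV, hW]; ring
    exact_mod_cast this

/-- data for the ring of integers -/
structure OData (O : Type*) [CommRing O] (l : ℕ) (t : O) (σ : O →+* ℂ) : Prop where
  inj : Function.Injective σ
  theta : σ t = Complex.I * (√(5 * l : ℝ) : ℝ)
  rep : ∀ x : O, ∃ U V W : ℤ, 2 * x = U + V * t ∧ U ^ 2 + 5 * l * V ^ 2 = 4 * W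
  omega : l % 4 = 3 → ∃ ω : O, 2 * ω = 1 + t
  basis : ∀ L : AddSubgroup O, (∃ z ∈ L, z ≠ 0) → (∀ z ∈ L, t * z ∈ L) → ∃ v w : O, L = lat v w ∧
    ∀ m n : ℤ, (m : O) * v + n * w = 0 → m = 0 ∧ n = 0

lemma exists_odata (hl : l.Prime) (h5 : 5 < l) (hθ : θ ^ 2 = -((5 * l : ℕ) : K)) (hK : Module.finrank ℚ K = 2) :
    ∃ (t : 𝓞 K) (σ : 𝓞 K →+* ℂ), OData (𝓞 K) l t σ := by
  obtain ⟨σ, hσ⟩ := exists_sigma hθ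
  have hThetaInt : IsIntegral ℤ θ := by
    refine IsIntegral.of_pow (n := 2) (by norm_num) ?_
    rw [hθ]
    have := isIntegral_algebraMap (R := ℤ) (A := K) (x := -((5 * l : ℕ) : ℤ))
    simpa using this
  set t : 𝓞 K := ⟨θ, hThetaInt⟩ with ht
  have htc : algebraMap (𝓞 K) K t = θ := rfl
  have hinj : Function.Injective (algebraMap (𝓞 K) K) := NumberField.RingOfIntegers.coe_injective
  refine ⟨t, σ.comp (algebraMap (𝓞 K) K), ?_, ?_, ?_, ?_, ?_⟩
  · exact σ.injective.comp hinj
  · rw [RingHom.comp_apply, htc, hσ]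
  · intro x
    obtain ⟨U, V, W, h1, h2⟩ := integer_rep hl h5 hK hσ (algebraMap (𝓞 K) K x) x.2
    refine ⟨U, V, W, ?_, h2⟩
    apply hinj
    simp only [map_mul, map_add, map_intCast, map_ofNat, htc]
    exact h1
  · intro hl4
    obtain ⟨m, hm⟩ : ∃ m : ℕ, 4 * m = 5 * l + 1 := ⟨(5 * l + 1) / 4, by omega⟩
    have h4 : (4 * m : K) = 5 * l + 1 := by
      exact_mod_cast congrArg (Nat.cast : ℕ → K) hm
    have hω : IsIntegral ℤ ((1 + θ) / 2) := by
      refine ⟨Polynomial.X ^ 2 - Polynomial.X + Polynomial.C (m : ℤ), by monicity!, ?_⟩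
      simp only [Polynomial.eval₂_add, Polynomial.eval₂_sub, Polynomial.eval₂_pow, Polynomial.eval₂_X, Polynomial.eval₂_C]
      rw [map_natCast]
      push_cast at hθ
      linear_combination (1/4) * h4 + (1/4) * hθ
    obtain ⟨ω, hω'⟩ : ∃ ω : 𝓞 K, algebraMap (𝓞 K) K ω = (1 + θ) / 2 := ⟨⟨_, hω⟩, rfl⟩
    refine ⟨ω, ?_⟩
    apply hinj
    rw [map_mul, map_add, map_one, map_ofNat, htc, hω']
    ring
  · rintro L ⟨z, hz, hz0⟩ hst
    set M : Submodule ℤ (𝓞 K) := AddSubgroup.toIntSubmodule L with hM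
    have hfin : Module.finrank ℤ M = 2 := by
      apply le_antisymm
      · have h1 := Submodule.finrank_le M
        rw [NumberField.RingOfIntegers.rank, hK] at h1
        exact h1
      · have hli : LinearIndependent ℤ ![(⟨z, hz⟩ : M), ⟨t * z, hst z hz⟩] := by
          rw [LinearIndependent.pair_iff]
          intro p q h
          have h1 : (p : 𝓞 K) * z + q * (t * z) = 0 := by
            have := congrArg Subtype.val h
            simpa using this
          have h2 : (p : 𝓞 K) + q * t = 0 := by
            apply mul_right_cancel₀ hz0
            linear_combination h1
          have h3 := congrArg (σ.comp (algebraMap (𝓞 K) K)) h2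
          simp only [map_add, map_mul, map_intCast, map_zero] at h3
          rw [RingHom.comp_apply, htc, hσ] at h3
          have h4 := congrArg Complex.im h3
          have h5' := congrArg Complex.re h3
          simp at h4 h5'
          refine ⟨h5', ?_⟩
          rcases h4 with h4 | h4
          · exact h4
          · omega
        have := hli.fintype_card_le_finrank
        simpa using this
    let b : Module.Basis (Fin 2) ℤ M := Module.finBasisOfFinrankEq ℤ M hfin
    refine ⟨b 0, b 1, ?_, ?_⟩
    · apply le_antisymm
      · intro y hy
        have := b.sum_repr ⟨y, hy⟩
        rw [Fin.sum_univ_two] at this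
        refine mem_lat.mpr ⟨b.repr ⟨y, hy⟩ 0, b.repr ⟨y, hy⟩ 1, ?_⟩
        have h2 := congrArg Subtype.val this
        simpa using h2
      · exact lat_le (b 0).2 (b 1).2
    · intro m n h
      have hli := b.linearIndependent
      have e : (b : Fin 2 → M) = ![b 0, b 1] := by ext i; fin_cases i <;> rfl
      rw [e, LinearIndependent.pair_iff] at hli
      apply hli m n
      apply Subtype.ext
      simpa using h

end

end HQ
end

section
namespace HQ
open PowerSeries Filter Topology UpperHalfPlane
open scoped MatrixGroups ModularForm Manifold NumberField

section
variable {O : Type*} [CommRing O] {t : O} {σ : O →+* ℂ} {l : ℕ}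

lemma OData.unit [IsDomain O] [CharZero O] (hd : OData O l t σ) (hl : 0 < l) {u u' : O} (h : u * u' = 1) : u = 1 ∨ u = -1 := by
  have key : ∀ (x : O) (U V W : ℤ), 2 * x = U + V * t → U ^ 2 + 5 * l * V ^ 2 = 4 * W → Complex.normSq (σ x) = W := by
    intro x U V W h1 h2
    have h3 := congrArg σ h1
    simp only [map_mul, map_add, map_intCast, map_ofNat, hd.theta] at h3
    have h4 := congrArg Complex.normSq h3
    have hs : √(5 * l : ℝ) * √(5 * l : ℝ) = 5 * l := Real.mul_self_sqrt (by positivity)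
    have e1 : Complex.normSq ((U : ℂ) + V * (Complex.I * (√(5 * l : ℝ) : ℝ))) = U ^ 2 + 5 * l * V ^ 2 := by
      generalize √(5 * l : ℝ) = ρ at hs
      rw [Complex.normSq_apply]
      simp
      linear_combination (V:ℝ)^2 * hs
    rw [e1, map_mul] at h4
    have e2 : Complex.normSq (2:ℂ) = 4 := by
      rw [Complex.normSq_ofNat]; norm_num
    rw [e2] at h4
    have h5 : (U ^ 2 + 5 * l * V ^ 2 : ℝ) = 4 * W := by exact_mod_cast h2
    linarith
  obtain ⟨U, V, W, h1, h2⟩ := hd.rep u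
  obtain ⟨U', V', W', h1', h2'⟩ := hd.rep u'
  have k1 := key u U V W h1 h2
  have k2 := key u' U' V' W' h1' h2'
  have k3 : (W * W' : ℝ) = 1 := by
    rw [← k1, ← k2, ← map_mul, ← map_mul, h]; simp
  have k4 : W * W' = 1 := by exact_mod_cast k3
  have k5 : 0 ≤ W := by nlinarith [sq_nonneg U, sq_nonneg V, mul_nonneg (by positivity : (0:ℤ) ≤ 5 * l) (sq_nonneg V)]
  have k6 : W = 1 := by
    rcases Int.mul_eq_one_iff_eq_one_or_neg_one.mp k4 with h | h
    · exact h.1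
    · omega
  subst k6
  have hV : V = 0 := by
    by_contra hV
    have : 0 < V ^ 2 := by positivity
    have hl' : (0:ℤ) < l := by exact_mod_cast hl
    nlinarith [sq_nonneg U]
  subst hV
  have hU : (U - 2) * (U + 2) = 0 := by linarith
  have h20 : (2:O) ≠ 0 := two_ne_zero
  rcases mul_eq_zero.mp hU with h | h
  · left
    have : U = 2 := by linarith
    subst this
    apply mul_left_cancel₀ h20
    rw [h1]; simp
  · right
    have : U = -2 := by linarith
    subst this
    apply mul_left_cancel₀ h20
    rw [h1]; simp

/-- stable subgroups generating a given ideal -/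
def Lset (t : O) (I : Ideal O) : Set (AddSubgroup O) := {L | (∀ z ∈ L, t * z ∈ L) ∧ Ideal.span (L : Set O) = I}

lemma span_map (L : AddSubgroup O) (x : O) :
    Ideal.span ((L.map (AddMonoidHom.mulLeft x) : AddSubgroup O) : Set O) = Ideal.span {x} * Ideal.span (L : Set O) := by
  rw [Ideal.span_mul_span', Set.singleton_mul]
  rfl

lemma OData.rep_of_stable [IsDomain O] [CharZero O] (hd : OData O l t σ) (hl : 0 < l) {L : AddSubgroup O}
    (h0 : ∃ z ∈ L, z ≠ 0) (hst : ∀ z ∈ L, t * z ∈ L) : ∃ τ, Rep t σ l L τ := by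
  obtain ⟨v, w, rfl, hi⟩ := hd.basis L h0 hst
  exact rep_exists hl hd.inj hd.theta hi hst

lemma Lset_ne_bot {I : Ideal O} (hI : I ≠ ⊥) {L : AddSubgroup O} (hL : L ∈ Lset t I) : ∃ z ∈ L, z ≠ 0 := by
  by_contra h
  push Not at h
  apply hI
  rw [← hL.2, Ideal.span_eq_bot]
  exact h

lemma OData.card [IsDedekindDomain O] [CharZero O] [Fintype (ClassGroup O)] (hd : OData O l t σ) (hl : l.Prime) (h5 : 5 < l)
    (f : ℕ) (hf0 : f ≠ 0) (hf : ∀ I : Ideal O, I ≠ ⊥ → Nat.card (Lset t I) = f) :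
    {z : ℂ | ∃ τ a b c, CM l τ a b c (-a) ∧ tt τ = z}.ncard = Fintype.card (ClassGroup O) * f := by
  have h5l : ¬ 5 ∣ l := by
    intro h
    have := (Nat.prime_dvd_prime_iff_eq Nat.prime_five hl).mp h
    omega
  choose I hI using (ClassGroup.mk0_surjective (R := O))
  have hI0 : ∀ g, (I g : Ideal O) ≠ ⊥ := fun g => nonZeroDivisors.coe_ne_zero (I g)
  have hfin : ∀ g, Finite (Lset t (I g : Ideal O)) := fun g =>
    Nat.finite_of_card_ne_zero (by rw [hf _ (hI0 g)]; exact hf0)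
  have hrep : ∀ (p : Σ g, Lset t (I g : Ideal O)), ∃ τ, Rep t σ l p.2.1 τ := by
    rintro ⟨g, L, hL⟩
    exact hd.rep_of_stable hl.pos (Lset_ne_bot (hI0 g) hL) hL.1
  choose T hT using hrep
  let Ψ : (Σ g, Lset t (I g : Ideal O)) → {z : ℂ | ∃ τ a b c, CM l τ a b c (-a) ∧ tt τ = z} := fun p =>
    ⟨tt (T p), by
      obtain ⟨a, b, c, h⟩ := (hT p).cm hd.inj
      exact ⟨T p, a, b, c, h, rfl⟩⟩
  have hinj : Function.Injective Ψ := by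
    intro p p' hpp
    have h1 : tt (T p) = tt (T p') := congrArg Subtype.val hpp
    obtain ⟨x, y, hx, hy, hxy⟩ := (hT p).homothety hd.inj (hT p') h1
    obtain ⟨g, L, hL⟩ := p
    obtain ⟨g', L', hL'⟩ := p'
    simp only at hxy
    have h2 := congrArg (fun M : AddSubgroup O => Ideal.span (M : Set O)) hxy
    simp only [span_map, hL.2, hL'.2] at h2
    have hg : g = g' := by
      rw [← hI g, ← hI g', ClassGroup.mk0_eq_mk0_iff]
      exact ⟨x, y, hx, hy, h2⟩
    subst hg
    have h3 : Ideal.span {x} = Ideal.span {y} := mul_right_cancel₀ (hI0 g) h2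
    rw [Ideal.span_singleton_eq_span_singleton] at h3
    obtain ⟨u, hu⟩ := h3
    have hLL : L = L' := by
      ext z
      have hm : ∀ (M : AddSubgroup O) z, x * z ∈ M.map (AddMonoidHom.mulLeft x) ↔ z ∈ M := by
        intro M z
        constructor
        · rintro ⟨z', hz', h⟩
          have : z' = z := mul_left_cancel₀ hx h
          exact this ▸ hz'
        · intro h; exact ⟨z, h, rfl⟩
      have hm' : ∀ (M : AddSubgroup O) z, x * z ∈ M.map (AddMonoidHom.mulLeft y) ↔ z ∈ M := by
        intro M z
        rcases hd.unit hl.pos (u.mul_inv) with h | h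
        · rw [h, mul_one] at hu
          rw [← hu]; exact hm M z
        · rw [h] at hu
          have hyx : y = -x := by rw [← hu]; ring
          rw [← hm M z]
          have e : M.map (AddMonoidHom.mulLeft y) = M.map (AddMonoidHom.mulLeft x) := by
            ext a
            constructor
            · rintro ⟨b, hb, rfl⟩
              exact ⟨-b, M.neg_mem hb, by simp [hyx]⟩
            · rintro ⟨b, hb, rfl⟩
              exact ⟨-b, M.neg_mem hb, by simp [hyx]⟩
          rw [e]
      rw [← hm L z, hxy, hm' L' z]
    subst hLL
    rfl
  have hsurj : Function.Surjective Ψ := by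
    rintro ⟨z, τ, a, b, c, h, rfl⟩
    obtain ⟨L, hL⟩ := rep_of_cm hl hd.inj hd.theta h
    set J : Ideal O := Ideal.span (L : Set O) with hJ
    have hJ0 : J ≠ ⊥ := by
      obtain ⟨z, hz, hz0⟩ := hL.ne_bot
      intro h
      exact hz0 (Ideal.span_eq_bot.mp h z hz)
    set J' : nonZeroDivisors (Ideal O) := ⟨J, mem_nonZeroDivisors_of_ne_zero hJ0⟩ with hJ'
    obtain ⟨x, y, hx, hy, hxy⟩ := (ClassGroup.mk0_eq_mk0_iff (I := J') (J := I (ClassGroup.mk0 J'))).mp (hI _).symm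
    set g := ClassGroup.mk0 J'
    set L' : AddSubgroup O := (L.map (AddMonoidHom.mulLeft x)).comap (AddMonoidHom.mulLeft y) with hL'
    have hmap : L'.map (AddMonoidHom.mulLeft y) = L.map (AddMonoidHom.mulLeft x) := by
      apply le_antisymm
      · rintro _ ⟨z, hz, rfl⟩
        exact hz
      · rintro _ ⟨z, hz, rfl⟩
        have h1 : x * z ∈ Ideal.span {y} * (I g : Ideal O) := by
          rw [← hxy]
          exact Ideal.mul_mem_mul (Ideal.mem_span_singleton_self x) (Ideal.subset_span hz)
        obtain ⟨w, hw, hw'⟩ := Ideal.mem_span_singleton_mul.mp h1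
        refine ⟨w, ?_, hw'⟩
        exact ⟨z, hz, hw'.symm⟩
    have hL'm : L' ∈ Lset t (I g : Ideal O) := by
      refine ⟨?_, ?_⟩
      · rintro z ⟨z', hz', h⟩
        refine ⟨t * z', hL.stable _ hz', ?_⟩
        change x * z' = y * z at h
        change x * (t * z') = y * (t * z)
        linear_combination t * h
      · have h2 := congrArg (fun M : AddSubgroup O => Ideal.span (M : Set O)) hmap
        simp only [span_map] at h2
        apply mul_left_cancel₀ (a := Ideal.span {y})
        · rw [Ne, Ideal.zero_eq_bot, Ideal.span_singleton_eq_bot]; exact hy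
        · rw [h2]; exact hxy
    refine ⟨⟨g, L', hL'm⟩, ?_⟩
    apply Subtype.ext
    exact (hT _).tt_eq hd.inj h5l hL hy hx hmap
  rw [← Nat.card_coe_set_eq, ← Nat.card_congr (Equiv.ofBijective Ψ ⟨hinj, hsurj⟩), Nat.card_sigma]
  simp [hf _ (hI0 _)]

lemma OData.f1 [IsDomain O] [CharZero O] (hd : OData O l t σ) (h4 : l % 4 = 1) (I : Ideal O) : Nat.card (Lset t I) = 1 := by
  have hO : ∀ x : O, ∃ m n : ℤ, x = m + n * t := by
    intro x
    obtain ⟨U, V, W, h1, h2⟩ := hd.rep x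
    have hmod : (U ^ 2 + V ^ 2) % 4 = 0 := by
      obtain ⟨k, hk⟩ : ∃ k : ℤ, (l:ℤ) = 4 * k + 1 := ⟨l / 4, by omega⟩
      rw [hk] at h2
      have : U ^ 2 + V ^ 2 = 4 * (W - V^2 - 5 * k * V ^ 2) := by linarith
      omega
    have hUV : (∃ a, U = 2 * a) ∧ ∃ b, V = 2 * b := by
      rcases Int.even_or_odd' U with ⟨a, ha | ha⟩ <;> rcases Int.even_or_odd' V with ⟨b, hb | hb⟩
      · exact ⟨⟨a, ha⟩, b, hb⟩
      all_goals
        exfalso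
        subst ha hb
        ring_nf at hmod
        omega
    obtain ⟨⟨a, rfl⟩, b, rfl⟩ := hUV
    refine ⟨a, b, ?_⟩
    apply mul_left_cancel₀ (two_ne_zero : (2:O) ≠ 0)
    rw [h1]; push_cast; ring
  have : Lset t I = {Submodule.toAddSubgroup I} := by
    ext L
    rw [Set.mem_singleton_iff]
    constructor
    · rintro ⟨h1, h2⟩
      have hmul : ∀ (x z : O), z ∈ L → x * z ∈ L := by
        intro x z hz
        obtain ⟨m, n, rfl⟩ := hO x
        have e : ((m:O) + n * t) * z = m • z + n • (t * z) := by simp [zsmul_eq_mul]; ring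
        rw [e]
        exact L.add_mem (L.zsmul_mem hz _) (L.zsmul_mem (h1 z hz) _)
      let L' : Ideal O := { carrier := L, add_mem' := L.add_mem, zero_mem' := L.zero_mem, smul_mem' := fun x z hz => hmul x z hz }
      have : Ideal.span (L : Set O) = L' := Ideal.span_eq L'
      rw [this] at h2
      subst h2
      rfl
    · rintro rfl
      exact ⟨fun z hz => I.mul_mem_left t hz, Ideal.span_eq I⟩
  rw [this]
  simp


/-- the finite condition modulo 2 -/
def PP (p q r s : ZMod 2) (S : Finset (ZMod 2 × ZMod 2)) : Prop :=
  0 ∈ S ∧ (∀ a ∈ S, ∀ b ∈ S, a + b ∈ S) ∧ ∀ x : ZMod 2 × ZMod 2, ∃ a ∈ S, ∃ b ∈ S,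
    x = (a.1 + (p * b.1 + q * b.2), a.2 + (r * b.1 + s * b.2))

instance (p q r s : ZMod 2) : DecidablePred (PP p q r s) := fun S => by unfold PP; infer_instance

set_option maxRecDepth 100000 in
lemma PP_card0 : ∀ p q r s : ZMod 2, p + s = 1 → p * s - q * r = 0 → (Finset.univ.filter (PP p q r s)).card = 2 := by
  decide

set_option maxRecDepth 100000 in
lemma PP_card1 : ∀ p q r s : ZMod 2, p + s = 1 → p * s - q * r = 1 → (Finset.univ.filter (PP p q r s)).card = 4 := by
  decide

end
end HQ
end

section
namespace HQ
open PowerSeries Filter Topology UpperHalfPlane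
open scoped MatrixGroups ModularForm Manifold NumberField

section
variable {O : Type*} [CommRing O] {t : O} {σ : O →+* ℂ} {l : ℕ}

/-- reduction mod two of a subgroup -/
noncomputable def redF (v w : O) (L : AddSubgroup O) : Finset (ZMod 2 × ZMod 2) :=
  open Classical in Finset.univ.filter (fun x => ∃ m n : ℤ, (m : ZMod 2) = x.1 ∧ (n : ZMod 2) = x.2 ∧ (m : O) * v + n * w ∈ L)

lemma mem_redF {v w : O} {L : AddSubgroup O} {x : ZMod 2 × ZMod 2} :
    x ∈ redF v w L ↔ ∃ m n : ℤ, (m : ZMod 2) = x.1 ∧ (n : ZMod 2) = x.2 ∧ (m : O) * v + n * w ∈ L := by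
  unfold redF; simp

lemma zmod2_sub {m m' : ℤ} (h : (m : ZMod 2) = m') : ∃ a, m = m' + 2 * a := by
  have := (ZMod.intCast_eq_intCast_iff_dvd_sub m' m 2).mp h.symm
  obtain ⟨a, ha⟩ := this
  exact ⟨a, by push_cast at ha; linarith⟩

lemma zmod2_lift (x : ZMod 2) : ∃ m : ℤ, (m : ZMod 2) = x := ZMod.intCast_surjective x

lemma mem_redF_iff {v w : O} {L : AddSubgroup O} (h2 : ∀ z ∈ lat v w, 2 * z ∈ L) (m n : ℤ) :
    ((m : ZMod 2), (n : ZMod 2)) ∈ redF v w L ↔ (m : O) * v + n * w ∈ L := by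
  rw [mem_redF]
  constructor
  · rintro ⟨m', n', h, h', hL⟩
    obtain ⟨a, rfl⟩ := zmod2_sub h.symm
    obtain ⟨b, rfl⟩ := zmod2_sub h'.symm
    have := L.add_mem hL (h2 (a * v + b * w) (mem_lat.mpr ⟨a, b, rfl⟩))
    have e : ((m' + 2 * a : ℤ) : O) * v + ((n' + 2 * b : ℤ) : O) * w = (m' : O) * v + n' * w + 2 * (a * v + b * w) := by
      push_cast; ring
    rw [e]; exact this
  · intro h
    exact ⟨m, n, rfl, rfl, h⟩

/-- the inverse construction -/
def redG (v w : O) {p q r s : ZMod 2} (S : Finset (ZMod 2 × ZMod 2)) (hS : PP p q r s S) : AddSubgroup O where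
  carrier := {z | ∃ m n : ℤ, z = (m : O) * v + n * w ∧ ((m : ZMod 2), (n : ZMod 2)) ∈ S}
  zero_mem' := ⟨0, 0, by simp, by simp only [Int.cast_zero]; exact hS.1⟩
  add_mem' := by
    rintro _ _ ⟨m, n, rfl, h⟩ ⟨m', n', rfl, h'⟩
    refine ⟨m + m', n + n', by push_cast; ring, ?_⟩
    have := hS.2.1 _ h _ h'
    simpa using this
  neg_mem' := by
    rintro _ ⟨m, n, rfl, h⟩
    refine ⟨-m, -n, by push_cast; ring, ?_⟩
    simpa using h

lemma count3 {ω v w : O} {I : Ideal O} (hI : Submodule.toAddSubgroup I = lat v w)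
    (hi : ∀ m n : ℤ, (m : O) * v + n * w = 0 → m = 0 ∧ n = 0)
    (hω : 2 * ω = 1 + t) (μ : ℤ) (hω2 : ω ^ 2 = ω - μ) (hO : ∀ x : O, ∃ a b : ℤ, x = a + b * ω)
    {p q r s : ℤ} (h1 : ω * v = p * v + r * w) (h2 : ω * w = q * v + s * w) :
    Nat.card (Lset t I) = (Finset.univ.filter (PP (p : ZMod 2) q r s)).card := by
  have hi' : ∀ m n m' n' : ℤ, (m : O) * v + n * w = m' * v + n' * w → m = m' ∧ n = n' := by
    intro m n m' n' h
    have := hi (m - m') (n - n') (by push_cast; linear_combination h)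
    omega
  have memI : ∀ z, z ∈ I ↔ z ∈ lat v w := by
    intro z; rw [← hI]; rfl
  have hLI : ∀ L ∈ Lset t I, ∀ z ∈ L, z ∈ lat v w := by
    intro L hL z hz
    rw [← memI, ← hL.2]
    exact Ideal.subset_span hz
  have hdec : ∀ L ∈ Lset t I, ∀ z ∈ lat v w, ∃ y ∈ L, ∃ y' ∈ L, z = y + ω * y' := by
    intro L hL z hz
    rw [← memI, ← hL.2] at hz
    induction hz using Submodule.span_induction with
    | mem x hx => exact ⟨x, hx, 0, L.zero_mem, by simp⟩
    | zero => exact ⟨0, L.zero_mem, 0, L.zero_mem, by simp⟩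
    | add x y _ _ hx hy =>
      obtain ⟨a, ha, b, hb, rfl⟩ := hx
      obtain ⟨c, hc, d, hd, rfl⟩ := hy
      exact ⟨a + c, L.add_mem ha hc, b + d, L.add_mem hb hd, by ring⟩
    | smul x y _ hy =>
      obtain ⟨a, ha, b, hb, rfl⟩ := hy
      obtain ⟨i, j, rfl⟩ := hO x
      refine ⟨i • a - (j * μ) • b, L.sub_mem (L.zsmul_mem ha _) (L.zsmul_mem hb _), i • b + j • a + j • b,
        L.add_mem (L.add_mem (L.zsmul_mem hb _) (L.zsmul_mem ha _)) (L.zsmul_mem hb _), ?_⟩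
      simp only [zsmul_eq_mul, smul_eq_mul]
      push_cast
      linear_combination (j * b) * hω2
  have h2L : ∀ L ∈ Lset t I, ∀ z ∈ lat v w, 2 * z ∈ L := by
    intro L hL z hz
    obtain ⟨y, hy, y', hy', rfl⟩ := hdec L hL z hz
    have e : 2 * (y + ω * y') = y + y + (y' + t * y') := by linear_combination y' * hω
    rw [e]
    exact L.add_mem (L.add_mem hy hy) (L.add_mem hy' (hL.1 _ hy'))
  have hF : ∀ L ∈ Lset t I, PP (p : ZMod 2) q r s (redF v w L) := by
    intro L hL
    refine ⟨mem_redF.mpr ⟨0, 0, by simp⟩, ?_, ?_⟩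
    · intro a ha b hb
      obtain ⟨m, n, e1, e2, h⟩ := mem_redF.mp ha
      obtain ⟨m', n', e1', e2', h'⟩ := mem_redF.mp hb
      refine mem_redF.mpr ⟨m + m', n + n', by simp [e1, e1'], by simp [e2, e2'], ?_⟩
      have := L.add_mem h h'
      have e : ((m + m' : ℤ) : O) * v + ((n + n' : ℤ) : O) * w = (m : O) * v + n * w + (m' * v + n' * w) := by
        push_cast; ring
      rw [e]; exact this
    · rintro ⟨x1, x2⟩
      obtain ⟨m, rfl⟩ := zmod2_lift x1
      obtain ⟨n, rfl⟩ := zmod2_lift x2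
      obtain ⟨y, hy, y', hy', h⟩ := hdec L hL (m * v + n * w) (mem_lat.mpr ⟨m, n, rfl⟩)
      obtain ⟨m1, n1, rfl⟩ := mem_lat.mp (hLI L hL y hy)
      obtain ⟨m2, n2, rfl⟩ := mem_lat.mp (hLI L hL y' hy')
      refine ⟨(m1, n1), mem_redF.mpr ⟨m1, n1, rfl, rfl, hy⟩, (m2, n2), mem_redF.mpr ⟨m2, n2, rfl, rfl, hy'⟩, ?_⟩
      obtain ⟨e1, e2⟩ := hi' m n (m1 + (p * m2 + q * n2)) (n1 + (r * m2 + s * n2)) (by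
        push_cast
        linear_combination h + m2 * h1 + n2 * h2)
      rw [e1, e2]
      push_cast
      rfl
  have hG : ∀ S (hS : PP (p : ZMod 2) q r s S), redG v w S hS ∈ Lset t I := by
    intro S hS
    refine ⟨?_, ?_⟩
    · rintro _ ⟨m, n, rfl, h⟩
      refine ⟨2 * (p * m + q * n) - m, 2 * (r * m + s * n) - n, ?_, ?_⟩
      · push_cast
        linear_combination -(m * v + n * w) * hω + 2 * m * h1 + 2 * n * h2
      · have h20 : (2 : ZMod 2) = 0 := rfl
        push_cast
        rw [h20]
        simpa using h
    · apply le_antisymm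
      · rw [Ideal.span_le]
        rintro _ ⟨m, n, rfl, h⟩
        exact (memI _).mpr (mem_lat.mpr ⟨m, n, rfl⟩)
      · intro z hz
        obtain ⟨m, n, rfl⟩ := mem_lat.mp ((memI z).mp hz)
        obtain ⟨⟨a1, a2⟩, ha, ⟨b1, b2⟩, hb, hab⟩ := hS.2.2 (m, n)
        obtain ⟨a1, rfl⟩ := zmod2_lift a1
        obtain ⟨a2, rfl⟩ := zmod2_lift a2
        obtain ⟨b1, rfl⟩ := zmod2_lift b1
        obtain ⟨b2, rfl⟩ := zmod2_lift b2
        rw [Prod.mk.injEq] at hab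
        obtain ⟨c, hc⟩ := zmod2_sub (m := m) (m' := a1 + (p * b1 + q * b2)) (by push_cast; exact hab.1)
        obtain ⟨d, hd⟩ := zmod2_sub (m := n) (m' := a2 + (r * b1 + s * b2)) (by push_cast; exact hab.2)
        have ya : (a1 : O) * v + a2 * w ∈ redG v w S hS := ⟨a1, a2, rfl, ha⟩
        have yb : (b1 : O) * v + b2 * w ∈ redG v w S hS := ⟨b1, b2, rfl, hb⟩
        have yc : ((2 * c : ℤ) : O) * v + (2 * d : ℤ) * w ∈ redG v w S hS := ⟨2 * c, 2 * d, rfl, by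
          have h20 : (2 : ZMod 2) = 0 := rfl
          push_cast
          rw [h20]
          simp only [zero_mul]; exact hS.1⟩
        have e : (m : O) * v + n * w = (a1 * v + a2 * w) + ω * (b1 * v + b2 * w) + (((2 * c : ℤ) : O) * v + (2 * d : ℤ) * w) := by
          rw [hc, hd]; push_cast
          linear_combination -(b1:O) * h1 - (b2:O) * h2
        rw [e]
        exact Ideal.add_mem _ (Ideal.add_mem _ (Ideal.subset_span ya) (Ideal.mul_mem_left _ _ (Ideal.subset_span yb)))
          (Ideal.subset_span yc)
  have e : Lset t I ≃ {S : Finset (ZMod 2 × ZMod 2) // PP (p : ZMod 2) q r s S} :=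
    { toFun := fun L => ⟨redF v w L.1, hF L.1 L.2⟩
      invFun := fun S => ⟨redG v w S.1 S.2, hG S.1 S.2⟩
      left_inv := by
        rintro ⟨L, hL⟩
        apply Subtype.ext
        ext z
        constructor
        · rintro ⟨m, n, rfl, h⟩
          exact (mem_redF_iff (h2L L hL) m n).mp h
        · intro h
          obtain ⟨m, n, rfl⟩ := mem_lat.mp (hLI L hL z h)
          exact ⟨m, n, rfl, (mem_redF_iff (h2L L hL) m n).mpr h⟩
      right_inv := by
        rintro ⟨S, hS⟩
        apply Subtype.ext
        ext ⟨x1, x2⟩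
        change _ ∈ redF v w (redG v w S hS) ↔ _
        rw [mem_redF]
        constructor
        · rintro ⟨m, n, rfl, rfl, m', n', h, h'⟩
          obtain ⟨rfl, rfl⟩ := hi' _ _ _ _ h
          exact h'
        · intro h
          obtain ⟨m, rfl⟩ := zmod2_lift x1
          obtain ⟨n, rfl⟩ := zmod2_lift x2
          exact ⟨m, n, rfl, rfl, m, n, rfl, h⟩ }
  rw [Nat.card_congr e, Nat.card_eq_fintype_card, Fintype.card_subtype]

lemma OData.f3 [IsDomain O] [CharZero O] (hd : OData O l t σ) (hl : 0 < l) (h4 : l % 4 = 3) (I : Ideal O) (hI : I ≠ ⊥) :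
    Nat.card (Lset t I) = if l % 8 = 3 then 2 else 4 := by
  obtain ⟨ω, hω⟩ := hd.omega h4
  obtain ⟨μ, hμ⟩ : ∃ μ : ℤ, 4 * μ = 5 * l + 1 := ⟨(5 * l + 1) / 4, by omega⟩
  have ht2 := theta_sq hd.inj hd.theta
  have hμO : 4 * (μ : O) = 5 * l + 1 := by exact_mod_cast congrArg (Int.cast : ℤ → O) hμ
  have h20 : (2:O) ≠ 0 := two_ne_zero
  have hω2 : ω ^ 2 = ω - μ := by
    apply mul_left_cancel₀ h20
    apply mul_left_cancel₀ h20
    linear_combination (2 * ω + t - 1) * hω + ht2 + hμO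
  have hO : ∀ x : O, ∃ a b : ℤ, x = a + b * ω := by
    intro x
    obtain ⟨U, V, W, h1, h2⟩ := hd.rep x
    have hUV : ∃ a, U = V + 2 * a := by
      obtain ⟨k, hk⟩ : ∃ k : ℤ, (l:ℤ) = 4 * k + 3 := ⟨l / 4, by omega⟩
      rw [hk] at h2
      have hmod : U ^ 2 + 15 * V ^ 2 = 4 * (W - 5 * k * V ^ 2) := by linarith
      rcases Int.even_or_odd' U with ⟨a, ha | ha⟩ <;> rcases Int.even_or_odd' V with ⟨b, hb | hb⟩
      · exact ⟨a - b, by omega⟩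
      · exfalso; subst ha hb; ring_nf at hmod; omega
      · exfalso; subst ha hb; ring_nf at hmod; omega
      · exact ⟨a - b, by omega⟩
    obtain ⟨a, rfl⟩ := hUV
    refine ⟨a, V, ?_⟩
    apply mul_left_cancel₀ h20
    push_cast at h1
    linear_combination h1 - V * hω
  obtain ⟨z, hz, hz0⟩ := Submodule.exists_mem_ne_zero_of_ne_bot hI
  obtain ⟨v, w, hvw, hi⟩ := hd.basis (Submodule.toAddSubgroup I) ⟨z, hz, hz0⟩ (fun z hz => I.mul_mem_left t hz)
  have hvI : v ∈ Submodule.toAddSubgroup I := by rw [hvw]; exact left_mem_lat v w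
  have hwI : w ∈ Submodule.toAddSubgroup I := by rw [hvw]; exact right_mem_lat v w
  obtain ⟨p, r, h1⟩ := mem_lat.mp (show ω * v ∈ lat v w by rw [← hvw]; exact I.mul_mem_left ω hvI)
  obtain ⟨q, s, h2⟩ := mem_lat.mp (show ω * w ∈ lat v w by rw [← hvw]; exact I.mul_mem_left ω hwI)
  have hv0 : v ≠ 0 := by
    rintro rfl
    have := (hi 1 0 (by simp)).1
    omega
  have e1 := hi (p ^ 2 + r * q - p + μ) (p * r + r * s - r) (by
    push_cast
    linear_combination ((p:O) - 1 + ω) * h1 + (r:O) * h2 + v * hω2)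
  have hr : r ≠ 0 := by
    rintro rfl
    have h3 : ω = p := by
      apply mul_right_cancel₀ hv0
      rw [← h1]; simp
    have h4 : t = ((2 * p - 1 : ℤ) : O) := by
      push_cast
      rw [← h3]
      linear_combination -hω
    refine theta_not_int (σ := σ) (θ := t) hl hd.theta (2 * p - 1) ?_
    rw [h4, map_intCast]
  have hps : p + s = 1 := by
    have : r * (p + s - 1) = 0 := by linarith [e1.2]
    rcases mul_eq_zero.mp this with h | h
    · exact absurd h hr
    · linarith
  have hdet : p * s - q * r = μ := by
    have : s = 1 - p := by linarith
    rw [this]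
    linarith [e1.1]
  rw [count3 hvw hi hω μ hω2 hO h1.symm h2.symm]
  have hps' : (p : ZMod 2) + s = 1 := by exact_mod_cast congrArg (Int.cast : ℤ → ZMod 2) hps
  have hdet' : (p : ZMod 2) * s - q * r = μ := by exact_mod_cast congrArg (Int.cast : ℤ → ZMod 2) hdet
  split_ifs with h8
  · apply PP_card0 _ _ _ _ hps'
    rw [hdet', ZMod.intCast_zmod_eq_zero_iff_dvd]
    omega
  · apply PP_card1 _ _ _ _ hps'
    obtain ⟨k, hk⟩ : ∃ k, μ = 2 * k + 1 := ⟨μ / 2, by omega⟩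
    have h20 : (2 : ZMod 2) = 0 := rfl
    rw [hdet', hk]
    push_cast
    rw [h20]; simp
end

/-- the count of CM points -/
lemma card_R0 {K : Type} [Field K] [NumberField K] {θ : K} {l : ℕ} (hl : l.Prime) (h5 : 5 < l)
    (hθ : θ ^ 2 = -((5 * l : ℕ) : K)) (hK : Module.finrank ℚ K = 2) :
    {z : ℂ | ∃ τ a b c, CM l τ a b c (-a) ∧ tt τ = z}.ncard =
      NumberField.classNumber K * (if l % 4 = 1 then 1 else if l % 8 = 3 then 2 else 4) := by
  obtain ⟨t, σ, hd⟩ := exists_odata hl h5 hθ hK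
  have hodd : l % 4 = 1 ∨ l % 4 = 3 := by
    have := hl.eq_two_or_odd
    omega
  rw [NumberField.classNumber]
  apply hd.card hl h5
  · split_ifs <;> norm_num
  · intro I hI
    rcases hodd with h | h
    · rw [if_pos h]; exact hd.f1 h I
    · rw [if_neg (by omega)]; exact hd.f3 hl.pos h I hI
end HQ
end

section
namespace HQ
open PowerSeries Filter Topology UpperHalfPlane
open scoped MatrixGroups ModularForm Manifold NumberField

section
variable {k : Type*} [Field k] {l : ℕ} [Algebra (ZMod l) k]

/-- exponents -/
def nn (l : ℕ) : ℕ := l / 12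
def rr (l : ℕ) : ℕ := if l % 3 = 2 then 1 else 0
def sg (l : ℕ) : ℕ := if l % 4 = 3 then 1 else 0

lemma hasse_aeval (x : k) : aeval x (hasseInvariant5 l) =
    (x ^ 4 + 12 * x ^ 3 + 14 * x ^ 2 - 12 * x + 1) ^ (rr l) *
    ((x ^ 2 + 1) * (x ^ 4 + 18 * x ^ 3 + 74 * x ^ 2 - 18 * x + 1)) ^ (sg l) *
    ∑ i ∈ Finset.range (nn l + 1), (cc (nn l) (sg l) i : k) *
      ((x ^ 4 + 12 * x ^ 3 + 14 * x ^ 2 - 12 * x + 1) ^ 3 - 1728 * (x ^ 5 * (1 - 11 * x - x ^ 2))) ^ i *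
      (x ^ 5 * (1 - 11 * x - x ^ 2)) ^ (nn l - i) := by
  unfold hasseInvariant5 nn rr sg
  simp only [map_mul, map_pow, map_add, map_sub, map_sum, map_natCast, map_one, map_neg, map_ofNat, Polynomial.aeval_X]
  congr 1
  apply Finset.sum_congr rfl
  intro i _
  unfold cc
  push_cast
  ring

lemma A0_eval_div (n s : ℕ) (c d : k) (hd : d ≠ 0) :
    ∑ i ∈ Finset.range (n + 1), (cc n s i : k) * (c - 1728 * d) ^ i * d ^ (n - i) = d ^ n * (A0 k n s).eval (c / d) := by
  unfold A0
  rw [Polynomial.eval_finsetSum, Finset.mul_sum]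
  apply Finset.sum_congr rfl
  intro i hi
  have hi' : i ≤ n := by rw [Finset.mem_range] at hi; omega
  have e : c / d - 1728 = (c - 1728 * d) / d := by field_simp
  simp only [Polynomial.eval_mul, Polynomial.eval_pow, Polynomial.eval_sub, Polynomial.eval_X, Polynomial.eval_intCast, Polynomial.eval_ofNat]
  rw [e, div_pow]
  have : d ^ n = d ^ (n - i) * d ^ i := by rw [← pow_add]; congr 1; omega
  rw [this]
  field_simp

lemma sum_d_zero (n s : ℕ) (c : k) :
    ∑ i ∈ Finset.range (n + 1), (cc n s i : k) * (c - 1728 * 0) ^ i * (0:k) ^ (n - i) = c ^ n := by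
  rw [Finset.sum_eq_single n]
  · unfold cc; simp
  · intro i hi hin
    rw [Finset.mem_range] at hi
    rw [zero_pow (by omega)]; simp
  · simp

/-- the Hauptmodul in terms of x -/
def tx (x : k) : k := (1 - 11 * x - x ^ 2) / x

lemma hasse_iff (h5 : (5:k) ≠ 0) (x : k) : aeval x (hasseInvariant5 l) = 0 ↔
    x ≠ 0 ∧ tx x ≠ 0 ∧ ss (nn l) (rr l) (sg l) (tx x) := by
  rw [hasse_aeval]
  have hsq : (x ^ 4 + 12 * x ^ 3 + 14 * x ^ 2 - 12 * x + 1) ^ 3 - 1728 * (x ^ 5 * (1 - 11 * x - x ^ 2)) =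
    ((x ^ 2 + 1) * (x ^ 4 + 18 * x ^ 3 + 74 * x ^ 2 - 18 * x + 1)) ^ 2 := by ring
  by_cases hd : x ^ 5 * (1 - 11 * x - x ^ 2) = 0
  · have hc : x ^ 4 + 12 * x ^ 3 + 14 * x ^ 2 - 12 * x + 1 ≠ 0 := by
      rcases mul_eq_zero.mp hd with h | h
      · have : x = 0 := pow_eq_zero_iff (by norm_num) |>.mp h
        subst this; simp
      · have e : x ^ 4 + 12 * x ^ 3 + 14 * x ^ 2 - 12 * x + 1 = 5 * x ^ 2 := by
          linear_combination (1 - x - x ^ 2) * h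
        rw [e]
        refine mul_ne_zero h5 (pow_ne_zero _ ?_)
        rintro rfl
        simp at h
    rw [hd] at hsq ⊢
    rw [sum_d_zero]
    have hq : (x ^ 2 + 1) * (x ^ 4 + 18 * x ^ 3 + 74 * x ^ 2 - 18 * x + 1) ≠ 0 := by
      intro h
      rw [h] at hsq
      apply pow_ne_zero 3 hc
      linear_combination hsq
    constructor
    · intro h
      exfalso
      exact mul_ne_zero (mul_ne_zero (pow_ne_zero _ hc) (pow_ne_zero _ hq)) (pow_ne_zero _ (pow_ne_zero _ hc)) h
    · rintro ⟨h1, h2, -⟩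
      exfalso
      rcases mul_eq_zero.mp hd with h | h
      · exact h1 (pow_eq_zero_iff (by norm_num) |>.mp h)
      · exact h2 (by unfold tx; rw [h]; simp)
  · have hx : x ≠ 0 := by rintro rfl; simp at hd
    have ht : 1 - 11 * x - x ^ 2 ≠ 0 := fun h => hd (by rw [h]; simp)
    have htx : tx x ≠ 0 := div_ne_zero ht hx
    rw [A0_eval_div _ _ _ _ hd]
    have hJ : (tx x ^ 2 + 10 * tx x + 5) ^ 3 / tx x =
        (x ^ 4 + 12 * x ^ 3 + 14 * x ^ 2 - 12 * x + 1) ^ 3 / (x ^ 5 * (1 - 11 * x - x ^ 2)) := by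
      have e1 : x * tx x = 1 - 11 * x - x ^ 2 := by unfold tx; field_simp
      rw [div_eq_div_iff htx hd, ← e1]
      have e2 : x ^ 4 + 12 * x ^ 3 + 14 * x ^ 2 - 12 * x + 1 = x ^ 2 * (tx x ^ 2 + 10 * tx x + 5) := by
        have : x ^ 2 * (tx x ^ 2 + 10 * tx x + 5) = (x * tx x) ^ 2 + 10 * x * (x * tx x) + 5 * x ^ 2 := by ring
        rw [this, e1]; ring
      rw [e2]; ring
    have hJ2 : (x ^ 4 + 12 * x ^ 3 + 14 * x ^ 2 - 12 * x + 1) ^ 3 / (x ^ 5 * (1 - 11 * x - x ^ 2)) - 1728 =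
        ((x ^ 2 + 1) * (x ^ 4 + 18 * x ^ 3 + 74 * x ^ 2 - 18 * x + 1)) ^ 2 / (x ^ 5 * (1 - 11 * x - x ^ 2)) := by
      rw [← hsq, sub_div, mul_div_assoc, div_self hd, mul_one]
    unfold ss A12
    rw [hJ]
    simp only [Polynomial.eval_mul, Polynomial.eval_pow, Polynomial.eval_sub, Polynomial.eval_X, Polynomial.eval_ofNat]
    rw [hJ2]
    simp only [hx, htx, ne_eq, not_false_eq_true, true_and, mul_eq_zero, pow_eq_zero_iff', div_eq_zero_iff, hd, or_false, false_and, false_or]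
    have hr : rr l = 0 ∨ rr l = 1 := by unfold rr; split_ifs <;> simp
    have hs : sg l = 0 ∨ sg l = 1 := by unfold sg; split_ifs <;> simp
    rcases hr with hr | hr <;> rcases hs with hs | hs <;> simp [hr, hs]

end
end HQ
end

section
namespace HQ
open PowerSeries Filter Topology UpperHalfPlane
open scoped MatrixGroups ModularForm Manifold NumberField

section
variable {k : Type*} [Field k] {l : ℕ} [Fact l.Prime] [Algebra (ZMod l) k]

/-- the quadratic polynomial of a pair -/
noncomputable def quadP (uv : ZMod l × ZMod l) : Polynomial (ZMod l) :=
  Polynomial.X ^ 2 + Polynomial.C uv.1 * Polynomial.X + Polynomial.C uv.2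

lemma quadP_monic (uv : ZMod l × ZMod l) : (quadP uv).Monic := by
  unfold quadP; monicity!

lemma quadP_natDegree (uv : ZMod l × ZMod l) : (quadP uv).natDegree = 2 := by
  unfold quadP; compute_degree!

lemma quadP_aeval (uv : ZMod l × ZMod l) (x : k) :
    aeval x (quadP uv) = x ^ 2 + algebraMap (ZMod l) k uv.1 * x + algebraMap (ZMod l) k uv.2 := by
  unfold quadP
  simp only [map_add, map_mul, map_pow, Polynomial.aeval_X, Polynomial.aeval_C]

/-- the set counted in the theorem -/
def PS (l : ℕ) : Set (ZMod l × ZMod l) := {uv : ZMod l × ZMod l |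
        Irreducible (Polynomial.X ^ 2 + Polynomial.C uv.1 * Polynomial.X + Polynomial.C uv.2) ∧
        (Polynomial.X ^ 2 + Polynomial.C uv.1 * Polynomial.X + Polynomial.C uv.2) ∣ hasseInvariant5 l ∧
        ∃ e : ZMod l, e ^ 2 + e = 1 ∧ uv.1 = e ^ 5 * (uv.2 - 1)}

lemma mem_PS (uv : ZMod l × ZMod l) : uv ∈ PS l ↔ Irreducible (quadP uv) ∧ quadP uv ∣ hasseInvariant5 l ∧
        ∃ e : ZMod l, e ^ 2 + e = 1 ∧ uv.1 = e ^ 5 * (uv.2 - 1) := Iff.rfl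

lemma quad_count [IsAlgClosed k] : 2 * (PS l).ncard = {x : k | ∃ uv ∈ PS l, aeval x (quadP uv) = 0}.ncard := by
  classical
  have hfin : (PS l).Finite := Set.toFinite _
  have hset : {x : k | ∃ uv ∈ PS l, aeval x (quadP uv) = 0} =
      ((hfin.toFinset.biUnion (fun uv => ((quadP uv).aroots k).toFinset) : Finset k) : Set k) := by
    ext x
    simp only [Set.mem_ofPred_eq, Finset.coe_biUnion, Set.mem_iUnion, Finset.mem_coe, Set.Finite.mem_toFinset, Multiset.mem_toFinset,
      exists_prop]
    apply exists_congr
    intro uv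
    rw [Polynomial.mem_aroots]
    simp [(quadP_monic uv).ne_zero]
  rw [hset, Set.ncard_coe_finset, Finset.card_biUnion]
  · have : ∀ uv ∈ hfin.toFinset, ((quadP uv).aroots k).toFinset.card = 2 := by
      intro uv huv
      have hirr := ((mem_PS uv).mp (hfin.mem_toFinset.mp huv)).1
      have hsep : (quadP uv).Separable := PerfectField.separable_of_irreducible hirr
      rw [Multiset.toFinset_card_of_nodup (Polynomial.nodup_roots hsep.map), ← (IsAlgClosed.splits _).natDegree_eq_card_roots,
        Polynomial.natDegree_map, quadP_natDegree]
    rw [Finset.sum_congr rfl this, Finset.sum_const, smul_eq_mul, mul_comm, Set.ncard_eq_toFinset_card _ hfin]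
  · intro uv huv uv' huv' hne
    rw [Function.onFun, Finset.disjoint_left]
    intro x hx hx'
    rw [Multiset.mem_toFinset, Polynomial.mem_aroots] at hx hx'
    apply hne
    have h1 := ((mem_PS uv).mp (hfin.mem_toFinset.mp huv)).1
    have h2 := ((mem_PS uv').mp (hfin.mem_toFinset.mp huv')).1
    have e : quadP uv = quadP uv' := by
      rw [minpoly.eq_of_irreducible_of_monic h1 hx.2 (quadP_monic uv), minpoly.eq_of_irreducible_of_monic h2 hx'.2 (quadP_monic uv')]
    have e1 := congrArg (fun p => Polynomial.coeff p 1) e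
    have e0 := congrArg (fun p => Polynomial.coeff p 0) e
    simp [quadP, Polynomial.coeff_X] at e1 e0
    exact Prod.ext e1 e0

lemma mem_range_of_pow [CharP k l] {x : k} (h : x ^ l = x) : ∃ a : ZMod l, algebraMap (ZMod l) k a = x := by
  have h1 := (Subfield.mem_bot_iff_pow_eq_self k l).mpr h
  rw [← ZMod.fieldRange_castHom_eq_bot l] at h1
  obtain ⟨a, ha⟩ := h1
  refine ⟨a, ?_⟩
  rw [← ha]
  congr 1
  exact Subsingleton.elim _ _

lemma algebraMap_pow_l (a : ZMod l) : (algebraMap (ZMod l) k a) ^ l = algebraMap (ZMod l) k a := by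
  rw [← map_pow, ZMod.pow_card]

lemma tx_pow [CharP k l] (x : k) : tx x ^ l = tx (x ^ l) := by
  have : ExpChar k l := ExpChar.prime Fact.out
  have h := map_div₀ (frobenius k l) (1 - 11 * x - x ^ 2) x
  simp only [map_sub, map_mul, map_pow, map_one, map_ofNat, frobenius_def] at h
  unfold tx
  exact h

lemma tx_mul {x y : k} (hx : x ≠ 0) (hy : y ≠ 0) :
    tx x * tx y = 125 ↔ (x + y) ^ 2 - 11 * (x + y) * (x * y - 1) - (x * y - 1) ^ 2 = 0 := by
  unfold tx
  rw [div_mul_div_comm, div_eq_iff (mul_ne_zero hx hy)]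
  constructor
  · intro h; linear_combination -h
  · intro h; linear_combination -h

lemma e_five {R : Type*} [CommRing R] {e : R} (he : e ^ 2 + e = 1) : e ^ 5 = 5 * e - 3 := by
  linear_combination (e^3 - e^2 + 2 * e - 3) * he

lemma five_ne [CharP k l] (h5 : 5 < l) : (5 : k) ≠ 0 := by
  intro h
  have : ((5 : ℕ) : k) = 0 := by exact_mod_cast h
  rw [CharP.cast_eq_zero_iff k l] at this
  have := Nat.le_of_dvd (by norm_num) this
  omega

lemma eps_ne [CharP k l] (h5 : 5 < l) {ε : k} (hε : ε ^ 2 + 11 * ε = 1) : ε ^ 2 ≠ -1 := by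
  intro h
  have h1 : 11 * ε = 2 := by linear_combination hε - h
  have h2 : (125 : k) = 0 := by linear_combination 121 * h - (11 * ε + 2) * h1
  have : (5 : k) ^ 3 = 0 := by rw [← h2]; norm_num
  exact five_ne h5 (pow_eq_zero_iff (by norm_num) |>.mp this)

/-- Description of the union of root sets. -/
lemma X_eq [CharP k l] (h5 : 5 < l) {e₀ : ZMod l} (he₀ : e₀ ^ 2 + e₀ = 1)
    (hF : ∀ a : ZMod l, algebraMap (ZMod l) k a ≠ 0 → tx (algebraMap (ZMod l) k a) ^ 2 = 125 →
      ss (nn l) (rr l) (sg l) (tx (algebraMap (ZMod l) k a)) → False) :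
    {x : k | ∃ uv ∈ PS l, aeval x (quadP uv) = 0} =
      {x : k | x ≠ 0 ∧ tx x ^ (l + 1) = 125 ∧ ss (nn l) (rr l) (sg l) (tx x)} := by
  have hexp : ExpChar k l := ExpChar.prime Fact.out
  have h50 : (5 : k) ≠ 0 := five_ne h5
  have hl0 : l ≠ 0 := by omega
  ext x
  simp only [Set.mem_ofPred_eq]
  constructor
  · rintro ⟨uv, huv, hx⟩
    obtain ⟨hirr, hdvd, e, he, hu⟩ := (mem_PS uv).mp huv
    have hH : aeval x (hasseInvariant5 l) = 0 := by
      obtain ⟨g, hg⟩ := hdvd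
      rw [hg, map_mul, hx, zero_mul]
    obtain ⟨hx0, htx, hss⟩ := (hasse_iff h50 x).mp hH
    refine ⟨hx0, ?_, hss⟩
    set y := x ^ l with hy
    have hy0 : y ≠ 0 := pow_ne_zero _ hx0
    rw [quadP_aeval] at hx
    set u := algebraMap (ZMod l) k uv.1 with hu'
    set v := algebraMap (ZMod l) k uv.2 with hv'
    have hyr : y ^ 2 + u * y + v = 0 := by
      have h := congrArg (frobenius k l) hx
      simp only [map_add, map_mul, map_pow, map_zero, frobenius_def] at h
      rw [algebraMap_pow_l, algebraMap_pow_l] at h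
      exact h
    have hxy : x ≠ y := by
      intro h
      obtain ⟨a, ha⟩ := mem_range_of_pow (l := l) h.symm
      refine hirr.not_isRoot_of_natDegree_ne_one (by rw [quadP_natDegree]; norm_num) (x := a) ?_
      have h1 : aeval (algebraMap (ZMod l) k a) (quadP uv) = 0 := by
        rw [ha, quadP_aeval]; exact hx
      rw [Polynomial.aeval_algebraMap_apply] at h1
      rw [Polynomial.IsRoot, ← Polynomial.coe_aeval_eq_eval]
      exact (map_eq_zero_iff _ (algebraMap (ZMod l) k).injective).mp h1
    have hsum : x + y = -u := by
      apply mul_left_cancel₀ (sub_ne_zero.mpr hxy)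
      linear_combination hx - hyr
    have hprod : x * y = v := by
      linear_combination x * hsum - hx
    rw [pow_succ, tx_pow, ← hy, mul_comm, tx_mul hx0 hy0, hsum, hprod]
    have he' : (algebraMap (ZMod l) k e) ^ 2 + algebraMap (ZMod l) k e = 1 := by
      rw [← map_pow, ← map_add, he, map_one]
    have huk : u = (algebraMap (ZMod l) k e) ^ 5 * (v - 1) := by
      rw [hu', hu, hv']; simp only [map_mul, map_pow, map_sub, map_one]
    rw [huk, e_five he']
    linear_combination 25 * (v - 1) ^ 2 * he'
  · rintro ⟨hx0, ht, hss⟩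
    set y := x ^ l with hy
    have hy0 : y ≠ 0 := pow_ne_zero _ hx0
    have htx0 : tx x ≠ 0 := by
      intro h
      rw [h, zero_pow (by omega)] at ht
      have : (5 : k) ^ 3 = 0 := by rw [ht]; norm_num
      exact h50 (pow_eq_zero_iff (by norm_num) |>.mp this)
    rw [pow_succ, tx_pow, ← hy, mul_comm, tx_mul hx0 hy0] at ht
    have he₀' : (algebraMap (ZMod l) k e₀) ^ 2 + algebraMap (ZMod l) k e₀ = 1 := by
      rw [← map_pow, ← map_add, he₀, map_one]
    obtain ⟨e, he, hxy⟩ : ∃ e : ZMod l, e ^ 2 + e = 1 ∧ x + y + algebraMap (ZMod l) k (e ^ 5) * (x * y - 1) = 0 := by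
      set E := algebraMap (ZMod l) k e₀ with hE
      have hfac : (x + y + (5 * E - 3) * (x * y - 1)) * (x + y + (5 * (-1 - E) - 3) * (x * y - 1)) = 0 := by
        linear_combination ht - 25 * (x * y - 1) ^ 2 * he₀'
      rcases mul_eq_zero.mp hfac with h | h
      · refine ⟨e₀, he₀, ?_⟩
        rw [e_five he₀]
        simp only [map_mul, map_sub, map_ofNat, ← hE]
        exact h
      · have he1 : (-1 - e₀) ^ 2 + (-1 - e₀) = 1 := by linear_combination he₀
        refine ⟨-1 - e₀, he1, ?_⟩
        rw [e_five he1]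
        simp only [map_mul, map_sub, map_ofNat, map_neg, map_one, ← hE]
        exact h
    set ε := algebraMap (ZMod l) k (e ^ 5) with hε
    have hε1 : ε ^ 2 + 11 * ε = 1 := by
      have : (e ^ 5) ^ 2 + 11 * e ^ 5 = 1 := by
        rw [e_five he]; linear_combination 25 * he
      rw [hε, ← map_pow, ← map_ofNat (algebraMap (ZMod l) k) 11, ← map_mul, ← map_add, this, map_one]
    have hε2 := eps_ne h5 hε1
    have hzz : y ^ l = x := by
      have h := congrArg (frobenius k l) hxy
      simp only [map_add, map_mul, map_sub, map_one, map_zero, frobenius_def] at h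
      rw [hε, algebraMap_pow_l, ← hε, ← hy] at h
      have hne : ε * y + 1 ≠ 0 := by
        intro h0
        apply hε2
        have : y = ε := by linear_combination hxy - x * h0
        rw [this] at h0
        linear_combination h0
      apply mul_left_cancel₀ hne
      linear_combination h - hxy
    have hxF : ∀ a : ZMod l, algebraMap (ZMod l) k a ≠ x := by
      rintro a ha
      refine hF a (by rwa [ha]) ?_ (by rwa [ha])
      have hyx : y = x := by rw [hy, ← ha, algebraMap_pow_l]
      rw [ha, sq, tx_mul hx0 hx0]
      rw [hyx] at ht
      exact ht
    obtain ⟨u, hu⟩ : ∃ u : ZMod l, algebraMap (ZMod l) k u = -(x + y) := by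
      apply mem_range_of_pow
      have : frobenius k l (-(x + y)) = -(y + y ^ l) := by
        rw [map_neg, map_add, frobenius_def, frobenius_def]
      rw [frobenius_def] at this
      rw [this, hzz]; ring
    obtain ⟨v, hv⟩ : ∃ v : ZMod l, algebraMap (ZMod l) k v = x * y := by
      apply mem_range_of_pow
      rw [mul_pow, hzz, ← hy, mul_comm]
    have hroot : ∀ z : k, aeval z (quadP (u, v)) = (z - x) * (z - y) := by
      intro z
      rw [quadP_aeval]
      simp only [hu, hv]; ring
    have hx' : aeval x (quadP (u, v)) = 0 := by rw [hroot]; ring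
    have hirr : Irreducible (quadP (u, v)) := by
      apply Polynomial.irreducible_of_degree_le_three_of_not_isRoot
      · rw [quadP_natDegree]; decide
      · intro a ha
        rw [Polynomial.IsRoot, ← Polynomial.coe_aeval_eq_eval] at ha
        have h1 : aeval (algebraMap (ZMod l) k a) (quadP (u, v)) = 0 := by
          rw [Polynomial.aeval_algebraMap_apply]
          rw [show aeval a (quadP (u, v)) = 0 from ha, map_zero]
        rw [hroot] at h1
        rcases mul_eq_zero.mp h1 with h | h
        · exact hxF a (sub_eq_zero.mp h)
        · have h2 := sub_eq_zero.mp h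
          apply hxF a
          rw [← hzz, ← h2, algebraMap_pow_l]
    refine ⟨(u, v), (mem_PS _).mpr ⟨hirr, ?_, e, he, ?_⟩, hx'⟩
    · rw [minpoly.eq_of_irreducible_of_monic hirr hx' (quadP_monic _)]
      apply minpoly.dvd
      exact (hasse_iff h50 x).mpr ⟨hx0, htx0, hss⟩
    · apply (algebraMap (ZMod l) k).injective
      simp only
      rw [map_mul, map_sub, hu, hv, map_one]
      linear_combination -hxy
end
end HQ
end

section
namespace HQ
open PowerSeries Filter Topology UpperHalfPlane
open scoped MatrixGroups ModularForm Manifold NumberField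

section
variable {k : Type*} [Field k] {l : ℕ}

lemma i_pow (hl : l % 4 = 1 ∨ l % 4 = 3) {i : k} (hi : i ^ 2 = -1) : i ^ l = if l % 4 = 1 then i else -i := by
  have h4 : i ^ 4 = 1 := by linear_combination (i ^ 2 - 1) * hi
  split_ifs with h
  · obtain ⟨m, hm⟩ : ∃ m, l = 4 * m + 1 := ⟨l / 4, by omega⟩
    rw [hm, pow_succ, pow_mul, h4, one_pow, one_mul]
  · obtain ⟨m, hm⟩ : ∃ m, l = 4 * m + 3 := ⟨l / 4, by omega⟩
    rw [hm, pow_add, pow_mul, h4, one_pow, one_mul]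
    linear_combination i * hi

lemma small_ne [CharP k l] [Fact l.Prime] (m : ℕ) (hm : ∀ p, p.Prime → p ∣ m → p ≤ 5) (h5 : 5 < l) : (m : k) ≠ 0 := by
  intro h
  rw [CharP.cast_eq_zero_iff k l] at h
  have := hm l Fact.out h
  omega

lemma two_ne [CharP k l] [Fact l.Prime] (h5 : 5 < l) : (2 : k) ≠ 0 := by
  have := small_ne (k := k) (l := l) 2 (fun p hp h => (Nat.le_of_dvd (by norm_num) h).trans (by norm_num)) h5
  exact_mod_cast this

lemma card_special [IsAlgClosed k] [CharP k l] [Fact l.Prime] (h5 : 5 < l) (hl : l % 4 = 1 ∨ l % 4 = 3) (n r : ℕ) :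
    {t : k | (t ^ (l + 1) = 125 ∧ ss n r (sg l) t) ∧ (t + 11) ^ 2 + 4 = 0}.ncard = 2 * sg l := by
  have hexp : ExpChar k l := ExpChar.prime Fact.out
  have h50 : (5 : k) ≠ 0 := by
    have := small_ne (k := k) (l := l) 5 (fun p hp h => (Nat.le_of_dvd (by norm_num) h)) h5
    exact_mod_cast this
  have h20 : (2 : k) ≠ 0 := two_ne h5
  obtain ⟨i, hi⟩ := IsAlgClosed.exists_pow_nat_eq (-1 : k) (n := 2) (by norm_num)
  have hi0 : i ≠ 0 := by rintro rfl; norm_num at hi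
  have hsol : ∀ t : k, (t + 11) ^ 2 + 4 = 0 ↔ t = -11 + 2 * i ∨ t = -11 - 2 * i := by
    intro t
    have : (t + 11) ^ 2 + 4 = (t - (-11 + 2 * i)) * (t - (-11 - 2 * i)) := by linear_combination 4 * hi
    rw [this, mul_eq_zero, sub_eq_zero, sub_eq_zero]
  have hpow : ∀ j : k, j ^ 2 = -1 → (-11 + 2 * j) ^ l = -11 + 2 * (if l % 4 = 1 then j else -j) := by
    intro j hj
    have h := map_add (frobenius k l) (-11) (2 * j)
    simp only [map_neg, map_mul, map_ofNat, frobenius_def] at h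
    rw [h, i_pow hl hj]
  have hi' : (-i) ^ 2 = -1 := by rw [neg_sq, hi]
  rcases hl with h | h
  · have hs : sg l = 0 := by unfold sg; rw [if_neg (by omega)]
    rw [hs]
    have : {t : k | (t ^ (l + 1) = 125 ∧ ss n r 0 t) ∧ (t + 11) ^ 2 + 4 = 0} = ∅ := by
      rw [Set.eq_empty_iff_forall_notMem]
      rintro t ⟨⟨h1, -⟩, h2⟩
      have htl : t ^ l = t := by
        rcases (hsol t).mp h2 with rfl | rfl
        · rw [hpow i hi, if_pos h]
        · have := hpow (-i) hi'
          rw [if_pos h] at this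
          rw [show -11 - 2 * i = -11 + 2 * -i by ring]
          exact this
      rw [pow_succ, htl] at h1
      have h3 : 2 * (11 * t + 125) = 0 := by linear_combination h2 - h1
      have h4 := (mul_eq_zero.mp h3).resolve_left h20
      have h6 : (2:k) ^ 2 * 5 ^ 3 = 0 := by linear_combination (125 - 11 * t) * h4 + 121 * h1
      rcases mul_eq_zero.mp h6 with h | h
      · exact h20 (pow_eq_zero_iff (by norm_num) |>.mp h)
      · exact h50 (pow_eq_zero_iff (by norm_num) |>.mp h)
    rw [this]; simp
  · have hs : sg l = 1 := by unfold sg; rw [if_pos h]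
    rw [hs]
    have : {t : k | (t ^ (l + 1) = 125 ∧ ss n r 1 t) ∧ (t + 11) ^ 2 + 4 = 0} = {-11 + 2 * i, -11 - 2 * i} := by
      ext t
      simp only [Set.mem_ofPred_eq, Set.mem_insert_iff, Set.mem_singleton_iff]
      rw [hsol t]
      constructor
      · exact fun h => h.2
      · intro h'
        refine ⟨⟨?_, ?_⟩, h'⟩
        · rcases h' with rfl | rfl
          · rw [pow_succ, hpow i hi, if_neg (by omega)]
            linear_combination (-4) * hi
          · have := hpow (-i) hi'
            rw [if_neg (by omega)] at this
            rw [pow_succ, show -11 - 2 * i = -11 + 2 * -i by ring, this]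
            linear_combination (-4) * hi
        · have h2 := (hsol t).mpr h'
          have ht0 : t ≠ 0 := by
            rintro rfl
            have : (5:k) ^ 3 = 0 := by linear_combination h2
            exact h50 (pow_eq_zero_iff (by norm_num) |>.mp this)
          have hJ : (t ^ 2 + 10 * t + 5) ^ 3 / t = 1728 := by
            rw [div_eq_iff ht0]
            linear_combination (t ^ 2 + 4 * t - 1) ^ 2 * h2
          unfold ss A12
          rw [hJ]
          simp
    rw [this, Set.ncard_pair]
    intro h0
    have : (2:k) * (2 * i) = 0 := by linear_combination h0
    exact mul_ne_zero h20 (mul_ne_zero h20 hi0) this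

lemma T_count [IsAlgClosed k] [CharP k l] [Fact l.Prime] (h5 : 5 < l) (n r : ℕ) :
    {x : k | x ≠ 0 ∧ tx x ^ (l + 1) = 125 ∧ ss n r (sg l) (tx x)}.ncard + 2 * sg l =
      2 * {t : k | t ^ (l + 1) = 125 ∧ ss n r (sg l) t}.ncard := by
  classical
  have hl : l % 4 = 1 ∨ l % 4 = 3 := by
    have := (Fact.out : l.Prime).eq_two_or_odd
    omega
  set TT := {t : k | t ^ (l + 1) = 125 ∧ ss n r (sg l) t} with hTT
  have hfin : TT.Finite := by
    apply Set.Finite.subset (((Polynomial.X ^ (l + 1) - Polynomial.C 125 : Polynomial k).roots.toFinset).finite_toSet)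
    intro t ht
    have hne : (Polynomial.X ^ (l + 1) - Polynomial.C 125 : Polynomial k) ≠ 0 := Polynomial.X_pow_sub_C_ne_zero (by omega) _
    rw [Finset.mem_coe, Multiset.mem_toFinset, Polynomial.mem_roots hne]
    simp [ht.1]
  have hab : ∀ t : k, ∃ a b : k, a + b = -(11 + t) ∧ a * b = -1 := by
    intro t
    have hdeg : (Polynomial.X ^ 2 + Polynomial.C (11 + t) * Polynomial.X - 1 : Polynomial k).degree ≠ 0 := by
      have : (Polynomial.X ^ 2 + Polynomial.C (11 + t) * Polynomial.X - 1 : Polynomial k).degree = 2 := by compute_degree!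
      rw [this]; norm_num
    obtain ⟨a, ha⟩ := IsAlgClosed.exists_root _ hdeg
    simp only [Polynomial.IsRoot, Polynomial.eval_sub, Polynomial.eval_add, Polynomial.eval_mul, Polynomial.eval_pow,
      Polynomial.eval_X, Polynomial.eval_C, Polynomial.eval_one] at ha
    exact ⟨a, -(11 + t) - a, by ring, by linear_combination -ha⟩
  choose a b hsum hprod using hab
  have hfib : ∀ t x : k, (x ≠ 0 ∧ tx x = t) ↔ x = a t ∨ x = b t := by
    intro t x
    have hfac : x ^ 2 + (11 + t) * x - 1 = (x - a t) * (x - b t) := by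
      linear_combination x * hsum t - hprod t
    constructor
    · rintro ⟨h1, h2⟩
      unfold tx at h2
      rw [div_eq_iff h1] at h2
      have : (x - a t) * (x - b t) = 0 := by rw [← hfac]; linear_combination -h2
      rcases mul_eq_zero.mp this with h | h
      · left; exact sub_eq_zero.mp h
      · right; exact sub_eq_zero.mp h
    · intro h
      have h0 : (x - a t) * (x - b t) = 0 := by rcases h with rfl | rfl <;> simp
      rw [← hfac] at h0
      have hx : x ≠ 0 := by rintro rfl; simp at h0
      refine ⟨hx, ?_⟩
      unfold tx
      rw [div_eq_iff hx]
      linear_combination -h0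
  have hset : {x : k | x ≠ 0 ∧ tx x ^ (l + 1) = 125 ∧ ss n r (sg l) (tx x)} =
      ((hfin.toFinset.biUnion (fun t => ({a t, b t} : Finset k)) : Finset k) : Set k) := by
    ext x
    simp only [Set.mem_ofPred_eq, Finset.coe_biUnion, Set.mem_iUnion, Finset.mem_coe, Set.Finite.mem_toFinset, exists_prop,
      Finset.mem_insert, Finset.mem_singleton]
    constructor
    · rintro ⟨h1, h2⟩
      exact ⟨tx x, h2, (hfib _ _).mp ⟨h1, rfl⟩⟩
    · rintro ⟨t, ht, h⟩
      obtain ⟨h1, rfl⟩ := (hfib _ _).mpr h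
      exact ⟨h1, ht⟩
  have hcard : ∀ t ∈ hfin.toFinset, ({a t, b t} : Finset k).card + (if (t + 11) ^ 2 + 4 = 0 then 1 else 0) = 2 := by
    intro t _
    have hd : (t + 11) ^ 2 + 4 = (a t - b t) ^ 2 := by
      linear_combination (t + 11 - a t - b t) * hsum t + 4 * hprod t
    split_ifs with h
    · rw [hd] at h
      have : a t = b t := sub_eq_zero.mp (pow_eq_zero_iff (by norm_num) |>.mp h)
      rw [this]; simp
    · rw [Finset.card_pair]
      intro h'
      apply h; rw [hd, h']; simp
  have hsp : 2 * sg l = ∑ t ∈ hfin.toFinset, (if (t + 11) ^ 2 + 4 = 0 then 1 else 0) := by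
    rw [← card_special (k := k) h5 hl n r, Finset.sum_boole]
    rw [← Set.ncard_coe_finset]
    simp only [Nat.cast_id]
    congr 1
    ext t
    simp [hTT]
  rw [hset, Set.ncard_coe_finset, Finset.card_biUnion, hsp, ← Finset.sum_add_distrib, Finset.sum_congr rfl hcard,
    Finset.sum_const, smul_eq_mul, mul_comm, Set.ncard_eq_toFinset_card _ hfin]
  intro t _ t' _ hne
  rw [Function.onFun, Finset.disjoint_left]
  intro x hx hx'
  rw [Finset.mem_insert, Finset.mem_singleton] at hx hx'
  exact hne (((hfib _ _).mpr hx).2.symm.trans ((hfib _ _).mpr hx').2)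

lemma exists_e0 [Fact l.Prime] (h : l % 5 = 1) : ∃ e₀ : ZMod l, e₀ ^ 2 + e₀ = 1 ∧ ∀ e : ZMod l, e ^ 2 + e = 1 → ∃ d, d ^ 2 = -3 - e := by
  have : Fact (Nat.Prime 5) := ⟨Nat.prime_five⟩
  have hcard : 5 ∣ Fintype.card (ZMod l)ˣ := by
    rw [ZMod.card_units]; omega
  obtain ⟨g, hg⟩ := exists_prime_orderOf_dvd_card 5 hcard
  set ζ : ZMod l := Units.val g with hζ
  have h1 : ζ ^ 5 = 1 := by
    rw [hζ, ← Units.val_pow_eq_pow_val, ← hg, pow_orderOf_eq_one]; simp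
  have h2 : ζ ≠ 1 := by
    intro h
    have : g = 1 := Units.ext h
    rw [this, orderOf_one] at hg
    omega
  have h3 : 1 + ζ + ζ ^ 2 + ζ ^ 3 + ζ ^ 4 = 0 := by
    apply mul_left_cancel₀ (sub_ne_zero.mpr h2)
    linear_combination h1
  have he0 : (ζ + ζ ^ 4) ^ 2 + (ζ + ζ ^ 4) = 1 := by
    linear_combination h3 + (2 + ζ ^ 3) * h1
  refine ⟨ζ + ζ ^ 4, he0, ?_⟩
  intro e he
  have : (e - (ζ + ζ ^ 4)) * (e + 1 + (ζ + ζ ^ 4)) = 0 := by linear_combination he - he0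
  rcases mul_eq_zero.mp this with h | h
  · refine ⟨ζ - ζ ^ 4, ?_⟩
    linear_combination h + h3 + (ζ ^ 3 - 2) * h1
  · refine ⟨ζ ^ 2 - ζ ^ 3, ?_⟩
    linear_combination h + (ζ - 2) * h1

lemma hF3 [Fact l.Prime] [Algebra (ZMod l) k] [CharP k l] (h5 : 5 < l) (h : l % 5 = 1) (h4 : l % 4 = 3)
    (a : ZMod l) (ha : algebraMap (ZMod l) k a ≠ 0) (ht : tx (algebraMap (ZMod l) k a) ^ 2 = 125) : False := by
  obtain ⟨e₀, he₀, hd⟩ := exists_e0 h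
  rw [sq, tx_mul ha ha] at ht
  have ht' : (a + a) ^ 2 - 11 * (a + a) * (a * a - 1) - (a * a - 1) ^ 2 = 0 := by
    apply (algebraMap (ZMod l) k).injective
    simp only [map_sub, map_mul, map_add, map_pow, map_one, map_zero, map_ofNat]; exact ht
  obtain ⟨e, he, hae⟩ : ∃ e : ZMod l, e ^ 2 + e = 1 ∧ a + a + (5 * e - 3) * (a * a - 1) = 0 := by
    have hfac : (a + a + (5 * e₀ - 3) * (a * a - 1)) * (a + a + (5 * (-1 - e₀) - 3) * (a * a - 1)) = 0 := by
      linear_combination ht' - 25 * (a * a - 1) ^ 2 * he₀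
    rcases mul_eq_zero.mp hfac with h | h
    · exact ⟨e₀, he₀, h⟩
    · exact ⟨-1 - e₀, by linear_combination he₀, h⟩
  obtain ⟨d, hd⟩ := hd e he
  have h50 : (5 : ZMod l) ≠ 0 := five_ne (l := l) h5
  have he0 : e ≠ 0 := by rintro rfl; norm_num at he
  have hk : (((5 * e - 3) * a + 1) * d) ^ 2 = -(5 * e ^ 2) ^ 2 := by
    have e1 : ((5 * e - 3) * a + 1) ^ 2 = 35 - 55 * e := by
      linear_combination (5 * e - 3) * hae + 25 * he
    have e2 : e ^ 4 = 2 - 3 * e := by linear_combination (e ^ 2 - e + 2) * he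
    rw [mul_pow, e1, hd, mul_pow, ← pow_mul, e2]
    linear_combination 55 * he
  have hsq : IsSquare (-1 : ZMod l) := by
    refine ⟨((5 * e - 3) * a + 1) * d / (5 * e ^ 2), ?_⟩
    have : (5 * e ^ 2) ≠ 0 := mul_ne_zero h50 (pow_ne_zero _ he0)
    rw [← sq, div_pow, eq_div_iff (pow_ne_zero _ this), hk]; ring
  rw [ZMod.exists_sq_eq_neg_one_iff] at hsq
  exact hsq h4

end
end HQ
end

section
namespace HQ
open PowerSeries Filter Topology UpperHalfPlane
open scoped MatrixGroups ModularForm Manifold NumberField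

section
variable {l : ℕ}

lemma not_square [Fact l.Prime] (x : ℤ) : x ^ 2 ≠ l := by
  intro h
  have hl : l.Prime := Fact.out
  have h2 : x.natAbs ^ 2 = l := by
    zify; rw [sq_abs]; exact h
  exact (Nat.Prime.prime hl).irreducible.not_isSquare ⟨x.natAbs, by rw [← h2, sq]⟩

lemma thue [Fact l.Prime] (c : ZMod l) (hc : c ^ 2 = -5) :
    ∃ x y m : ℤ, x ^ 2 + 5 * y ^ 2 = m * l ∧ 0 < m ∧ m < 6 := by
  have hl : l.Prime := Fact.out
  set q := Nat.sqrt l with hq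
  have hq1 : q * q ≤ l := Nat.sqrt_le l
  have hq2 : l < (q + 1) * (q + 1) := Nat.lt_succ_sqrt l
  have hlt : Fintype.card (ZMod l) < Fintype.card (Fin (q + 1) × Fin (q + 1)) := by
    rw [ZMod.card, Fintype.card_prod, Fintype.card_fin]; exact hq2
  obtain ⟨⟨i, j⟩, ⟨i', j'⟩, hne, heq⟩ := Fintype.exists_ne_map_eq_of_card_lt
    (fun p : Fin (q + 1) × Fin (q + 1) => ((p.1 : ℕ) : ZMod l) + c * ((p.2 : ℕ) : ZMod l)) hlt
  simp only at heq
  set x : ℤ := (i : ℕ) - (i' : ℕ) with hx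
  set y : ℤ := (j : ℕ) - (j' : ℕ) with hy
  have hxb : x ^ 2 ≤ q * q := by
    have h1 := i.2; have h2 := i'.2
    have h3 : |x| ≤ q := by rw [abs_le]; omega
    nlinarith [abs_nonneg x, sq_abs x]
  have hyb : y ^ 2 ≤ q * q := by
    have h1 := j.2; have h2 := j'.2
    have h3 : |y| ≤ q := by rw [abs_le]; omega
    nlinarith [abs_nonneg y, sq_abs y]
  have hql : (q : ℤ) * q ≤ l := by exact_mod_cast hq1
  have hql' : (q : ℤ) * q ≠ l := by rw [← sq]; exact not_square _
  have hxy : x ≠ 0 ∨ y ≠ 0 := by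
    by_contra hcon
    push Not at hcon
    apply hne
    ext <;> simp <;> omega
  have hdvd : (l : ℤ) ∣ x ^ 2 + 5 * y ^ 2 := by
    rw [← ZMod.intCast_zmod_eq_zero_iff_dvd]
    push_cast [hx, hy]
    linear_combination (((i : ℕ) : ZMod l) - ((i' : ℕ) : ZMod l) - c * (((j : ℕ) : ZMod l) - ((j' : ℕ) : ZMod l))) * heq + (((j : ℕ) : ZMod l) - ((j' : ℕ) : ZMod l)) ^ 2 * hc
  obtain ⟨m, hm⟩ := hdvd
  have hl0 : (0 : ℤ) < l := by exact_mod_cast hl.pos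
  have hpos : 0 < x ^ 2 + 5 * y ^ 2 := by
    rcases hxy with h | h <;> positivity
  refine ⟨x, y, m, by rw [hm]; ring, ?_, ?_⟩
  · by_contra hcon
    push Not at hcon
    nlinarith
  · by_contra hcon
    push Not at hcon
    have : (q : ℤ) * q < l := lt_of_le_of_ne hql hql'
    nlinarith

lemma norm_form [Fact l.Prime] (h5 : l % 5 = 1) (h4 : l % 4 = 1) : ∃ α β : ℤ, α ^ 2 + 5 * β ^ 2 = l ∧ β ≠ 0 := by
  obtain ⟨e, he, -⟩ := exists_e0 h5
  have hi : ∃ i : ZMod l, i ^ 2 = -1 := by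
    have : IsSquare (-1 : ZMod l) := ZMod.exists_sq_eq_neg_one_iff.mpr (by omega)
    obtain ⟨i, hi⟩ := this
    exact ⟨i, by rw [hi, sq]⟩
  obtain ⟨i, hi⟩ := hi
  obtain ⟨x, y, m, h, hm0, hm6⟩ := thue (l := l) (i * (2 * e + 1)) (by linear_combination (2 * e + 1) ^ 2 * hi - 4 * he)
  have hne : ∀ α β : ℤ, α ^ 2 + 5 * β ^ 2 = l → β ≠ 0 := by
    rintro α β h rfl
    exact not_square (l := l) α (by linarith)
  obtain ⟨n, hn⟩ : ∃ n : ℤ, (l : ℤ) = 5 * n + 1 := ⟨l / 5, by omega⟩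
  have hx5 : x % 5 = 0 ∨ x % 5 = 1 ∨ x % 5 = 2 ∨ x % 5 = 3 ∨ x % 5 = 4 := by omega
  have key : ∀ r : ℤ, x % 5 = r → (r * r - m) % 5 = 0 := by
    intro r hr
    obtain ⟨z, hz⟩ : ∃ z, x = 5 * z + r := ⟨x / 5, by omega⟩
    rw [hn] at h
    have : r * r - m = 5 * (m * n - y ^ 2 - 5 * z ^ 2 - 2 * z * r) := by
      rw [hz] at h; linear_combination h
    omega
  have hm : m = 1 ∨ m = 4 ∨ (m = 5 ∧ x % 5 = 0) := by
    rcases hx5 with h | h | h | h | h <;> have := key _ h <;> omega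
  rcases hm with rfl | rfl | ⟨rfl, hx⟩
  · exact ⟨x, y, by linarith, hne x _ (by linarith)⟩
  · have hev : x % 2 = 0 ∧ y % 2 = 0 := by
      have hx2 := Int.emod_two_eq_zero_or_one x
      have hy2 := Int.emod_two_eq_zero_or_one y
      obtain ⟨z, hz⟩ : ∃ z, x = 2 * z + x % 2 := ⟨x / 2, by omega⟩
      obtain ⟨w, hw⟩ : ∃ w, y = 2 * w + y % 2 := ⟨y / 2, by omega⟩
      rcases hx2 with h1 | h1 <;> rcases hy2 with h2 | h2 <;> rw [h1] at hz <;> rw [h2] at hw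
      · exact ⟨h1, h2⟩
      · exfalso
        have : 4 * (z ^ 2 + 5 * w ^ 2 + 5 * w) + 5 = 4 * (l : ℤ) := by rw [hz, hw] at h; linarith
        omega
      · exfalso
        have : 4 * (z ^ 2 + z + 5 * w ^ 2) + 1 = 4 * (l : ℤ) := by rw [hz, hw] at h; linarith
        omega
      · exfalso
        have h8 : 4 * (z ^ 2 + z) + 20 * (w ^ 2 + w) + 6 = 4 * (l : ℤ) := by rw [hz, hw] at h; linarith
        omega
    obtain ⟨z, rfl⟩ : ∃ z, x = 2 * z := ⟨x / 2, by omega⟩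
    obtain ⟨w, rfl⟩ : ∃ z, y = 2 * z := ⟨y / 2, by omega⟩
    exact ⟨z, w, by linarith, hne z _ (by linarith)⟩
  · obtain ⟨z, rfl⟩ : ∃ z, x = 5 * z := ⟨x / 5, by omega⟩
    exact ⟨y, z, by linarith, hne y _ (by linarith)⟩

/-- The two fixed points. -/
lemma exists_fix1 : ∃ τ : ℍ, 5 * (τ : ℂ) ^ 2 = -1 ∧ (τ : ℂ).re = 0 := by
  have h5 : (0 : ℝ) < (Real.sqrt 5)⁻¹ := by positivity
  refine ⟨⟨⟨0, (Real.sqrt 5)⁻¹⟩, h5⟩, ?_, rfl⟩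
  have hs : (Real.sqrt 5)⁻¹ * (Real.sqrt 5)⁻¹ = 1 / 5 := by
    rw [← mul_inv, Real.mul_self_sqrt (by norm_num)]; norm_num
  apply Complex.ext <;> simp [sq] <;> nlinarith

lemma exists_fix2 : ∃ τ : ℍ, 10 * (τ : ℂ) ^ 2 - 10 * τ + 3 = 0 := by
  have h5 : (0 : ℝ) < (2 * Real.sqrt 5)⁻¹ := by positivity
  refine ⟨⟨⟨1 / 2, (2 * Real.sqrt 5)⁻¹⟩, h5⟩, ?_⟩
  have hs : (2 * Real.sqrt 5)⁻¹ * (2 * Real.sqrt 5)⁻¹ = 1 / 20 := by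
    rw [← mul_inv]
    have : 2 * Real.sqrt 5 * (2 * Real.sqrt 5) = 20 := by
      have := Real.mul_self_sqrt (show (0 : ℝ) ≤ 5 by norm_num); linarith
    rw [this]; norm_num
  have e : ((⟨⟨1 / 2, (2 * Real.sqrt 5)⁻¹⟩, h5⟩ : ℍ) : ℂ) = ⟨1 / 2, (2 * Real.sqrt 5)⁻¹⟩ := rfl
  rw [e]
  generalize (2 * Real.sqrt 5)⁻¹ = w at *
  apply Complex.ext
  · simp [sq]; linarith
  · simp [sq]; ring

lemma tt_fix1 {τ : ℍ} (h : 5 * (τ : ℂ) ^ 2 = -1) : tt τ ^ 2 = 125 := by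
  have h1 : mob 0 (-1) 5 0 τ = τ := ext_mob (by norm_num) τ (by push_cast; linear_combination h)
  have := tt_W τ
  rw [h1] at this
  rw [sq]; exact this

lemma tt_fix2 {τ : ℍ} (h : 10 * (τ : ℂ) ^ 2 - 10 * τ + 3 = 0) : tt τ ^ 2 = 125 := by
  have h1 := tt_W (mob 2 (-1) (5 * (-1)) 3 τ)
  rw [tt_mob (by norm_num), mob_mob (by norm_num) (by norm_num)] at h1
  rw [ext_mob (by norm_num) τ (by push_cast; linear_combination h)] at h1
  rw [sq]; exact h1

lemma tt_fix_ne {τ₁ τ₂ : ℍ} (h1 : 5 * (τ₁ : ℂ) ^ 2 = -1) (hre : (τ₁ : ℂ).re = 0)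
    (h2 : 10 * (τ₂ : ℂ) ^ 2 - 10 * τ₂ + 3 = 0) : tt τ₁ ≠ tt τ₂ := by
  intro ht
  obtain ⟨γ, hγ, rfl⟩ := tt_inj ht
  have hdet := sl_det γ
  have hpos := sl_det_pos γ
  rw [sl_smul, coe_mob hpos] at h2
  have hne := lin_ne_zero hpos τ₁
  rw [CongruenceSubgroup.Gamma0_mem] at hγ
  obtain ⟨c, hc⟩ : (5 : ℤ) ∣ γ 1 0 := by
    have := (ZMod.intCast_zmod_eq_zero_iff_dvd _ 5).mp hγ
    exact_mod_cast this
  have h2' : 10 * ((γ 0 0 : ℤ) * (τ₁ : ℂ) + (γ 0 1 : ℤ)) ^ 2 - 10 * ((γ 0 0 : ℤ) * (τ₁ : ℂ) + (γ 0 1 : ℤ)) * ((γ 1 0 : ℤ) * (τ₁ : ℂ) + (γ 1 1 : ℤ))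
      + 3 * ((γ 1 0 : ℤ) * (τ₁ : ℂ) + (γ 1 1 : ℤ)) ^ 2 = 0 := by
    generalize ((γ 1 0 : ℤ) * (τ₁ : ℂ) + (γ 1 1 : ℤ)) = w at *
    field_simp at h2
    linear_combination h2
  clear h2 hne hpos
  rename' h2' => h2
  rw [hc] at h2 hdet
  generalize γ 0 0 = a at *
  generalize γ 0 1 = b at *
  generalize γ 1 1 = d at *
  have h3 : ((10 * b ^ 2 - 10 * b * d + 3 * d ^ 2 - (2 * a ^ 2 - 10 * a * c + 15 * c ^ 2) : ℤ) : ℂ)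
      + ((20 * a * b - 10 * a * d - 50 * b * c + 30 * c * d : ℤ) : ℂ) * τ₁ = 0 := by
    push_cast at h2 ⊢
    linear_combination h2 - (2 * (a : ℂ) ^ 2 - 10 * a * c + 15 * c ^ 2) * h1
  have h4 := congrArg Complex.re h3
  rw [Complex.add_re, Complex.intCast_re, Complex.mul_re, Complex.intCast_re, Complex.intCast_im, hre] at h4
  simp only [mul_zero, zero_mul, sub_zero, add_zero, Complex.zero_re] at h4
  have h5 : (10 * b ^ 2 - 10 * b * d + 3 * d ^ 2 - (2 * a ^ 2 - 10 * a * c + 15 * c ^ 2) : ℤ) = 0 := by exact_mod_cast h4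
  have h6 := congrArg (Int.cast : ℤ → ZMod 5) h5
  have h7 := congrArg (Int.cast : ℤ → ZMod 5) hdet
  push_cast at h6 h7
  have hz : (5 : ZMod 5) = 0 := by decide
  have key : ∀ a d : ZMod 5, a * d = 1 → 3 * d ^ 2 - 2 * a ^ 2 = 0 → False := by decide
  exact key a d (by linear_combination h7 + b * c * hz) (by linear_combination h6 - (2 * b ^ 2 - 2 * b * d + 2 * a * c - 3 * c ^ 2) * hz)

lemma not_ss_fix (A : ValuationSubring ℂ) [Fact l.Prime] (hA : (l : ℂ) ∈ A.nonunits) (h5 : 5 < l) (n r s : ℕ) (hr : r ≤ 1) (hs : s ≤ 1)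
    (hln : l = 12 * n + 4 * r + 6 * s + 1) (h51 : l % 5 = 1) (h4 : l % 4 = 1) (x : IsLocalRing.ResidueField A)
    (hx : x ^ 2 = 125) : ¬ ss n r s x := by
  have hl : l.Prime := Fact.out
  have : CharP (IsLocalRing.ResidueField A) l := charP_residue A l hl hA
  obtain ⟨α, β, hαβ, hβ⟩ := norm_form h51 h4
  obtain ⟨τ₁, h1, hre⟩ := exists_fix1
  obtain ⟨τ₂, h2⟩ := exists_fix2
  have hn := tt_fix_ne h1 hre h2
  have e1 := tt_fix1 h1
  have e2 := tt_fix2 h2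
  have hneg : tt τ₂ = - tt τ₁ := by
    have : (tt τ₁ - tt τ₂) * (tt τ₂ + tt τ₁) = 0 := by linear_combination e1 - e2
    rcases mul_eq_zero.mp this with h | h
    · exact absurd (sub_eq_zero.mp h) hn
    · exact eq_neg_of_add_eq_zero_left h
  obtain ⟨t, ht⟩ := mem_of_monic A (Polynomial.X ^ 2 - Polynomial.C 125) (Polynomial.monic_X_pow_sub_C _ (by norm_num)) (tt τ₁) (by
    simp [e1, map_ofNat])
  have ht2 : t ^ 2 = 125 := by
    apply Subtype.ext
    push_cast
    rw [ht, e1]; rfl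
  have hr2 : (IsLocalRing.residue A t) ^ 2 = 125 := by
    rw [← map_pow, ht2, map_ofNat]
  have hr0 : IsLocalRing.residue A t ≠ 0 := by
    intro h0
    rw [h0] at hr2
    have h50 : (5 : IsLocalRing.ResidueField A) ^ 3 = 0 := by
      rw [show (5 : IsLocalRing.ResidueField A) ^ 3 = 125 by norm_num, ← hr2]; simp
    have h51' := pow_eq_zero_iff (by norm_num) |>.mp h50
    exact isUnit_five A l hA h5 (by rw [map_ofNat]; exact h51')
  have hcm1 : CM l τ₁ β (-α) α β := ⟨by linear_combination hαβ, by push_cast; linear_combination (α : ℂ) * h1⟩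
  have hcm2 : CM l τ₂ (α + β) (-3 * α) (2 * α) (β - α) := ⟨by linear_combination hαβ, by push_cast; linear_combination (α : ℂ) * h2⟩
  have : (x - IsLocalRing.residue A t) * (x + IsLocalRing.residue A t) = 0 := by linear_combination hx - hr2
  rcases mul_eq_zero.mp this with h | h
  · rw [sub_eq_zero.mp h]
    exact not_ss_of_trace A l hA h5 n r s hr hs hln τ₁ t ht hr0 hcm1 (by omega)
  · have hxe : x = IsLocalRing.residue A (-t) := by rw [map_neg]; exact eq_neg_of_add_eq_zero_left h
    rw [hxe]
    exact not_ss_of_trace A l hA h5 n r s hr hs hln τ₂ (-t) (by push_cast; rw [ht, hneg]) (by rw [map_neg]; exact neg_ne_zero.mpr hr0) hcm2 (by omega)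
end
end HQ
end

section
namespace HQ
open PowerSeries Filter Topology UpperHalfPlane
open scoped MatrixGroups ModularForm Manifold NumberField

lemma hln_aux {l : ℕ} (hl : l.Prime) (h5 : 5 < l) : l = 12 * nn l + 4 * rr l + 6 * sg l + 1 := by
  have h2 : l % 2 ≠ 0 := by
    intro h
    have := (Nat.prime_dvd_prime_iff_eq Nat.prime_two hl).mp (Nat.dvd_of_mod_eq_zero h); omega
  have h3 : l % 3 ≠ 0 := by
    intro h
    have := (Nat.prime_dvd_prime_iff_eq Nat.prime_three hl).mp (Nat.dvd_of_mod_eq_zero h); omega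
  unfold nn rr sg
  split_ifs <;> omega

theorem main_count (l : ℕ) (hl : Nat.Prime l) (hl5 : 5 < l) (hmod5 : l % 5 = 1)
    (K : Type) [Field K] [NumberField K] (θ : K)
    (hθ : θ ^ 2 = -((5 * l : ℕ) : K)) (hK : Module.finrank ℚ K = 2) :
    2 * (PS l).ncard + 2 * sg l = NumberField.classNumber K * (if l % 4 = 1 then 1 else if l % 8 = 3 then 2 else 4) := by
  have : Fact l.Prime := ⟨hl⟩
  obtain ⟨A, hA⟩ := exists_valuation l hl
  have hchar : CharP (IsLocalRing.ResidueField A) l := charP_residue A l hl hA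
  letI : Algebra (ZMod l) (IsLocalRing.ResidueField A) := ZMod.algebra _ l
  have hln := hln_aux hl hl5
  have hr : rr l ≤ 1 := by unfold rr; split_ifs <;> omega
  have hs : sg l ≤ 1 := by unfold sg; split_ifs <;> omega
  obtain ⟨e₀, he₀, -⟩ := exists_e0 hmod5
  have hodd : l % 4 = 1 ∨ l % 4 = 3 := by
    have := hl.eq_two_or_odd
    omega
  have hF : ∀ a : ZMod l, algebraMap (ZMod l) (IsLocalRing.ResidueField A) a ≠ 0 →
      tx (algebraMap (ZMod l) (IsLocalRing.ResidueField A) a) ^ 2 = 125 →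
      ss (nn l) (rr l) (sg l) (tx (algebraMap (ZMod l) (IsLocalRing.ResidueField A) a)) → False := by
    intro a ha ht hss
    rcases hodd with h | h
    · exact not_ss_fix A hA hl5 _ _ _ hr hs hln hmod5 h _ ht hss
    · exact hF3 hl5 hmod5 h a ha ht
  have h1 := quad_count (l := l) (k := IsLocalRing.ResidueField A)
  rw [X_eq hl5 he₀ hF] at h1
  have h2 := T_count (k := IsLocalRing.ResidueField A) (l := l) hl5 (nn l) (rr l)
  have h3 := count_T A l hA hl5 (nn l) (rr l) (sg l) hr hs hln
  rw [card_R0 hl hl5 hθ hK] at h3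
  rw [h1, h2, h3]
end HQ
end

/-- Theorem 1.1 C of Morton's paper: for a prime `l > 5`, `l ≡ 1 (mod 5)`, the number `N`
of pairs `(u,v) ∈ 𝔽_l²` such that `x² + u·x + v` is irreducible over `𝔽_l`, divides the
Hasse invariant `Ĥ_{5,l}(x)`, and `u = e⁵(v−1)` for some root `e` of `e² + e = 1`, satisfies
`2N = h(−5l)` if `l ≡ 1 (mod 4)`, `N = h(−5l) − 1` if `l ≡ 3 (mod 8)` and
`N = 2h(−5l) − 1` if `l ≡ 7 (mod 8)`. -/
theorem quadratic_factors_of_hasse_invariant_count_one_mod_five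
    (l : ℕ) (hl : Nat.Prime l) (hl5 : 5 < l)
    (hmod5 : l % 5 = 1)
    (K : Type) [Field K] [NumberField K] (θ : K)
    (hθ : θ ^ 2 = -((5 * l : ℕ) : K))
    (hK : Module.finrank ℚ K = 2)
    (N : ℕ)
    (hN : N = {uv : ZMod l × ZMod l |
        Irreducible (X ^ 2 + C uv.1 * X + C uv.2) ∧
        (X ^ 2 + C uv.1 * X + C uv.2) ∣ hasseInvariant5 l ∧
        ∃ e : ZMod l, e ^ 2 + e = 1 ∧ uv.1 = e ^ 5 * (uv.2 - 1)}.ncard) :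
    (l % 4 = 1 → 2 * N = NumberField.classNumber K) ∧
    (l % 8 = 3 → (N : ℤ) = (NumberField.classNumber K : ℤ) - 1) ∧
    (l % 8 = 7 → (N : ℤ) = 2 * (NumberField.classNumber K : ℤ) - 1) := by
  have h := HQ.main_count l hl hl5 hmod5 K θ hθ hK
  have hN' : N = (HQ.PS l).ncard := hN
  rw [← hN'] at h
  unfold HQ.sg at h
  refine ⟨fun h4 => ?_, fun h8 => ?_, fun h8 => ?_⟩
  · have h3 : ¬ l % 4 = 3 := by omega
    rw [if_pos h4, if_neg h3] at h; omega
  · have h4 : ¬ l % 4 = 1 := by omega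
    have h3 : l % 4 = 3 := by omega
    rw [if_pos h3, if_neg h4, if_pos h8] at h; omega
  · have h4 : ¬ l % 4 = 1 := by omega
    have h3 : l % 4 = 3 := by omega
    have h8' : ¬ l % 8 = 3 := by omega
    rw [if_pos h3, if_neg h4, if_neg h8'] at h; omega
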